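/- Let D_k^new(x) = #{ d_k^new(N) : N ∈ ℕ, d_k^new(N) ≤ ((k−1)/12)·x }. There exists an absolute constant A > 0 such that for every even integer k ≥ 2 and every real x ≥ 16, (x/log x)·exp( C·log²( (log log x)/(log log log x) ) − A·log log log x ) ≤ D_k^new(x) ≤ (x/log x)·exp( C·log²( (log log x)/(log log log x) ) + A·log log log x ). -/

import Mathlib

noncomputable section

/-- Value at `N` of the multiplicative function determined by local values `f p e`
on prime powers `p^e` (`e ≥ 1`). -/
def mval (f : ℕ → ℕ → ℝ) (N : ℕ) : ℝ := ∏ p ∈ N.primeFactors, f p (N.factorization p)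

def psiFull : ℕ → ℝ := mval fun p e => (p:ℝ)^e + (p:ℝ)^(e-1)

def nuInfFull : ℕ → ℝ := mval fun p e =>
  if Odd e then 2*(p:ℝ)^((e-1)/2) else (p:ℝ)^(e/2) + (p:ℝ)^(e/2-1)

def nu2Full : ℕ → ℝ := mval fun p e =>
  if p^e = 2 then 1 else if p % 4 = 1 then 2 else 0

def nu3Full : ℕ → ℝ := mval fun p e =>
  if p^e = 3 then 1 else if p % 3 = 1 then 2 else 0

def psiNew : ℕ → ℝ := mval fun p e =>
  if e = 1 then (p:ℝ)-1
  else if e = 2 then (p:ℝ)^2-(p:ℝ)-1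
  else (p:ℝ)^(e-3)*((p:ℝ)-1)^2*((p:ℝ)+1)

def nuInfNew : ℕ → ℝ := mval fun p e =>
  if e = 2 then (p:ℝ)-2
  else if Even e ∧ 2 < e then (p:ℝ)^(e/2-2)*((p:ℝ)-1)^2
  else 0

def nu2New : ℕ → ℝ := mval fun p e =>
  if p % 4 = 3 ∧ e = 1 then -2
  else if (p % 4 = 3 ∧ e = 2) ∨ p^e = 8 then 1
  else if (p % 4 = 1 ∧ e = 2) ∨ p^e = 2 ∨ p^e = 4 then -1
  else 0

def nu3New : ℕ → ℝ := mval fun p e =>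
  if p % 3 = 2 ∧ e = 1 then -2
  else if (p % 3 = 2 ∧ e = 2) ∨ p^e = 27 then 1
  else if (p % 3 = 1 ∧ e = 2) ∨ p^e = 3 ∨ p^e = 9 then -1
  else 0

def psiMin : ℕ → ℝ := mval fun p e =>
  ((p:ℝ)-1)/((Nat.gcd (Nat.gcd 2 (p-1)) e : ℕ) : ℝ)
    * (if e = 1 then 1 else if e = 2 then (p:ℝ)-1 else (p:ℝ)^(e-3)*((p:ℝ)^2-1))

def nuInfMin : ℕ → ℝ := mval fun p e =>
  if p = 2 ∧ Even e ∧ 2 < e then (2:ℝ)^(e/2-2) else 0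

def nu2Min : ℕ → ℝ := mval fun p e =>
  if p % 4 = 3 then -2*((ArithmeticFunction.moebius (p^(e-1)) : ℤ) : ℝ)
  else if p^e = 2 ∨ p^e = 4 then -1
  else if p^e = 8 then 1
  else 0

def nu3Min : ℕ → ℝ := mval fun p e =>
  if p % 3 = 2 ∧ p^e ≠ 4 then -2*((ArithmeticFunction.moebius (p^(e-1)) : ℤ) : ℝ)
  else if p^e = 3 ∨ p^e = 9 then -1
  else if p^e = 4 ∨ p^e = 27 then 1
  else 0

/-- The Kronecker symbol `(−4|n)`, i.e. the nontrivial character mod 4. -/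
def chi4 (n : ℕ) : ℝ := if n % 4 = 1 then 1 else if n % 4 = 3 then -1 else 0

/-- The Kronecker symbol `(−3|n)`, i.e. the nontrivial character mod 3. -/
def chi3 (n : ℕ) : ℝ := if n % 3 = 1 then 1 else if n % 3 = 2 then -1 else 0

def c2 (k : ℕ) : ℝ := -(1/4) * chi4 (k-1)

def c3 (k : ℕ) : ℝ := -(1/3) * chi3 (k-1)

def delta2 (k : ℕ) : ℝ := if k = 2 then 1 else 0

def dFull (k N : ℕ) : ℝ :=
  ((k:ℝ)-1)/12 * psiFull N - 1/2 * nuInfFull N + c2 k * nu2Full N + c3 k * nu3Full N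
    + delta2 k

def dNew (k N : ℕ) : ℝ :=
  ((k:ℝ)-1)/12 * psiNew N - 1/2 * nuInfNew N + c2 k * nu2New N + c3 k * nu3New N
    + delta2 k * ((ArithmeticFunction.moebius N : ℤ) : ℝ)

def dMin (k N : ℕ) : ℝ :=
  ((k:ℝ)-1)/12 * psiMin N - 1/2 * nuInfMin N + c2 k * nu2Min N + c3 k * nu3Min N
    + delta2 k * ((ArithmeticFunction.moebius N : ℤ) : ℝ)

/-- `ω(N)`: the number of distinct prime divisors of `N`. -/
def omega (N : ℕ) : ℕ := N.primeFactors.card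

/-- A positive integer is squarefull if `p² ∣ N` for every prime `p ∣ N`. -/
def Squarefull (n : ℕ) : Prop := ∀ p : ℕ, p.Prime → p ∣ n → p^2 ∣ n

/-- `H(N)`: the largest squarefull divisor of `N`. -/
def squarefullPart (N : ℕ) : ℕ := sSup {d : ℕ | d ∣ N ∧ Squarefull d}

/-- `η = ζ(3/2)/ζ(3)`. -/
def eta : ℝ := (riemannZeta (3/2) / riemannZeta 3).re

/-- Ford's coefficients `a_n = (n+1)log(n+1) − n log n − 1`. -/
def fordA (n : ℕ) : ℝ := ((n:ℝ)+1)*Real.log ((n:ℝ)+1) - (n:ℝ)*Real.log n - 1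


def loglog (x : ℝ) : ℝ := Real.log (Real.log x)

def logloglog (x : ℝ) : ℝ := Real.log (Real.log (Real.log x))

def loglogloglog (x : ℝ) : ℝ := Real.log (Real.log (Real.log (Real.log x)))

end

set_option linter.unusedSimpArgs false
set_option linter.unusedVariables false

namespace FordT
open Real Finset
abbrev PL (n : ℕ) : Finset ℕ := (Finset.range (n+1)).filter Nat.Prime
lemma mem_PL {n p : ℕ} : p ∈ PL n ↔ p ≤ n ∧ p.Prime := by simp [PL, Nat.lt_succ_iff]
lemma theta_eq (n : ℕ) : Chebyshev.theta n = ∑ p ∈ PL n, log p := by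
  rw [Chebyshev.theta_eq_sum_Icc, Nat.floor_natCast]
  apply Finset.sum_congr _ (fun _ _ => rfl)
  ext p; simp [PL, Nat.lt_succ_iff]
lemma log_fact (n : ℕ) : log (n.factorial) = ∑ p ∈ PL n, (padicValNat p n.factorial) * log p := by
  conv_lhs => rw [← Nat.prod_factorization_pow_eq_self (Nat.factorial_ne_zero n)]
  rw [Finsupp.prod, Nat.cast_prod, Real.log_prod]
  · have : (n.factorial.factorization).support = PL n := by
      ext p
      simp only [Nat.support_factorization, Nat.mem_primeFactors, mem_PL]
      constructor
      · rintro ⟨h1, h2, _⟩; exact ⟨(h1.dvd_factorial).1 h2, h1⟩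
      · rintro ⟨h1, h2⟩; exact ⟨h2, (h2.dvd_factorial).2 h1, Nat.factorial_ne_zero n⟩
    rw [this]
    apply Finset.sum_congr rfl
    intro p hp
    rw [Nat.cast_pow, Real.log_pow, Nat.factorization_def _ (mem_PL.1 hp).2]
  · intro p hp
    have := Nat.support_factorization n.factorial ▸ hp
    have := (Nat.prime_of_mem_primeFactors this).pos
    positivity
lemma log_fact_le (n : ℕ) : log (n.factorial) ≤ n * log n := by
  rw [← Real.log_pow]
  apply Real.log_le_log (by positivity)
  exact_mod_cast Nat.factorial_le_pow n
lemma log_fact_ge (n : ℕ) : n * log n - n ≤ log (n.factorial) := by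
  rcases Nat.eq_zero_or_pos n with rfl | hn
  · simp
  have h : (n:ℝ)^n / n.factorial ≤ Real.exp n := by
    exact Real.pow_div_factorial_le_exp (n:ℝ) (by positivity) n
  have := Real.log_le_log (by positivity) h
  rw [Real.log_exp, Real.log_div (by positivity) (by positivity), Real.log_pow] at this
  linarith
lemma padic_le {n p : ℕ} (hp : p.Prime) :
    (padicValNat p n.factorial : ℝ) ≤ n / (p-1) := by
  have := Fact.mk hp
  have h := sub_one_mul_padicValNat_factorial (p := p) n
  have h1 : (1:ℝ) < p := by exact_mod_cast hp.one_lt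
  rw [le_div_iff₀ (by linarith)]
  have h2 : (p-1) * padicValNat p n.factorial ≤ n := by rw [h]; omega
  have : (((p-1 : ℕ):ℝ)) * padicValNat p n.factorial ≤ n := by exact_mod_cast h2
  rw [Nat.cast_sub hp.one_lt.le] at this
  push_cast at this; linarith
lemma padic_ge {n p : ℕ} (hp : p.Prime) (hpn : p ≤ n) :
    (n:ℝ)/p - 1 ≤ (padicValNat p n.factorial : ℝ) := by
  have := Fact.mk hp
  have h : n / p ≤ padicValNat p n.factorial := by
    have h1 : p ^ (n/p) ∣ n.factorial := by
      have h2 : (p * (n/p)).factorial ∣ n.factorial := Nat.factorial_dvd_factorial (Nat.mul_div_le n p)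
      refine dvd_trans ?_ h2
      rw [padicValNat_dvd_iff_le (Nat.factorial_ne_zero _), padicValNat_factorial_mul]
      omega
    exact (padicValNat_dvd_iff_le (Nat.factorial_ne_zero _)).1 h1
  have h3 : (n:ℝ)/p < (n/p : ℕ) + 1 := by
    rw [← Nat.floor_div_eq_div (K := ℝ)]; exact Nat.lt_floor_add_one _
  have h4 : ((n/p:ℕ):ℝ) ≤ padicValNat p n.factorial := by exact_mod_cast h
  linarith
noncomputable def MA (n : ℕ) : ℝ := ∑ p ∈ PL n, log p / p
lemma MA_le (n : ℕ) (hn : 1 ≤ n) : MA n ≤ log n + log 4 := by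
  have hn' : (0:ℝ) < n := by exact_mod_cast hn
  have h1 : ∑ p ∈ PL n, ((n:ℝ)/p - 1) * log p ≤ log (n.factorial) := by
    rw [log_fact]
    apply Finset.sum_le_sum
    intro p hp
    have hp := mem_PL.1 hp
    exact mul_le_mul_of_nonneg_right (padic_ge hp.2 hp.1) (log_natCast_nonneg p)
  have h2 : ∑ p ∈ PL n, ((n:ℝ)/p - 1) * log p = n * MA n - Chebyshev.theta n := by
    rw [theta_eq, MA, Finset.mul_sum, ← Finset.sum_sub_distrib]
    apply Finset.sum_congr rfl; intro p _; ring
  have h3 := Chebyshev.theta_le_log4_mul_x (x := n) (by positivity)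
  have h4 := log_fact_le n
  have : n * MA n ≤ n * (log n + log 4) := by nlinarith
  exact le_of_mul_le_mul_left this hn'
lemma sum_aux : ∃ C : ℝ, 0 ≤ C ∧ ∀ n : ℕ, ∑ p ∈ PL n, log p * (1/((p:ℝ)-1) - 1/p) ≤ C := by
  have hs : Summable (fun n : ℕ => 4 * (1 / (n:ℝ)^(3/2:ℝ))) :=
    (Real.summable_one_div_nat_rpow.2 (by norm_num)).mul_left 4
  refine ⟨∑' n : ℕ, 4 * (1 / (n:ℝ)^(3/2:ℝ)), tsum_nonneg fun _ => by positivity, fun n => ?_⟩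
  refine le_trans (Finset.sum_le_sum (g := fun n : ℕ => 4 * (1 / (n:ℝ)^(3/2:ℝ))) ?_)
    (hs.sum_le_tsum _ (fun _ _ => by positivity))
  intro p hp
  have hp2 : (2:ℝ) ≤ p := by exact_mod_cast (mem_PL.1 hp).2.two_le
  have hl : log p ≤ (p:ℝ)^(1/2:ℝ) / (1/2) := Real.log_le_rpow_div (by linarith) (by norm_num)
  have e1 : 1/((p:ℝ)-1) - 1/p = 1/((p-1)*p) := by
    have : (p:ℝ)-1 ≠ 0 := by linarith
    field_simp; ring
  have e2 : 1/(((p:ℝ)-1)*p) ≤ 2 / p^2 := by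
    rw [div_le_div_iff₀ (by nlinarith) (by positivity)]; nlinarith
  rw [e1]
  calc log p * (1/(((p:ℝ)-1)*p)) ≤ ((p:ℝ)^(1/2:ℝ) / (1/2)) * (2/p^2) := by
        apply mul_le_mul hl e2 _ (by positivity)
        apply one_div_nonneg.2; nlinarith
    _ = 4 * (1 / (p:ℝ)^(3/2:ℝ)) := by
        have : (p:ℝ)^2 = (p:ℝ)^(1/2:ℝ) * (p:ℝ)^(3/2:ℝ) := by
          rw [← Real.rpow_add (by linarith), ← Real.rpow_natCast]; norm_num
        rw [this]
        have : (p:ℝ)^(1/2:ℝ) ≠ 0 := by positivity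
        field_simp; norm_num
lemma MA_ge : ∃ C : ℝ, 0 ≤ C ∧ ∀ n : ℕ, 1 ≤ n → log n - C ≤ MA n := by
  obtain ⟨C, hC, h⟩ := sum_aux
  refine ⟨C + 1, by linarith, fun n hn => ?_⟩
  have hn' : (0:ℝ) < n := by exact_mod_cast hn
  have h1 : log (n.factorial) ≤ ∑ p ∈ PL n, ((n:ℝ)/(p-1)) * log p := by
    rw [log_fact]
    apply Finset.sum_le_sum
    intro p hp
    have hp := mem_PL.1 hp
    exact mul_le_mul_of_nonneg_right (padic_le hp.2) (log_natCast_nonneg p)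
  have h2 : ∑ p ∈ PL n, ((n:ℝ)/(p-1)) * log p =
      n * (MA n + ∑ p ∈ PL n, log p * (1/((p:ℝ)-1) - 1/p)) := by
    rw [MA, ← Finset.sum_add_distrib, Finset.mul_sum]
    apply Finset.sum_congr rfl; intro p _; ring
  have h4 := log_fact_ge n
  have h5 := h n
  have : n * (log n - (C+1)) ≤ n * MA n := by nlinarith
  exact le_of_mul_le_mul_left this hn'
noncomputable def PR (n : ℕ) : ℝ := ∑ p ∈ PL n, 1 / (p:ℝ)
lemma PL_succ (n : ℕ) (g : ℕ → ℝ) : ∑ p ∈ PL (n+1), g p =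
    ∑ p ∈ PL n, g p + if (n+1).Prime then g (n+1) else 0 := by
  rw [PL, PL, Finset.range_add_one, Finset.filter_insert]
  split_ifs with h
  · rw [Finset.sum_insert (by simp), add_comm]
  · simp
lemma abel (n : ℕ) (hn : 2 ≤ n) : PR n = MA n / log n +
    ∑ k ∈ Finset.Ico 2 n, MA k * (1 / log k - 1 / log (k+1)) := by
  induction n, hn using Nat.le_induction with
  | base =>
    have : PL 2 = {2} := by decide
    have h2 : log 2 ≠ 0 := by positivity
    simp [PR, MA, this]; field_simp
  | succ n hn ih =>
    have hn1 : (2:ℝ) ≤ n := by exact_mod_cast hn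
    have l1 : log n ≠ 0 := (Real.log_pos (by linarith)).ne'
    have l2 : log ((n:ℝ)+1) ≠ 0 := (Real.log_pos (by linarith)).ne'
    rw [Finset.sum_Ico_succ_top hn]
    have e1 : PR (n+1) = PR n + if (n+1).Prime then 1/((n+1 : ℕ):ℝ) else 0 := PL_succ n _
    have e2 : MA (n+1) = MA n + if (n+1).Prime then log ((n+1 : ℕ):ℝ)/((n+1 : ℕ):ℝ) else 0 := PL_succ n _
    rw [e1, e2, ih]
    push_cast
    split_ifs <;> field_simp <;> ring
lemma mertens : ∃ C : ℝ, 1 ≤ C ∧ ∀ n : ℕ, 2 ≤ n → |PR n - log (log n)| ≤ C := by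
  obtain ⟨C, hC, h⟩ := MA_ge
  have hs : Summable (fun n : ℕ => 4 * (1 / (n:ℝ)^2)) :=
    (Real.summable_one_div_nat_pow.2 (by norm_num)).mul_left 4
  set S := ∑' n : ℕ, 4 * (1 / (n:ℝ)^2) with hS
  have hS0 : 0 ≤ S := tsum_nonneg fun _ => by positivity
  set D := C + log 4 with hD
  have l2 : 0 < log 2 := by positivity
  have l4 : 0 < log 4 := by positivity
  have hR : ∀ n : ℕ, 1 ≤ n → |MA n - log n| ≤ D := fun n hn => by
    rw [abs_le]; constructor <;> [have := h n hn; have := MA_le n hn] <;> linarith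
  refine ⟨1 + S + 2 * (D / log 2) + |log (log 2)| , ?_, fun n hn => ?_⟩
  · have : 0 ≤ D / log 2 := by positivity
    have := abs_nonneg (log (log 2))
    linarith
  have key : ∀ n : ℕ, 2 ≤ n → |∑ k ∈ Finset.Ico 2 n, MA k * (1 / log k - 1 / log (k+1)) -
      (log (log n) - log (log 2))| ≤
      (∑ k ∈ Finset.Ico 2 n, 4 * (1 / (k:ℝ)^2)) + D * (1 / log 2 - 1/ log n) := by
    intro n hn
    induction n, hn using Nat.le_induction with
    | base => simp
    | succ n hn ih =>
      have hn1 : (2:ℝ) ≤ n := by exact_mod_cast hn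
      have ln2 : log 2 ≤ log n := Real.log_le_log (by norm_num) hn1
      set a := log n with ha
      set b := log ((n:ℝ)+1) with hb
      have hab : a ≤ b := Real.log_le_log (by linarith) (by linarith)
      have ha0 : 0 < a := by linarith
      have hb0 : 0 < b := by linarith
      have hba : b - a ≤ 1/n := by
        rw [hb, ha, ← Real.log_div (by linarith) (by linarith)]
        have := Real.log_le_sub_one_of_pos (x := ((n:ℝ)+1)/n) (by positivity)
        have e : ((n:ℝ)+1)/n - 1 = 1/n := by field_simp; try ring
        linarith
      rw [Finset.sum_Ico_succ_top hn, Finset.sum_Ico_succ_top hn]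
      push_cast
      rw [← ha, ← hb]
      have hRn := hR n (by omega)
      rw [← ha] at hRn
      have d0 : 0 ≤ 1/a - 1/b := by
        have := one_div_le_one_div_of_le ha0 hab; linarith
      have e1 : |(MA n - a) * (1/a - 1/b)| ≤ D * (1/a-1/b) := by
        rw [abs_mul, abs_of_nonneg d0]; exact mul_le_mul_of_nonneg_right hRn d0
      have e2 : a * (1/a - 1/b) = 1 - a/b := by field_simp
      have u1 : 1 - a/b ≤ log b - log a := by
        have := Real.log_le_sub_one_of_pos (x := a/b) (by positivity)
        rw [Real.log_div ha0.ne' hb0.ne'] at this; linarith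
      have u2 : log b - log a ≤ b/a - 1 := by
        have := Real.log_le_sub_one_of_pos (x := b/a) (by positivity)
        rw [Real.log_div hb0.ne' ha0.ne'] at this; linarith
      have u3 : (b/a - 1) - (1 - a/b) ≤ 4 * (1/(n:ℝ)^2) := by
        have : (b/a - 1) - (1 - a/b) = (b-a)^2/(a*b) := by field_simp; try ring
        rw [this]
        have hab4 : 1/4 ≤ a * b := by
          have := Real.log_two_gt_d9
          nlinarith
        calc (b-a)^2/(a*b) ≤ (1/n)^2/(1/4) := by
              apply div_le_div₀ (by positivity) _ (by norm_num) hab4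
              apply pow_le_pow_left₀ (by linarith) hba
          _ = _ := by ring
      rw [abs_le] at ih e1 ⊢
      have e3 : MA n * (1/a-1/b) = (MA n - a) * (1/a-1/b) + (1 - a/b) := by rw [← e2]; ring
      rw [e3]
      constructor <;> nlinarith
  have hk := key n hn
  have hn1 : (2:ℝ) ≤ n := by exact_mod_cast hn
  have ln2 : log 2 ≤ log n := Real.log_le_log (by norm_num) hn1
  have b1 : ∑ k ∈ Finset.Ico 2 n, 4 * (1 / (k:ℝ)^2) ≤ S := hs.sum_le_tsum _ (fun _ _ => by positivity)
  have hRn := hR n (by omega)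
  have b2 : |MA n / log n - 1| ≤ D / log 2 := by
    have : MA n / log n - 1 = (MA n - log n)/log n := by
      have : log n ≠ 0 := by linarith
      field_simp
    rw [this, abs_div, abs_of_pos (a := log n) (by linarith)]
    apply div_le_div₀ (by positivity) hRn l2 ln2
  have b3 : D * (1 / log 2 - 1/ log n) ≤ D / log 2 := by
    have : 0 ≤ 1 / log n := one_div_nonneg.2 (by linarith)
    have : D / log 2 = D * (1/ log 2) := by ring
    nlinarith
  rw [abel n hn]
  have := neg_abs_le (log (log 2))
  have := le_abs_self (log (log 2))
  rw [abs_le] at hk b2 ⊢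
  constructor <;> linarith
end FordT

namespace FordT
open Real Finset
lemma mval_one (f : ℕ → ℕ → ℝ) : mval f 1 = 1 := by simp [mval]
lemma mval_nonneg {f : ℕ → ℕ → ℝ} (hf : ∀ p e, p.Prime → 1 ≤ e → 0 ≤ f p e) (N : ℕ) : 0 ≤ mval f N :=
  Finset.prod_nonneg fun p hp => hf p _ (Nat.prime_of_mem_primeFactors hp)
    ((Nat.prime_of_mem_primeFactors hp).factorization_pos_of_dvd
      (Nat.mem_primeFactors.1 hp).2.2 (Nat.dvd_of_mem_primeFactors hp))
lemma mval_pos {f : ℕ → ℕ → ℝ} (hf : ∀ p e, p.Prime → 1 ≤ e → 0 < f p e) (N : ℕ) : 0 < mval f N :=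
  Finset.prod_pos fun p hp => hf p _ (Nat.prime_of_mem_primeFactors hp)
    ((Nat.prime_of_mem_primeFactors hp).factorization_pos_of_dvd
      (Nat.mem_primeFactors.1 hp).2.2 (Nat.dvd_of_mem_primeFactors hp))
lemma mval_le {f g : ℕ → ℕ → ℝ} (hf : ∀ p e, p.Prime → 1 ≤ e → 0 ≤ f p e)
    (h : ∀ p e, p.Prime → 1 ≤ e → f p e ≤ g p e) (N : ℕ) : mval f N ≤ mval g N :=
  Finset.prod_le_prod (fun p hp => hf p _ (Nat.prime_of_mem_primeFactors hp)
    ((Nat.prime_of_mem_primeFactors hp).factorization_pos_of_dvd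
      (Nat.mem_primeFactors.1 hp).2.2 (Nat.dvd_of_mem_primeFactors hp)))
    (fun p hp => h p _ (Nat.prime_of_mem_primeFactors hp)
    ((Nat.prime_of_mem_primeFactors hp).factorization_pos_of_dvd
      (Nat.mem_primeFactors.1 hp).2.2 (Nat.dvd_of_mem_primeFactors hp)))
lemma mval_mulfun (f g : ℕ → ℕ → ℝ) (N : ℕ) :
    mval (fun p e => f p e * g p e) N = mval f N * mval g N := by
  simp only [mval]; exact Finset.prod_mul_distrib
lemma mval_mul (f : ℕ → ℕ → ℝ) {a b : ℕ} (h : a.Coprime b) :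
    mval f (a*b) = mval f a * mval f b := by
  rw [mval, h.primeFactors_mul, Finset.prod_union h.disjoint_primeFactors]
  congr 1
  · exact Finset.prod_congr rfl fun p hp => by
      rw [Nat.factorization_eq_of_coprime_left h (by simpa using hp)]
  · exact Finset.prod_congr rfl fun p hp => by
      rw [Nat.factorization_eq_of_coprime_right h (by simpa using hp)]
lemma mval_pp (f : ℕ → ℕ → ℝ) {p e : ℕ} (hp : p.Prime) (he : e ≠ 0) : mval f (p^e) = f p e := by
  simp [mval, Nat.primeFactors_pow p he, hp.primeFactors, hp.factorization]
lemma mval_p (f : ℕ → ℕ → ℝ) {p : ℕ} (hp : p.Prime) : mval f p = f p 1 := by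
  simpa using mval_pp f hp one_ne_zero
lemma mval_cm (c : ℕ → ℝ) {a b : ℕ} (ha : a ≠ 0) (hb : b ≠ 0) :
    mval (fun p e => c p ^ e) (a*b) = mval (fun p e => c p ^ e) a * mval (fun p e => c p ^ e) b := by
  have key : ∀ n m : ℕ, n ≠ 0 → m ≠ 0 → mval (fun p e => c p ^ e) n =
      ∏ p ∈ (n*m).primeFactors, c p ^ (n.factorization p) := by
    intro n m hn hm
    apply Finset.prod_subset (Nat.primeFactors_mono (dvd_mul_right n m) (by positivity))
    intro p _ hp
    rw [← Nat.support_factorization, Finsupp.notMem_support_iff] at hp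
    simp [hp]
  rw [key a b ha hb, key b a hb ha, mul_comm b a, ← Finset.prod_mul_distrib, mval]
  apply Finset.prod_congr rfl
  intro p _
  rw [Nat.factorization_mul ha hb, Finsupp.add_apply, pow_add]
lemma euler (G : ℕ → ℕ → ℝ) (b : ℕ → ℝ) (n : ℕ) (hG : ∀ p e, p.Prime → 1 ≤ e → 0 ≤ G p e)
    (hb : ∀ p, p.Prime → p ≤ n → ∀ K, ∑ e ∈ Finset.Icc 1 K, G p e ≤ b p)
    (S : Finset ℕ) (hS : ∀ N ∈ S, N ≠ 0 ∧ ∀ p, p.Prime → p ∣ N → p ≤ n) :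
    ∑ N ∈ S, mval G N ≤ exp (∑ p ∈ PL n, b p) := by
  set K := S.sup id with hK
  let G' : ℕ → ℕ → ℝ := fun p e => if e = 0 then 1 else G p e
  have hG' : ∀ p e, p.Prime → 0 ≤ G' p e := by
    intro p e hp; simp only [G']; split_ifs with h
    · norm_num
    · exact hG p e hp (by omega)
  have h1 : ∏ p ∈ PL n, ∑ e ∈ Finset.range (K+1), G' p e ≤ exp (∑ p ∈ PL n, b p) := by
    rw [Real.exp_sum]
    apply Finset.prod_le_prod
    · exact fun p hp => Finset.sum_nonneg fun e _ => hG' p e (mem_PL.1 hp).2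
    intro p hp
    rw [Finset.sum_range_succ', ]
    have : ∑ k ∈ Finset.range K, G' p (k+1) = ∑ e ∈ Finset.Icc 1 K, G p e := by
      rw [Finset.range_eq_Ico, Finset.sum_Ico_add' (fun k => G' p k) 0 K 1]
      have : Finset.Ico (0+1) (K+1) = Finset.Icc 1 K := by ext; simp
      rw [this]
      exact Finset.sum_congr rfl fun e he => by
        have := (Finset.mem_Icc.1 he).1
        simp only [G']; rw [if_neg (by omega)]
    rw [this]
    have := hb p (mem_PL.1 hp).2 (mem_PL.1 hp).1 K
    simp only [G', if_true]
    have := Real.add_one_le_exp (b p)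
    linarith
  refine le_trans ?_ h1
  rw [Finset.prod_sum]
  let F : ℕ → (∀ a ∈ PL n, ℕ) := fun N p _ => N.factorization p
  have hinj : Set.InjOn F S := by
    intro N hN M hM hNM
    have hN' := hS N hN; have hM' := hS M hM
    apply Nat.eq_of_factorization_eq hN'.1 hM'.1
    intro p
    by_cases hp : p.Prime
    · by_cases hpn : p ≤ n
      · exact congrFun (congrFun hNM p) (mem_PL.2 ⟨hpn, hp⟩)
      · rw [Nat.factorization_eq_zero_of_not_dvd (fun h => hpn (hN'.2 p hp h)),
          Nat.factorization_eq_zero_of_not_dvd (fun h => hpn (hM'.2 p hp h))]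
    · rw [Nat.factorization_eq_zero_of_not_prime _ hp, Nat.factorization_eq_zero_of_not_prime _ hp]
  have hmem : ∀ N ∈ S, F N ∈ (PL n).pi (fun _ => Finset.range (K+1)) := by
    intro N hN
    rw [Finset.mem_pi]
    intro p hp
    have h1 : N ≤ K := Finset.le_sup (f := id) hN
    have := Nat.factorization_lt p (hS N hN).1
    simp only [F, Finset.mem_range]; omega
  have him := Finset.sum_image (f := fun φ : (∀ a ∈ PL n, ℕ) => ∏ x ∈ (PL n).attach, G' x.1 (φ x.1 x.2))
    (g := F) (s := S) hinj
  refine le_trans (le_of_eq (Eq.trans ?_ him.symm)) ?_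
  rotate_left
  · apply Finset.sum_le_sum_of_subset_of_nonneg
    · intro φ hφ
      obtain ⟨N, hN, rfl⟩ := Finset.mem_image.1 hφ
      exact hmem N hN
    · intro φ _ _
      exact Finset.prod_nonneg fun x _ => hG' _ _ (mem_PL.1 x.2).2
  · apply Finset.sum_congr rfl
    intro N hN
    rw [Finset.prod_attach (PL n) (fun p => G' p (N.factorization p)), mval]
    apply Finset.prod_subset_one_on_sdiff
    · intro p hp
      exact mem_PL.2 ⟨(hS N hN).2 p (Nat.prime_of_mem_primeFactors hp) (Nat.dvd_of_mem_primeFactors hp),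
        Nat.prime_of_mem_primeFactors hp⟩
    · intro p hp
      have := (Finset.mem_sdiff.1 hp).2
      rw [← Nat.support_factorization, Finsupp.notMem_support_iff] at this
      simp [G', this]
    · intro p hp
      rw [← Nat.support_factorization, Finsupp.mem_support_iff] at hp
      simp [G', hp]
lemma rankin (c : ℕ → ℝ) (n : ℕ) (hc : ∀ p, p.Prime → 0 ≤ c p ∧ c p ≤ 3/4 * p)
    (S : Finset ℕ) (hS : ∀ N ∈ S, N ≠ 0 ∧ ∀ p, p.Prime → p ∣ N → p ≤ n) :
    ∑ N ∈ S, mval (fun p e => c p ^ e) N / N ≤ exp (∑ p ∈ PL n, (c p / p + 4 * (c p / p)^2)) := by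
  have h := euler (fun p e => (c p / p)^e) (fun p => c p / p + 4 * (c p / p)^2) n
    (fun p e hp _ => pow_nonneg (div_nonneg (hc p hp).1 (by positivity)) e) ?_ S hS
  · refine le_trans (le_of_eq (Finset.sum_congr rfl fun N hN => ?_)) h
    have hN0 := (hS N hN).1
    have : (N:ℝ) = mval (fun p e => (p:ℝ)^e) N := by
      conv_lhs => rw [← Nat.prod_factorization_pow_eq_self hN0]
      rw [Finsupp.prod, Nat.cast_prod, mval]
      simp
    rw [this, mval, mval, mval, ← Finset.prod_div_distrib]
    exact Finset.prod_congr rfl fun p _ => (div_pow _ _ _).symm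
  · intro p hp _ K
    have hp0 : (0:ℝ) < p := by exact_mod_cast hp.pos
    set x := c p / p with hx
    have hx0 : 0 ≤ x := div_nonneg (hc p hp).1 hp0.le
    have hx1 : x ≤ 3/4 := by rw [hx, div_le_iff₀ hp0]; exact (hc p hp).2
    have h1 : ∀ K, (1-x) * ∑ e ∈ Finset.Icc 1 K, x^e = x - x^(K+1) := by
      intro K
      induction K with
      | zero => simp
      | succ K ih =>
        rw [Finset.sum_Icc_succ_top (by omega), mul_add, ih]; ring
    have h2 := h1 K
    have h3 : 0 ≤ x^(K+1) := by positivity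
    have h4 : (1-x) * ∑ e ∈ Finset.Icc 1 K, x^e ≤ (1-x)*(x + 4*x^2) := by rw [h2]; nlinarith
    exact le_of_mul_le_mul_left h4 (by linarith)
end FordT

namespace FordT
open Real Finset
lemma ap_count (N m a : ℕ) (hm : 0 < m) :
    |(#{n ∈ Finset.range N | n ≡ a [MOD m]} : ℝ) - N / m| ≤ 1 := by
  rw [← Nat.count_eq_card_filter_range, Nat.count_modEq_card N hm a]
  have h1 : (N:ℝ)/m < (N/m : ℕ) + 1 := by
    rw [← Nat.floor_div_eq_div (K := ℝ)]; exact Nat.lt_floor_add_one _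
  have h2 : ((N/m : ℕ):ℝ) ≤ (N:ℝ)/m := Nat.cast_div_le
  rw [abs_le]; push_cast; split_ifs <;> constructor <;> linarith
lemma crt_count (N ρ : ℕ) (Ω : ℕ → Finset ℕ) (d : Finset ℕ)
    (hd : ∀ p ∈ d, p.Prime ∧ (Ω p).card = ρ ∧ ∀ r ∈ Ω p, r < p) : ∀ m a : ℕ, 0 < m →
    (∀ p ∈ d, m.Coprime p) →
    |(#{n ∈ Finset.range N | n ≡ a [MOD m] ∧ ∀ p ∈ d, n % p ∈ Ω p} : ℝ) - N / m * ∏ p ∈ d, (ρ/p : ℝ)|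
      ≤ (ρ:ℝ)^d.card := by
  induction d using Finset.induction_on with
  | empty => intro m a hm _; simpa using ap_count N m a hm
  | insert p d hpd ih =>
    intro m a hm hcop
    have hp := hd p (Finset.mem_insert_self p d)
    have ih' := ih (fun q hq => hd q (Finset.mem_insert_of_mem hq))
    have hmp : m.Coprime p := hcop p (Finset.mem_insert_self p d)
    have hp0 : 0 < p := hp.1.pos
    have hcop' : ∀ q ∈ d, (m*p).Coprime q := fun q hq =>
      Nat.Coprime.mul_left (hcop q (Finset.mem_insert_of_mem hq))
        ((Nat.coprime_primes hp.1 (hd q (Finset.mem_insert_of_mem hq)).1).2 (fun h => hpd (h ▸ hq)))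
    have e1 : #{n ∈ Finset.range N | n ≡ a [MOD m] ∧ ∀ q ∈ insert p d, n % q ∈ Ω q} =
        ∑ r ∈ Ω p, #{n ∈ Finset.range N | n ≡ (Nat.chineseRemainder hmp a r : ℕ) [MOD m*p] ∧
          ∀ q ∈ d, n % q ∈ Ω q} := by
      rw [Finset.card_eq_sum_card_fiberwise (f := fun n => n % p) (t := Ω p)]
      · apply Finset.sum_congr rfl
        intro r hr
        congr 1
        ext n
        simp only [Finset.mem_filter, Finset.mem_range, Finset.mem_insert, forall_eq_or_imp]
        have hrp := hp.2.2 r hr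
        have c := (Nat.chineseRemainder hmp a r).2
        have : n ≡ (Nat.chineseRemainder hmp a r : ℕ) [MOD m*p] ↔ n ≡ a [MOD m] ∧ n % p = r := by
          rw [← Nat.modEq_and_modEq_iff_modEq_mul hmp]
          constructor
          · rintro ⟨h1, h2⟩
            refine ⟨h1.trans c.1, ?_⟩
            have := h2.trans c.2
            rwa [Nat.ModEq, Nat.mod_eq_of_lt hrp] at this
          · rintro ⟨h1, h2⟩
            refine ⟨h1.trans c.1.symm, Nat.ModEq.trans ?_ c.2.symm⟩
            rw [Nat.ModEq, h2, Nat.mod_eq_of_lt hrp]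
        rw [this]
        constructor
        · rintro ⟨⟨h1, h2, h3, h4⟩, h5⟩; exact ⟨h1, ⟨h2, h5⟩, h4⟩
        · rintro ⟨h1, ⟨h2, h5⟩, h4⟩; exact ⟨⟨h1, h2, h5 ▸ hr, h4⟩, h5⟩
      · intro n hn
        simp only [Finset.coe_filter, Set.mem_ofPred_eq] at hn
        exact hn.2.2 p (Finset.mem_insert_self p d)
    rw [e1, Finset.prod_insert hpd, Finset.card_insert_of_notMem hpd]
    push_cast
    have e2 : (N:ℝ)/m * ((ρ:ℝ)/p * ∏ q ∈ d, (ρ/q:ℝ)) =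
        ∑ r ∈ Ω p, (N / ((m*p : ℕ):ℝ) * ∏ q ∈ d, (ρ/q:ℝ)) := by
      rw [Finset.sum_const, hp.2.1]
      have : (p:ℝ) ≠ 0 := by positivity
      have : (m:ℝ) ≠ 0 := by positivity
      push_cast; rw [nsmul_eq_mul]; field_simp
    rw [e2, ← Finset.sum_sub_distrib]
    refine (Finset.abs_sum_le_sum_abs _ _).trans ?_
    refine (Finset.sum_le_sum fun r _ => ih' (m*p) _ (by positivity) hcop').trans ?_
    rw [Finset.sum_const, hp.2.1, nsmul_eq_mul, pow_succ, mul_comm]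
lemma bonf (B : Finset ℕ) (r : ℕ) :
    (if B = ∅ then (1:ℝ) else 0) ≤ ∑ d ∈ B.powerset with d.card ≤ 2*r, (-1:ℝ)^d.card := by
  have h1 : ∑ d ∈ B.powerset with d.card ≤ 2*r, (-1:ℝ)^d.card =
      ∑ i ∈ Finset.range (2*r+1), (-1:ℝ)^i * (B.card.choose i) := by
    rw [← Finset.sum_fiberwise_of_maps_to (g := Finset.card) (t := Finset.range (2*r+1))]
    · apply Finset.sum_congr rfl
      intro i hi
      rw [Finset.sum_congr rfl (g := fun _ => (-1:ℝ)^i) (by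
        intro d hd; rw [(Finset.mem_filter.1 hd).2]), Finset.sum_const, nsmul_eq_mul, mul_comm,
        ← Finset.card_powersetCard]
      congr 3
      ext d
      have := Finset.mem_range.1 hi
      simp only [Finset.mem_filter, Finset.mem_powerset, Finset.mem_powersetCard]
      constructor
      · rintro ⟨⟨h1, h2⟩, h3⟩; exact ⟨h1, h3⟩
      · rintro ⟨h1, h3⟩; exact ⟨⟨h1, by omega⟩, h3⟩
    · intro d hd; have := (Finset.mem_filter.1 hd).2; simp; omega
  rw [h1]
  rcases Nat.eq_zero_or_pos B.card with h | h
  · rw [if_pos (Finset.card_eq_zero.1 h), h, Finset.sum_range_succ']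
    simp
  · rw [if_neg (fun h0 => by simp [h0] at h)]
    obtain ⟨n, hn⟩ := Nat.exists_eq_succ_of_ne_zero h.ne'
    have := Int.alternating_sum_range_choose_eq_choose (n := n) (m := 2*r)
    have h2 : ∑ i ∈ Finset.range (2*r+1), (-1:ℝ)^i * (B.card.choose i) =
      ((∑ i ∈ Finset.range (2*r+1), ((-1)^i * ((n+1).choose i) : ℤ) : ℤ):ℝ) := by
      push_cast; rw [hn]
    rw [h2, this, pow_mul]; simp
lemma brun (N ρ r : ℕ) (Ω : ℕ → Finset ℕ) (ps : Finset ℕ)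
    (hd : ∀ p ∈ ps, p.Prime ∧ (Ω p).card = ρ ∧ (∀ r ∈ Ω p, r < p) ∧ ρ ≤ p) :
    (#{n ∈ Finset.range N | ∀ p ∈ ps, n % p ∉ Ω p} : ℝ) ≤
      N * (exp (-∑ p ∈ ps, (ρ/p:ℝ)) + exp (3 * ∑ p ∈ ps, (ρ/p:ℝ) - 2*r)) + (ρ * ps.card + 1)^(2*r) := by
  set s := ∑ p ∈ ps, (ρ/p:ℝ)
  set D := ps.powerset.filter (fun d => d.card ≤ 2*r) with hD
  have h1 : (#{n ∈ Finset.range N | ∀ p ∈ ps, n % p ∉ Ω p} : ℝ) ≤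
      ∑ d ∈ D, (-1:ℝ)^d.card * #{n ∈ Finset.range N | n ≡ 0 [MOD 1] ∧ ∀ p ∈ d, n % p ∈ Ω p} := by
    rw [Finset.card_filter]
    push_cast
    have : ∀ d ∈ D, (-1:ℝ)^d.card * #{n ∈ Finset.range N | n ≡ 0 [MOD 1] ∧ ∀ p ∈ d, n % p ∈ Ω p} =
        ∑ n ∈ Finset.range N, if ∀ p ∈ d, n % p ∈ Ω p then (-1:ℝ)^d.card else 0 := by
      intro d _
      rw [Finset.card_filter]; push_cast; rw [Finset.mul_sum]
      simp [Nat.modEq_one]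
    rw [Finset.sum_congr rfl this, Finset.sum_comm]
    apply Finset.sum_le_sum
    intro n _
    have hb := bonf (ps.filter fun p => n % p ∈ Ω p) r
    have e : ∑ d ∈ D, (if ∀ p ∈ d, n % p ∈ Ω p then (-1:ℝ)^d.card else 0) =
      ∑ d ∈ (ps.filter fun p => n % p ∈ Ω p).powerset with d.card ≤ 2*r, (-1:ℝ)^d.card := by
      rw [← Finset.sum_filter]
      apply Finset.sum_congr _ (fun _ _ => rfl)
      ext d
      simp only [hD, Finset.mem_filter, Finset.mem_powerset, Finset.subset_iff]
      grind
    rw [e]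
    refine le_trans (le_of_eq ?_) hb
    simp only [Finset.filter_eq_empty_iff]
  have h2 : ∀ d ∈ D, (-1:ℝ)^d.card * #{n ∈ Finset.range N | n ≡ 0 [MOD 1] ∧ ∀ p ∈ d, n % p ∈ Ω p} ≤
      N * ((-1:ℝ)^d.card * ∏ p ∈ d, (ρ/p : ℝ)) + (ρ:ℝ)^d.card := by
    intro d hd'
    have hsub := Finset.mem_powerset.1 (Finset.mem_filter.1 hd').1
    have := crt_count N ρ Ω d (fun p hp => ⟨(hd p (hsub hp)).1, (hd p (hsub hp)).2.1, (hd p (hsub hp)).2.2.1⟩)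
      1 0 one_pos (by simp)
    rw [abs_le] at this
    simp only [Nat.cast_one, div_one] at this
    rcases neg_one_pow_eq_or ℝ d.card with h | h <;> rw [h] <;> linarith
  have hfull : ∑ d ∈ ps.powerset, (-1:ℝ)^d.card * ∏ p ∈ d, (ρ/p : ℝ) ≤ exp (-s) := by
    have : ∏ p ∈ ps, (1 + -(ρ/p:ℝ)) = ∑ d ∈ ps.powerset, (-1:ℝ)^d.card * ∏ p ∈ d, (ρ/p : ℝ) := by
      rw [Finset.prod_one_add]
      exact Finset.sum_congr rfl fun d _ => by rw [Finset.prod_neg]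
    rw [← this, ← Finset.sum_neg_distrib, Real.exp_sum]
    apply Finset.prod_le_prod
    · intro p hp
      have h0 : (0:ℝ) < p := by exact_mod_cast (hd p hp).1.pos
      have : (ρ:ℝ)/p ≤ 1 := by rw [div_le_one h0]; exact_mod_cast (hd p hp).2.2.2
      linarith
    · intro p _; have := Real.add_one_le_exp (-(ρ/p:ℝ)); linarith
  have htail : ∑ d ∈ ps.powerset with ¬ d.card ≤ 2*r, ∏ p ∈ d, (ρ/p : ℝ) ≤ exp (3*s-2*r) := by
    have he : exp 1 ≤ 3 := by have := Real.exp_one_lt_d9; linarith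
    have : ∀ d ∈ ps.powerset.filter (fun d => ¬ d.card ≤ 2*r), ∏ p ∈ d, (ρ/p : ℝ) ≤
        exp (-(2*r)) * ∏ p ∈ d, (exp 1 * (ρ/p) : ℝ) := by
      intro d hd'
      have hc := (Finset.mem_filter.1 hd').2
      rw [Finset.prod_mul_distrib, Finset.prod_const, ← mul_assoc, ← Real.exp_nat_mul, ← Real.exp_add]
      apply le_mul_of_one_le_left (Finset.prod_nonneg fun _ _ => by positivity)
      apply Real.one_le_exp
      have : (2*r:ℝ) ≤ d.card := by exact_mod_cast (by omega : 2*r ≤ d.card)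
      linarith
    refine (Finset.sum_le_sum this).trans ?_
    rw [← Finset.mul_sum]
    have h3 : ∑ d ∈ ps.powerset with ¬ d.card ≤ 2*r, ∏ p ∈ d, (exp 1 * (ρ/p) : ℝ) ≤ exp (3*s) := by
      refine (Finset.sum_le_sum_of_subset_of_nonneg (Finset.filter_subset _ _)
        (fun _ _ _ => Finset.prod_nonneg fun _ _ => by positivity)).trans ?_
      rw [← Finset.prod_one_add, Finset.mul_sum, Real.exp_sum]
      apply Finset.prod_le_prod (fun _ _ => by positivity)
      intro p _
      have h0 : (0:ℝ) ≤ ρ/p := by positivity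
      have := Real.add_one_le_exp (3*(ρ/p):ℝ)
      nlinarith
    calc _ ≤ exp (-(2*r)) * exp (3*s) := by gcongr
      _ = _ := by rw [← Real.exp_add]; ring_nf
  have herr : ∑ d ∈ D, (ρ:ℝ)^d.card ≤ (ρ * ps.card + 1)^(2*r) := by
    rw [← Finset.sum_fiberwise_of_maps_to (g := Finset.card) (t := Finset.range (2*r+1)) (by
      intro d hd; have := (Finset.mem_filter.1 hd).2; simp; omega), add_pow]
    apply Finset.sum_le_sum
    intro i hi
    have hi' := Finset.mem_range.1 hi
    rw [Finset.sum_congr rfl (g := fun _ => (ρ:ℝ)^i) (by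
        intro d hd; rw [(Finset.mem_filter.1 hd).2]), Finset.sum_const, nsmul_eq_mul]
    have c1 : (#(D.filter fun d => d.card = i) : ℝ) ≤ (ps.card:ℝ)^i := by
      have : (D.filter fun d => d.card = i) ⊆ ps.powersetCard i := by
        intro d; simp only [hD, Finset.mem_filter, Finset.mem_powerset, Finset.mem_powersetCard]; tauto
      have := Finset.card_le_card this
      rw [Finset.card_powersetCard] at this
      exact_mod_cast this.trans (Nat.choose_le_pow _ _)
    have c2 : (1:ℝ) ≤ (2*r).choose i := by exact_mod_cast Nat.choose_pos (by omega)
    rw [one_pow, mul_one, mul_pow]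
    calc _ ≤ (ps.card:ℝ)^i * (ρ:ℝ)^i := by gcongr
      _ = (ρ:ℝ)^i * (ps.card:ℝ)^i * 1 := by ring
      _ ≤ _ := by gcongr
  have hsplit : ∑ d ∈ D, (-1:ℝ)^d.card * ∏ p ∈ d, (ρ/p : ℝ) ≤ exp (-s) + exp (3*s-2*r) := by
    have := Finset.sum_filter_add_sum_filter_not ps.powerset (fun d => d.card ≤ 2*r)
      (fun d => (-1:ℝ)^d.card * ∏ p ∈ d, (ρ/p : ℝ))
    have h3 : -∑ d ∈ ps.powerset with ¬ d.card ≤ 2*r, (-1:ℝ)^d.card * ∏ p ∈ d, (ρ/p : ℝ) ≤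
        ∑ d ∈ ps.powerset with ¬ d.card ≤ 2*r, ∏ p ∈ d, (ρ/p : ℝ) := by
      rw [← Finset.sum_neg_distrib]
      apply Finset.sum_le_sum
      intro d _
      have : 0 ≤ ∏ p ∈ d, (ρ/p : ℝ) := Finset.prod_nonneg fun _ _ => by positivity
      rcases neg_one_pow_eq_or ℝ d.card with h | h <;> rw [h] <;> linarith
    linarith
  calc _ ≤ _ := h1
    _ ≤ _ := Finset.sum_le_sum h2
    _ = N * ∑ d ∈ D, ((-1:ℝ)^d.card * ∏ p ∈ d, (ρ/p : ℝ)) + ∑ d ∈ D, (ρ:ℝ)^d.card := by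
      rw [Finset.sum_add_distrib, Finset.mul_sum]
    _ ≤ _ := by gcongr
end FordT

namespace FordT
open Real Finset
lemma omega_le {D : ℕ} (hD : D ≠ 0) : (D.primeFactors.card : ℝ) ≤ 2 * log D := by
  have h1 : 2 ^ D.primeFactors.card ≤ D := by
    calc 2 ^ D.primeFactors.card = ∏ p ∈ D.primeFactors, 2 := by simp
      _ ≤ ∏ p ∈ D.primeFactors, p := Finset.prod_le_prod' fun p hp => (Nat.prime_of_mem_primeFactors hp).two_le
      _ ≤ D := Nat.le_of_dvd (Nat.pos_of_ne_zero hD) (Nat.prod_primeFactors_dvd D)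
  have h2 : (D.primeFactors.card : ℝ) * log 2 ≤ log D := by
    rw [← Real.log_pow]; apply Real.log_le_log (by positivity); exact_mod_cast h1
  have := Real.log_two_gt_d9
  have : (0:ℝ) ≤ D.primeFactors.card := by positivity
  nlinarith
lemma sieve_aux (κ w z r N D : ℕ) (Bs : Finset ℕ) (hB : Bs.card = κ) (hw : κ + 1 ≤ w)
    (hp : ∀ p, p.Prime → ¬ p ∣ D → (∀ b ∈ Bs, ¬ p ∣ b) ∧ ∀ b ∈ Bs, ∀ b' ∈ Bs, b ≠ b' → ¬ b ≡ b' [MOD p]) :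
    (#{n ∈ Finset.range N | n.Prime ∧ ∀ b ∈ Bs, (b*n+1).Prime} : ℝ) ≤ (z+1) +
      (N * (exp (-∑ p ∈ (PL z).filter (fun p => w < p ∧ ¬ p ∣ D), ((κ+1:ℕ)/p:ℝ)) +
        exp (3 * ∑ p ∈ (PL z).filter (fun p => w < p ∧ ¬ p ∣ D), ((κ+1:ℕ)/p:ℝ) - 2*r)) +
        ((κ+1:ℕ) * z + 1)^(2*r)) := by
  classical
  set ps := (PL z).filter (fun p => w < p ∧ ¬ p ∣ D) with hps
  let Ω : ℕ → Finset ℕ := fun p => insert 0 (Bs.image (fun b : ℕ => (-((b:ℕ):ZMod p)⁻¹).val))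
  have hmem : ∀ p ∈ ps, p ≤ z ∧ p.Prime ∧ w < p ∧ ¬ p ∣ D := by
    intro p h; obtain ⟨h1,h2⟩ := Finset.mem_filter.1 h; have := mem_PL.1 h1; exact ⟨this.1,this.2,h2.1,h2.2⟩
  have hbr := brun N (κ+1) r Ω ps (by
    intro p hpp
    obtain ⟨h1, h2, h3, h4⟩ := hmem p hpp
    have := Fact.mk h2
    obtain ⟨h5, h6⟩ := hp p h2 h4
    have hb0 : ∀ b ∈ Bs, (b : ZMod p) ≠ 0 := fun b hb h => h5 b hb ((ZMod.natCast_eq_zero_iff b p).1 h)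
    refine ⟨h2, ?_, ?_, by omega⟩
    · rw [Finset.card_insert_of_notMem, Finset.card_image_of_injOn, hB]
      · intro b hb b' hb' h
        by_contra hne
        apply h6 b hb b' hb' hne
        have := ZMod.val_injective p h
        rw [neg_inj, inv_inj] at this
        exact (ZMod.natCast_eq_natCast_iff b b' p).1 this
      · intro h
        obtain ⟨b, hb, h⟩ := Finset.mem_image.1 h
        rw [ZMod.val_eq_zero, neg_eq_zero, inv_eq_zero] at h
        exact hb0 b hb h
    · intro r hr
      rcases Finset.mem_insert.1 hr with rfl | h
      · exact h2.pos
      · obtain ⟨b, _, rfl⟩ := Finset.mem_image.1 h; exact ZMod.val_lt _)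
  have hcard : ps.card ≤ z := by
    have : ps ⊆ Finset.Icc 1 z := fun p h => Finset.mem_Icc.2 ⟨(hmem p h).2.1.pos, (hmem p h).1⟩
    simpa using Finset.card_le_card this
  have hsub : {n ∈ Finset.range N | n.Prime ∧ ∀ b ∈ Bs, (b*n+1).Prime} ⊆
      Finset.range (z+1) ∪ {n ∈ Finset.range N | ∀ p ∈ ps, n % p ∉ Ω p} := by
    intro n hn
    obtain ⟨h1, h2, h3⟩ := by simpa using hn
    by_cases hz : n < z+1
    · exact Finset.mem_union_left _ (Finset.mem_range.2 hz)
    apply Finset.mem_union_right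
    refine Finset.mem_filter.2 ⟨Finset.mem_range.2 h1, fun p hpp hr => ?_⟩
    obtain ⟨g1, g2, g3, g4⟩ := hmem p hpp
    have := Fact.mk g2
    rcases Finset.mem_insert.1 hr with h | h
    · rcases (Nat.dvd_prime h2).1 (Nat.dvd_of_mod_eq_zero h) with h | h
      · exact g2.one_lt.ne' h
      · omega
    · obtain ⟨b, hb, h⟩ := Finset.mem_image.1 h
      obtain ⟨h5, h6⟩ := hp p g2 g4
      have hb0 : (b : ZMod p) ≠ 0 := fun h => h5 b hb ((ZMod.natCast_eq_zero_iff b p).1 h)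
      have e : (n : ZMod p) = -(b:ZMod p)⁻¹ := by
        have := congrArg (fun k : ℕ => (k : ZMod p)) h
        simpa using this.symm
      have : ((b*n+1 : ℕ) : ZMod p) = 0 := by
        push_cast; rw [e]; field_simp; ring
      have hdvd := (ZMod.natCast_eq_zero_iff _ p).1 this
      rcases (Nat.dvd_prime (h3 b hb)).1 hdvd with h | h
      · exact g2.one_lt.ne' h
      · have : 0 < b := Nat.pos_of_ne_zero (fun h => by simp [h] at hb0)
        nlinarith
  have h1 := (Finset.card_le_card hsub).trans (Finset.card_union_le _ _)
  have h2 : (#{n ∈ Finset.range N | n.Prime ∧ ∀ b ∈ Bs, (b*n+1).Prime} : ℝ) ≤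
      (z+1) + #{n ∈ Finset.range N | ∀ p ∈ ps, n % p ∉ Ω p} := by
    rw [Finset.card_range] at h1; exact_mod_cast h1
  refine h2.trans (add_le_add le_rfl (hbr.trans (add_le_add le_rfl ?_)))
  gcongr
lemma sieve_sum (w z D : ℕ) (hD : D ≠ 0) (hw : 2 ≤ w) (hDw : 2 * log D ≤ w) :
    PR z - PR w - 1 ≤ ∑ p ∈ (PL z).filter (fun p => w < p ∧ ¬ p ∣ D), (1/p:ℝ) ∧
    ∑ p ∈ (PL z).filter (fun p => w < p ∧ ¬ p ∣ D), (1/p:ℝ) ≤ PR z := by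
  refine ⟨?_, Finset.sum_le_sum_of_subset_of_nonneg (Finset.filter_subset _ _) fun _ _ _ => by positivity⟩
  have hw0 : (0:ℝ) < w := by positivity
  have h1 : ∑ p ∈ D.primeFactors.filter (fun p => w < p), (1/p:ℝ) ≤ 1 := by
    calc _ ≤ ∑ p ∈ D.primeFactors.filter (fun p => w < p), (1/w:ℝ) := by
          apply Finset.sum_le_sum; intro p hp
          have : (w:ℝ) < p := by exact_mod_cast (Finset.mem_filter.1 hp).2
          exact one_div_le_one_div_of_le hw0 this.le
      _ ≤ D.primeFactors.card * (1/w:ℝ) := by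
          rw [Finset.sum_const, nsmul_eq_mul]; gcongr; apply Finset.filter_subset
      _ ≤ 1 := by
          rw [mul_one_div, div_le_one hw0]; exact (omega_le hD).trans hDw
  have h2 : PL z ⊆ PL w ∪ (D.primeFactors.filter (fun p => w < p) ∪ (PL z).filter (fun p => w < p ∧ ¬ p ∣ D)) := by
    intro p hp
    have hq := mem_PL.1 hp
    by_cases h : p ≤ w
    · exact Finset.mem_union_left _ (mem_PL.2 ⟨h, hq.2⟩)
    refine Finset.mem_union_right _ ?_
    by_cases h' : p ∣ D
    · exact Finset.mem_union_left _ (Finset.mem_filter.2 ⟨Nat.mem_primeFactors.2 ⟨hq.2, h', hD⟩, by omega⟩)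
    · exact Finset.mem_union_right _ (Finset.mem_filter.2 ⟨hp, by omega, h'⟩)
  have h3 : ∀ s t : Finset ℕ, ∑ p ∈ s ∪ t, (1/p:ℝ) ≤ ∑ p ∈ s, (1/p:ℝ) + ∑ p ∈ t, (1/p:ℝ) := fun s t => by
    rw [← Finset.sum_union_inter]
    have : 0 ≤ ∑ p ∈ s ∩ t, (1/p:ℝ) := Finset.sum_nonneg fun _ _ => by positivity
    linarith
  have h4 : PR z ≤ _ := (Finset.sum_le_sum_of_subset_of_nonneg h2 fun _ _ _ => by positivity).trans (h3 _ _)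
  have h5 := h3 (D.primeFactors.filter (fun p => w < p)) ((PL z).filter (fun p => w < p ∧ ¬ p ∣ D))
  have : ∑ p ∈ PL w, (1/p:ℝ) = PR w := rfl
  linarith
end FordT

namespace FordT
open Real Finset
open Filter in
lemma ev_log (M : ℝ) : ∀ᶠ l : ℝ in atTop, M * log l ≤ l := by
  have h := (Real.isLittleO_log_id_atTop.def (c := 1/(|M|+1)) (by positivity))
  filter_upwards [h, eventually_ge_atTop 1] with l h1 h2
  simp only [id, Real.norm_eq_abs] at h1
  rw [abs_of_nonneg (Real.log_nonneg h2), abs_of_nonneg (by linarith : (0:ℝ) ≤ l), div_mul_eq_mul_div, le_div_iff₀ (by positivity)] at h1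
  have := le_abs_self M
  nlinarith [Real.log_nonneg h2]
open Filter in
lemma ev_pow_exp (n : ℕ) (c : ℝ) (hc : 0 < c) : ∀ᶠ l : ℝ in atTop, l^n ≤ exp (c*l) := by
  filter_upwards [ev_log (n/c), eventually_gt_atTop 0] with l h1 h2
  rw [← Real.log_le_log_iff (by positivity) (by positivity), Real.log_pow, Real.log_exp]
  rw [div_mul_eq_mul_div, div_le_iff₀ hc] at h1; linarith
set_option maxHeartbeats 1000000 in
open Filter in
lemma sieve (κ : ℕ) : ∃ C Y0 : ℝ, 0 < C ∧ 3 ≤ Y0 ∧ ∀ Y : ℝ, Y0 ≤ Y → ∀ (Bs : Finset ℕ) (D : ℕ), Bs.card = κ → D ≠ 0 →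
    log D ≤ (log Y)^3 →
    (∀ p, p.Prime → ¬ p ∣ D → (∀ b ∈ Bs, ¬ p ∣ b) ∧ ∀ b ∈ Bs, ∀ b' ∈ Bs, b ≠ b' → ¬ b ≡ b' [MOD p]) →
    (#{n ∈ Finset.range (⌊Y⌋₊+1) | n.Prime ∧ ∀ b ∈ Bs, (b*n+1).Prime} : ℝ) ≤
      C * Y * (log (log Y))^(2*(κ+1)) / (log Y)^(κ+1) := by
  obtain ⟨C0, hC0, hM⟩ := mertens
  set ρ : ℕ := κ + 1 with hρ
  have hρ1 : (1:ℝ) ≤ ρ := by exact_mod_cast Nat.succ_le_succ (Nat.zero_le κ)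
  set K : ℝ := 40*ρ with hK
  set A : ℝ := log (2*K) + log 4 + 2*C0 + 1 with hA
  have hev : ∀ᶠ l : ℝ in atTop, (2 + log (ρ+2)) * K * log l ≤ l ∧ l^ρ ≤ exp (1/2*l) ∧ ρ + 4 ≤ l ∧ C0 + 1 ≤ log l := by
    filter_upwards [ev_log ((2 + log (ρ+2)) * K), ev_pow_exp ρ (1/2) (by norm_num), eventually_ge_atTop (ρ+4:ℝ),
      tendsto_log_atTop.eventually_ge_atTop (C0+1)] with l a b c d
    exact ⟨a, b, c, d⟩
  obtain ⟨l0, hl0⟩ := hev.exists_forall_of_atTop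
  refine ⟨2 + 4*exp (ρ*A), max (exp l0) (exp 2), by positivity, ?_, ?_⟩
  · refine le_trans ?_ (le_max_right _ _); linarith [Real.add_one_le_exp (2:ℝ)]
  intro Y hY Bs D hB hD hDl hp
  have hY1 : exp l0 ≤ Y := (le_max_left _ _).trans hY
  have hY0 : 0 < Y := (exp_pos _).trans_le hY1
  set l := log Y with hl
  have hll : l0 ≤ l := by rw [hl, Real.le_log_iff_exp_le hY0]; exact hY1
  obtain ⟨e1, e2, e3, e4⟩ := hl0 l hll
  set L := log l with hL
  have hl5 : 5 ≤ l := by linarith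
  have hL1 : 2 ≤ L := by linarith
  have hY' : Y = exp l := (Real.exp_log hY0).symm
  set T := l/(K*L) with hT
  have hK40 : 40 ≤ K := by rw [hK]; linarith
  have hlρ : 0 ≤ log ((ρ:ℝ)+2) := Real.log_nonneg (by linarith)
  have hT2 : 2 + log (ρ+2) ≤ T := by
    rw [hT, le_div_iff₀ (by positivity)]; linarith
  have hTl : T ≤ l/4 := by
    rw [hT]; apply div_le_div_of_nonneg_left (by linarith) (by norm_num); nlinarith only [hK40, hL1]
  set z := ⌊exp T⌋₊ with hz
  have hz1 : (z:ℝ) ≤ exp T := Nat.floor_le (exp_pos _).le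
  have hz2 : exp T < z + 1 := Nat.lt_floor_add_one _
  have hT3 : exp (T/2) ≤ z := by
    have : exp T = exp (T/2) * exp (T/2) := by rw [← Real.exp_add]; congr 1; ring
    have h2 : 2 ≤ exp (T/2) := by linarith only [Real.add_one_le_exp (T/2), hT2, hlρ]
    have h3 := mul_le_mul_of_nonneg_right h2 (exp_pos (T/2)).le
    linarith only [this, h3, hz2, h2]
  have hzρ : (ρ:ℝ) + 1 ≤ z := by
    have : exp (log ((ρ:ℝ)+2)) ≤ exp T := Real.exp_le_exp.2 (by linarith)
    rw [Real.exp_log (by positivity)] at this; linarith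
  set w := ⌈2*l^3⌉₊ + (κ+2) with hw
  have hwl : (w:ℝ) ≤ l^4 := by
    have : (⌈2*l^3⌉₊ : ℝ) < 2*l^3+1 := Nat.ceil_lt_add_one (by positivity)
    have : (w:ℝ) = ⌈2*l^3⌉₊ + (κ+2) := by rw [hw]; push_cast; ring
    have hk : (ρ:ℝ) = κ + 1 := by rw [hρ]; push_cast; ring
    have h1 : l ≤ l^3 := le_self_pow₀ (by linarith) (by norm_num)
    have h2 : 5*l^3 ≤ l^4 := by rw [pow_succ l 3]; linarith only [mul_le_mul_of_nonneg_left hl5 (by positivity : 0 ≤ l^3)]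
    linarith
  have hwD : 2 * log D ≤ w := by
    have : 2*l^3 ≤ ⌈2*l^3⌉₊ := Nat.le_ceil _
    have : (w:ℝ) = ⌈2*l^3⌉₊ + (κ+2) := by rw [hw]; push_cast; ring
    have : (0:ℝ) ≤ κ := by positivity
    linarith
  have hw2 : 2 ≤ w := by omega
  obtain ⟨s1, s2⟩ := sieve_sum w z D hD hw2 hwD
  set S := ∑ p ∈ (PL z).filter (fun p => w < p ∧ ¬ p ∣ D), (1/p:ℝ) with hS
  have hz22 : 2 ≤ z := by
    have : (2:ℝ) ≤ z := by linarith
    exact_mod_cast this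
  have hlz1 : T/2 ≤ log z := by rw [Real.le_log_iff_exp_le (by positivity)]; exact hT3
  have hlz2 : log z ≤ l := by
    rw [Real.log_le_iff_le_exp (by positivity)]
    exact hz1.trans (Real.exp_le_exp.2 (by linarith))
  have m1 := abs_le.1 (hM z hz22)
  have m2 := abs_le.1 (hM w hw2)
  have k1 : L - log (2*K) - log L ≤ log (log z) := by
    have : log (T/2) = L - log (2*K) - log L := by
      rw [hT, div_div, Real.log_div (by positivity) (by positivity), show K*L*2 = (2*K)*L by ring, Real.log_mul (by positivity) (by positivity)]; ring
    rw [← this]; exact Real.log_le_log (by linarith) hlz1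
  have k2 : log (log z) ≤ L := Real.log_le_log (by linarith) hlz2
  have k3 : log (log w) ≤ log 4 + log L := by
    rw [← Real.log_mul (by norm_num) (by positivity)]
    have h4 : log (w:ℝ) ≤ 4*L := by
      have := Real.log_le_log (by positivity) hwl
      rw [Real.log_pow] at this; exact_mod_cast this
    apply Real.log_le_log _ h4
    apply Real.log_pos; exact_mod_cast hw2
  have hSlow : L - 2*log L - A ≤ S := by rw [hA]; linarith
  have hSup : S ≤ 2*L := by linarith
  have hS0 : 0 ≤ S := Finset.sum_nonneg fun _ _ => by positivity
  set s := (ρ:ℝ) * S with hs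
  have hs0 : 0 ≤ s := by positivity
  set r := ⌈2*s⌉₊ with hr
  have hr1 : 2*s ≤ r := Nat.le_ceil _
  have hr2 : (r:ℝ) < 2*s+1 := Nat.ceil_lt_add_one (by positivity)
  have hsum : ∑ p ∈ (PL z).filter (fun p => w < p ∧ ¬ p ∣ D), ((κ+1:ℕ)/p:ℝ) = s := by
    rw [hs, hS, Finset.mul_sum]; apply Finset.sum_congr rfl; intros; rw [mul_one_div]
  have main := sieve_aux κ w z r (⌊Y⌋₊+1) D Bs hB (by omega) hp
  rw [hsum] at main
  have hes : exp (-s) ≤ exp (ρ*A) * L^(2*ρ) / l^ρ := by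
    have : exp (ρ*A) * L^(2*ρ) / l^ρ = exp (ρ*A + (2*ρ)*log L - ρ * L) := by
      rw [Real.exp_sub, Real.exp_add]
      congr 1
      · congr 1
        rw [show (2*ρ:ℝ)*log L = ((2*ρ:ℕ):ℝ) * log L by push_cast; ring, Real.exp_nat_mul, Real.exp_log (by positivity)]
      · rw [hL, Real.exp_nat_mul, Real.exp_log (by positivity)]
    rw [this, Real.exp_le_exp, hs]
    linarith [mul_le_mul_of_nonneg_left hSlow (by linarith : (0:ℝ) ≤ ρ)]
  have hes2 : exp (3*s-2*r) ≤ exp (-s) := Real.exp_le_exp.2 (by linarith)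
  have hsq : exp (l/2) ≤ Y * (L^(2*ρ) / l^ρ) := by
    have : (1:ℝ) ≤ L^(2*ρ) := one_le_pow₀ (by linarith)
    have h3 : exp (l/2) ≤ Y/l^ρ := by
      rw [le_div_iff₀ (by positivity), hY']
      calc _ ≤ exp (l/2) * exp (1/2*l) := by gcongr
        _ = exp l := by rw [← Real.exp_add]; congr 1; ring
    calc _ ≤ Y/l^ρ := h3
      _ = Y * (1/l^ρ) := by ring
      _ ≤ _ := by gcongr
  have herr : (((κ+1:ℕ):ℝ) * z + 1)^(2*r) ≤ exp (l/2) := by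
    have h1 : ((κ+1:ℕ):ℝ) * z + 1 ≤ exp (2*T) := by
      calc _ ≤ (z:ℝ)*z := by rw [← hρ]; nlinarith only [hzρ, hρ1]
        _ ≤ exp T * exp T := by gcongr
        _ = _ := by rw [← Real.exp_add]; congr 1; ring
    calc _ ≤ (exp (2*T))^(2*r) := by gcongr
      _ = exp ((2*r:ℕ) * (2*T)) := by rw [← Real.exp_nat_mul]
      _ ≤ _ := by
        apply Real.exp_le_exp.2
        have : s ≤ ρ*(2*L) := by rw [hs]; gcongr
        have h5 : (r:ℝ) ≤ 5*ρ*L := by nlinarith only [this, hr2, hL1, hρ1, mul_le_mul hρ1 hL1 (by norm_num) (by linarith)]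
        push_cast
        have : T * (K*L) = l := by rw [hT]; field_simp
        have hT0 : 0 ≤ T := by linarith
        rw [hK] at this
        have := mul_le_mul_of_nonneg_right h5 hT0
        linarith
  have hz3 : (z:ℝ) + 1 ≤ exp (l/2) := by
    have : exp (l/2) = exp (l/4) * exp (l/4) := by rw [← Real.exp_add]; congr 1; ring
    have h2 : exp T ≤ exp (l/4) := Real.exp_le_exp.2 hTl
    nlinarith only [Real.add_one_le_exp (l/4), hz1, hl5, h2, this]
  have hfl : ((⌊Y⌋₊+1 : ℕ) : ℝ) ≤ 2*Y := by
    push_cast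
    have : (⌊Y⌋₊:ℝ) ≤ Y := Nat.floor_le hY0.le
    have : 1 ≤ Y := by rw [hY']; exact Real.one_le_exp (by linarith)
    linarith
  calc _ ≤ _ := main
    _ ≤ exp (l/2) + (2*Y * (exp (-s) + exp (-s)) + exp (l/2)) := by gcongr
    _ ≤ Y * (L^(2*ρ) / l^ρ) + (2*Y * (exp (ρ*A) * L^(2*ρ) / l^ρ + exp (ρ*A) * L^(2*ρ) / l^ρ) + Y * (L^(2*ρ) / l^ρ)) := by gcongr
    _ = _ := by ring
end FordT

namespace FordT
open Real Finset
noncomputable def E (t : ℝ) : ℝ := exp (exp t)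
lemma E_pos (t : ℝ) : 0 < E t := exp_pos _
lemma E_mono {s t : ℝ} (h : s ≤ t) : E s ≤ E t := Real.exp_le_exp.2 (Real.exp_le_exp.2 h)
lemma loglogE (t : ℝ) : log (log (E t)) = t := by simp [E]
lemma E_loglog {y : ℝ} (hy : 1 < y) : E (log (log y)) = y := by
  rw [E, Real.exp_log (Real.log_pos hy), Real.exp_log (by linarith)]
lemma E_gt {t : ℝ} (h : 0 ≤ t) : 2 < E t := by
  have := Real.exp_one_gt_d9
  calc (2:ℝ) < exp 1 := by linarith
    _ ≤ _ := Real.exp_le_exp.2 (Real.one_le_exp h)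
lemma PRE : ∃ C, 1 ≤ C ∧ ∀ t : ℝ, 0 ≤ t → |PR ⌊E t⌋₊ - t| ≤ C := by
  obtain ⟨C, hC, h⟩ := mertens
  refine ⟨C + 3, by linarith, fun t ht => ?_⟩
  have h2 : 2 ≤ ⌊E t⌋₊ := Nat.le_floor (by exact_mod_cast (E_gt ht).le)
  have := abs_le.1 (h _ h2)
  have h2' : (2:ℝ) ≤ ⌊E t⌋₊ := by exact_mod_cast h2
  have f1 : (⌊E t⌋₊:ℝ) ≤ E t := Nat.floor_le (E_pos t).le
  have f2 : E t < ⌊E t⌋₊ + 1 := Nat.lt_floor_add_one _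
  have l2 := Real.log_two_lt_d9
  have g1 : log (log ⌊E t⌋₊) ≤ t := by
    conv_rhs => rw [← loglogE t]
    exact Real.log_le_log (Real.log_pos (by linarith)) (Real.log_le_log (by linarith) f1)
  have g2 : t - 3 ≤ log (log ⌊E t⌋₊) := by
    rw [Real.le_log_iff_exp_le (Real.log_pos (by linarith))]
    have : log (E t / 2) ≤ log ⌊E t⌋₊ := Real.log_le_log (by linarith [E_pos t]) (by linarith)
    rw [Real.log_div (E_pos t).ne' (by norm_num), show log (E t) = exp t by simp [E]] at this
    have e1 : exp (t-3) * exp 3 = exp t := by rw [← Real.exp_add]; congr 1; ring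
    have : 1 ≤ exp t := Real.one_le_exp ht
    have : (4:ℝ) ≤ exp 3 := by linarith [Real.add_one_le_exp (3:ℝ)]
    nlinarith [exp_pos (t-3)]
  rw [abs_le]; constructor <;> linarith
lemma sum_inv_sq (n : ℕ) : ∑ p ∈ PL n, (1/(p:ℝ))^2 ≤ 1 := by
  have h := sum_Ioo_inv_sq_le (α := ℝ) 1 (n+1)
  refine le_trans ?_ (h.trans (by norm_num))
  refine le_trans (Finset.sum_le_sum_of_subset_of_nonneg (t := Finset.Ioo 1 (n+1)) ?_ fun _ _ _ => by positivity)
    (le_of_eq (Finset.sum_congr rfl fun i _ => by rw [one_div, inv_pow]))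
  intro p hp
  have := mem_PL.1 hp
  exact Finset.mem_Ioo.2 ⟨this.2.one_lt, by omega⟩
noncomputable def Om (t : ℕ) (n : ℕ) : ℕ := n.factorization.sum fun p e => if p ≤ ⌊E t⌋₊ then e else 0
lemma Om_mul (t : ℕ) {a b : ℕ} (ha : a ≠ 0) (hb : b ≠ 0) : Om t (a*b) = Om t a + Om t b := by
  rw [Om, Nat.factorization_mul ha hb, Finsupp.sum_add_index']
  · rfl
  · intro; simp
  · intro p e f; split_ifs <;> rfl
lemma Om_prime (t : ℕ) {p : ℕ} (hp : p.Prime) : Om t p = if p ≤ ⌊E t⌋₊ then 1 else 0 := by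
  rw [Om, hp.factorization, Finsupp.sum_single_index]; simp
lemma mval_Om (s : ℝ) (t n : ℕ) :
    mval (fun p e => (if p ≤ ⌊E t⌋₊ then exp s else 1)^e) n = exp (s * Om t n) := by
  rw [mval, Om, Finsupp.sum]; push_cast
  rw [Finset.mul_sum, Real.exp_sum]
  apply Finset.prod_congr rfl
  intro p _
  split_ifs with h
  · rw [mul_comm, Real.exp_nat_mul]
  · simp
lemma PL_filter (n m : ℕ) : ∑ p ∈ PL n, (if p ≤ m then (1/p:ℝ) else 0) = PR (min n m) := by
  rw [← Finset.sum_filter]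
  apply Finset.sum_congr _ fun _ _ => rfl
  ext p
  rw [Finset.mem_filter, mem_PL, mem_PL]
  constructor
  · rintro ⟨⟨a, b⟩, c⟩; exact ⟨le_min a c, b⟩
  · rintro ⟨a, b⟩; exact ⟨⟨a.trans (min_le_left _ _), b⟩, a.trans (min_le_right _ _)⟩
lemma rankin' (c : ℕ → ℝ) (n : ℕ) (hc : ∀ p, p.Prime → 0 ≤ c p ∧ c p ≤ 3/2)
    (S : Finset ℕ) (hS : ∀ N ∈ S, N ≠ 0 ∧ ∀ p, p.Prime → p ∣ N → p ≤ n) :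
    ∑ N ∈ S, mval (fun p e => c p ^ e) N / N ≤ exp (∑ p ∈ PL n, c p / p + 9) := by
  refine (rankin c n (fun p hp => ⟨(hc p hp).1, ?_⟩) S hS).trans (Real.exp_le_exp.2 ?_)
  · have : (2:ℝ) ≤ p := by exact_mod_cast hp.two_le
    linarith [(hc p hp).2]
  rw [Finset.sum_add_distrib]
  gcongr
  calc _ ≤ ∑ p ∈ PL n, 9 * (1/(p:ℝ))^2 := by
        apply Finset.sum_le_sum; intro p hp
        have := hc p (mem_PL.1 hp).2
        rw [div_pow, div_pow, one_pow]
        have h2 : c p ^2 ≤ 9/4 := by nlinarith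
        rw [show 9 * (1/(p:ℝ)^2) = 4 * ((9/4)/(p:ℝ)^2) by ring]
        gcongr
    _ ≤ 9 := by rw [← Finset.mul_sum]; linarith [sum_inv_sq n]
lemma dev_sum : ∃ C, 1 ≤ C ∧ ∀ (t : ℕ) (s y : ℝ), |s| ≤ 1/4 → 3 ≤ y →
    ∑ a ∈ Finset.Icc 1 ⌊y⌋₊, exp (s * Om t a) / a ≤ C * log y * exp ((exp s - 1) * min (t:ℝ) (log (log y))) := by
  obtain ⟨C0, hC0, h0⟩ := PRE
  refine ⟨exp (2*C0+9), Real.one_le_exp (by linarith), fun t s y hs hy => ?_⟩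
  set G := log (log y) with hG
  have hly : 1 ≤ log y := by
    rw [Real.le_log_iff_exp_le (by linarith)]; linarith [Real.exp_one_lt_d9]
  have hG0 : 0 ≤ G := Real.log_nonneg hly
  have hEG : E G = y := E_loglog (by linarith)
  have hs2 := abs_le.1 hs
  have hes := abs_le.1 (Real.abs_exp_sub_one_sub_id_le (hs.trans (by norm_num)))
  have hss : s^2 ≤ 1/16 := by nlinarith
  have hz1 : exp s ≤ 3/2 := by linarith
  have hb := rankin' (fun p => if p ≤ ⌊E t⌋₊ then exp s else 1) ⌊y⌋₊ (fun p _ => by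
    beta_reduce; split_ifs
    · exact ⟨(exp_pos s).le, hz1⟩
    · norm_num) (Finset.Icc 1 ⌊y⌋₊) (fun N hN => by
      rw [Finset.mem_Icc] at hN
      exact ⟨by omega, fun p _ hp => (Nat.le_of_dvd (by omega) hp).trans hN.2⟩)
  simp only [mval_Om] at hb
  refine hb.trans ?_
  have e1 : ∑ p ∈ PL ⌊y⌋₊, (if p ≤ ⌊E t⌋₊ then exp s else 1) / (p:ℝ) = PR ⌊y⌋₊ + (exp s - 1) * PR (min ⌊y⌋₊ ⌊E t⌋₊) := by
    rw [← PL_filter, PR, Finset.mul_sum, ← Finset.sum_add_distrib]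
    apply Finset.sum_congr rfl; intro p _; split_ifs <;> ring
  rw [e1]
  have e2 : (min ⌊y⌋₊ ⌊E t⌋₊) = ⌊E (min (t:ℝ) G)⌋₊ := by
    rw [← hEG, ← Nat.floor_mono.map_min]
    congr 1
    rcases le_total (t:ℝ) G with h | h
    · rw [min_eq_left h, min_eq_right (E_mono h)]
    · rw [min_eq_right h, min_eq_left (E_mono h)]
  have a1 := abs_le.1 (h0 G hG0)
  rw [hEG] at a1
  have a2 := abs_le.1 (h0 (min t G) (le_min (by positivity) hG0))
  rw [← e2] at a2
  have : exp (2*C0+9) * log y * exp ((exp s - 1) * min (t:ℝ) G) = exp (2*C0 + 9 + G + (exp s - 1) * min (t:ℝ) G) := by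
    have hx : exp G = log y := Real.exp_log (by linarith)
    rw [← hx, ← Real.exp_add, ← Real.exp_add]
  rw [this, Real.exp_le_exp]
  have hx : (exp s - 1) * (PR (min ⌊y⌋₊ ⌊E t⌋₊) - min (t:ℝ) G) ≤ C0 := by
    refine (le_abs_self _).trans ?_
    rw [abs_mul]
    have h1 : |exp s - 1| ≤ 1 := abs_le.2 ⟨by linarith, by linarith⟩
    have h2 := abs_le.2 a2
    calc _ ≤ 1 * C0 := mul_le_mul h1 h2 (abs_nonneg _) (by norm_num)
      _ = C0 := one_mul _
  linarith
end FordT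

namespace FordT
open Real Finset
noncomputable def gw (q : ℕ) : ℕ := ⌊log (log q)⌋₊
def Nrm (η : ℝ) (q : ℕ) : Prop := ∀ t : ℕ, |(Om t (q-1) : ℝ) - (min t (gw q) : ℕ)| ≤ η * gw q
lemma Om_eq {t t' n : ℕ} (h : t ≤ t') (hn : n ≤ ⌊E t⌋₊) : Om t' n = Om t n := by
  unfold Om Finsupp.sum
  apply Finset.sum_congr rfl
  intro p hp
  have h1 : p ≤ n := by
    have := (Nat.mem_primeFactors.1 (by simpa using hp : p ∈ n.primeFactors)); exact Nat.le_of_dvd (Nat.pos_of_ne_zero this.2.2) this.2.1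
  have h2 : ⌊E t⌋₊ ≤ ⌊E t'⌋₊ := Nat.floor_mono (E_mono (by exact_mod_cast h))
  beta_reduce
  rw [if_pos (by omega), if_pos (by omega)]
lemma log_le_Om {t n : ℕ} {M : ℝ} (hn0 : n ≠ 0) (hn : n ≤ ⌊E t⌋₊) (h : ∀ p, p.Prime → p ∣ n → log p ≤ M) :
    log n ≤ Om t n * M := by
  conv_lhs => rw [← Nat.prod_factorization_pow_eq_self hn0]
  unfold Finsupp.prod Om Finsupp.sum
  push_cast
  rw [Real.log_prod, Finset.sum_mul]
  · apply Finset.sum_le_sum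
    intro p hp
    have hp' := (Nat.mem_primeFactors.1 (by simpa using hp : p ∈ n.primeFactors))
    rw [if_pos ((Nat.le_of_dvd (Nat.pos_of_ne_zero hn0) hp'.2.1).trans hn), Real.log_pow]
    gcongr; exact h p hp'.1 hp'.2.1
  · intro p hp
    have hp' := (Nat.mem_primeFactors.1 (by simpa using hp : p ∈ n.primeFactors))
    have := hp'.1.pos
    positivity
lemma gw_bd {y : ℝ} {q : ℕ} (hy : 16 ≤ y) (h1 : √y < q) (h2 : (q:ℝ) ≤ y) :
    log y / 2 < log q ∧ log (log y) - 2 ≤ gw q ∧ (gw q : ℝ) ≤ log (log y) := by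
  have hs : log (√y) = log y / 2 := Real.log_sqrt (by linarith)
  have hsy : 0 < √y := Real.sqrt_pos.2 (by linarith)
  have a1 : log y / 2 < log q := hs ▸ Real.log_lt_log hsy h1
  have hly : 2 < log y := by
    rw [Real.lt_log_iff_exp_lt (by linarith)]
    have : exp 2 = exp 1 * exp 1 := by rw [← Real.exp_add]; norm_num
    have := Real.exp_one_lt_d9
    nlinarith [exp_pos (1:ℝ)]
  have a2 : log (log q) ≤ log (log y) := Real.log_le_log (by linarith) (Real.log_le_log (by linarith) h2)
  have a3 : log (log y) - log 2 ≤ log (log q) := by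
    rw [← Real.log_div (by linarith) (by norm_num)]; exact Real.log_le_log (by linarith) a1.le
  have l2 := Real.log_two_lt_d9
  have h0 : 0 ≤ log (log q) := Real.log_nonneg (by linarith)
  refine ⟨a1, ?_, ?_⟩
  · have := Nat.lt_floor_add_one (log (log q)); unfold gw; linarith
  · exact (Nat.floor_le h0).trans a2
set_option maxHeartbeats 600000 in
lemma abn_smooth : ∃ C, 1 ≤ C ∧ ∀ y : ℝ, 36 ≤ log y → 100 ≤ y → 1 ≤ log (log y) → ∀ S : Finset ℕ,
    (∀ q ∈ S, (q:ℝ) ≤ y ∧ √y < q ∧ ∀ p : ℕ, p.Prime → p ∣ q - 1 → log p ≤ log y / (50 * log (log y))) →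
    (S.card : ℝ) ≤ C * (y / log y) * exp (-log (log y)) := by
  obtain ⟨C, hC, hd⟩ := dev_sum
  refine ⟨C, hC, fun y hy36 hy hG1 S hS => ?_⟩
  set G := log (log y) with hG
  have hly : 0 < log y := Real.log_pos (by linarith)
  have hexpG : exp G = log y := Real.exp_log hly
  set T := ⌈G⌉₊ with hT
  have hTG : G ≤ T := Nat.le_ceil _
  have hyE : y ≤ E T := by rw [← E_loglog (by linarith : 1 < y)]; exact E_mono hTG
  have hsy : 10 ≤ √y := by rw [show (10:ℝ) = √(10^2) by rw [Real.sqrt_sq (by norm_num)]]; exact Real.sqrt_le_sqrt (by linarith)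
  have key : ∀ q ∈ S, 1 ≤ q - 1 ∧ q - 1 ≤ ⌊y⌋₊ ∧ (1:ℝ) ≤ y * exp (-6*G) * (exp (1/4 * Om T (q-1)) / (q-1:ℕ)) := by
    intro q hq
    obtain ⟨hqy, h2, h3⟩ := hS q hq
    have h1' : q ≤ ⌊y⌋₊ := Nat.le_floor hqy
    have hq10 : 10 < q := by have : (10:ℝ) < q := by linarith
                             exact_mod_cast this
    have hgb := gw_bd (by linarith : 16 ≤ y) h2 hqy
    have hqq : ((q-1:ℕ):ℝ) = q - 1 := by push_cast [Nat.cast_sub (by omega : 1 ≤ q)]; ring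
    have hq0 : (0:ℝ) < (q-1:ℕ) := by rw [hqq]; linarith
    refine ⟨by omega, by omega, ?_⟩
    have hom := log_le_Om (t := T) (by omega) ((by omega : q-1 ≤ ⌊y⌋₊).trans (Nat.floor_mono hyE)) h3
    have hlog : 12/25 * log y ≤ log (q-1:ℕ) := by
      have : log (q/2:ℝ) ≤ log (q-1:ℕ) := Real.log_le_log (by linarith) (by rw [hqq]; linarith)
      rw [Real.log_div (by linarith) (by norm_num)] at this
      have := hgb.1
      have l2 := Real.log_two_lt_d9
      linarith
    have hO : 24*G ≤ Om T (q-1) := by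
      have h4 : 12/25*log y ≤ Om T (q-1) * (log y / (50*G)) := hlog.trans hom
      rw [mul_div_assoc', le_div_iff₀ (by positivity)] at h4
      have : log y * (24*G) ≤ log y * Om T (q-1) := by linarith
      exact le_of_mul_le_mul_left this hly
    have h5 : 1 ≤ exp (-6*G) * exp (1/4 * Om T (q-1)) := by
      rw [← Real.exp_add]; apply Real.one_le_exp; linarith
    rw [show y * exp (-6*G) * (exp (1/4 * Om T (q-1)) / (q-1:ℕ)) = (y/(q-1:ℕ)) * (exp (-6*G) * exp (1/4 * Om T (q-1))) by ring]
    have h6 : 1 ≤ y/(q-1:ℕ) := by rw [one_le_div hq0, hqq]; linarith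
    exact one_le_mul_of_one_le_of_one_le h6 h5
  have hinj : Set.InjOn (fun q : ℕ => q - 1) S := by
    intro a ha b hb hab
    have := (key a ha).1; have := (key b hb).1
    simp only at hab; omega
  have hs14 : exp (1/4:ℝ) ≤ 3/2 := by
    have := abs_le.1 (Real.abs_exp_sub_one_sub_id_le (x := 1/4) (by rw [abs_of_nonneg] <;> norm_num)); linarith
  calc (S.card : ℝ) = ∑ q ∈ S, (1:ℝ) := by simp
    _ ≤ ∑ q ∈ S, y * exp (-6*G) * (exp (1/4 * Om T (q-1)) / (q-1:ℕ)) := Finset.sum_le_sum fun q hq => (key q hq).2.2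
    _ = y * exp (-6*G) * ∑ a ∈ S.image (fun q => q - 1), exp (1/4 * Om T a) / (a:ℕ) := by
        rw [← Finset.mul_sum, Finset.sum_image hinj]
    _ ≤ y * exp (-6*G) * ∑ a ∈ Finset.Icc 1 ⌊y⌋₊, exp (1/4 * Om T a) / (a:ℕ) := by
        apply mul_le_mul_of_nonneg_left _ (by positivity)
        apply Finset.sum_le_sum_of_subset_of_nonneg _ fun _ _ _ => by positivity
        intro a ha
        obtain ⟨q, hq, rfl⟩ := Finset.mem_image.1 ha
        exact Finset.mem_Icc.2 ⟨(key q hq).1, (key q hq).2.1⟩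
    _ ≤ y * exp (-6*G) * (C * log y * exp ((exp (1/4) - 1) * min (T:ℝ) G)) := by
        apply mul_le_mul_of_nonneg_left _ (by positivity)
        exact hd T (1/4) y (by rw [abs_of_nonneg] <;> norm_num) (by linarith)
    _ = C * y * exp (-6*G + G + (exp (1/4) - 1) * min (T:ℝ) G) := by
        rw [← hexpG, Real.exp_add, Real.exp_add]; ring
    _ ≤ C * y * exp (-2*G) := by
        have : min (T:ℝ) G = G := min_eq_right hTG
        rw [this]
        gcongr
        nlinarith
    _ = _ := by
        rw [show C * (y / log y) * exp (-G) = C * y * exp (-2*G) from ?_]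
        rw [← hexpG, show -2*G = -G + -G by ring, Real.exp_add, Real.exp_neg]; field_simp
end FordT

namespace FordT
open Real Finset
lemma dev_point {y η : ℝ} {q p a : ℕ} (hy : 16 ≤ y) (hG : 2 ≤ log (log y)) (hη : 0 < η) (hη1 : η ≤ 1/2) (h1 : √y < q) (h2 : (q:ℝ) ≤ y)
    (hN : ¬ Nrm η q) (hp : p.Prime) (hpa : q - 1 = a * p) (ha : a ≠ 0) :
    ∃ t ∈ Finset.range (⌈log (log y)⌉₊+1), ∃ s ∈ ({η/2, -(η/2)} : Finset ℝ),
      1 ≤ exp (5 * (η/2) - 2*(η/2)^2 * log (log y)) * exp (s * (Om t a - min (t:ℝ) (log (log y)))) := by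
  obtain ⟨-, b1, b2⟩ := gw_bd hy h1 h2
  set G := log (log y) with hG
  set T := ⌈G⌉₊ with hT
  have hTG : G ≤ T := Nat.le_ceil _
  have hyE : y ≤ E T := by rw [← E_loglog (by linarith : 1 < y)]; exact E_mono hTG
  have hqT : q - 1 ≤ ⌊E T⌋₊ := by
    apply Nat.le_floor
    have : ((q-1:ℕ):ℝ) ≤ q := by exact_mod_cast Nat.sub_le _ _
    linarith
  have hgT : gw q ≤ T := by exact_mod_cast b2.trans hTG
  have ht : ∃ t ≤ T, η * gw q < |(Om t (q-1) : ℝ) - (min t (gw q) : ℕ)| := by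
    unfold Nrm at hN
    push Not at hN
    obtain ⟨t, ht⟩ := hN
    rcases le_or_gt t T with h | h
    · exact ⟨t, h, ht⟩
    · refine ⟨T, le_rfl, ?_⟩
      rw [Om_eq h.le hqT] at ht
      rw [min_eq_right (hgT.trans h.le)] at ht; rwa [min_eq_right hgT]
  obtain ⟨t, htT, ht⟩ := ht
  refine ⟨t, Finset.mem_range.2 (by omega), ?_⟩
  have hmin : |((min t (gw q) : ℕ):ℝ) - min (t:ℝ) G| ≤ 2 := by
    push_cast
    rcases le_total (t:ℝ) (gw q) with h | h
    · rw [min_eq_left h, min_eq_left (h.trans b2)]; norm_num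
    · rw [min_eq_right h]
      have : min (t:ℝ) G ≤ G := min_le_right _ _
      have : (gw q:ℝ) ≤ min (t:ℝ) G := le_min h b2
      rw [abs_le]; constructor <;> linarith
  have hOm : |(Om t (q-1):ℝ) - Om t a| ≤ 1 := by
    rw [hpa, Om_mul t ha hp.ne_zero, Om_prime t hp]; split_ifs <;> simp
  have hdev : η * G - 5 ≤ |(Om t a:ℝ) - min (t:ℝ) G| := by
    have e : (Om t (q-1) : ℝ) - (min t (gw q) : ℕ) = ((Om t a:ℝ) - min (t:ℝ) G) + ((Om t (q-1):ℝ) - Om t a) - (((min t (gw q) : ℕ):ℝ) - min (t:ℝ) G) := by ring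
    have h3 := abs_sub (((Om t a:ℝ) - min (t:ℝ) G) + ((Om t (q-1):ℝ) - Om t a)) (((min t (gw q) : ℕ):ℝ) - min (t:ℝ) G)
    have h4 := abs_add_le ((Om t a:ℝ) - min (t:ℝ) G) ((Om t (q-1):ℝ) - Om t a)
    rw [e] at ht
    have : η * (G - 2) ≤ η * gw q := by gcongr
    linarith
  have fin : ∀ s : ℝ, s * ((Om t a:ℝ) - min (t:ℝ) G) = η/2 * |(Om t a:ℝ) - min (t:ℝ) G| →
     1 ≤ exp (5 * (η/2) - 2*(η/2)^2 * G) * exp (s * (Om t a - min (t:ℝ) G)) := by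
    intro s hs
    rw [hs, ← Real.exp_add]
    apply Real.one_le_exp
    have := mul_le_mul_of_nonneg_left hdev (by linarith : 0 ≤ η/2)
    linarith
  rcases abs_cases ((Om t a:ℝ) - min (t:ℝ) G) with ⟨h, _⟩ | ⟨h, _⟩
  · exact ⟨η/2, by simp, fin _ (by rw [h])⟩
  · exact ⟨-(η/2), by simp, fin _ (by rw [h]; ring)⟩
open Filter in
set_option maxHeartbeats 1000000 in
lemma abn_count : ∃ C y0 : ℝ, 1 ≤ C ∧ exp 16 ≤ y0 ∧ ∀ y : ℝ, y0 ≤ y → ∀ η : ℝ, 0 < η → η ≤ 1/2 → ∀ S : Finset ℕ,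
    (∀ q ∈ S, q.Prime ∧ (q:ℝ) ≤ y ∧ √y < q ∧ ¬ Nrm η q) →
    (S.card : ℝ) ≤ C * (y / log y) * (log (log y))^7 * exp (- (η^2/4 * log (log y))) := by
  classical
  obtain ⟨C1, hC1, hA⟩ := abn_smooth
  obtain ⟨C2, Y0, hC2, hY0, hB⟩ := sieve 1
  obtain ⟨C3, hC3, hd⟩ := dev_sum
  have hev : ∀ᶠ G : ℝ in atTop, log Y0 * (50*G) ≤ exp G ∧ (50*G)^3 ≤ exp G ∧ 4 ≤ G := by
    filter_upwards [ev_pow_exp 2 1 one_pos, ev_pow_exp 4 1 one_pos, eventually_ge_atTop (50*log Y0), eventually_ge_atTop (50^3:ℝ)] with G h1 h2 h3 h4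
    rw [one_mul] at h1 h2
    refine ⟨by nlinarith, ?_, by linarith⟩
    calc (50*G)^3 = 50^3*G^3 := by ring
      _ ≤ G*G^3 := by gcongr
      _ = G^4 := by ring
      _ ≤ _ := h2
  obtain ⟨G0, hG0⟩ := hev.exists_forall_of_atTop
  refine ⟨C1 + C2*2500*4*(exp 2*C3), max (E G0) (max (exp 36) 100), ?_, ?_, ?_⟩
  · have : 0 ≤ C2*2500*4*(exp 2*C3) := by positivity
    linarith
  · refine le_trans ?_ ((le_max_left _ _).trans (le_max_right _ _)); exact Real.exp_le_exp.2 (by norm_num)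
  intro y hy η hη hη1 S hS
  have y1 : E G0 ≤ y := (le_max_left _ _).trans hy
  have y2 : exp 36 ≤ y := ((le_max_left _ _).trans (le_max_right _ _)).trans hy
  have y3 : 100 ≤ y := ((le_max_right _ _).trans (le_max_right _ _)).trans hy
  have hy0 : 0 < y := by linarith
  set G := log (log y) with hG
  have hly : 36 ≤ log y := by rw [Real.le_log_iff_exp_le hy0]; exact y2
  have hly0 : 0 < log y := by linarith
  have hexpG : exp G = log y := Real.exp_log hly0
  have hGG : G0 ≤ G := by
    rw [hG, Real.le_log_iff_exp_le hly0, Real.le_log_iff_exp_le hy0]; exact y1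
  obtain ⟨g1, g2, g3⟩ := hG0 G hGG
  rw [hexpG] at g1 g2
  set θ := η/2 with hθ
  have hsplit := Finset.card_filter_add_card_filter_not (s := S) (fun q => ∀ p : ℕ, p.Prime → p ∣ q - 1 → log p ≤ log y / (50 * G))
  set SA := S.filter (fun q => ∀ p : ℕ, p.Prime → p ∣ q - 1 → log p ≤ log y / (50 * G)) with hSA
  set SB := S.filter (fun q => ¬ ∀ p : ℕ, p.Prime → p ∣ q - 1 → log p ≤ log y / (50 * G)) with hSB
  have bA : (SA.card:ℝ) ≤ C1 * (y / log y) * exp (-G) := by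
    apply hA y hly y3 (by linarith) SA
    intro q hq
    obtain ⟨h1, h2⟩ := Finset.mem_filter.1 hq
    obtain ⟨h3, h4, h5, h6⟩ := hS q h1
    exact ⟨h4, h5, h2⟩
  set T := ⌈G⌉₊ with hT
  have hTG : G ≤ T := Nat.le_ceil _
  have hTG' : (T:ℝ) < G + 1 := Nat.ceil_lt_add_one (by linarith)
  let W : ℕ → ℝ → ℕ → ℝ := fun t s a => exp (5 * θ - 2*θ^2 * G) * exp (s * (Om t a - min (t:ℝ) G))
  let cnt : ℕ → Finset ℕ := fun a => (Finset.range (⌊y/a⌋₊+1)).filter (fun n => n.Prime ∧ ∀ b ∈ ({a}:Finset ℕ), (b*n+1).Prime)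
  let As : ℕ → ℝ → Finset ℕ := fun t s => (Finset.Icc 1 ⌊y⌋₊).filter (fun a => 1 ≤ W t s a ∧ log y / (50*G) ≤ log (y/a))
  have hsub : SB ⊆ (Finset.range (T+1)).biUnion fun t => ({θ, -θ}:Finset ℝ).biUnion fun s => (As t s).biUnion fun a => (cnt a).image fun n => a*n+1 := by
    intro q hq
    obtain ⟨h1, h2⟩ := Finset.mem_filter.1 hq
    obtain ⟨h3, h4, h5, h6⟩ := hS q h1
    push Not at h2
    obtain ⟨p, hp, hpd, hpl⟩ := h2
    obtain ⟨a, ha⟩ := hpd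
    have hq1 : 1 < q := h3.one_lt
    have ha0 : a ≠ 0 := by rintro rfl; omega
    have hqa : q = a * p + 1 := by rw [mul_comm]; omega
    obtain ⟨t, ht, s, hs, hW⟩ := dev_point (by linarith) (by linarith) hη hη1 h5 h4 h6 hp (by rw [ha, mul_comm]) ha0
    have ha' : (0:ℝ) < a := by positivity
    have hpy : (p:ℝ) ≤ y/a := by
      rw [le_div_iff₀ ha']
      have : ((a*p+1:ℕ):ℝ) ≤ y := by rw [← hqa]; exact h4
      push_cast at this; linarith
    refine Finset.mem_biUnion.2 ⟨t, ht, Finset.mem_biUnion.2 ⟨s, hs, Finset.mem_biUnion.2 ⟨a, ?_, Finset.mem_image.2 ⟨p, ?_, hqa.symm⟩⟩⟩⟩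
    · refine Finset.mem_filter.2 ⟨Finset.mem_Icc.2 ⟨by omega, ?_⟩, hW, ?_⟩
      · have : a ≤ q := by rw [hqa]; nlinarith [hp.one_lt]
        exact this.trans (Nat.le_floor h4)
      · exact hpl.le.trans (Real.log_le_log (by exact_mod_cast hp.pos) hpy)
    · refine Finset.mem_filter.2 ⟨Finset.mem_range.2 (Nat.lt_succ_of_le (Nat.le_floor hpy)), hp, ?_⟩
      intro b hb; rw [Finset.mem_singleton.1 hb, ← hqa]; exact h3
  have hcnt : ∀ t s, ∀ a ∈ As t s, ((cnt a).card:ℝ) ≤ C2*2500 * y * G^6 / (log y)^2 * (1/a) := by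
    intro t s a haA
    obtain ⟨h1, -, h2⟩ := Finset.mem_filter.1 haA
    have ha1 : 1 ≤ a := (Finset.mem_Icc.1 h1).1
    have ha0 : (1:ℝ) ≤ a := by exact_mod_cast ha1
    have hay : (a:ℝ) ≤ y := le_trans (by exact_mod_cast (Finset.mem_Icc.1 h1).2) (Nat.floor_le hy0.le)
    have h50 : 0 < 50*G := by linarith
    have hlog0 : 0 < log y/(50*G) := by positivity
    have hya0 : 0 < y/a := by positivity
    have e1 : Y0 ≤ y/a := by
      rw [← Real.log_le_log_iff (by linarith) hya0]
      exact le_trans (by rw [le_div_iff₀ h50]; exact g1) h2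
    have e2 : log (a:ℝ) ≤ (log (y/a))^3 := by
      calc log (a:ℝ) ≤ log y := Real.log_le_log (by linarith) hay
        _ ≤ (log y/(50*G))^3 := by
          rw [div_pow, le_div_iff₀ (by positivity)]
          calc log y * (50*G)^3 ≤ log y * log y := by gcongr
            _ ≤ log y^3 := by nlinarith only [hly, mul_pos hly0 hly0]
        _ ≤ _ := by gcongr
    have h := hB (y/a) e1 {a} a (Finset.card_singleton a) (by omega) e2 (by
      intro p hp hpa
      simp only [Finset.mem_singleton]
      refine ⟨fun b hb => hb ▸ hpa, ?_⟩
      rintro b rfl b' rfl h; exact absurd rfl h)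
    have e3 : log (log (y/a)) ≤ G := by
      apply Real.log_le_log (by linarith)
      apply Real.log_le_log hya0
      exact div_le_self hy0.le ha0
    have e4 : 0 ≤ log (log (y/a)) := by
      apply Real.log_nonneg
      have : 1 ≤ log y/(50*G) := by
        rw [le_div_iff₀ h50, one_mul]; refine le_trans ?_ g2; exact le_self_pow₀ (by linarith) (by norm_num)
      linarith
    refine h.trans ?_
    calc C2 * (y/a) * log (log (y/a))^(2*(1+1)) / log (y/a)^(1+1) ≤ C2 * (y/a) * G^(2*(1+1)) / (log y/(50*G))^(1+1) := by gcongr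
      _ = _ := by
        have n1 : (a:ℝ) ≠ 0 := by positivity
        have n2 : G ≠ 0 := by positivity
        have n3 := hly0.ne'
        clear_value G
        norm_num
        field_simp
        try ring
  have hsumW : ∀ t : ℕ, ∀ s ∈ ({θ, -θ}:Finset ℝ), ∑ a ∈ As t s, (1/a:ℝ) ≤ exp 2 * C3 * log y * exp (-(η^2/4*G)) := by
    intro t s hs
    have hs2 : s^2 = θ^2 ∧ |s| = θ := by
      rcases Finset.mem_insert.1 hs with rfl | h
      · exact ⟨rfl, abs_of_pos (by positivity)⟩
      · rw [Finset.mem_singleton.1 h, neg_sq, abs_neg]; exact ⟨rfl, abs_of_pos (by positivity)⟩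
    have hD := hd t s y (by rw [hs2.2]; linarith) (by linarith)
    have hes := abs_le.1 (Real.abs_exp_sub_one_sub_id_le (x := s) (by rw [hs2.2]; linarith))
    have hmm : min (t:ℝ) G ≤ G := min_le_right _ _
    have hm0 : 0 ≤ min (t:ℝ) G := le_min (by positivity) (by linarith)
    calc ∑ a ∈ As t s, (1/a:ℝ) ≤ ∑ a ∈ As t s, exp (5 * θ - 2*θ^2 * G - s * min (t:ℝ) G) * (exp (s * Om t a) / a) := by
          apply Finset.sum_le_sum; intro a ha
          obtain ⟨-, h1, -⟩ := Finset.mem_filter.1 ha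
          have : W t s a = exp (5 * θ - 2*θ^2 * G - s * min (t:ℝ) G) * exp (s * Om t a) := by
            simp only [W]; rw [← Real.exp_add, ← Real.exp_add]; congr 1; ring
          rw [this] at h1
          rw [mul_div_assoc']; gcongr
      _ ≤ ∑ a ∈ Finset.Icc 1 ⌊y⌋₊, exp (5 * θ - 2*θ^2 * G - s * min (t:ℝ) G) * (exp (s * Om t a) / a) :=
          Finset.sum_le_sum_of_subset_of_nonneg (Finset.filter_subset _ _) fun _ _ _ => by positivity
      _ ≤ exp (5 * θ - 2*θ^2 * G - s * min (t:ℝ) G) * (C3 * log y * exp ((exp s - 1) * min (t:ℝ) G)) := by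
          rw [← Finset.mul_sum]; gcongr
      _ = C3 * log y * exp (5 * θ - 2*θ^2 * G + (exp s - 1 - s) * min (t:ℝ) G) := by
          rw [mul_left_comm, ← Real.exp_add]; congr 2; ring
      _ ≤ C3 * log y * exp (2 + -(η^2/4*G)) := by
          apply mul_le_mul_of_nonneg_left (Real.exp_le_exp.2 _) (by positivity)
          have h1 : (exp s - 1 - s) * min (t:ℝ) G ≤ θ^2 * G := by
            rw [← hs2.1]; exact (mul_le_mul_of_nonneg_right hes.2 hm0).trans (by gcongr)
          have : η^2/4 = θ^2 := by rw [hθ]; ring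
          rw [this]; linarith
      _ = _ := by rw [Real.exp_add]; ring
  have hG0' : 0 < G := by linarith
  have bB : (SB.card:ℝ) ≤ (C2*2500*4*(exp 2*C3)) * (y / log y) * G^7 * exp (-(η^2/4*G)) := by
    have h1 : (SB.card:ℝ) ≤ ∑ t ∈ Finset.range (T+1), ∑ s ∈ ({θ, -θ}:Finset ℝ), ∑ a ∈ As t s, ((cnt a).card:ℝ) := by
      have := (Finset.card_le_card hsub).trans (Finset.card_biUnion_le.trans (Finset.sum_le_sum fun t _ => Finset.card_biUnion_le.trans (Finset.sum_le_sum fun s _ => Finset.card_biUnion_le.trans (Finset.sum_le_sum fun a _ => Finset.card_image_le))))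
      exact_mod_cast this
    refine h1.trans ?_
    calc _ ≤ ∑ t ∈ Finset.range (T+1), ∑ s ∈ ({θ, -θ}:Finset ℝ), C2*2500 * y * G^6 / (log y)^2 * (exp 2 * C3 * log y * exp (-(η^2/4*G))) := by
          apply Finset.sum_le_sum; intro t _; apply Finset.sum_le_sum; intro s hs
          refine (Finset.sum_le_sum (hcnt t s)).trans ?_
          rw [← Finset.mul_sum]
          apply mul_le_mul_of_nonneg_left (hsumW t s hs); positivity
      _ ≤ (T+1) * (2 * (C2*2500 * y * G^6 / (log y)^2 * (exp 2 * C3 * log y * exp (-(η^2/4*G))))) := by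
          rw [Finset.sum_const, Finset.sum_const, Finset.card_range, nsmul_eq_mul, nsmul_eq_mul]
          push_cast
          gcongr
          exact_mod_cast Finset.card_le_two
      _ ≤ (2*G) * (2 * (C2*2500 * y * G^6 / (log y)^2 * (exp 2 * C3 * log y * exp (-(η^2/4*G))))) := by
          gcongr; linarith
      _ = _ := by field_simp; try ring
  have bA2 : C1 * (y / log y) * exp (-G) ≤ C1 * (y / log y) * G^7 * exp (-(η^2/4*G)) := by
    have h1 : (1:ℝ) ≤ G^7 := one_le_pow₀ (by linarith)
    have h2 : exp (-G) ≤ exp (-(η^2/4*G)) := by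
      apply Real.exp_le_exp.2
      have : η^2/4 ≤ 1 := by nlinarith only [hη, hη1]
      nlinarith only [this, hG0']
    calc _ ≤ C1 * (y / log y) * exp (-(η^2/4*G)) := by gcongr
      _ ≤ _ := by
        apply mul_le_mul_of_nonneg_right _ (exp_pos _).le
        exact le_mul_of_one_le_right (by positivity) h1
  have : (S.card:ℝ) = SA.card + SB.card := by rw [← hsplit]; push_cast; ring
  rw [this]
  calc _ ≤ _ := add_le_add (bA.trans bA2) bB
    _ = _ := by ring
end FordT

namespace FordT
open Real Finset
lemma dyadic (S I : Finset ℕ) (b : ℕ → ℝ) (h0 : ∀ q ∈ S, q ≠ 0 ∧ Nat.log 2 q ∈ I)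
    (hb : ∀ i ∈ I, ∀ S' ⊆ S, (∀ q ∈ S', (2:ℝ)^i ≤ q ∧ (q:ℝ) ≤ 2^(i+1)) → (S'.card:ℝ) ≤ b i * 2^(i+1)) :
    ∑ q ∈ S, (1/q:ℝ) ≤ ∑ i ∈ I, 2 * b i := by
  rw [← Finset.sum_fiberwise_of_maps_to (g := Nat.log 2) (t := I) (fun q hq => (h0 q hq).2)]
  apply Finset.sum_le_sum
  intro i hi
  have hq : ∀ q ∈ S.filter (fun q => Nat.log 2 q = i), (2:ℝ)^i ≤ q ∧ (q:ℝ) ≤ 2^(i+1) := by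
    intro q hq
    obtain ⟨h1, h2⟩ := Finset.mem_filter.1 hq
    have h3 := Nat.pow_log_le_self 2 (h0 q h1).1
    have h4 := Nat.lt_pow_succ_log_self (b := 2) (by norm_num) q
    rw [h2] at h3 h4
    exact ⟨by exact_mod_cast h3, by exact_mod_cast h4.le⟩
  have := hb i hi _ (Finset.filter_subset _ _) hq
  calc _ ≤ ∑ q ∈ S.filter (fun q => Nat.log 2 q = i), (1/2^i:ℝ) := by
        apply Finset.sum_le_sum; intro q h; exact one_div_le_one_div_of_le (by positivity) (hq q h).1
    _ = (S.filter (fun q => Nat.log 2 q = i)).card * (1/2^i:ℝ) := by rw [Finset.sum_const, nsmul_eq_mul]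
    _ ≤ (b i * 2^(i+1)) * (1/2^i:ℝ) := by gcongr
    _ = _ := by rw [pow_succ]; field_simp
lemma abn_sum : ∃ C, 1 ≤ C ∧ ∃ g0 : ℕ, 1 ≤ g0 ∧ ∀ g : ℕ, g0 ≤ g → ∀ η : ℝ, 0 < η → η ≤ 1/2 → ∀ S : Finset ℕ,
    (∀ q ∈ S, q.Prime ∧ gw q = g ∧ ¬ Nrm η q) →
    ∑ q ∈ S, (1/q:ℝ) ≤ C * g^7 * exp (-(η^2/4 * g)) := by
  obtain ⟨C, y0, hC, hy0, h⟩ := abn_count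
  have hy00 : 0 < y0 := (exp_pos _).trans_le hy0
  have hly0 : 16 ≤ log y0 := by rw [Real.le_log_iff_exp_le hy00]; exact hy0
  refine ⟨2 * (C * 3^7) * 24, by nlinarith, ⌈log (log y0)⌉₊, ?_, ?_⟩
  · apply Nat.one_le_ceil_iff.2; apply Real.log_pos; linarith
  intro g hg η hη hη1 S hS
  have hgy : log (log y0) ≤ g := (Nat.le_ceil _).trans (by exact_mod_cast hg)
  have hg1 : (1:ℝ) ≤ g := by
    refine le_trans ?_ hgy
    rw [Real.le_log_iff_exp_le (by linarith)]; linarith [Real.exp_one_lt_d9]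
  have l2 := Real.log_two_lt_d9
  have l2' := Real.log_two_gt_d9
  set M := ⌊exp (g+1) * 2⌋₊ with hM
  have hq : ∀ q ∈ S, exp g ≤ log q ∧ log q ≤ exp (g+1) := by
    intro q hq
    obtain ⟨h1, h2, h3⟩ := hS q hq
    have hpos : 0 < log (q:ℝ) := Real.log_pos (by exact_mod_cast h1.one_lt)
    have f1 := Nat.lt_floor_add_one (log (log q))
    have f2 : 0 ≤ log (log q) := by
      by_contra hh
      have := Nat.floor_of_nonpos (not_le.1 hh).le
      rw [gw, this] at h2; rw [← h2] at hg1; norm_num at hg1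
    have f3 := Nat.floor_le f2
    unfold gw at h2; rw [h2] at f1 f3
    exact ⟨(Real.le_log_iff_exp_le hpos).1 f3, (Real.log_le_iff_le_exp hpos).1 f1.le⟩
  have hqlog : ∀ q ∈ S, ∀ i : ℕ, (2:ℝ)^i ≤ q → (q:ℝ) ≤ 2^(i+1) → (i:ℝ) * log 2 ≤ log q ∧ log q ≤ (i+1)*log 2 := by
    intro q hqS i h1 h2
    have hq0 : (0:ℝ) < q := by exact_mod_cast (hS q hqS).1.pos
    have a := Real.log_le_log (by positivity) h1
    have b := Real.log_le_log hq0 h2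
    rw [Real.log_pow] at a b
    push_cast at b
    exact ⟨a, b⟩
  have key := dyadic S (Finset.range (M+1)) (fun i => C * 3^7 * g^7 * exp (-(η^2/4*g)) * exp (-g)) ?_ ?_
  · refine key.trans ?_
    rw [Finset.sum_const, Finset.card_range, nsmul_eq_mul]
    have hM1 : ((M+1:ℕ):ℝ) ≤ 24 * exp g := by
      push_cast
      have : (M:ℝ) ≤ exp (g+1)*2 := Nat.floor_le (by positivity)
      rw [Real.exp_add] at this
      have : 1 ≤ exp (g:ℝ) := Real.one_le_exp (by linarith)
      have := Real.exp_one_lt_d9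
      nlinarith
    calc _ ≤ (24 * exp g) * (2 * (C * 3^7 * g^7 * exp (-(η^2/4*g)) * exp (-g))) := by gcongr
      _ = 2 * (C*3^7) * 24 * g^7 * exp (-(η^2/4*g)) * (exp g * exp (-g)) := by ring
      _ ≤ _ := by rw [← Real.exp_add]; simp
  · intro q hqS
    have h1 := (hS q hqS).1
    refine ⟨h1.ne_zero, Finset.mem_range.2 (Nat.lt_succ_of_le (Nat.le_floor ?_))⟩
    have := Nat.pow_log_le_self 2 h1.ne_zero
    have := hqlog q hqS (Nat.log 2 q) (by exact_mod_cast this) (by exact_mod_cast (Nat.lt_pow_succ_log_self (b := 2) (by norm_num) q).le)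
    have := (hq q hqS).2
    nlinarith
  · intro i hi S' hS' hqi
    rcases S'.eq_empty_or_nonempty with rfl | ⟨q1, hq1⟩
    · simp; positivity
    set y : ℝ := 2^(i+1) with hy
    have b1 := hqlog q1 (hS' hq1) i (hqi q1 hq1).1 (hqi q1 hq1).2
    have b2 := hq q1 (hS' hq1)
    have hlogy : log y = (i+1)*log 2 := by rw [hy, Real.log_pow]; push_cast; ring
    have hey : exp g ≤ log y := by rw [hlogy]; linarith
    have heg : 1 ≤ exp (g:ℝ) := Real.one_le_exp (by linarith)
    have hly : 0 < log y := by linarith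
    have hGg : (g:ℝ) ≤ log (log y) := by rw [Real.le_log_iff_exp_le hly]; exact hey
    have hGg' : log (log y) ≤ 3*g := by
      rw [Real.log_le_iff_le_exp hly, hlogy]
      have e1 : exp (3*g:ℝ) = exp (g+1) * exp (2*g-1) := by rw [← Real.exp_add]; congr 1; ring
      have e2 : 2 ≤ exp (2*(g:ℝ)-1) := by linarith [Real.add_one_le_exp (2*(g:ℝ)-1)]
      have e3 : 1 ≤ exp ((g:ℝ)+1) := Real.one_le_exp (by linarith)
      nlinarith
    have hyy0 : y0 ≤ y := by
      have : log (log y0) ≤ log (log y) := hgy.trans hGg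
      rw [Real.log_le_log_iff (by linarith) hly, Real.log_le_log_iff hy00 (by positivity)] at this
      exact this
    have hh := h y hyy0 η hη hη1 S' (by
      intro q hqS
      obtain ⟨c1, c2, c3⟩ := hS q (hS' hqS)
      refine ⟨c1, (hqi q hqS).2, ?_, c3⟩
      refine lt_of_lt_of_le ?_ (hqi q hqS).1
      rw [Real.sqrt_lt' (by positivity), hy, ← pow_mul]
      apply pow_lt_pow_right₀ (by norm_num)
      have : (1:ℝ) < i := by
        have : 16 ≤ exp (g:ℝ) := by
          calc (16:ℝ) ≤ log y0 := hly0
            _ = exp (log (log y0)) := (Real.exp_log (by linarith)).symm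
            _ ≤ _ := Real.exp_le_exp.2 hgy
        nlinarith
      have : 1 < i := by exact_mod_cast this
      omega)
    have hG0 : 0 ≤ log (log y) := by linarith
    calc (S'.card:ℝ) ≤ _ := hh
      _ ≤ C * (y / exp g) * (3*g)^7 * exp (-(η^2/4*g)) := by
        have e1 : exp (-(η^2/4*log (log y))) ≤ exp (-(η^2/4*g)) := by
          apply Real.exp_le_exp.2; apply neg_le_neg; gcongr
        have e2 : y / log y ≤ y / exp g := by gcongr
        have e3 : log (log y)^7 ≤ (3*g:ℝ)^7 := by gcongr
        gcongr
      _ = _ := by rw [Real.exp_neg (g:ℝ)]; ring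
end FordT

namespace FordT
open Real Finset
lemma recip_sieve (κ : ℕ) (hκ : 1 ≤ κ) : ∃ C Y0 : ℝ, 1 ≤ C ∧ 3 ≤ Y0 ∧ ∀ P0 β : ℝ, Y0 ≤ P0 → ∀ (Bs : Finset ℕ) (D : ℕ),
    Bs.card = κ → D ≠ 0 → log D ≤ (log P0)^3 →
    (∀ p, p.Prime → ¬ p ∣ D → (∀ b ∈ Bs, ¬ p ∣ b) ∧ ∀ b ∈ Bs, ∀ b' ∈ Bs, b ≠ b' → ¬ b ≡ b' [MOD p]) →
    ∀ S : Finset ℕ, (∀ P ∈ S, P.Prime ∧ (∀ b ∈ Bs, (b*P+1).Prime) ∧ P0 ≤ P ∧ (P:ℝ) ≤ E β) →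
    ∑ P ∈ S, (1/P:ℝ) ≤ C * (β+1)^(2*(κ+1)) / (log P0)^κ := by
  obtain ⟨C, Y0, hC, hY0, h⟩ := sieve κ
  refine ⟨max 1 (2*(C*2^(κ+1))*2), Y0, le_max_left _ _, hY0, ?_⟩
  intro P0 β hP0 Bs D hB hD hDl hp S hS
  have hP3 : 3 ≤ P0 := hY0.trans hP0
  set ℓ := log P0 with hℓ
  have hℓ1 : 1 ≤ ℓ := by rw [hℓ, Real.le_log_iff_exp_le (by linarith)]; linarith [Real.exp_one_lt_d9]
  have l2 := Real.log_two_lt_d9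
  have l2' := Real.log_two_gt_d9
  have hq : ∀ q ∈ S, ∀ i : ℕ, (q:ℝ) ≤ 2^(i+1) → ℓ ≤ i + 1 := by
    intro q hq i h1
    have := Real.log_le_log (by linarith) ((hS q hq).2.2.1.trans h1)
    rw [Real.log_pow] at this; push_cast at this
    have hi : (0:ℝ) ≤ i := by positivity
    nlinarith
  set B := C * (β+1)^(2*(κ+1)) * 2^(κ+1) with hBdef
  have hB0 : 0 ≤ B := by rw [hBdef, pow_mul]; positivity
  have key := dyadic S (S.image (Nat.log 2)) (fun i => B / ((i:ℝ)+1)^(κ+1)) ?_ ?_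
  · refine key.trans ?_
    have hsum : ∑ i ∈ S.image (Nat.log 2), 1/((i:ℝ)+1)^2 ≤ 2/ℓ := by
      set k := ⌈ℓ⌉₊ - 1 with hk
      have hk1 : 1 ≤ ⌈ℓ⌉₊ := Nat.one_le_ceil_iff.2 (by linarith)
      have hs := sum_Ioo_inv_sq_le (α := ℝ) k ((S.image (Nat.log 2)).sup id + 2)
      have e1 : ((k:ℝ)+1) = ⌈ℓ⌉₊ := by rw [hk, Nat.cast_sub hk1]; push_cast; ring
      rw [e1] at hs
      refine le_trans ?_ (hs.trans (by gcongr; exact Nat.le_ceil _))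
      have hre : ∑ i ∈ S.image (Nat.log 2), 1/((i:ℝ)+1)^2 = ∑ j ∈ (S.image (Nat.log 2)).image (fun i : ℕ => i+1), (((j:ℕ):ℝ)^2)⁻¹ := by
        symm
        rw [Finset.sum_image (s := S.image (Nat.log 2)) (g := fun i : ℕ => i+1) (fun a _ b _ hab => by simpa using hab)]
        exact Finset.sum_congr rfl fun i _ => by push_cast; rw [one_div]
      rw [hre]
      · apply Finset.sum_le_sum_of_subset_of_nonneg ?_ fun _ _ _ => by positivity
        intro j hj
        obtain ⟨i, hi, rfl⟩ := Finset.mem_image.1 hj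
        have hle : i ≤ (S.image (Nat.log 2)).sup id := Finset.le_sup (f := id) hi
        obtain ⟨q, hqS, rfl⟩ := Finset.mem_image.1 hi
        have := hq q hqS (Nat.log 2 q) (by exact_mod_cast (Nat.lt_pow_succ_log_self (b := 2) (by norm_num) q).le)
        have : ⌈ℓ⌉₊ ≤ Nat.log 2 q + 1 := Nat.ceil_le.2 (by exact_mod_cast this)
        exact Finset.mem_Ioo.2 ⟨by omega, by omega⟩
    obtain ⟨m, rfl⟩ : ∃ m, κ = m + 1 := ⟨κ - 1, by omega⟩
    calc _ ≤ ∑ i ∈ S.image (Nat.log 2), (2*B/ℓ^m) * (1/((i:ℝ)+1)^2) := by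
          apply Finset.sum_le_sum; intro i hi
          obtain ⟨q, hqS, rfl⟩ := Finset.mem_image.1 hi
          have := hq q hqS (Nat.log 2 q) (by exact_mod_cast (Nat.lt_pow_succ_log_self (b := 2) (by norm_num) q).le)
          have e : 2 * (B / ((Nat.log 2 q:ℝ)+1)^(m+1+1)) = (2*B/((Nat.log 2 q:ℝ)+1)^m) * (1/((Nat.log 2 q:ℝ)+1)^2) := by
            rw [pow_add, pow_add]; field_simp
          rw [e]; gcongr
      _ ≤ (2*B/ℓ^m) * (2/ℓ) := by rw [← Finset.mul_sum]; gcongr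
      _ = (2*(C*2^(m+1+1))*2) * (β+1)^(2*(m+1+1)) / ℓ^(m+1) := by rw [hBdef, pow_succ ℓ m]; field_simp
      _ ≤ _ := by
        have : 0 ≤ (β+1)^(2*(m+1+1)) := by rw [pow_mul]; positivity
        gcongr; exact le_max_right _ _
  · intro q hqS; exact ⟨(hS q hqS).1.ne_zero, Finset.mem_image_of_mem _ hqS⟩
  · intro i hi S' hS' hqi
    rcases S'.eq_empty_or_nonempty with rfl | ⟨q1, hq1⟩
    · simp; positivity
    set y : ℝ := 2^(i+1) with hy
    have hy0 : 0 < y := by positivity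
    have hPy : P0 ≤ y := (hS q1 (hS' hq1)).2.2.1.trans (hqi q1 hq1).2
    have hℓy : ℓ ≤ log y := Real.log_le_log (by linarith) hPy
    have hlogy : log y = (i+1)*log 2 := by rw [hy, Real.log_pow]; push_cast; ring
    have hh := h y (hP0.trans hPy) Bs D hB hD (hDl.trans (by gcongr)) hp
    have hq1p := hS q1 (hS' hq1)
    have hLL : log (log y) ≤ β + 1 := by
      have hqpos : (0:ℝ) < q1 := by exact_mod_cast hq1p.1.pos
      have a1 : log q1 ≤ exp β := by rw [Real.log_le_iff_le_exp hqpos]; exact hq1p.2.2.2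
      have a0 : ℓ ≤ log q1 := Real.log_le_log (by linarith) hq1p.2.2.1
      have a2 : log y ≤ log (2*q1) := Real.log_le_log hy0 (by rw [hy, pow_succ]; linarith [(hqi q1 hq1).1])
      rw [Real.log_mul (by norm_num) (by positivity)] at a2
      rw [Real.log_le_iff_le_exp (by linarith), Real.exp_add]
      have := Real.exp_one_gt_d9
      nlinarith
    have hLL0 : 0 ≤ log (log y) := Real.log_nonneg (by linarith)
    have hcard : (S'.card:ℝ) ≤ (#{n ∈ Finset.range (⌊y⌋₊+1) | n.Prime ∧ ∀ b ∈ Bs, (b*n+1).Prime} : ℝ) := by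
      rw [Nat.cast_le]
      apply Finset.card_le_card
      intro P hP
      exact (Finset.mem_filter.2 ⟨Finset.mem_range.2 (Nat.lt_succ_of_le (Nat.le_floor (hqi P hP).2)), (hS P (hS' hP)).1, (hS P (hS' hP)).2.1⟩)
    refine hcard.trans (hh.trans ?_)
    have e1 : ((i:ℝ)+1)^(κ+1) ≤ 2^(κ+1) * log y^(κ+1) := by
      rw [← mul_pow]; gcongr; rw [hlogy]
      have hi : (0:ℝ) ≤ i := by positivity
      nlinarith
    have hly : 0 < log y := by linarith
    calc C * y * log (log y)^(2*(κ+1)) / log y^(κ+1) ≤ C * y * (β+1)^(2*(κ+1)) / log y^(κ+1) := by gcongr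
      _ = C * y * (β+1)^(2*(κ+1)) * 2^(κ+1) / (2^(κ+1) * log y^(κ+1)) := by field_simp
      _ ≤ C * y * (β+1)^(2*(κ+1)) * 2^(κ+1) / ((i:ℝ)+1)^(κ+1) := by
        have : 0 ≤ (β+1)^(2*(κ+1)) := by rw [pow_mul]; positivity
        gcongr
      _ = _ := by rw [hBdef]; ring
end FordT

namespace FordT
open Real Finset
def Fl (p e : ℕ) : ℕ := if e = 1 then p-1 else if e = 2 then p^2-p-1 else p^(e-3)*(p-1)^2*(p+1)
def F (N : ℕ) : ℕ := ∏ p ∈ N.primeFactors, Fl p (N.factorization p)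
lemma Fl_cast {p e : ℕ} (hp : p.Prime) : (Fl p e : ℝ) = if e = 1 then (p:ℝ)-1
  else if e = 2 then (p:ℝ)^2-(p:ℝ)-1 else (p:ℝ)^(e-3)*((p:ℝ)-1)^2*((p:ℝ)+1) := by
  have h1 : 1 ≤ p := hp.one_le
  have h2 : p + 1 ≤ p^2 := by have := hp.two_le; nlinarith
  unfold Fl; split_ifs
  · push_cast [h1]; ring
  · rw [Nat.sub_sub, Nat.cast_sub h2]; push_cast; ring
  · push_cast [h1]; ring
lemma F_mval (N : ℕ) : (F N : ℝ) = mval (fun p e => (Fl p e : ℝ)) N := by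
  simp [F, mval]
lemma F_cast (N : ℕ) : (F N : ℝ) = psiNew N := by
  rw [F, psiNew, mval, Nat.cast_prod]
  exact Finset.prod_congr rfl fun p hp => Fl_cast (Nat.prime_of_mem_primeFactors hp)
lemma F_mul {a b : ℕ} (h : a.Coprime b) : F (a*b) = F a * F b := by
  have := mval_mul (fun p e => (Fl p e : ℝ)) h
  rw [← F_mval, ← F_mval, ← F_mval] at this
  exact_mod_cast this
lemma F_pp {p e : ℕ} (hp : p.Prime) (he : e ≠ 0) : F (p^e) = Fl p e := by
  have := mval_pp (fun p e => (Fl p e : ℝ)) hp he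
  rw [← F_mval] at this
  exact_mod_cast this
lemma F_p {p : ℕ} (hp : p.Prime) : F p = p - 1 := by
  have := F_pp hp one_ne_zero
  simpa [Fl] using this
lemma F_one : F 1 = 1 := by simp [F]
lemma Fl_ge {p e : ℕ} (hp : p.Prime) (he : 1 ≤ e) : (p:ℝ)^e ≤ 4 * Fl p e := by
  rw [Fl_cast hp]
  have h2 : (2:ℝ) ≤ p := by exact_mod_cast hp.two_le
  split_ifs with h h'
  · rw [h, pow_one]; linarith
  · rw [h']; nlinarith
  · have h3 : 3 ≤ e := by omega
    have : (p:ℝ)^e = (p:ℝ)^(e-3) * p^3 := by rw [← pow_add]; congr 1; omega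
    rw [this]
    have h4 : (p:ℝ)^3 ≤ 4*((p-1)^2*(p+1)) := by nlinarith [mul_nonneg (sub_nonneg.2 h2) (sub_nonneg.2 h2)]
    have := mul_le_mul_of_nonneg_left h4 (by positivity : (0:ℝ) ≤ (p:ℝ)^(e-3))
    linarith
lemma Fl_pos {p e : ℕ} (hp : p.Prime) (he : 1 ≤ e) : (0:ℝ) < Fl p e := by
  have := Fl_ge hp he
  have : (0:ℝ) < (p:ℝ)^e := by have := hp.pos; positivity
  linarith
lemma F_pos (N : ℕ) : 0 < F N := by
  have := mval_pos (f := fun p e => (Fl p e : ℝ)) (fun p e hp he => Fl_pos hp he) N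
  rw [← F_mval] at this
  exact_mod_cast this
lemma mval_id {N : ℕ} (hN : N ≠ 0) : (N:ℝ) = mval (fun p e => (p:ℝ)^e) N := by
  conv_lhs => rw [← Nat.prod_factorization_pow_eq_self hN]
  rw [Finsupp.prod, Nat.cast_prod, Nat.support_factorization, mval]
  exact Finset.prod_congr rfl fun p _ => by push_cast; rfl
lemma F_ge {N : ℕ} (hN : N ≠ 0) : (N:ℝ) ≤ 4 * (F N:ℝ)^2 := by
  rw [mval_id hN]
  have h2 : mval (fun p e => (p:ℝ)^e) N ≤ mval (fun p e => (if p = 2 then 4 else 1) * ((Fl p e:ℝ) * Fl p e)) N := by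
    apply mval_le
    · intro p e hp he; positivity
    intro p e hp he
    have hg := Fl_ge hp he
    have h2 : (2:ℝ) ≤ p := by exact_mod_cast hp.two_le
    have hpe : (0:ℝ) < (p:ℝ)^e := by positivity
    by_cases e2 : p = 2
    · rw [if_pos e2]
      rcases Nat.lt_or_ge e 2 with h | h
      · have : e = 1 := by omega
        subst this; subst e2; norm_num [Fl]
      · have : (p:ℝ)^2 ≤ p^e := pow_le_pow_right₀ (by linarith) h
        have h4 : (4:ℝ) ≤ p^e := le_trans (by nlinarith) this
        nlinarith [mul_self_le_mul_self hpe.le hg]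
    · rw [if_neg e2]
      have h3 : (3:ℝ) ≤ p := by exact_mod_cast (by have := hp.two_le; omega : 3 ≤ p)
      rcases Nat.lt_or_ge e 3 with h | h
      · rw [Fl_cast hp]
        interval_cases e
        · simp; nlinarith
        · simp
          have : (p:ℝ) ≤ (p:ℝ)^2-p-1 := by nlinarith
          nlinarith
      · have : (3:ℝ)^3 ≤ p^e := (pow_le_pow_left₀ (by norm_num) h3 3).trans (pow_le_pow_right₀ (by linarith) h)
        nlinarith
  refine h2.trans ?_
  rw [mval_mulfun, mval_mulfun, ← F_mval, ← pow_two]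
  gcongr
  rw [mval, Finset.prod_ite_eq']
  split_ifs <;> norm_num
noncomputable def RR (S : Finset ℕ) : ℝ := ∑ v ∈ S.image F, (1/v:ℝ)
def SM (X n : ℕ) : Finset ℕ := (Finset.Icc 1 X).filter fun N => N.primeFactors ⊆ PL n
noncomputable def R (X n : ℕ) : ℝ := RR (SM X n)
lemma mem_SM {X n N : ℕ} : N ∈ SM X n ↔ (1 ≤ N ∧ N ≤ X) ∧ ∀ p, p.Prime → p ∣ N → p ≤ n := by
  rw [SM, Finset.mem_filter, Finset.mem_Icc]
  refine and_congr_right fun h => ⟨fun h1 p hp hd => (mem_PL.1 (h1 (Nat.mem_primeFactors.2 ⟨hp, hd, by omega⟩))).1, fun h1 p hp => ?_⟩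
  exact mem_PL.2 ⟨h1 p (Nat.prime_of_mem_primeFactors hp) (Nat.dvd_of_mem_primeFactors hp), Nat.prime_of_mem_primeFactors hp⟩
lemma img_sum {ι : Type*} (V : Finset ℕ) (T : Finset ι) (g : ι → ℕ) (h : ∀ v ∈ V, ∃ i ∈ T, v = g i) :
    ∑ v ∈ V, (1/v:ℝ) ≤ ∑ i ∈ T, (1/g i:ℝ) := by
  classical
  refine (Finset.sum_le_sum_of_subset_of_nonneg (t := T.image g) ?_ fun _ _ _ => by positivity).trans
    (Finset.sum_image_le_of_nonneg fun _ _ => by positivity)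
  intro v hv
  obtain ⟨i, hi, rfl⟩ := h v hv
  exact Finset.mem_image_of_mem g hi
lemma RR_nonneg (S : Finset ℕ) : 0 ≤ RR S := Finset.sum_nonneg fun _ _ => by positivity
lemma RR_mono {S T : Finset ℕ} (h : S ⊆ T) : RR S ≤ RR T :=
  Finset.sum_le_sum_of_subset_of_nonneg (Finset.image_subset_image h) fun _ _ _ => by positivity
lemma RR_union (S T : Finset ℕ) : RR (S ∪ T) ≤ RR S + RR T := by
  rw [RR, Finset.image_union, RR, RR, ← Finset.sum_union_inter]
  exact le_add_of_nonneg_right (Finset.sum_nonneg fun _ _ => by positivity)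
lemma RR_le {ι : Type*} (S : Finset ℕ) (T : Finset ι) (g : ι → ℕ) (h : ∀ N ∈ S, ∃ i ∈ T, F N = g i) :
    RR S ≤ ∑ i ∈ T, (1/g i:ℝ) := by
  apply img_sum
  intro v hv
  obtain ⟨N, hN, rfl⟩ := Finset.mem_image.1 hv
  exact h N hN
lemma RR_prod (S A B : Finset ℕ) (h : ∀ N ∈ S, ∃ a ∈ A, ∃ b ∈ B, N = a * b ∧ a.Coprime b) :
    RR S ≤ RR A * RR B := by
  rw [RR, RR, RR, Finset.sum_mul_sum, ← Finset.sum_product']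
  refine (RR_le S ((A.image F) ×ˢ (B.image F)) (fun i => i.1*i.2) ?_).trans (le_of_eq ?_)
  · intro N hN
    obtain ⟨a, ha, b, hb, rfl, hc⟩ := h N hN
    exact ⟨(F a, F b), Finset.mem_product.2 ⟨Finset.mem_image_of_mem F ha, Finset.mem_image_of_mem F hb⟩, F_mul hc⟩
  · exact Finset.sum_congr rfl fun i _ => by push_cast; rw [one_div_mul_one_div]
lemma RR_dvd {X n : ℕ} (S A : Finset ℕ) (hS : S ⊆ SM X n)
    (h : ∀ N ∈ S, ∃ a ∈ A, ∃ b, N = a * b ∧ a.Coprime b) : RR S ≤ RR A * R X n := by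
  apply RR_prod
  intro N hN
  obtain ⟨a, ha, b, rfl, hc⟩ := h N hN
  have h1 := mem_SM.1 (hS hN)
  have hb : b ≠ 0 := by rintro rfl; omega
  have ha0 : a ≠ 0 := by rintro rfl; omega
  refine ⟨a, ha, b, mem_SM.2 ⟨⟨by omega, (Nat.le_mul_of_pos_left b (by omega)).trans h1.1.2⟩, fun p hp hd => h1.2 p hp (hd.mul_left a)⟩, rfl, hc⟩
lemma geom_le {r : ℝ} (h0 : 0 ≤ r) (h1 : r ≤ 1/2) (K : ℕ) : ∑ e ∈ Finset.Icc 1 K, r^e ≤ 2*r := by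
  have h : ∀ K : ℕ, ∑ e ∈ Finset.Icc 1 K, r^e ≤ 2*r - 2*(r^K*r) := by
    intro K
    induction K with
    | zero => simp
    | succ n ih =>
      rw [Finset.sum_Icc_succ_top (by omega)]
      have : 0 ≤ r^n := by positivity
      have h3 := mul_le_mul_of_nonneg_left h1 (mul_nonneg this h0)
      rw [pow_succ]; nlinarith
  have := h K
  have : 0 ≤ r^K*r := by positivity
  linarith [h K]
lemma R_triv : ∃ C : ℝ, 1 ≤ C ∧ ∀ (X : ℕ) (U : ℝ), 0 ≤ U → R X ⌊E U⌋₊ ≤ exp (8*U + C) := by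
  obtain ⟨C, hC, h⟩ := PRE
  refine ⟨8*C, by linarith, fun X U hU => ?_⟩
  have h1 : R X ⌊E U⌋₊ ≤ ∑ N ∈ SM X ⌊E U⌋₊, mval (fun p e => 1/(Fl p e:ℝ)) N := by
    refine (RR_le _ (SM X ⌊E U⌋₊) F fun N hN => ⟨N, hN, rfl⟩).trans (le_of_eq (Finset.sum_congr rfl fun N _ => ?_))
    rw [F_mval, mval, mval, one_div, ← Finset.prod_inv_distrib]; simp
  refine h1.trans ((euler _ (fun p => 8*(1/p)) ⌊E U⌋₊ (fun p e hp he => by positivity) ?_ _ ?_).trans (Real.exp_le_exp.2 ?_))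
  · intro p hp _ K
    have h2 : (2:ℝ) ≤ p := by exact_mod_cast hp.two_le
    have := geom_le (r := 1/p) (by positivity) (by gcongr) K
    calc _ ≤ ∑ e ∈ Finset.Icc 1 K, 4*((1:ℝ)/p)^e := by
          apply Finset.sum_le_sum; intro e he
          have he1 := (Finset.mem_Icc.1 he).1
          rw [div_pow, one_pow, mul_one_div, div_le_div_iff₀ (Fl_pos hp he1) (by positivity)]
          linarith [Fl_ge hp he1]
      _ ≤ _ := by rw [← Finset.mul_sum]; linarith
  · intro N hN; have := mem_SM.1 hN; exact ⟨by omega, this.2⟩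
  · rw [← Finset.mul_sum]
    have := (abs_le.1 (h U hU)).2
    change 8 * PR _ ≤ _
    linarith
lemma sq_sum (n1 n X : ℕ) : ∑ i ∈ ((PL n).filter (n1 < ·)) ×ˢ Finset.Icc 2 X, (1/(Fl i.1 i.2:ℕ):ℝ) ≤ 16/(n1+1) := by
  rw [Finset.sum_product]
  have h1 : ∀ p ∈ (PL n).filter (n1 < ·), ∑ e ∈ Finset.Icc 2 X, (1/(Fl p e:ℕ):ℝ) ≤ 8*((p:ℝ)^2)⁻¹ := by
    intro p hp
    have hp := (mem_PL.1 (Finset.mem_filter.1 hp).1).2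
    have h2 : (2:ℝ) ≤ p := by exact_mod_cast hp.two_le
    have := geom_le (r := 1/p) (by positivity) (by gcongr) (X-1)
    calc _ ≤ ∑ e ∈ Finset.Icc 2 X, (4/p)*((1:ℝ)/p)^(e-1) := by
          apply Finset.sum_le_sum; intro e he
          have he1 := (Finset.mem_Icc.1 he).1
          have e1 : (4/(p:ℝ))*((1:ℝ)/p)^(e-1) = 4/(p:ℝ)^e := by
            obtain ⟨k, rfl⟩ : ∃ k, e = k+1 := ⟨e-1, by omega⟩
            rw [Nat.add_sub_cancel, div_pow, one_pow, pow_succ]; field_simp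
          rw [e1, div_le_div_iff₀ (Fl_pos hp (by omega)) (by positivity)]
          linarith [Fl_ge hp (by omega : 1 ≤ e)]
      _ = (4/p) * ∑ e ∈ Finset.Icc 1 (X-1), ((1:ℝ)/p)^e := by
          rw [Finset.mul_sum]
          refine Finset.sum_bij' (fun e _ => e-1) (fun e _ => e+1) ?_ ?_ ?_ ?_ ?_
          · intro e he; have := Finset.mem_Icc.1 he; exact Finset.mem_Icc.2 (by omega)
          · intro e he; have := Finset.mem_Icc.1 he; exact Finset.mem_Icc.2 (by omega)
          · intro e he; have := Finset.mem_Icc.1 he; omega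
          · intro e he; omega
          · intro e he; rfl
      _ ≤ (4/p) * (2*(1/p)) := by gcongr
      _ = _ := by field_simp; norm_num
  refine (Finset.sum_le_sum h1).trans ?_
  rw [← Finset.mul_sum]
  have h2 := sum_Ioo_inv_sq_le (α := ℝ) n1 (n+1)
  have h3 : ∑ p ∈ (PL n).filter (n1 < ·), ((p:ℝ)^2)⁻¹ ≤ ∑ p ∈ Finset.Ioo n1 (n+1), ((p:ℝ)^2)⁻¹ := by
    apply Finset.sum_le_sum_of_subset_of_nonneg _ fun _ _ _ => by positivity
    intro p hp
    have := Finset.mem_filter.1 hp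
    exact Finset.mem_Ioo.2 ⟨this.2, Nat.lt_succ_of_le (mem_PL.1 this.1).1⟩
  calc _ ≤ 8*(2/((n1:ℝ)+1)) := by linarith
    _ = _ := by ring
lemma dvd_pp {N p : ℕ} (hN : N ≠ 0) (hp : p.Prime) : ∃ b, N = p^(N.factorization p) * b ∧ (p^(N.factorization p)).Coprime b :=
  ⟨N / p^(N.factorization p), (Nat.ordProj_mul_ordCompl_eq_self N p).symm,
    (Nat.coprime_ordCompl hp hN).pow_left _⟩
lemma case_a {X n : ℕ} (n1 : ℕ) (S : Finset ℕ) (hS : S ⊆ SM X n)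
    (h : ∀ N ∈ S, ∃ p, p.Prime ∧ n1 < p ∧ p^2 ∣ N) : RR S ≤ 16/(n1+1) * R X n := by
  refine (RR_dvd S ((((PL n).filter (n1 < ·)) ×ˢ Finset.Icc 2 X).image fun i => i.1^i.2) hS ?_).trans ?_
  · intro N hN
    obtain ⟨p, hp, hn, hd⟩ := h N hN
    have h1 := mem_SM.1 (hS hN)
    obtain ⟨b, hb, hc⟩ := dvd_pp (by omega : N ≠ 0) hp
    have h2 : 2 ≤ N.factorization p := (hp.pow_dvd_iff_le_factorization (by omega)).1 hd
    refine ⟨_, Finset.mem_image.2 ⟨(p, N.factorization p), Finset.mem_product.2 ⟨Finset.mem_filter.2 ⟨mem_PL.2 ⟨h1.2 p hp ((dvd_pow_self p two_ne_zero).trans hd), hp⟩, hn⟩, Finset.mem_Icc.2 ⟨h2, ?_⟩⟩, rfl⟩, b, hb, hc⟩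
    exact (Nat.factorization_lt p (by omega : N ≠ 0)).le.trans h1.1.2
  · apply mul_le_mul_of_nonneg_right _ (RR_nonneg _)
    refine le_trans ?_ (sq_sum n1 n X)
    apply RR_le
    intro N hN
    obtain ⟨i, hi, rfl⟩ := Finset.mem_image.1 hN
    refine ⟨i, hi, ?_⟩
    have h1 := Finset.mem_product.1 hi
    exact F_pp (mem_PL.1 (Finset.mem_filter.1 h1.1).1).2 (by have := (Finset.mem_Icc.1 h1.2).1; omega)
lemma case_b {X n : ℕ} (Q S : Finset ℕ) (hS : S ⊆ SM X n) (hQ : ∀ q ∈ Q, q.Prime)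
    (h : ∀ N ∈ S, ∃ q ∈ Q, q ∣ N ∧ ¬ q^2 ∣ N) : RR S ≤ 2 * (∑ q ∈ Q, (1/q:ℝ)) * R X n := by
  refine (RR_dvd S Q hS ?_).trans ?_
  · intro N hN
    obtain ⟨q, hq, hd, hd2⟩ := h N hN
    obtain ⟨b, rfl⟩ := hd
    refine ⟨q, hq, b, rfl, ((hQ q hq).coprime_iff_not_dvd).2 fun h => hd2 ?_⟩
    rw [pow_two]; exact mul_dvd_mul_left q h
  · apply mul_le_mul_of_nonneg_right _ (RR_nonneg _)
    refine (RR_le Q Q (fun q => q - 1) fun q hq => ⟨q, hq, F_p (hQ q hq)⟩).trans ?_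
    rw [Finset.mul_sum]
    apply Finset.sum_le_sum
    intro q hq
    have h2 : (2:ℝ) ≤ q := by exact_mod_cast (hQ q hq).two_le
    rw [Nat.cast_sub (hQ q hq).one_le, mul_one_div, div_le_div_iff₀ (by push_cast; linarith) (by linarith)]
    push_cast; linarith
end FordT

namespace FordT
open Real Finset
noncomputable def Wr (φ : ℕ → ℝ) : List ℕ → ℝ
  | [] => 0
  | g :: r => fordA (r.length+1) * φ g + Wr φ r
noncomputable def lam (k : ℕ) : ℝ := log (((k:ℝ)+2)/(k+1))
noncomputable def cw (T : ℕ) : List ℕ → ℕ → ℝ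
  | [], _ => 1
  | g :: r, p => cw T r p * ((if p ≤ ⌊E g⌋₊ then exp (lam r.length) else 1) * (if p ≤ T then exp (-lam r.length) else 1))
noncomputable def Lh (t0 : ℕ) : List ℕ → ℕ → ℝ
  | [], _ => 0
  | g :: r, n => Lh t0 r n + lam r.length * (Om g n - Om t0 n)
noncomputable def Hh : List ℕ → ℕ → ℝ
  | [], _ => 0
  | g :: r, x => Hh r x + lam r.length * (min g x : ℕ)
lemma lam_nonneg (k : ℕ) : 0 ≤ lam k := Real.log_nonneg (by rw [le_div_iff₀ (by positivity)]; linarith)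
lemma exp_lam (k : ℕ) : exp (lam k) = ((k:ℝ)+2)/(k+1) := Real.exp_log (by positivity)
lemma lam_le (k : ℕ) : lam k ≤ 1 := by
  have := Real.log_le_sub_one_of_pos (show (0:ℝ) < ((k:ℝ)+2)/(k+1) by positivity)
  have h2 : ((k:ℝ)+2)/(k+1) ≤ 2 := by
    rw [div_le_iff₀ (by positivity)]
    have : (0:ℝ) ≤ k := by positivity
    linarith
  unfold lam; linarith
lemma hv_eq (t0 : ℕ) (r : List ℕ) (n : ℕ) : mval (fun p e => cw ⌊E t0⌋₊ r p ^ e) n = exp (Lh t0 r n) := by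
  induction r with
  | nil => simp [cw, Lh, mval]
  | cons g r ih =>
    simp only [cw, Lh, mul_pow]
    rw [mval_mulfun, mval_mulfun, ih, mval_Om, mval_Om, ← Real.exp_add, ← Real.exp_add]
    congr 1; ring
lemma cw_bd (t0 : ℕ) (r : List ℕ) (p : ℕ) (hr : ∀ g ∈ r, t0 ≤ g) : 
    1 ≤ cw ⌊E t0⌋₊ r p ∧ cw ⌊E t0⌋₊ r p ≤ r.length + 1 ∧ (p ≤ ⌊E t0⌋₊ → cw ⌊E t0⌋₊ r p = 1) ∧
    cw ⌊E t0⌋₊ r p ≤ 1 + (r.map fun g : ℕ => if p ≤ ⌊E g⌋₊ then (1:ℝ) else 0).sum := by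
  induction r with
  | nil => simp [cw]
  | cons g r ih =>
    obtain ⟨h1, h2, h3, h4⟩ := ih fun g hg => hr g (List.mem_cons_of_mem _ hg)
    have hg := hr g List.mem_cons_self
    have hle : ⌊E t0⌋₊ ≤ ⌊E g⌋₊ := Nat.floor_mono (E_mono (by exact_mod_cast hg))
    simp only [cw, List.length_cons, List.map_cons, List.sum_cons]
    push_cast
    by_cases hT : p ≤ ⌊E t0⌋₊
    · rw [if_pos hT, if_pos (hT.trans hle), ← Real.exp_add, add_neg_cancel, Real.exp_zero, mul_one, h3 hT]
      have : (0:ℝ) ≤ (r.map fun g : ℕ => if p ≤ ⌊E g⌋₊ then (1:ℝ) else 0).sum := by rw [h3 hT] at h4; linarith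
      have := Nat.cast_nonneg (α := ℝ) r.length
      rw [if_pos (hT.trans hle)]
      refine ⟨le_rfl, by linarith, fun _ => rfl, by linarith⟩
    · rw [if_neg hT, mul_one]
      by_cases hG : p ≤ ⌊E g⌋₊
      · rw [if_pos hG, if_pos hG, exp_lam]
        have e1 : ((r.length:ℝ)+2)/(r.length+1) = 1 + 1/(r.length+1) := by field_simp; ring
        have e2 : cw ⌊E t0⌋₊ r p * (1/((r.length:ℝ)+1)) ≤ 1 := by
          rw [mul_one_div, div_le_one (by positivity)]; exact h2
        have e3 : 0 ≤ cw ⌊E t0⌋₊ r p * (1/((r.length:ℝ)+1)) := by positivity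
        rw [e1, mul_add, mul_one]
        refine ⟨by linarith, by linarith, fun h => absurd h hT, by linarith⟩
      · rw [if_neg hG, if_neg hG, mul_one]
        refine ⟨h1, by linarith, fun h => absurd h hT, by linarith⟩
lemma Hh_small (r : List ℕ) (x : ℕ) (h : ∀ g ∈ r, x ≤ g) : Hh r x = x * log (r.length+1) := by
  induction r with
  | nil => simp [Hh]
  | cons g r ih =>
    rw [Hh, ih fun g hg => h g (List.mem_cons_of_mem _ hg), min_eq_right (h g List.mem_cons_self), lam,
      Real.log_div (by positivity) (by positivity)]
    rw [List.length_cons]; push_cast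
    rw [show (r.length:ℝ)+1+1 = r.length+2 by ring]; ring
lemma DD_eq (G : ℕ) (r : List ℕ) (hr : r.Pairwise (· ≤ ·)) (hG : ∀ g ∈ r, g ≤ G) :
    Hh r G + (r.map (Hh r)).sum = Wr (fun g => (g:ℝ)) r + (r.map fun g : ℕ => (g:ℝ)).sum := by
  induction r with
  | nil => simp [Hh, Wr]
  | cons g r ih =>
    have hp := List.pairwise_cons.1 hr
    have ih := ih hp.2 fun g hg => hG g (List.mem_cons_of_mem _ hg)
    have e1 : (r.map (Hh (g::r))).sum = (r.map (Hh r)).sum + r.length * (lam r.length * g) := by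
      have : r.map (Hh (g::r)) = r.map (fun x => Hh r x + lam r.length * g) := by
        apply List.map_congr_left; intro x hx
        rw [Hh, min_eq_left (hp.1 x hx)]
      rw [this, List.sum_map_add]; simp
    rw [List.map_cons, List.sum_cons, e1, Hh, Hh, min_self, min_eq_left (hG g List.mem_cons_self), Hh_small r g hp.1, Wr, List.map_cons, List.sum_cons]
    have e2 : fordA (r.length+1) = (r.length+2) * lam r.length + log (r.length+1) - 1 := by
      rw [fordA, lam, Real.log_div (by positivity) (by positivity)]
      push_cast; rw [show (r.length:ℝ)+1+1 = r.length+2 by ring]; ring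
    rw [e2]; linear_combination ih
lemma Lh_ge {η : ℝ} (hη : 0 ≤ η) (t0 G q : ℕ) (hq : Nrm η q) (hG : gw q ≤ G) (r : List ℕ) :
    Hh r (gw q) - r.length * (t0 + 2*η*G) ≤ Lh t0 r (q-1) := by
  induction r with
  | nil => simp [Hh, Lh]
  | cons g r ih =>
    have h1 := (abs_le.1 (hq g)).1
    have h2 := (abs_le.1 (hq t0)).2
    have h3 : ((min t0 (gw q):ℕ):ℝ) ≤ t0 := by exact_mod_cast min_le_left _ _
    have h4 : η * gw q ≤ η * G := by gcongr
    have h5 : ((min g (gw q):ℕ):ℝ) - (t0 + 2*η*G) ≤ Om g (q-1) - Om t0 (q-1) := by linarith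
    have h6 := mul_le_mul_of_nonneg_left h5 (lam_nonneg r.length)
    have h7 : lam r.length * (t0+2*η*G) ≤ 1 * (t0+2*η*G) := mul_le_mul_of_nonneg_right (lam_le _) (by positivity)
    simp only [Hh, Lh, List.length_cons]; rw [Nat.cast_succ]
    linarith
lemma cw_rk {C : ℝ} (hPR : ∀ t : ℝ, 0 ≤ t → |PR ⌊E t⌋₊ - t| ≤ C) (t0 G : ℕ) (r : List ℕ) (hr : ∀ g ∈ r, t0 ≤ g) (hlen : (r.length:ℝ) + 1 ≤ ⌊E t0⌋₊/2)
    (V : Finset ℕ) (hV : ∀ v ∈ V, v ≠ 0 ∧ ∀ p, p.Prime → p ∣ v → p ≤ ⌊E ((G:ℝ)+1)⌋₊) :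
    ∑ v ∈ V, mval (fun p e => cw ⌊E t0⌋₊ r p ^ e) v / v ≤ exp (G + 1 + C + ((r.map fun g : ℕ => (g:ℝ)).sum + r.length * C) + 4*((r.length:ℝ)+1)^2) := by
  set n := ⌊E ((G:ℝ)+1)⌋₊ with hn
  set m : ℝ := (r.length:ℝ) + 1 with hm
  have hcb := fun p => cw_bd t0 r p hr
  have hPLs : ∑ p ∈ PL n, (cw ⌊E t0⌋₊ r p / p + 4 * (cw ⌊E t0⌋₊ r p / p)^2) ≤ G + 1 + C + ((r.map fun g : ℕ => (g:ℝ)).sum + r.length * C) + 4*m^2 := by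
    rw [Finset.sum_add_distrib]
    have a1 : ∑ p ∈ PL n, cw ⌊E t0⌋₊ r p / p ≤ PR n + (r.map fun g : ℕ => PR ⌊E (g:ℝ)⌋₊).sum := by
      calc _ ≤ ∑ p ∈ PL n, ((1:ℝ)/p + (r.map fun g : ℕ => (if p ≤ ⌊E (g:ℝ)⌋₊ then (1:ℝ)/p else 0)).sum) := by
            apply Finset.sum_le_sum; intro p hp
            have : (r.map fun g : ℕ => (if p ≤ ⌊E (g:ℝ)⌋₊ then (1:ℝ)/p else 0)).sum = (r.map fun g : ℕ => if p ≤ ⌊E g⌋₊ then (1:ℝ) else 0).sum * (1/p) := by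
              rw [← List.sum_map_mul_right]; congr 1; apply List.map_congr_left; intro g _; split_ifs <;> simp
            rw [this, div_eq_mul_one_div, ← one_add_mul]
            exact mul_le_mul_of_nonneg_right (hcb p).2.2.2 (by positivity)
        _ ≤ _ := by
          rw [Finset.sum_add_distrib]
          apply add_le_add le_rfl
          clear * -
          induction r with
          | nil => simp
          | cons g r ih =>
            simp only [List.map_cons, List.sum_cons]
            rw [Finset.sum_add_distrib]
            refine add_le_add ?_ ih
            rw [← Finset.sum_filter, PR]
            apply Finset.sum_le_sum_of_subset_of_nonneg _ fun _ _ _ => by positivity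
            intro p hp
            have := Finset.mem_filter.1 hp
            exact mem_PL.2 ⟨this.2, (mem_PL.1 this.1).2⟩
    have a2 : PR n ≤ G + 1 + C := by have := (abs_le.1 (hPR ((G:ℝ)+1) (by positivity))).2; linarith
    have a3 : (r.map fun g : ℕ => PR ⌊E (g:ℝ)⌋₊).sum ≤ (r.map fun g : ℕ => (g:ℝ)).sum + r.length * C := by
      have : (r.map fun g : ℕ => (g:ℝ)).sum + r.length * C = (r.map fun g : ℕ => (g:ℝ) + C).sum := by rw [List.sum_map_add]; simp
      rw [this]; apply List.sum_le_sum; intro g _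
      have := (abs_le.1 (hPR (g:ℝ) (by positivity))).2; linarith
    have a4 : ∑ p ∈ PL n, 4 * (cw ⌊E t0⌋₊ r p / p)^2 ≤ 4*m^2 := by
      calc _ ≤ ∑ p ∈ PL n, (4*m^2) * ((1:ℝ)/p)^2 := by
            apply Finset.sum_le_sum; intro p _
            have h0 : 0 ≤ cw ⌊E t0⌋₊ r p := by linarith [(hcb p).1]
            have : cw ⌊E t0⌋₊ r p ^2 ≤ m^2 := by gcongr; exact (hcb p).2.1
            have := mul_le_mul_of_nonneg_right this (by positivity : (0:ℝ) ≤ (1/(p:ℝ))^2)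
            rw [div_eq_mul_one_div, mul_pow]; linarith
        _ ≤ _ := by rw [← Finset.mul_sum]; have := sum_inv_sq n; nlinarith [sq_nonneg m]
    linarith
  refine (rankin (cw ⌊E t0⌋₊ r) n (fun p hp => ?_) V hV).trans (Real.exp_le_exp.2 hPLs)
  refine ⟨by linarith [(hcb p).1], ?_⟩
  have h2 : (2:ℝ) ≤ p := by exact_mod_cast hp.two_le
  by_cases hT : p ≤ ⌊E t0⌋₊
  · rw [(hcb p).2.2.1 hT]; linarith
  · have : ((⌊E t0⌋₊:ℕ):ℝ) ≤ p := by exact_mod_cast (not_le.1 hT).le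
    linarith [(hcb p).2.1]
lemma block_shape : ∃ C : ℝ, 1 ≤ C ∧ ∀ (η : ℝ) (t0 G : ℕ) (r : List ℕ), 0 ≤ η → r.Pairwise (· ≤ ·) →
    (∀ g ∈ r, t0 ≤ g ∧ g ≤ G) → (r.length:ℝ) + 1 ≤ ⌊E t0⌋₊/2 → ∀ V : Finset ℕ,
    (∀ v ∈ V, ∃ (q : ℕ) (ℓ : List ℕ), gw q = G ∧ ℓ.map gw = r ∧ (∀ p ∈ q::ℓ, p.Prime ∧ Nrm η p) ∧
      v = ((q::ℓ).map (· - 1)).prod) →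
    ∑ v ∈ V, (1/v:ℝ) ≤ exp (G - Wr (fun g => (g:ℝ)) r + C * ((r.length:ℝ)+1)^2 * (t0 + 2*η*G + 1)) := by
  obtain ⟨C, hC, hPR⟩ := PRE
  refine ⟨C + 6, by linarith, ?_⟩
  intro η t0 G r hη hr hg hlen V hV
  set n := ⌊E ((G:ℝ)+1)⌋₊ with hn
  set m : ℝ := (r.length:ℝ) + 1 with hm
  have hm1 : 1 ≤ m := by
    have : (0:ℝ) ≤ r.length := by positivity
    linarith
  have hgl : ∀ q : ℕ, q.Prime → gw q ≤ G → q ≤ n := by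
    intro q hq h
    apply Nat.le_floor
    rcases Nat.lt_or_ge q 3 with h3 | h3
    · have : (q:ℝ) ≤ 2 := by exact_mod_cast (by omega : q ≤ 2)
      exact this.trans (E_gt (by positivity)).le
    have : (1:ℝ) < q := by exact_mod_cast (by omega)
    rw [← E_loglog this]
    apply E_mono
    have h1 := Nat.lt_floor_add_one (log (log q))
    have h2 : ((⌊log (log q)⌋₊:ℕ):ℝ) ≤ G := by exact_mod_cast h
    linarith
  have hrk := cw_rk hPR t0 G r (fun g h => (hg g h).1) hlen V ?_
  rotate_left
  · intro v hv
    obtain ⟨q, ℓ, h1, h2, h3, rfl⟩ := hV v hv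
    have hpos : ∀ p ∈ q::ℓ, p - 1 ≠ 0 := fun p hp => by have := (h3 p hp).1.two_le; omega
    constructor
    · intro h0
      obtain ⟨p, hp, h⟩ := List.mem_map.1 (List.prod_eq_zero_iff.1 h0)
      exact hpos p hp h
    · intro p hp hd
      obtain ⟨a, ha, hd⟩ := (hp.prime.dvd_prod_iff).1 hd
      obtain ⟨p', hp', rfl⟩ := List.mem_map.1 ha
      have h5 : gw p' ≤ G := by
        rcases List.mem_cons.1 hp' with rfl | h
        · exact h1.le
        · exact (hg _ (h2 ▸ List.mem_map_of_mem h)).2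
      exact (Nat.le_of_dvd (Nat.pos_of_ne_zero (hpos p' hp')) hd).trans ((Nat.sub_le _ _).trans (hgl p' (h3 p' hp').1 h5))
  set err : ℝ := m * (r.length * (t0 + 2*η*G)) with herr
  have hlow : ∀ v ∈ V, exp (Wr (fun g => (g:ℝ)) r + (r.map fun g : ℕ => (g:ℝ)).sum - err) ≤ mval (fun p e => cw ⌊E t0⌋₊ r p ^ e) v := by
    intro v hv
    obtain ⟨q, ℓ, h1, h2, h3, rfl⟩ := hV v hv
    have hprod : ∀ l : List ℕ, (∀ p ∈ l, p.Prime) → (l.map (·-1)).prod ≠ 0 ∧ mval (fun p e => cw ⌊E t0⌋₊ r p ^ e) (l.map (·-1)).prod = exp ((l.map fun p => Lh t0 r (p-1)).sum) := by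
      intro l hl
      induction l with
      | nil => simp [mval_one]
      | cons a l ih =>
        have ih := ih fun p hp => hl p (List.mem_cons_of_mem _ hp)
        have ha : a - 1 ≠ 0 := by have := (hl a List.mem_cons_self).two_le; omega
        rw [List.map_cons, List.prod_cons, List.map_cons, List.sum_cons, Real.exp_add, ← ih.2, ← hv_eq, mval_cm _ ha ih.1]
        exact ⟨mul_ne_zero ha ih.1, rfl⟩
    rw [(hprod _ fun p hp => (h3 p hp).1).2]
    apply Real.exp_le_exp.2
    rw [← DD_eq G r hr fun g h => (hg g h).2, List.map_cons, List.sum_cons]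
    have hq := Lh_ge hη t0 G q (h3 q List.mem_cons_self).2 h1.le r
    rw [h1] at hq
    have hs : ((r.map (Hh r)).sum - ℓ.length * (r.length * (t0 + 2*η*G))) ≤ (ℓ.map fun p => Lh t0 r (p-1)).sum := by
      have e : (r.map (Hh r)).sum - ℓ.length * (r.length * (t0 + 2*η*G)) = (ℓ.map fun p => Hh r (gw p) - r.length * (t0 + 2*η*G)).sum := by
        rw [← h2, List.map_map]
        generalize (List.map gw ℓ) = r'
        clear * -
        induction ℓ with
        | nil => simp
        | cons a l ih => simp only [List.map_cons, List.sum_cons, List.length_cons, Function.comp] at ih ⊢; push_cast; linarith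
      rw [e]
      apply List.sum_le_sum
      intro p hp
      exact Lh_ge hη t0 G p (h3 p (List.mem_cons_of_mem _ hp)).2 (hg _ (h2 ▸ List.mem_map_of_mem hp)).2 r
    have hl : ℓ.length = r.length := by rw [← h2, List.length_map]
    rw [hl] at hs
    rw [herr, hm]; linarith
  set Z := Wr (fun g => (g:ℝ)) r + (r.map fun g : ℕ => (g:ℝ)).sum - err with hZ
  have hfin : ∑ v ∈ V, (1/v:ℝ) ≤ exp (-Z) * exp (G + 1 + C + ((r.map fun g : ℕ => (g:ℝ)).sum + r.length * C) + 4*m^2) := by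
    refine le_trans ?_ (mul_le_mul_of_nonneg_left hrk (exp_pos _).le)
    rw [Finset.mul_sum]
    apply Finset.sum_le_sum; intro v hv
    rw [Real.exp_neg, mul_div_assoc', ← div_eq_inv_mul]
    apply div_le_div_of_nonneg_right _ (by positivity)
    rw [le_div_iff₀ (exp_pos _), one_mul]; exact hlow v hv
  refine hfin.trans ?_
  rw [← Real.exp_add]
  apply Real.exp_le_exp.2
  have b1 : err ≤ m^2 * (t0+2*η*G) := by
    rw [herr]
    have : (r.length:ℝ) * (t0+2*η*G) ≤ m * (t0+2*η*G) := mul_le_mul_of_nonneg_right (by rw [hm]; linarith) (by positivity)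
    nlinarith
  have b2 : 0 ≤ m^2 * (t0+2*η*G) := by positivity
  have b3 : m ≤ m^2 := by nlinarith
  have b4 : m * C ≤ m^2 * C := mul_le_mul_of_nonneg_right b3 (by linarith)
  have b5 : 0 ≤ (C+5) * (m^2 * (t0+2*η*G)) := mul_nonneg (by linarith) b2
  have b6 : (r.length:ℝ) = m - 1 := by rw [hm]; ring
  rw [hZ, b6]
  nlinarith only [b1, b2, b3, b4, b5, hm1]
end FordT

namespace FordT
open Real Finset
noncomputable def ll (q : ℕ) : ℝ := log (log q)
noncomputable def Wf (φ : ℕ → ℝ) : ℕ → List ℕ → ℝ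
  | _, [] => 0
  | k, q :: t => fordA k * φ q + Wf φ (k+1) t
lemma Wf_append (φ : ℕ → ℝ) (l : List ℕ) (g k : ℕ) : Wf φ k (l ++ [g]) = Wf φ k l + fordA (k + l.length) * φ g := by
  induction l generalizing k with
  | nil => simp [Wf]
  | cons a l ih => 
    simp only [List.cons_append, Wf, ih, List.length_cons]
    rw [show k + 1 + l.length = k + (l.length+1) by omega]; ring
lemma Wr_eq (φ : ℕ → ℝ) (r : List ℕ) : Wr φ r = Wf φ 1 r.reverse := by
  induction r with
  | nil => simp [Wf, Wr]
  | cons a l ih => rw [List.reverse_cons, Wf_append, ← ih, Wr, List.length_reverse, add_comm 1]; ring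
lemma fordA_ge {n : ℕ} (hn : 1 ≤ n) : log n ≤ fordA n := by
  have hn' : (1:ℝ) ≤ n := by exact_mod_cast hn
  have h := Real.one_sub_inv_le_log_of_pos (show (0:ℝ) < (n+1)/n by positivity)
  rw [Real.log_div (by positivity) (by positivity)] at h
  have h2 : ((n:ℝ)+1) * (1 - (((n:ℝ)+1)/n)⁻¹) = 1 := by field_simp; ring
  have := mul_le_mul_of_nonneg_left h (show (0:ℝ) ≤ n+1 by positivity)
  unfold fordA; linarith
lemma fordA_le {n : ℕ} (hn : 1 ≤ n) : fordA n ≤ log (n+1) := by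
  have hn' : (1:ℝ) ≤ n := by exact_mod_cast hn
  have h := Real.log_le_sub_one_of_pos (show (0:ℝ) < (n+1)/n by positivity)
  rw [Real.log_div (by positivity) (by positivity)] at h
  have h2 : (n:ℝ) * ((n+1)/n - 1) = 1 := by field_simp; ring
  have := mul_le_mul_of_nonneg_left h (show (0:ℝ) ≤ n by positivity)
  unfold fordA; linarith
lemma fordA_nn {n : ℕ} (hn : 1 ≤ n) : 0 ≤ fordA n :=
  (Real.log_nonneg (by exact_mod_cast hn)).trans (fordA_ge hn)
lemma fordA_le_n {n : ℕ} (hn : 1 ≤ n) : fordA n ≤ n := by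
  have := Real.log_le_sub_one_of_pos (show (0:ℝ) < (n:ℝ)+1 by positivity)
  linarith [fordA_le hn]
lemma fordA_one : fordA 1 = 2*log 2 - 1 := by norm_num [fordA]
lemma fordA_12 : 1.29 ≤ fordA 1 + fordA 2 := by
  have h : 19 * log 2 ≤ 12 * log 3 := by
    have : log ((2:ℝ)^19) ≤ log ((3:ℝ)^12) := Real.log_le_log (by norm_num) (by norm_num)
    rwa [Real.log_pow, Real.log_pow] at this
  have := Real.log_two_gt_d9
  norm_num [fordA]; linarith
lemma Wf_nonneg {φ : ℕ → ℝ} (t : List ℕ) (k : ℕ) (hk : 1 ≤ k) (h : ∀ q ∈ t, 0 ≤ φ q) : 0 ≤ Wf φ k t := by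
  induction t generalizing k with
  | nil => simp [Wf]
  | cons q t ih =>
    have h1 := ih (k+1) (by omega) fun q hq => h q (List.mem_cons_of_mem _ hq)
    have h2 := mul_nonneg (fordA_nn hk) (h q List.mem_cons_self)
    rw [Wf]; linarith
def good (δ : ℝ) : List ℕ → Prop
  | [] => True
  | q :: t => Wf ll 1 t ≤ (1+δ) * ll q ∧ good δ t
lemma ll_mono {p q : ℕ} (hp : 2 ≤ p) (h : p ≤ q) : ll p ≤ ll q := by
  have h2 : (2:ℝ) ≤ p := by exact_mod_cast hp
  exact Real.log_le_log (Real.log_pos (by linarith)) (Real.log_le_log (by linarith) (by exact_mod_cast h))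
lemma good_len {δ : ℝ} (hδ : δ ≤ 1/20) : ∀ ℓ : List ℕ, good δ ℓ → ℓ.Pairwise (· > ·) → (∀ q ∈ ℓ, 2 ≤ q ∧ 1 ≤ ll q) →
    ∀ q ∈ ℓ.head?, (6/5:ℝ)^((ℓ.length-1)/2) ≤ ll q
  | [], _, _, _ => by simp
  | [q], _, _, h => by simpa using (h q (by simp)).2
  | [q, q'], _, _, h => by simpa using (h q (by simp)).2
  | q :: q' :: q'' :: t, hg, hp, h => by
    have hg1 := hg.1
    have ih := good_len hδ (q''::t) hg.2.2 (List.pairwise_cons.1 (List.pairwise_cons.1 hp).2).2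
      (fun p hp => h p (by simp at hp ⊢; tauto)) q'' (by simp)
    intro x hx
    have : q = x := by simpa using hx
    subst this
    have e : ((q :: q' :: q'' :: t).length - 1)/2 = ((q''::t).length-1)/2 + 1 := by simp only [List.length_cons]; omega
    rw [e, pow_succ]
    have h1 : ll q'' ≤ ll q' := ll_mono (h q'' (by simp)).1 (List.rel_of_pairwise_cons (List.pairwise_cons.1 hp).2 (by simp : q'' ∈ q''::t)).le
    have hW := Wf_nonneg (φ := ll) t 3 (by norm_num) fun p hp => by
      have := (h p (by simp [hp])).2; linarith
    simp only [Wf] at hg1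
    have h3 := (h q (by simp)).2
    have h4 := (h q'' (by simp)).2
    have h5 := mul_le_mul_of_nonneg_left h1 (fordA_nn (le_refl 1))
    have h6 := mul_le_mul_of_nonneg_right fordA_12 (by linarith : 0 ≤ ll q'')
    have h7 := mul_le_mul_of_nonneg_right hδ (by linarith : 0 ≤ ll q)
    norm_num at hg1
    nlinarith only [h3, h4, h5, h6, h7, hg1, hW, ih]
def LL (Q : Finset ℕ) : ℕ → Finset (List ℕ)
  | 0 => {[]}
  | r+1 => (Q ×ˢ LL Q r).image fun i => i.1 :: i.2
lemma mem_LL (Q : Finset ℕ) (r : ℕ) (ℓ : List ℕ) : ℓ ∈ LL Q r ↔ ℓ.length = r ∧ ∀ q ∈ ℓ, q ∈ Q := by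
  induction r generalizing ℓ with
  | zero => 
    rw [LL, Finset.mem_singleton]
    exact ⟨fun h => by simp [h], fun h => List.length_eq_zero_iff.1 h.1⟩
  | succ r ih =>
    rw [LL, Finset.mem_image]
    constructor
    · rintro ⟨⟨q, t⟩, h, rfl⟩
      obtain ⟨h1, h2⟩ := Finset.mem_product.1 h
      have := (ih t).1 h2
      refine ⟨by simp [this.1], fun p hp => ?_⟩
      rcases List.mem_cons.1 hp with rfl | hp
      · exact h1
      · exact this.2 p hp
    · rintro ⟨h1, h2⟩
      match ℓ, h1 with
      | q :: t, h1 => exact ⟨(q,t), Finset.mem_product.2 ⟨h2 q List.mem_cons_self, (ih t).2 ⟨by simpa using h1, fun p hp => h2 p (List.mem_cons_of_mem _ hp)⟩⟩, rfl⟩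
lemma sum_LL (Q : Finset ℕ) (r : ℕ) (f : List ℕ → ℝ) : ∑ ℓ ∈ LL Q (r+1), f ℓ = ∑ t ∈ LL Q r, ∑ q ∈ Q, f (q::t) := by
  rw [LL, Finset.sum_image, Finset.sum_product_right]
  rintro ⟨a, b⟩ _ ⟨c, d⟩ _ h
  simpa using h
lemma card_LL (Q : Finset ℕ) (r : ℕ) : (LL Q r).card = Q.card^r := by
  have h : ∀ r : ℕ, ∑ ℓ ∈ LL Q r, (1:ℝ) = (Q.card:ℝ)^r := by
    intro r
    induction r with
    | zero => simp [LL]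
    | succ r ih => rw [sum_LL]; simp only [Finset.sum_const, nsmul_eq_mul, mul_one] at ih ⊢; rw [ih, pow_succ]
  have := h r
  simp only [Finset.sum_const, nsmul_eq_mul, mul_one] at this
  exact_mod_cast this
lemma shape_sum {α β : Type*} [DecidableEq β] (B : Finset α) (val : α → ℕ) (sh : α → β) (T : Finset β) (bd : ℝ) (hT : ∀ b ∈ B, sh b ∈ T)
    (h : ∀ σ ∈ T, ∑ v ∈ (B.filter fun b => sh b = σ).image val, (1/v:ℝ) ≤ bd) :
    ∑ v ∈ B.image val, (1/v:ℝ) ≤ T.card * bd := by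
  have h1 : ∑ v ∈ B.image val, (1/v:ℝ) ≤ ∑ i ∈ T.sigma (α := fun _ => ℕ) (fun σ => (B.filter fun b => sh b = σ).image val), (1/i.2:ℝ) := by
    apply img_sum (ι := Σ _ : β, ℕ) _ _ (fun i => i.2)
    intro v hv
    obtain ⟨b, hb, rfl⟩ := Finset.mem_image.1 hv
    exact ⟨⟨sh b, val b⟩, Finset.mem_sigma.2 ⟨hT b hb, Finset.mem_image_of_mem _ (Finset.mem_filter.2 ⟨hb, rfl⟩)⟩, rfl⟩
  refine h1.trans ?_
  rw [Finset.sum_sigma]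
  refine (Finset.sum_le_sum h).trans ?_
  rw [Finset.sum_const, nsmul_eq_mul]
lemma F_prod (l : List ℕ) (h : l.Pairwise (· > ·)) (hp : ∀ p ∈ l, p.Prime) : F l.prod = (l.map (· - 1)).prod := by
  induction l with
  | nil => simp [F_one]
  | cons a l ih =>
    have h' := List.pairwise_cons.1 h
    rw [List.prod_cons, List.map_cons, List.prod_cons, F_mul, ih h'.2 fun p hq => hp p (List.mem_cons_of_mem _ hq), F_p (hp a List.mem_cons_self)]
    apply Nat.coprime_list_prod_right_iff.2
    intro b hb
    exact (Nat.coprime_primes (hp a List.mem_cons_self) (hp b (List.mem_cons_of_mem _ hb))).2 (h'.1 b hb).ne'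
noncomputable def dl (u : ℝ) : ℝ := 1 / log u
noncomputable def et (u : ℝ) : ℝ := 1 / (log u)^4
noncomputable def U1 (u : ℝ) : ℝ := (log u)^12
noncomputable def n1 (u : ℝ) : ℕ := ⌊E (U1 u)⌋₊
lemma ll_bds {u : ℝ} (hu : 1 ≤ log u) {p : ℕ} (h1 : n1 u < p) (h2 : p ≤ ⌊E u⌋₊) :
    U1 u ≤ ll p ∧ ll p ≤ u ∧ 2 ≤ p ∧ U1 u - 1 ≤ gw p ∧ (gw p:ℝ) ≤ ll p ∧ ll p ≤ gw p + 1 := by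
  have hU : 0 ≤ U1 u := by unfold U1; positivity
  have a1 : E (U1 u) < p := Nat.lt_of_floor_lt h1
  have a2 : (p:ℝ) ≤ E u := (Nat.cast_le.2 h2).trans (Nat.floor_le (E_pos u).le)
  have a0 := E_gt hU
  have b1 : U1 u ≤ ll p := by
    rw [← loglogE (U1 u)]; exact Real.log_le_log (by simp only [E, Real.log_exp]; positivity) (Real.log_le_log (E_pos _) a1.le)
  have b2 : ll p ≤ u := by
    rw [← loglogE u]; exact Real.log_le_log (Real.log_pos (by linarith)) (Real.log_le_log (by linarith) a2)
  have h0 : 0 ≤ log (log p) := hU.trans b1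
  have b3 := Nat.floor_le h0
  have b4 := Nat.lt_floor_add_one (log (log p))
  refine ⟨b1, b2, ?_, ?_, b3, b4.le⟩
  · have : (2:ℝ) < p := by linarith
    exact_mod_cast this.le
  · have : U1 u < gw p + 1 := lt_of_le_of_lt b1 b4
    linarith
end FordT

namespace FordT
open Real Finset
lemma len_bd {u : ℝ} (hu : 20 ≤ log u) (t : List ℕ) (hg : good (dl u) t) (hp : t.Pairwise (· > ·))
    (h : ∀ p ∈ t, n1 u < p ∧ p ≤ ⌊E u⌋₊) : (t.length:ℝ) ≤ 12 * log u + 2 := by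
  have hU : 1 ≤ U1 u := by unfold U1; exact one_le_pow₀ (by linarith)
  have hd : dl u ≤ 1/20 := by unfold dl; gcongr
  match t, hg, hp, h with
  | [], _, _, _ => simp; linarith
  | q :: t, hg, hp, h =>
    have hb := fun p hp => ll_bds (by linarith : 1 ≤ log u) (h p hp).1 (h p hp).2
    have h1 := good_len hd (q::t) hg hp (fun p hp => ⟨(hb p hp).2.2.1, hU.trans (hb p hp).1⟩) q (by simp)
    have h2 := h1.trans (hb q List.mem_cons_self).2.1
    have h3 := Real.log_le_log (by positivity) h2
    rw [Real.log_pow] at h3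
    have h4 : (1/6:ℝ) ≤ log (6/5) := by
      have := Real.one_sub_inv_le_log_of_pos (show (0:ℝ) < 6/5 by norm_num); norm_num at this ⊢; linarith
    set k := ((q::t).length-1)/2 with hk
    have h5 : (q::t).length ≤ 2*k + 2 := by omega
    have h6 : ((q::t).length:ℝ) ≤ 2*k+2 := by exact_mod_cast h5
    have h7 : (k:ℝ)*(1/6) ≤ k*log (6/5) := by gcongr
    linarith
lemma Wr_floor (t : List ℕ) (h : ∀ p ∈ t, ll p ≤ gw p + 1) : Wr ll t ≤ Wr (fun g => (g:ℝ)) (t.map gw) + (t.length:ℝ)^2 := by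
  induction t with
  | nil => simp [Wr]
  | cons q t ih =>
    have ih := ih fun p hp => h p (List.mem_cons_of_mem _ hp)
    have h1 := mul_le_mul_of_nonneg_left (h q List.mem_cons_self) (fordA_nn (show 1 ≤ t.length+1 by omega))
    have h2 := fordA_le_n (show 1 ≤ t.length+1 by omega)
    simp only [List.map_cons, Wr, List.length_map, List.length_cons]
    push_cast at h2 ⊢
    nlinarith only [h1, h2, ih, Nat.cast_nonneg (α := ℝ) t.length]
def Pn (u : ℝ) (p : ℕ) : Prop := p.Prime ∧ n1 u < p ∧ p ≤ ⌊E u⌋₊ ∧ Nrm (et u) p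
def Bad (u : ℝ) (q : ℕ) (t : List ℕ) : Prop :=
  (q::t).Pairwise (· > ·) ∧ (∀ p ∈ q::t, Pn u p) ∧ good (dl u) t ∧ (1+dl u) * ll q < Wf ll 1 t
lemma expo_c {C ℓ G n c llq W Wg : ℝ} (hC : 1 ≤ C) (hℓ : 1600*C ≤ ℓ) (hU : ℓ^12 - 1 ≤ G) (hn0 : 0 ≤ n) (hn : n ≤ 13*ℓ) (hc0 : 0 ≤ c)
    (hc : c ≤ ℓ+1) (hG : G ≤ llq) (hbad : (1+1/ℓ)*llq < W) (hW : W ≤ Wg + n^2) :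
    G - Wg + C*(n+1)^2*(c+2*(1/ℓ^4)*G+1) ≤ -(40*ℓ^2) - 2 := by
  have hℓ1 : 1600 ≤ ℓ := by linarith
  have hp : 1 ≤ ℓ^12 := one_le_pow₀ (by linarith)
  have hG0 : 0 ≤ G := by linarith
  have hm2 : (n+1)^2 ≤ 196*ℓ^2 := by
    calc (n+1)^2 ≤ (14*ℓ)^2 := by gcongr; linarith
      _ = _ := by ring
  have hlm : n^2 ≤ (n+1)^2 := by gcongr; linarith
  have f1 : G/ℓ ≤ (1/ℓ) * llq := by rw [div_eq_mul_one_div, mul_comm]; gcongr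
  have f2 : C * (n+1)^2 * (c + 2*(1/ℓ^4)*G + 1) ≤ C*(196*ℓ^2) * (ℓ+1 + 2*(1/ℓ^4)*G+1) := by gcongr
  have f3 : C*(196*ℓ^2) * (ℓ+1 + 2*(1/ℓ^4)*G+1) = 196*C*ℓ^2*(ℓ+2) + 392*C*(G/ℓ^2) := by field_simp; ring
  have f4 : 392*C*(G/ℓ^2) ≤ (G/ℓ)/4 := by
    have h1 : G/ℓ^2 = (G/ℓ)/ℓ := by field_simp
    have h2 : 0 ≤ G/ℓ := by positivity
    rw [h1]
    generalize G/ℓ = y at h2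
    have h3 : y/ℓ*ℓ = y := div_mul_cancel₀ _ (by linarith)
    have h4 : 0 ≤ y/ℓ := by positivity
    nlinarith only [mul_le_mul_of_nonneg_left hℓ h4, h3, h4, hC]
  have f5 : 196*C*ℓ^2*(ℓ+2) ≤ ℓ^4 := by
    have h1 : 196*C*(ℓ+2) ≤ (ℓ/2)*(ℓ+ℓ) := mul_le_mul (by linarith) (by linarith) (by linarith) (by linarith)
    calc 196*C*ℓ^2*(ℓ+2) = ℓ^2*(196*C*(ℓ+2)) := by ring
      _ ≤ ℓ^2*((ℓ/2)*(ℓ+ℓ)) := by gcongr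
      _ = _ := by ring
  have f6 : ℓ^10 ≤ G/ℓ := by
    rw [le_div_iff₀ (by linarith)]
    have : ℓ^12 = ℓ^10*ℓ*ℓ := by ring
    have h1 : 1 ≤ ℓ^10 * ℓ := one_le_mul_of_one_le_of_one_le (one_le_pow₀ (by linarith)) (by linarith)
    linarith [mul_le_mul_of_nonneg_left hℓ1 (zero_le_one.trans h1)]
  have f7 : ℓ^4*16 ≤ ℓ^10 := by
    have : ℓ^10 = ℓ^4*ℓ^6 := by ring
    have h16 : (16:ℝ) ≤ ℓ^6 := le_trans (by linarith) (le_self_pow₀ (by linarith) (by norm_num))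
    rw [this]; gcongr
  have f8 : ℓ^2*1600 ≤ ℓ^4 := by
    have : ℓ^4 = ℓ^2*ℓ^2 := by ring
    rw [this]; gcongr; nlinarith only [hℓ1]
  have f9 : (1600:ℝ) ≤ ℓ^2 := by nlinarith only [hℓ1]
  linarith
lemma Bad_len {u : ℝ} (hu : 20 ≤ log u) {q : ℕ} {t : List ℕ} (hb : Bad u q t) : (t.length:ℝ) ≤ 12 * log u + 2 :=
  len_bd hu t hb.2.2.1 (List.pairwise_cons.1 hb.1).2 fun p hp =>
    ⟨(hb.2.1 p (List.mem_cons_of_mem _ hp)).2.1, (hb.2.1 p (List.mem_cons_of_mem _ hp)).2.2.1⟩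
lemma shape_c : ∃ C : ℝ, 1 ≤ C ∧ ∀ u, 1600*C ≤ log u → ∀ (G : ℕ) (r : List ℕ) (V : Finset ℕ),
    (∀ v ∈ V, ∃ q t, Bad u q t ∧ gw q = G ∧ t.reverse.map gw = r ∧ v = ((q::t).map (· - 1)).prod) →
    ∑ v ∈ V, (1/(v:ℝ)) ≤ exp (-(40*(log u)^2) - 2) := by
  obtain ⟨C, hC, hbs⟩ := block_shape
  refine ⟨C, hC, fun u hu G r V hV => ?_⟩
  rcases V.eq_empty_or_nonempty with rfl | ⟨v0, hv0⟩
  · simp; positivity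
  obtain ⟨q, t, hb, rfl, rfl, -⟩ := hV v0 hv0
  have hℓ1 : 1600 ≤ log u := by linarith
  have hbd := fun p hp => ll_bds (by linarith : 1 ≤ log u) (hb.2.1 p hp).2.1 (hb.2.1 p hp).2.2.1
  have hpw := List.pairwise_cons.1 hb.1
  have hgm : ∀ p ∈ q::t, ∀ p' ∈ q::t, p ≤ p' → gw p ≤ gw p' := by
    intro p hp p' _ hle
    exact Nat.floor_mono (ll_mono (hbd p hp).2.2.1 hle)
  have hU : (log u)^12 - 1 ≤ gw q := (hbd q List.mem_cons_self).2.2.2.1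
  have hlen : ((t.reverse.map gw).length:ℝ) = t.length := by simp
  have hMl : (t.length:ℝ) ≤ 13*log u := (Bad_len (by linarith) hb).trans (by linarith)
  have ht0 : (⌈log u⌉₊:ℝ) ≤ log u + 1 := (Nat.ceil_lt_add_one (by linarith)).le
  have := hbs (et u) ⌈log u⌉₊ (gw q) (t.reverse.map gw) (by unfold et; positivity) ?_ ?_ ?_ V ?_
  · refine this.trans (Real.exp_le_exp.2 ?_)
    have hW := Wr_floor t.reverse fun p hp => (hbd p (List.mem_cons_of_mem _ (List.mem_reverse.1 hp))).2.2.2.2.2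
    rw [Wr_eq, List.reverse_reverse, List.length_reverse] at hW
    rw [hlen]
    exact expo_c hC hu hU (Nat.cast_nonneg _) hMl (Nat.cast_nonneg _) ht0 (hbd q List.mem_cons_self).2.2.2.2.1 hb.2.2.2 hW
  · rw [List.pairwise_map, List.pairwise_reverse]
    exact hpw.2.imp_of_mem fun {a b} ha hb' hab => hgm b (List.mem_cons_of_mem _ hb') a (List.mem_cons_of_mem _ ha) (le_of_lt hab)
  · intro x hx
    obtain ⟨p, hp, rfl⟩ := List.mem_map.1 hx
    have hp' := List.mem_cons_of_mem q (List.mem_reverse.1 hp)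
    refine ⟨?_, hgm p hp' q List.mem_cons_self (hpw.1 p (List.mem_reverse.1 hp)).le⟩
    have h1 : (log u)^12 - 1 ≤ gw p := (hbd p hp').2.2.2.1
    have h2 : (log u)^2 ≤ (log u)^12 := pow_le_pow_right₀ (by linarith) (by norm_num)
    have : ((⌈log u⌉₊:ℕ):ℝ) ≤ gw p := by nlinarith only [h1, h2, ht0, hℓ1]
    exact_mod_cast this
  · have h1 : (30*log u) ≤ E (⌈log u⌉₊:ℝ) := by
      have a1 := Nat.le_ceil (log u)
      have a2 := Real.quadratic_le_exp_of_nonneg (x := log u) (by linarith)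
      calc 30*log u ≤ exp (log u) := by nlinarith only [a2, hℓ1]
        _ ≤ E (log u) := Real.exp_le_exp.2 (by linarith [Real.add_one_le_exp (log u)])
        _ ≤ _ := E_mono a1
    have h2 := Nat.lt_floor_add_one (E (⌈log u⌉₊:ℝ))
    rw [hlen]; linarith
  · intro v hv
    obtain ⟨q', t', hb', h1, h2, rfl⟩ := hV v hv
    refine ⟨q', t'.reverse, h1, h2, fun p hp => ?_, ?_⟩
    · have hp : p ∈ q' :: t' := by simpa using hp
      exact ⟨(hb'.2.1 p hp).1, (hb'.2.1 p hp).2.2.2⟩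
    · simp [List.prod_reverse]
lemma card_c {u : ℝ} (hu0 : 0 < u) (hu : 1600 ≤ log u) (M : ℕ) (hMb : (M:ℝ) ≤ 13*log u) :
    ((Finset.range (⌊u⌋₊+1) ×ˢ (Finset.range (M+1)).biUnion (LL (Finset.range (⌊u⌋₊+1)))).card : ℝ) ≤ exp (40*(log u)^2) := by
  generalize hg : ⌊u⌋₊ = g
  have hgu : (g:ℝ) ≤ u := hg ▸ Nat.floor_le hu0.le
  have c1 : (Finset.range (g+1) ×ˢ (Finset.range (M+1)).biUnion (LL (Finset.range (g+1)))).card ≤ (g+1)*((M+1)*(g+1)^M) := by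
    rw [Finset.card_product, Finset.card_range]
    apply Nat.mul_le_mul_left
    refine Finset.card_biUnion_le.trans ((Finset.sum_le_card_nsmul _ _ ((g+1)^M) ?_).trans ?_)
    · intro r hr
      rw [card_LL, Finset.card_range]
      exact Nat.pow_le_pow_right (by omega) (Nat.lt_succ_iff.1 (Finset.mem_range.1 hr))
    · rw [Finset.card_range, smul_eq_mul]
  generalize hℓ : log u = ℓ at *
  have huexp : u = exp ℓ := by rw [← hℓ, Real.exp_log hu0]
  have hue : (u:ℝ) + 1 ≤ exp (2*ℓ) := by
    rw [two_mul, Real.exp_add, ← huexp]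
    have := Real.add_one_le_exp ℓ
    nlinarith
  have hMu : (M:ℝ) + 1 ≤ exp (2*ℓ) := by
    have := Real.quadratic_le_exp_of_nonneg (x := 2*ℓ) (by linarith)
    nlinarith
  calc _ ≤ (((g+1)*((M+1)*(g+1)^M) : ℕ):ℝ) := by exact_mod_cast c1
    _ = ((g:ℝ)+1)*(((M:ℝ)+1)*((g:ℝ)+1)^M) := by push_cast; ring
    _ ≤ exp (2*ℓ) * (exp (2*ℓ) * exp (2*ℓ)^M) := by gcongr <;> linarith
    _ = exp (2*ℓ*(M+2)) := by rw [← Real.exp_nat_mul, ← Real.exp_add, ← Real.exp_add]; congr 1; ring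
    _ ≤ _ := Real.exp_le_exp.2 (by nlinarith)
lemma case_c : ∃ L0 : ℝ, 1600 ≤ L0 ∧ ∀ u, 0 < u → L0 ≤ log u → ∀ (X : ℕ) (S : Finset ℕ), S ⊆ SM X ⌊E u⌋₊ →
    (∀ N ∈ S, ∃ (q : ℕ) (t : List ℕ), Bad u q t ∧
      ∃ b, N = (q::t).prod * b ∧ ((q::t).prod).Coprime b) →
    RR S ≤ 1/4 * R X ⌊E u⌋₊ := by
  obtain ⟨C, hC, hbs⟩ := shape_c
  refine ⟨1600*C, by linarith, fun u hu0 hu X S hS h => ?_⟩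
  have hℓ1 : 1600 ≤ log u := by linarith
  obtain ⟨M, hM⟩ : ∃ M, M = ⌊12*log u+2⌋₊ := ⟨_, rfl⟩
  have hMb : (M:ℝ) ≤ 13*log u := hM ▸ (Nat.floor_le (by linarith)).trans (by linarith)
  obtain ⟨B, hB, hBS⟩ : ∃ B : Finset (ℕ × List ℕ), (∀ i ∈ B, Bad u i.1 i.2) ∧ ∀ N ∈ S, ∃ i ∈ B, ∃ b, N = (i.1::i.2).prod * b ∧ ((i.1::i.2).prod).Coprime b := by
    choose! q t h1 b h2 using h
    refine ⟨S.image fun N => (q N, t N), ?_, fun N hN => ⟨_, Finset.mem_image_of_mem _ hN, b N, h2 N hN⟩⟩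
    intro i hi
    obtain ⟨N, hN, rfl⟩ := Finset.mem_image.1 hi
    exact h1 N hN
  refine (RR_dvd S (B.image fun i => (i.1::i.2).prod) hS ?_).trans ?_
  · intro N hN
    obtain ⟨i, hi, b, hb⟩ := hBS N hN
    exact ⟨_, Finset.mem_image_of_mem _ hi, b, hb⟩
  apply mul_le_mul_of_nonneg_right _ (RR_nonneg _)
  have hgw : ∀ p, Pn u p → gw p ∈ Finset.range (⌊u⌋₊+1) := by
    intro p hp
    have := ll_bds (by linarith : 1 ≤ log u) hp.2.1 hp.2.2.1
    exact Finset.mem_range.2 (Nat.lt_succ_of_le (Nat.le_floor (by linarith)))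
  have hcard := card_c hu0 hℓ1 M hMb
  obtain ⟨T, hT⟩ : ∃ T, T = (Finset.range (⌊u⌋₊+1) ×ˢ (Finset.range (M+1)).biUnion (LL (Finset.range (⌊u⌋₊+1)))) := ⟨_, rfl⟩
  rw [← hT] at hcard
  have key := shape_sum B (fun i => ((i.1::i.2).map (· - 1)).prod) (fun i => (gw i.1, (i.2.reverse).map gw))
    T (exp (-(40*(log u)^2) - 2)) ?_ ?_
  · have himg : (B.image fun i => (i.1::i.2).prod).image F = B.image (fun i => ((i.1::i.2).map (· - 1)).prod) := by
      rw [Finset.image_image]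
      exact Finset.image_congr fun i hi => F_prod _ (hB i hi).1 fun p hp => ((hB i hi).2.1 p hp).1
    unfold RR
    rw [himg]
    refine key.trans ?_
    · calc _ ≤ exp (40*(log u)^2) * exp (-(40*(log u)^2) - 2) := by
            apply mul_le_mul_of_nonneg_right hcard (Real.exp_pos _).le
        _ = exp (-2) := by rw [← Real.exp_add]; congr 1; ring
        _ ≤ _ := by
          rw [Real.exp_neg, one_div]
          apply inv_anti₀ (by norm_num)
          have := Real.quadratic_le_exp_of_nonneg (x := 2) (by norm_num); linarith
  · intro i hi
    have hb := hB i hi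
    rw [hT]
    refine Finset.mem_product.2 ⟨hgw _ (hb.2.1 _ List.mem_cons_self), Finset.mem_biUnion.2 ⟨i.2.length, Finset.mem_range.2 (Nat.lt_succ_of_le ?_), (mem_LL _ _ _).2 ⟨by simp, ?_⟩⟩⟩
    · rw [hM]; exact Nat.le_floor (Bad_len (by linarith) hb)
    · intro x hx
      obtain ⟨p, hp, rfl⟩ := List.mem_map.1 hx
      exact hgw p (hb.2.1 p (List.mem_cons_of_mem _ (List.mem_reverse.1 hp)))
  · rintro ⟨G, r⟩ -
    apply hbs u hu G r
    intro v hv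
    obtain ⟨i, hi, rfl⟩ := Finset.mem_image.1 hv
    obtain ⟨hi, hsh⟩ := Finset.mem_filter.1 hi
    have hs2 := Prod.mk.inj hsh
    exact ⟨_, _, hB i hi, hs2.1, hs2.2, rfl⟩
end FordT

namespace FordT
open Real Finset
lemma abnQ : ∃ L0 : ℝ, 1600 ≤ L0 ∧ ∀ u, 0 < u → L0 ≤ log u → ∀ S : Finset ℕ,
    (∀ q ∈ S, q.Prime ∧ n1 u < q ∧ q ≤ ⌊E u⌋₊ ∧ ¬ Nrm (et u) q) → ∑ q ∈ S, (1/q:ℝ) ≤ 1/16 := by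
  obtain ⟨C, hC, g0, hg0, h⟩ := abn_sum
  refine ⟨1600*C+g0, by have : (1:ℝ) ≤ g0 := by exact_mod_cast hg0
                        linarith, fun u hu0 hu S hS => ?_⟩
  have hg0' : (1:ℝ) ≤ g0 := by exact_mod_cast hg0
  have hu1 : 1600 ≤ log u := by linarith
  have hp4 : (1600:ℝ)*log u ≤ (log u)^4 := by
    calc (1600:ℝ)*log u ≤ (log u)^3 * log u := by gcongr; exact hu1.trans (le_self_pow₀ (by linarith) (by norm_num))
      _ = _ := by ring
  have hp8 : (1:ℝ) ≤ (log u)^8 := one_le_pow₀ (by linarith)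
  have hp12 : (log u)^12 = (log u)^8 * (log u)^4 := by ring
  have hp12' : 2*log u ≤ (log u)^12 := by rw [hp12]; nlinarith
  have hbd := fun q hq => ll_bds (by linarith : 1 ≤ log u) (hS q hq).2.1 (hS q hq).2.2.1
  have hη : et u ≤ 1/2 := by
    unfold et; rw [div_le_div_iff₀ (by positivity) (by norm_num)]; linarith
  have hη0 : 0 < et u := by unfold et; have : 0 < log u := by linarith
                            positivity
  have hwin : ∀ g ∈ Finset.range (⌊u⌋₊+1), ∑ q ∈ S.filter (fun q => gw q = g), (1/q:ℝ) ≤ C * u^7 * exp (-((log u)^4/5)) := by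
    intro g hg
    have hgu : (g:ℝ) ≤ u := (Nat.cast_le.2 (Nat.lt_succ_iff.1 (Finset.mem_range.1 hg))).trans (Nat.floor_le hu0.le)
    rcases (S.filter (fun q => gw q = g)).eq_empty_or_nonempty with h0 | ⟨q, hq⟩
    · rw [h0]; simp; positivity
    obtain ⟨hqS, rfl⟩ := Finset.mem_filter.1 hq
    have h1 : (log u)^12 - 1 ≤ gw q := (hbd q hqS).2.2.2.1
    have h2 : g0 ≤ gw q := by
      have : (g0:ℝ) ≤ gw q := by linarith
      exact_mod_cast this
    refine (h (gw q) h2 (et u) hη0 hη _ ?_).trans ?_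
    · intro q' hq'
      obtain ⟨a, b⟩ := Finset.mem_filter.1 hq'
      exact ⟨(hS q' a).1, b, (hS q' a).2.2.2⟩
    · gcongr
      rw [et, div_pow, one_pow, ← pow_mul, div_div, one_div, inv_mul_eq_div, le_div_iff₀ (by positivity)]
      norm_num only
      nlinarith only [h1, hp12, hp8, hp4, hu1, mul_le_mul_of_nonneg_left hp4 (zero_le_one.trans hp8)]
  have hmap : ∀ q ∈ S, gw q ∈ Finset.range (⌊u⌋₊+1) := fun q hq =>
    Finset.mem_range.2 (Nat.lt_succ_of_le (Nat.le_floor ((hbd q hq).2.2.2.2.1.trans (hbd q hq).2.1)))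
  rw [← Finset.sum_fiberwise_of_maps_to hmap]
  refine (Finset.sum_le_sum hwin).trans ?_
  rw [Finset.sum_const, Finset.card_range, nsmul_eq_mul]
  have hue : u = exp (log u) := (Real.exp_log hu0).symm
  have hf : ((⌊u⌋₊+1:ℕ):ℝ) ≤ u * 2 := by
    have := Nat.floor_le hu0.le
    have := Real.add_one_le_exp (log u)
    push_cast; linarith
  have hC2 : 32*C ≤ exp (log u) := by linarith [Real.add_one_le_exp (log u)]
  calc ((⌊u⌋₊+1:ℕ):ℝ) * (C * u^7 * exp (-((log u)^4/5))) ≤ (u*2) * (C * u^7 * exp (-((log u)^4/5))) := by gcongr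
    _ = (32*C) * u^8 * exp (-((log u)^4/5)) / 16 := by ring
    _ ≤ exp (log u) * u^8 * exp (-((log u)^4/5)) / 16 := by gcongr
    _ = exp (9*log u - (log u)^4/5) / 16 := by
      have : u^8 = exp (8*log u) := by
        conv_lhs => rw [hue]
        rw [← Real.exp_nat_mul]; norm_num
      rw [this, ← Real.exp_add, ← Real.exp_add]; congr 2; ring
    _ ≤ 1/16 := by
      gcongr
      rw [Real.exp_le_one_iff]; linarith
def GoodL (u : ℝ) (t : List ℕ) : Prop := t.Pairwise (· > ·) ∧ (∀ p ∈ t, Pn u p) ∧ good (dl u) t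
lemma not_good {δ : ℝ} : ∀ l : List ℕ, ¬ good δ l → ∃ pre q t, l = pre ++ q::t ∧ good δ t ∧ (1+δ) * ll q < Wf ll 1 t
  | [], h => absurd trivial h
  | q :: t, h => by
    by_cases ht : good δ t
    · exact ⟨[], q, t, rfl, ht, by by_contra h0; exact h ⟨not_lt.1 h0, ht⟩⟩
    · obtain ⟨pre, q', t', rfl, h2⟩ := not_good t ht
      exact ⟨q::pre, q', t', rfl, h2⟩
lemma list_decomp (N m : ℕ) (hN : N ≠ 0) (h : ∀ p, p.Prime → m < p → ¬ p^2 ∣ N) :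
    ∃ (l : List ℕ) (b : ℕ), N = l.prod * b ∧ l.Pairwise (· > ·) ∧ (∀ p ∈ l, p.Prime ∧ m < p ∧ p ∣ N) ∧
      (∀ p, p.Prime → p ∣ b → p ≤ m) ∧ l.prod.Coprime b := by
  have hmem : ∀ p, p ∈ N.primeFactors.filter (m < ·) ↔ p.Prime ∧ m < p ∧ p ∣ N := by
    intro p; rw [Finset.mem_filter, Nat.mem_primeFactors]; tauto
  obtain ⟨P, hP⟩ : ∃ P, P = N.primeFactors.filter (m < ·) := ⟨_, rfl⟩
  rw [← hP] at hmem
  have hmem' : ∀ p, p ∈ P.sort (· ≥ ·) ↔ p.Prime ∧ m < p ∧ p ∣ N := fun p => by rw [Finset.mem_sort, hmem]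
  have hprod : (P.sort (· ≥ ·)).prod = ∏ p ∈ P, p := by
    have := List.prod_toFinset (fun p : ℕ => p) (Finset.sort_nodup P (· ≥ ·))
    rw [Finset.sort_toFinset] at this
    rw [this]; simp
  have hdv : ∏ p ∈ P, p ∣ N := Finset.prod_primes_dvd N (fun p hp => ((hmem p).1 hp).1.prime) fun p hp => ((hmem p).1 hp).2.2
  obtain ⟨b, hb⟩ := hdv
  have hbp : ∀ p, p.Prime → p ∣ b → p ≤ m := by
    intro p hp hpb
    by_contra hm
    push Not at hm
    have h1 : p ∈ P := (hmem p).2 ⟨hp, hm, hb ▸ hpb.mul_left _⟩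
    exact h p hp hm (by rw [hb, sq]; exact mul_dvd_mul (Finset.dvd_prod_of_mem _ h1) hpb)
  refine ⟨P.sort (· ≥ ·), b, by rw [hprod]; exact hb, ?_, fun p hp => (hmem' p).1 hp, hbp, ?_⟩
  · exact (Finset.sortedGT_sort P).pairwise
  · rw [hprod]
    apply Nat.Coprime.prod_left
    intro p hp
    have := (hmem p).1 hp
    rw [Nat.Prime.coprime_iff_not_dvd this.1]
    exact fun hd => absurd (hbp p this.1 hd) (by omega)
lemma upper_rec : ∃ L0 : ℝ, 1600 ≤ L0 ∧ ∀ u, 0 < u → L0 ≤ log u → ∀ (X : ℕ) (Gd : ℝ),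
    (∀ T : Finset (List ℕ), (∀ t ∈ T, GoodL u t) → ∑ t ∈ T, (1/((t.map (· - 1)).prod:ℕ):ℝ) ≤ Gd) →
    R X ⌊E u⌋₊ ≤ 2 * Gd * R X (n1 u) := by
  classical
  obtain ⟨L1, hL1, hb⟩ := abnQ
  obtain ⟨L2, hL2, hc⟩ := case_c
  refine ⟨max L1 L2, hL1.trans (le_max_left _ _), fun u hu0 hu X Gd hG => ?_⟩
  have hℓ : 1600 ≤ log u := hL1.trans ((le_max_left _ _).trans hu)
  have hN := fun N (hN : N ∈ SM X ⌊E u⌋₊) => mem_SM.1 hN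
  obtain ⟨Q, hQ⟩ : ∃ Q : Finset ℕ, ∀ q, q ∈ Q ↔ q.Prime ∧ n1 u < q ∧ q ≤ ⌊E u⌋₊ ∧ ¬ Nrm (et u) q :=
    ⟨(PL ⌊E u⌋₊).filter fun q => n1 u < q ∧ ¬ Nrm (et u) q, fun q => by rw [Finset.mem_filter, mem_PL]; tauto⟩
  have ha' := case_a (n1 u) ((SM X ⌊E u⌋₊).filter fun N => ∃ p, p.Prime ∧ n1 u < p ∧ p^2 ∣ N) (Finset.filter_subset _ _)
    fun N h => (Finset.mem_filter.1 h).2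
  have hb' := case_b Q ((SM X ⌊E u⌋₊).filter fun N => ∃ q ∈ Q, q ∣ N ∧ ¬ q^2 ∣ N) (Finset.filter_subset _ _) (fun q hq => ((hQ q).1 hq).1)
    fun N h => (Finset.mem_filter.1 h).2
  have hc' := hc u hu0 ((le_max_right _ _).trans hu) X ((SM X ⌊E u⌋₊).filter fun N => ∃ (q : ℕ) (t : List ℕ), Bad u q t ∧
      ∃ b, N = (q::t).prod * b ∧ ((q::t).prod).Coprime b) (Finset.filter_subset _ _)
    fun N h => (Finset.mem_filter.1 h).2
  have hbQ := hb u hu0 ((le_max_left _ _).trans hu) Q fun q hq => (hQ q).1 hq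
  have hn1 : (16:ℝ)/(n1 u+1) ≤ 1/16 := by
    rw [div_le_div_iff₀ (by positivity) (by norm_num)]
    have h1 : E (U1 u) < n1 u + 1 := Nat.lt_floor_add_one _
    have h2 : 1600 ≤ U1 u := hℓ.trans (le_self_pow₀ (by linarith) (by norm_num))
    have h3 : U1 u ≤ E (U1 u) := by
      unfold E; linarith [Real.add_one_le_exp (U1 u), Real.add_one_le_exp (exp (U1 u))]
    linarith
  have hR0 : 0 ≤ R X ⌊E u⌋₊ := RR_nonneg _
  have hd : RR ((SM X ⌊E u⌋₊).filter fun N => ∃ l b, GoodL u l ∧ N = l.prod * b ∧ l.prod.Coprime b ∧ ∀ p, p.Prime → p ∣ b → p ≤ n1 u) ≤ Gd * R X (n1 u) := by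
    obtain ⟨T, hT⟩ : ∃ T, T = (SM X ⌊E u⌋₊).filter fun N => ∃ l b, GoodL u l ∧ N = l.prod * b ∧ l.prod.Coprime b ∧ ∀ p, p.Prime → p ∣ b → p ≤ n1 u := ⟨_, rfl⟩
    have hT2 : ∀ N ∈ T, ∃ l b, GoodL u l ∧ N = l.prod * b ∧ l.prod.Coprime b ∧ ∀ p, p.Prime → p ∣ b → p ≤ n1 u := fun N hN => by
      rw [hT] at hN; exact (Finset.mem_filter.1 hN).2
    have hT1 : ∀ N ∈ T, 1 ≤ N ∧ N ≤ X := fun N hN' => by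
      rw [hT] at hN'; exact (hN N (Finset.mem_filter.1 hN').1).1
    rw [← hT]
    choose! l b h1 h2 h3 h4 using hT2
    refine (RR_prod T ((T.image l).image List.prod) (SM X (n1 u)) ?_).trans ?_
    · intro N hN'
      have e := hT1 N hN'
      have e2 := h2 N hN'
      refine ⟨_, Finset.mem_image_of_mem _ (Finset.mem_image_of_mem _ hN'), b N, mem_SM.2 ⟨⟨?_, ?_⟩, h4 N hN'⟩, e2, h3 N hN'⟩
      · rcases Nat.eq_zero_or_pos (b N) with h0 | h0
        · rw [h0] at e2; omega
        · exact h0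
      · exact (Nat.le_of_dvd (by omega) ⟨_, e2.trans (mul_comm _ _)⟩).trans e.2
    · refine mul_le_mul_of_nonneg_right ?_ (RR_nonneg _)
      have hgl : ∀ t ∈ T.image l, GoodL u t := by
        intro t ht
        obtain ⟨N, hN', rfl⟩ := Finset.mem_image.1 ht
        exact h1 N hN'
      refine (RR_le _ (T.image l) (fun t => (t.map (· - 1)).prod) ?_).trans (hG _ hgl)
      intro N hN'
      obtain ⟨t, ht, rfl⟩ := Finset.mem_image.1 hN'
      exact ⟨t, ht, F_prod t (hgl t ht).1 fun p hp => ((hgl t ht).2.1 p hp).1⟩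
  have hcov : R X ⌊E u⌋₊ ≤ _ := (RR_mono (S := SM X ⌊E u⌋₊) ?_).trans
    ((RR_union _ _).trans (add_le_add ((RR_union _ _).trans (add_le_add ((RR_union _ _).trans (add_le_add ha' hb')) hc')) hd))
  · have h1 : 16/((n1 u:ℝ)+1) * R X ⌊E u⌋₊ ≤ 1/16 * R X ⌊E u⌋₊ := by gcongr
    have h2 : 2*(∑ q ∈ Q, (1/q:ℝ)) * R X ⌊E u⌋₊ ≤ 1/8 * R X ⌊E u⌋₊ := by gcongr; linarith
    linarith
  · intro N hNN
    have h0 := hN N hNN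
    by_cases ca : ∃ p, p.Prime ∧ n1 u < p ∧ p^2 ∣ N
    · simp only [Finset.mem_union, Finset.mem_filter]; exact Or.inl (Or.inl (Or.inl ⟨hNN, ca⟩))
    by_cases cb : ∃ q ∈ Q, q ∣ N ∧ ¬ q^2 ∣ N
    · simp only [Finset.mem_union, Finset.mem_filter]; exact Or.inl (Or.inl (Or.inr ⟨hNN, cb⟩))
    have ca' : ∀ p, p.Prime → n1 u < p → ¬ p^2 ∣ N := fun p h1 h2 h3 => ca ⟨p, h1, h2, h3⟩
    obtain ⟨l, b, e1, e2, e3, e4, e5⟩ := list_decomp N (n1 u) (by omega) ca'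
    have hPn : ∀ p ∈ l, Pn u p := by
      intro p hp
      have := e3 p hp
      refine ⟨this.1, this.2.1, h0.2 p this.1 this.2.2, ?_⟩
      by_contra hn
      exact cb ⟨p, (hQ p).2 ⟨this.1, this.2.1, h0.2 p this.1 this.2.2, hn⟩, this.2.2, ca' p this.1 this.2.1⟩
    by_cases cg : good (dl u) l
    · simp only [Finset.mem_union, Finset.mem_filter]; exact Or.inr ⟨hNN, l, b, ⟨e2, hPn, cg⟩, e1, e5, e4⟩
    · obtain ⟨pre, q, t, rfl, hg, hw⟩ := not_good l cg
      simp only [Finset.mem_union, Finset.mem_filter]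
      refine Or.inl (Or.inr ⟨hNN, q, t, ⟨(List.pairwise_append.1 e2).2.1, fun p hp => hPn p (List.mem_append_right _ hp), hg, hw⟩, pre.prod * b, ?_, ?_⟩)
      · rw [e1, List.prod_append]; ring
      · rw [List.prod_append] at e5
        refine Nat.Coprime.mul_right ?_ (Nat.Coprime.coprime_mul_left e5)
        refine Nat.coprime_list_prod_left_iff.2 fun p hp => Nat.coprime_list_prod_right_iff.2 fun p' hp' => ?_
        have h6 := (List.pairwise_append.1 e2).2.2 p' hp' p hp
        exact (Nat.coprime_primes (hPn p (List.mem_append_right _ hp)).1 (hPn p' (List.mem_append_left _ hp')).1).2 (by omega)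
end FordT

namespace FordT
open Real Finset
structure HR (ϱ : ℝ) : Prop where
  h0 : 0 < ϱ
  h1 : ϱ < 1
  hs : ∑' n : ℕ, fordA (n+1) * ϱ^(n+1) = 1
lemma HR.summ {ϱ : ℝ} (h : HR ϱ) : Summable fun n : ℕ => ((n:ℝ)+1) * ϱ^(n+1) := by
  have h1 := summable_pow_mul_geometric_of_norm_lt_one 1 (r := ϱ) (by rw [Real.norm_eq_abs, abs_of_pos h.h0]; exact h.h1)
  have h2 := (summable_nat_add_iff 1).2 h1
  refine h2.congr fun n => ?_
  push_cast; ring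
lemma HR.summA {ϱ : ℝ} (h : HR ϱ) : Summable fun n : ℕ => fordA (n+1) * ϱ^(n+1) := by
  have := h.h0
  refine Summable.of_nonneg_of_le (fun n => mul_nonneg (fordA_nn (by omega)) (by positivity)) (fun n => ?_) h.summ
  have := fordA_le_n (show 1 ≤ n+1 by omega)
  push_cast at this
  gcongr
lemma fordA_ratio (k l : ℕ) : fordA (k+1+(l+1)) ≤ 6*((l:ℝ)+1)*fordA (k+1) := by
  have hk : log ((k:ℝ)+2)/2 ≤ fordA (k+1) := by
    rcases Nat.eq_zero_or_pos k with rfl | hk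
    · rw [fordA_one]; norm_num
      have := Real.log_two_gt_d9; linarith
    · have h1 := fordA_ge (show 1 ≤ k+1 by omega)
      have hk' : (1:ℝ) ≤ k := by exact_mod_cast hk
      have : log ((k:ℝ)+2) ≤ log (((k:ℝ)+1)^2) := Real.log_le_log (by positivity) (by nlinarith)
      rw [Real.log_pow] at this
      push_cast at h1 this; linarith
  have h1 := fordA_le (show 1 ≤ k+1+(l+1) by omega)
  have h2 : log (((k+1+(l+1):ℕ):ℝ)+1) ≤ log (((k:ℝ)+2)*((l:ℝ)+2)) := by
    apply Real.log_le_log (by positivity)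
    push_cast
    have : (0:ℝ) ≤ k*l := by positivity
    have : (0:ℝ) ≤ k := by positivity
    have : (0:ℝ) ≤ l := by positivity
    nlinarith
  rw [Real.log_mul (by positivity) (by positivity)] at h2
  have h3 : log ((l:ℝ)+2) ≤ l + 1 := by have := Real.log_le_sub_one_of_pos (show (0:ℝ) < l+2 by positivity); linarith
  have h4 : (1:ℝ)/2 ≤ log ((k:ℝ)+2) := by
    have := Real.log_le_log (by norm_num) (show (2:ℝ) ≤ k+2 by linarith [Nat.cast_nonneg (α := ℝ) k])
    have := Real.log_two_gt_d9; linarith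
  have hl : (0:ℝ) ≤ l := by positivity
  have h5 : ((l:ℝ)+1)*(log ((k:ℝ)+2)/2) ≤ (l+1)*fordA (k+1) := by gcongr
  nlinarith
noncomputable def dd (ϱ : ℝ) : ℕ → ℝ
  | 0 => 1
  | k+1 => dd ϱ k / ϱ - fordA (k+1)
lemma dd_le {ϱ : ℝ} (h : HR ϱ) : ∃ B : ℝ, 1 ≤ B ∧ ∀ k, dd ϱ (k+1) ≤ B * fordA (k+1) := by
  have hr := h.h0
  have hcl : ∀ k, dd ϱ k = (1 - ∑ j ∈ Finset.range k, fordA (j+1) * ϱ^(j+1)) / ϱ^k := by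
    intro k
    induction k with
    | zero => simp [dd]
    | succ k ih => rw [dd, ih, Finset.sum_range_succ]; field_simp; ring
  refine ⟨6 * (∑' n : ℕ, ((n:ℝ)+1) * ϱ^(n+1)) + 1, ?_, fun k => ?_⟩
  · have : 0 ≤ ∑' n : ℕ, ((n:ℝ)+1) * ϱ^(n+1) := tsum_nonneg fun n => by positivity
    linarith
  have h1 := h.summA.sum_add_tsum_nat_add (k+1)
  rw [h.hs] at h1
  have h2 : dd ϱ (k+1) = ∑' l : ℕ, fordA (l+(k+1)+1) * ϱ^(l+1) := by
    rw [hcl, ← h1, add_sub_cancel_left, div_eq_iff (by positivity), ← tsum_mul_right]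
    congr 1; ext l; ring
  have hnn := fordA_nn (show 1 ≤ k+1 by omega)
  calc dd ϱ (k+1) = ∑' l : ℕ, fordA (l+(k+1)+1) * ϱ^(l+1) := h2
    _ ≤ ∑' l : ℕ, (6*fordA (k+1)) * (((l:ℝ)+1)*ϱ^(l+1)) := by
      have hle : ∀ l : ℕ, fordA (l+(k+1)+1) * ϱ^(l+1) ≤ (6*fordA (k+1)) * (((l:ℝ)+1)*ϱ^(l+1)) := fun l => by
        have := fordA_ratio k l
        rw [show l+(k+1)+1 = k+1+(l+1) by ring]
        calc _ ≤ (6*((l:ℝ)+1)*fordA (k+1)) * ϱ^(l+1) := by gcongr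
          _ = _ := by ring
      refine Summable.tsum_le_tsum hle ?_ (h.summ.mul_left _)
      exact Summable.of_nonneg_of_le (fun l => mul_nonneg (fordA_nn (by omega)) (by positivity)) hle (h.summ.mul_left _)
    _ = (6*fordA (k+1)) * ∑' l : ℕ, (((l:ℝ)+1)*ϱ^(l+1)) := tsum_mul_left
    _ ≤ _ := by linarith
noncomputable def Sf (c : ℕ → ℝ) : ℕ → List ℕ → ℝ
  | _, [] => 0
  | k, q :: t => c k * ll q + Sf c (k+1) t
noncomputable def bc (δ : ℝ) (j : ℕ) : ℝ := fordA j / (1+δ)^j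
noncomputable def yy (δ : ℝ) (q : ℕ) (t : List ℕ) : ℝ := ll q - Sf (bc δ) 1 t
noncomputable def YY (δ ϱ' : ℝ) : ℝ → List ℕ → ℝ
  | _, [] => 0
  | lam, q :: t => lam * yy δ q t + YY δ ϱ' (lam/ϱ') t
lemma Sf_le (c d : ℕ → ℝ) (t : List ℕ) (k : ℕ) (h : ∀ j, k ≤ j → c j ≤ d j) (ht : ∀ q ∈ t, 0 ≤ ll q) : Sf c k t ≤ Sf d k t := by
  induction t generalizing k with
  | nil => simp [Sf]
  | cons q t ih =>
    have h1 := ih (k+1) (fun j hj => h j (by omega)) fun q hq => ht q (List.mem_cons_of_mem _ hq)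
    have h2 := mul_le_mul_of_nonneg_right (h k le_rfl) (ht q List.mem_cons_self)
    rw [Sf, Sf]; linarith
lemma Sf_smul (c : ℕ → ℝ) (a : ℝ) (t : List ℕ) (k : ℕ) : Sf (fun j => a * c j) k t = a * Sf c k t := by
  induction t generalizing k with
  | nil => simp [Sf]
  | cons q t ih => rw [Sf, Sf, ih]; ring
lemma Sf_Wf (t : List ℕ) (k : ℕ) : Sf fordA k t = Wf ll k t := by
  induction t generalizing k with
  | nil => simp [Sf, Wf]
  | cons q t ih => rw [Sf, Wf, ih]
lemma Sf_rec (c d : ℕ → ℝ) (a : ℝ) (t : List ℕ) (k : ℕ) : Sf (fun j => c j * a - d (j+1)) k t = a * Sf c k t - Sf d (k+1) t := by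
  induction t generalizing k with
  | nil => simp [Sf]
  | cons q t ih => rw [Sf, Sf, Sf, ih]; ring
lemma Sf_shift (c : ℕ → ℝ) (t : List ℕ) (k : ℕ) : Sf (fun j => c (j+1)) k t = Sf c (k+1) t := by
  induction t generalizing k with
  | nil => simp [Sf]
  | cons q t ih => rw [Sf, Sf, ih]
lemma YY_mul (δ ϱ' lam : ℝ) (t : List ℕ) : YY δ ϱ' lam t = lam * YY δ ϱ' 1 t := by
  induction t generalizing lam with
  | nil => simp [YY]
  | cons q t ih => rw [YY, YY, ih, ih (1/ϱ')]; ring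
lemma YY_eq {ϱ δ : ℝ} (hδ : 0 ≤ δ) (t : List ℕ) :
    YY δ (ϱ*(1+δ)) 1 t = Sf (fun k => dd ϱ k / (1+δ)^k) 0 t := by
  induction t with
  | nil => simp [YY, Sf]
  | cons q t ih =>
    have h1 := Sf_rec (fun k => dd ϱ k / (1+δ)^k) (bc δ) (1/(ϱ*(1+δ))) t 0
    rw [YY, YY_mul, ih, Sf, ← Sf_shift]
    have : (fun j => dd ϱ (j+1) / (1+δ)^(j+1)) = fun j => (dd ϱ j / (1+δ)^j) * (1/(ϱ*(1+δ))) - bc δ (j+1) := by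
      ext j; rw [dd, bc]
      rcases eq_or_ne ϱ 0 with rfl | h0
      · simp; ring
      · field_simp; ring
    rw [this, h1, yy]
    simp [dd]; ring
lemma Sf_bc {δ : ℝ} (hδ : 0 ≤ δ) (t : List ℕ) (ht : ∀ q ∈ t, 0 ≤ ll q) : Sf (bc δ) 1 t ≤ Wf ll 1 t / (1+δ) := by
  rw [← Sf_Wf, div_eq_inv_mul, ← Sf_smul]
  refine Sf_le _ _ _ _ (fun j hj => ?_) ht
  rw [bc, div_eq_inv_mul]
  have := fordA_nn hj
  gcongr
  exact le_self_pow₀ (by linarith) (by omega)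
lemma Sf_bc_nn {δ : ℝ} (hδ : 0 ≤ δ) (t : List ℕ) (ht : ∀ q ∈ t, 0 ≤ ll q) : 0 ≤ Sf (bc δ) 1 t := by
  have h := Sf_le (fun j => 0 * bc δ j) (bc δ) t 1 (fun j hj => ?_) ht
  · rw [Sf_smul] at h; linarith
  · have := fordA_nn hj
    rw [zero_mul, bc]; positivity
lemma yy_nn {δ : ℝ} (hδ : 0 ≤ δ) (q : ℕ) (t : List ℕ) (ht : ∀ q ∈ t, 0 ≤ ll q) (hg : good δ (q::t)) : 0 ≤ yy δ q t := by
  have h1 := Sf_bc hδ t ht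
  have h2 : Wf ll 1 t / (1+δ) ≤ ll q := by rw [div_le_iff₀ (by linarith), mul_comm]; exact hg.1
  rw [yy]; linarith
lemma YY_le {ϱ : ℝ} (h : HR ϱ) : ∃ B : ℝ, 1 ≤ B ∧ ∀ δ : ℝ, 0 ≤ δ → ∀ (u : ℝ) (t : List ℕ), 0 ≤ u → (∀ q ∈ t, 0 ≤ ll q ∧ ll q ≤ u) → good δ t →
    YY δ (ϱ*(1+δ)) 1 t ≤ B * u := by
  obtain ⟨B, hB, hd⟩ := dd_le h
  refine ⟨B+1, by linarith, fun δ hδ u t hu ht hg => ?_⟩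
  rw [YY_eq hδ]
  match t, ht, hg with
  | [], _, _ => simp [Sf]; positivity
  | q :: t, ht, hg =>
    have ht' : ∀ q ∈ t, 0 ≤ ll q := fun q hq => (ht q (List.mem_cons_of_mem _ hq)).1
    have h1 := yy_nn hδ q t ht' hg
    have h2 := (ht q List.mem_cons_self).2
    have h3 : Sf (fun k => dd ϱ k / (1+δ)^k) 1 t ≤ B * Sf (bc δ) 1 t := by
      rw [← Sf_smul]
      refine Sf_le _ _ _ _ (fun j hj => ?_) ht'
      obtain ⟨i, rfl⟩ : ∃ i, j = i+1 := ⟨j-1, by omega⟩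
      rw [bc, ← mul_div_assoc]
      have := hd i
      gcongr
    rw [yy] at h1
    rw [Sf, Nat.zero_add]
    simp only [dd, pow_zero, div_one, one_mul]
    nlinarith
end FordT

namespace FordT
open Real Finset
lemma exp_geom {lam : ℝ} (h : 0 < lam) (K : ℕ) : ∑ n ∈ Finset.range K, exp (-(lam*n)) ≤ 1 + 1/lam := by
  have h1 : ∀ n : ℕ, exp (-(lam*n)) = (exp (-lam))^n := fun n => by rw [← Real.exp_nat_mul]; congr 1; ring
  simp_rw [h1]
  have h2 : exp (-lam) < 1 := by rw [Real.exp_lt_one_iff]; linarith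
  have h3 : exp (-lam) ≤ 1/(1+lam) := by
    rw [Real.exp_neg, one_div]; exact inv_anti₀ (by linarith) (by linarith [Real.add_one_le_exp lam])
  refine (Summable.sum_le_tsum _ (fun n _ => by positivity) (summable_geometric_of_lt_one (Real.exp_pos _).le h2)).trans ?_
  rw [tsum_geometric_of_lt_one (Real.exp_pos _).le h2]
  have h4 : lam/(1+lam) ≤ 1 - exp (-lam) := by
    have : lam/(1+lam) = 1 - 1/(1+lam) := by field_simp; ring
    linarith
  calc (1 - exp (-lam))⁻¹ ≤ (lam/(1+lam))⁻¹ := inv_anti₀ (by positivity) h4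
    _ = _ := by field_simp; ring
lemma inner : ∃ C : ℝ, 1 ≤ C ∧ ∀ W : ℝ, 0 ≤ W → ∀ lam : ℝ, 0 < lam → ∀ Q : Finset ℕ, (∀ q ∈ Q, q.Prime ∧ W ≤ ll q) →
    ∑ q ∈ Q, (1/((q-1:ℕ):ℝ)) * exp (-(lam*(ll q - W))) ≤ C*(1+1/lam) := by
  obtain ⟨C, hC, hP⟩ := PRE
  refine ⟨2*(2*C+2), by linarith, fun W hW lam hl Q hQ => ?_⟩
  obtain ⟨K, hK⟩ : ∃ K, ∀ q ∈ Q, ⌊ll q - W⌋₊ ∈ Finset.range K := by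
    refine ⟨(Q.sup fun q => ⌊ll q - W⌋₊) + 1, fun q hq => Finset.mem_range.2 (Nat.lt_succ_of_le ?_)⟩
    exact Finset.le_sup (f := fun q => ⌊ll q - W⌋₊) hq
  rw [← Finset.sum_fiberwise_of_maps_to hK]
  have hb : ∀ n ∈ Finset.range K, ∑ q ∈ Q.filter (fun q => ⌊ll q - W⌋₊ = n), (1/((q-1:ℕ):ℝ)) * exp (-(lam*(ll q - W))) ≤ 2*(2*C+2)*exp (-(lam*n)) := by
    intro n _
    have hq : ∀ q ∈ Q.filter (fun q => ⌊ll q - W⌋₊ = n), q.Prime ∧ n ≤ ll q - W ∧ q ≤ ⌊E (W+n+1)⌋₊ ∧ ⌊E (W+n)⌋₊ ≤ q := by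
      intro q hq
      obtain ⟨h1, h2⟩ := Finset.mem_filter.1 hq
      have h3 := hQ q h1
      have h4 : (n:ℝ) ≤ ll q - W := h2 ▸ Nat.floor_le (by linarith)
      have h5 : ll q - W < n + 1 := h2 ▸ Nat.lt_floor_add_one _
      have hq2 : (2:ℝ) ≤ q := by exact_mod_cast h3.1.two_le
      have hlq : 0 < log q := Real.log_pos (by linarith)
      have e : E (ll q) = q := by rw [E, ll, Real.exp_log hlq, Real.exp_log (by linarith)]
      refine ⟨h3.1, h4, Nat.le_floor ?_, ?_⟩
      · rw [← e]; exact E_mono (by linarith)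
      · apply Nat.floor_le_of_le; rw [← e]; exact E_mono (by linarith)
    have h1 : ∑ q ∈ Q.filter (fun q => ⌊ll q - W⌋₊ = n), (1/(q:ℝ)) ≤ 2*C+2 := by
      have hsub : Q.filter (fun q => ⌊ll q - W⌋₊ = n) ⊆ ((PL ⌊E (W+n+1)⌋₊) \ (PL ⌊E (W+n)⌋₊)) ∪ {⌊E (W+n)⌋₊} := by
        intro q h
        have := hq q h
        rw [Finset.mem_union, Finset.mem_sdiff, mem_PL, mem_PL, Finset.mem_singleton]
        rcases this.2.2.2.eq_or_lt with h | h
        · right; exact h.symm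
        · left; exact ⟨⟨this.2.2.1, this.1⟩, fun h' => by omega⟩
      have hsub2 : PL ⌊E (W+n)⌋₊ ⊆ PL ⌊E (W+n+1)⌋₊ := by
        intro p hp
        have := mem_PL.1 hp
        exact mem_PL.2 ⟨this.1.trans (Nat.floor_mono (E_mono (by linarith))), this.2⟩
      have e1 := Finset.sum_sdiff (f := fun q : ℕ => (1/(q:ℝ))) hsub2
      have e2 := abs_le.1 (hP (W+n+1) (by positivity))
      have e3 := abs_le.1 (hP (W+n) (by positivity))
      have e4 : (1:ℝ)/(⌊E (W+n)⌋₊:ℝ) ≤ 1 := by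
        have : 2 ≤ ⌊E (W+n)⌋₊ := Nat.le_floor (by exact_mod_cast (E_gt (show 0 ≤ W+n by positivity)).le)
        have : (2:ℝ) ≤ ⌊E (W+n)⌋₊ := by exact_mod_cast this
        rw [div_le_one (by linarith)]; linarith
      have e5 := Finset.sum_union_inter (f := fun q : ℕ => (1/(q:ℝ))) (s₁ := (PL ⌊E (W+n+1)⌋₊) \ (PL ⌊E (W+n)⌋₊)) (s₂ := {⌊E (W+n)⌋₊})
      have e6 : 0 ≤ ∑ q ∈ ((PL ⌊E (W+n+1)⌋₊) \ (PL ⌊E (W+n)⌋₊)) ∩ {⌊E (W+n)⌋₊}, (1/(q:ℝ)) := Finset.sum_nonneg fun _ _ => by positivity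
      rw [Finset.sum_singleton] at e5
      have e7 := Finset.sum_le_sum_of_subset_of_nonneg hsub (f := fun q : ℕ => (1/(q:ℝ))) fun _ _ _ => by positivity
      unfold PR at e2 e3
      linarith
    calc _ ≤ ∑ q ∈ Q.filter (fun q => ⌊ll q - W⌋₊ = n), (2*exp (-(lam*n))) * (1/(q:ℝ)) := by
          apply Finset.sum_le_sum
          intro q h
          have h' := hq q h
          have h2 : (2:ℝ) ≤ q := by exact_mod_cast h'.1.two_le
          rw [Nat.cast_sub h'.1.one_le, Nat.cast_one]
          have h3 : (1:ℝ)/(q-1) ≤ 2*(1/q) := by rw [mul_one_div, div_le_div_iff₀ (by linarith) (by linarith)]; linarith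
          have h4 : exp (-(lam*(ll q - W))) ≤ exp (-(lam*n)) := by
            apply Real.exp_le_exp.2; have := mul_le_mul_of_nonneg_left h'.2.1 hl.le; linarith
          calc _ ≤ 2*(1/(q:ℝ)) * exp (-(lam*n)) := by gcongr
            _ = _ := by ring
      _ = (2*exp (-(lam*n))) * ∑ q ∈ Q.filter (fun q => ⌊ll q - W⌋₊ = n), (1/(q:ℝ)) := by rw [Finset.mul_sum]
      _ ≤ (2*exp (-(lam*n))) * (2*C+2) := by gcongr
      _ = _ := by ring
  refine (Finset.sum_le_sum hb).trans ?_
  rw [← Finset.mul_sum]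
  exact mul_le_mul_of_nonneg_left (exp_geom hl K) (by linarith)
open Classical in
noncomputable def wt (δ ϱ' : ℝ) : ℝ → List ℕ → ℝ
  | _, [] => 1
  | lam, q :: t => (if 0 ≤ yy δ q t then (1/((q-1:ℕ):ℝ)) * exp (-(lam * yy δ q t)) else 0) * wt δ ϱ' (lam/ϱ') t
lemma wt_nn (δ ϱ' lam : ℝ) (t : List ℕ) : 0 ≤ wt δ ϱ' lam t := by
  induction t generalizing lam with
  | nil => simp [wt]
  | cons q t ih =>
    rw [wt]; refine mul_nonneg ?_ (ih _)
    split_ifs <;> positivity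
lemma wt_good {δ : ℝ} (hδ : 0 ≤ δ) (ϱ' lam : ℝ) (t : List ℕ) (ht : ∀ q ∈ t, 0 ≤ ll q) (hg : good δ t) :
    (1/((t.map (· - 1)).prod:ℕ):ℝ) = exp (YY δ ϱ' lam t) * wt δ ϱ' lam t := by
  induction t generalizing lam with
  | nil => simp [wt, YY]
  | cons q t ih =>
    have ht' := fun q hq => ht q (List.mem_cons_of_mem _ hq)
    have h1 := ih (lam/ϱ') ht' hg.2
    have h2 := yy_nn hδ q t ht' hg
    rw [List.map_cons, List.prod_cons, Nat.cast_mul, ← one_div_mul_one_div, h1, wt, if_pos h2, YY, Real.exp_add, Real.exp_neg]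
    field_simp
lemma sum_wt : ∃ C : ℝ, 1 ≤ C ∧ ∀ δ ϱ' : ℝ, 0 ≤ δ → 0 < ϱ' → ∀ Q : Finset ℕ, (∀ q ∈ Q, q.Prime ∧ 0 ≤ ll q) → ∀ (r : ℕ) (lam : ℝ), 0 < lam →
    ∑ t ∈ LL Q r, wt δ ϱ' lam t ≤ ∏ i ∈ Finset.range r, (C*(1+ϱ'^i/lam)) := by
  classical
  obtain ⟨C, hC, hi⟩ := inner
  refine ⟨C, hC, fun δ ϱ' hδ hϱ Q hQ r => ?_⟩
  induction r with
  | zero => intro lam _; simp [LL, wt]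
  | succ r ih =>
    intro lam hl
    rw [sum_LL, Finset.prod_range_succ']
    calc _ ≤ ∑ t ∈ LL Q r, (C*(1+1/lam)) * wt δ ϱ' (lam/ϱ') t := by
          apply Finset.sum_le_sum
          intro t ht
          simp only [wt]
          rw [← Finset.sum_mul]
          refine mul_le_mul_of_nonneg_right ?_ (wt_nn _ _ _ _)
          rw [← Finset.sum_filter]
          have hW := Sf_bc_nn hδ t fun q hq => (hQ q (((mem_LL _ _ _).1 ht).2 q hq)).2
          refine le_trans (le_of_eq ?_) (hi _ hW lam hl (Q.filter fun q => 0 ≤ yy δ q t) ?_)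
          · rfl
          · intro q hq
            obtain ⟨h1, h2⟩ := Finset.mem_filter.1 hq
            exact ⟨(hQ q h1).1, by rw [yy] at h2; linarith⟩
      _ = (C*(1+1/lam)) * ∑ t ∈ LL Q r, wt δ ϱ' (lam/ϱ') t := by rw [Finset.mul_sum]
      _ ≤ (C*(1+1/lam)) * ∏ i ∈ Finset.range r, (C*(1+ϱ'^i/(lam/ϱ'))) := by
          apply mul_le_mul_of_nonneg_left (ih _ (by positivity)); positivity
      _ = _ := by
          rw [mul_comm, pow_zero]
          congr 1
          apply Finset.prod_congr rfl
          intro i _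
          rw [pow_succ]; congr 2; field_simp
lemma pos_part_sum {a lam : ℝ} (ha : 0 ≤ a) (hl : 0 < lam) (r : ℕ) : ∑ i ∈ Finset.range r, max 0 (a - i*lam) ≤ a^2/(2*lam) + a := by
  have key : ∀ r : ℕ, ∑ i ∈ Finset.range (r+1), max 0 (a - i*lam) ≤ a + (a^2 - (max 0 (a-r*lam))^2)/(2*lam) := by
    intro r
    induction r with
    | zero => simp [max_eq_right ha]
    | succ r ih =>
      rw [Finset.sum_range_succ]
      have : max 0 (a - ((r+1:ℕ):ℝ)*lam) ≤ ((max 0 (a-r*lam))^2 - (max 0 (a - ((r+1:ℕ):ℝ)*lam))^2)/(2*lam) := by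
        rw [le_div_iff₀ (by positivity)]
        push_cast
        rcases le_total 0 (a - ((r:ℝ)+1)*lam) with h | h
        · rw [max_eq_right h, max_eq_right (by linarith)]; nlinarith
        · rw [max_eq_left h]; simp
      have e : ∀ x y z : ℝ, (x - z)/(2*lam) = (x-y)/(2*lam) + (y-z)/(2*lam) := fun x y z => by ring
      rw [e _ ((max 0 (a-r*lam))^2)]
      linarith
  have h0 : ∑ i ∈ Finset.range r, max 0 (a - i*lam) ≤ ∑ i ∈ Finset.range (r+1), max 0 (a - i*lam) := by
    rw [Finset.sum_range_succ]; linarith [le_max_left 0 (a-r*lam)]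
  have h1 : (a^2 - (max 0 (a-r*lam))^2)/(2*lam) ≤ a^2/(2*lam) := by gcongr; linarith [sq_nonneg (max 0 (a-r*lam))]
  linarith [key r]
lemma good_prod {ϱ C : ℝ} (h0 : 0 < ϱ) (h1 : ϱ < 1) (hC : 1 ≤ C) {δ z : ℝ} (hδ : 0 ≤ δ) (hz : 1 ≤ z) (r : ℕ) (hr : r*δ ≤ 13) :
    ∏ i ∈ Finset.range r, (C*(1+(ϱ*(1+δ))^i*z)) ≤ exp (r*(log (2*C)+13)) * exp ((log z)^2/(2*log (1/ϱ)) + log z) := by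
  have hl : 0 < log (1/ϱ) := Real.log_pos (by rw [lt_div_iff₀ h0]; linarith)
  have hlz := Real.log_nonneg hz
  have hfac : ∀ i ∈ Finset.range r, C*(1+(ϱ*(1+δ))^i*z) ≤ exp (log (2*C)+13) * exp (max 0 (log z - i*log (1/ϱ))) := by
    intro i hi
    have hir : (i:ℝ) ≤ r := by exact_mod_cast (Finset.mem_range.1 hi).le
    have e1 : (1+δ)^i ≤ exp 13 := by
      calc (1+δ)^i ≤ (exp δ)^i := by gcongr; linarith [Real.add_one_le_exp δ]
        _ = exp (i*δ) := by rw [← Real.exp_nat_mul]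
        _ ≤ exp 13 := Real.exp_le_exp.2 (le_trans (by gcongr) hr)
    have e2 : ϱ^i*z = exp (log z - i*log (1/ϱ)) := by
      rw [Real.exp_sub, Real.exp_log (by linarith), ← Real.log_pow, Real.exp_log (by positivity)]
      simp; ring
    have e3 : ϱ^i*z ≤ exp (max 0 (log z - i*log (1/ϱ))) := by rw [e2]; exact Real.exp_le_exp.2 (le_max_right _ _)
    have e4 : 1 ≤ exp (max 0 (log z - i*log (1/ϱ))) := Real.one_le_exp (le_max_left _ _)
    have e5 : (1:ℝ) ≤ exp 13 := Real.one_le_exp (by norm_num)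
    rw [Real.exp_add, Real.exp_log (by linarith), mul_pow]
    generalize exp (max 0 (log z - i*log (1/ϱ))) = M at *
    have e6 : (1+δ)^i*(ϱ^i*z) ≤ exp 13 * M := by gcongr
    have e7 : 1 ≤ exp 13 * M := one_le_mul_of_one_le_of_one_le e5 e4
    calc C*(1+ϱ^i*(1+δ)^i*z) = C*(1+(1+δ)^i*(ϱ^i*z)) := by ring
      _ ≤ C*(exp 13*M + exp 13*M) := by gcongr
      _ = _ := by ring
  refine (Finset.prod_le_prod (fun i _ => by positivity) hfac).trans ?_
  rw [Finset.prod_mul_distrib, Finset.prod_const, Finset.card_range, ← Real.exp_nat_mul, ← Real.exp_sum]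
  gcongr
  exact pos_part_sum hlz hl r
lemma good_sum {ϱ : ℝ} (h : HR ϱ) : ∃ K : ℝ, 1 ≤ K ∧ ∀ u, 0 < u → 20 ≤ log u → ∀ T : Finset (List ℕ), (∀ t ∈ T, GoodL u t) →
    ∑ t ∈ T, (1/((t.map (· - 1)).prod:ℕ):ℝ) ≤ exp ((log (u/log u))^2/(2*log (1/ϱ)) + K*log u) := by
  classical
  obtain ⟨B, hB, hY⟩ := YY_le h
  obtain ⟨C, hC, hw⟩ := sum_wt
  have hlC : 0 ≤ log (2*(C*B)) := Real.log_nonneg (by nlinarith)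
  refine ⟨13*(log (2*(C*B))+13)+15, by linarith, fun u hu0 hu T hT => ?_⟩
  obtain ⟨Q, hQ⟩ : ∃ Q : Finset ℕ, ∀ p, p ∈ Q ↔ Pn u p := 
    ⟨(PL ⌊E u⌋₊).filter fun p => n1 u < p ∧ Nrm (et u) p, fun p => by rw [Finset.mem_filter, mem_PL, Pn]; tauto⟩
  have hδ : 0 ≤ dl u := by unfold dl; positivity
  have hU : 0 ≤ U1 u := by unfold U1; positivity
  have hll : ∀ p, Pn u p → 0 ≤ ll p ∧ ll p ≤ u := fun p hp => by
    have := ll_bds (by linarith : 1 ≤ log u) hp.2.1 hp.2.2.1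
    exact ⟨hU.trans this.1, this.2.1⟩
  have hlam : 0 < log u/(B*u) := by have : 0 < log u := by linarith
                                    positivity
  have hue : log u ≤ u := by linarith [Real.log_le_sub_one_of_pos hu0]
  have hz : 1 ≤ u/log u := by rw [le_div_iff₀ (by linarith)]; linarith
  obtain ⟨Mx, hMx⟩ : ∃ M, M = ⌊12*log u+2⌋₊ := ⟨_, rfl⟩
  have hMb : (Mx:ℝ) ≤ 12*log u+2 := hMx ▸ (Nat.floor_le (by linarith))
  have hlen : ∀ t ∈ T, t.length ∈ Finset.range (Mx+1) := by
    intro t ht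
    have hg := hT t ht
    have := len_bd hu t hg.2.2 hg.1 fun p hp => ⟨(hg.2.1 p hp).2.1, (hg.2.1 p hp).2.2.1⟩
    exact Finset.mem_range.2 (Nat.lt_succ_of_le (hMx ▸ Nat.le_floor this))
  have hterm : ∀ t ∈ T, (1/((t.map (· - 1)).prod:ℕ):ℝ) ≤ exp (log u) * wt (dl u) (ϱ*(1+dl u)) (log u/(B*u)) t := by
    intro t ht
    have hg := hT t ht
    have hl := fun q hq => hll q (hg.2.1 q hq)
    rw [wt_good hδ (ϱ*(1+dl u)) (log u/(B*u)) t (fun q hq => (hl q hq).1) hg.2.2]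
    refine mul_le_mul_of_nonneg_right (Real.exp_le_exp.2 ?_) (wt_nn _ _ _ _)
    rw [YY_mul]
    have := hY (dl u) hδ u t hu0.le hl hg.2.2
    calc _ ≤ log u/(B*u) * (B*u) := by gcongr
      _ = log u := by field_simp
  rw [← Finset.sum_fiberwise_of_maps_to hlen]
  have hr : ∀ r ∈ Finset.range (Mx+1), ∑ t ∈ T.filter (fun t => t.length = r), (1/((t.map (· - 1)).prod:ℕ):ℝ) ≤
      exp (log u) * (exp (13*log u*(log (2*(C*B))+13)) * exp ((log (u/log u))^2/(2*log (1/ϱ)) + log u)) := by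
    intro r hr
    have hrM : (r:ℝ) ≤ Mx := by exact_mod_cast Nat.lt_succ_iff.1 (Finset.mem_range.1 hr)
    have hr13 : (r:ℝ) ≤ 13*log u := by linarith
    calc _ ≤ ∑ t ∈ T.filter (fun t => t.length = r), exp (log u) * wt (dl u) (ϱ*(1+dl u)) (log u/(B*u)) t :=
          Finset.sum_le_sum fun t ht => hterm t (Finset.mem_filter.1 ht).1
      _ ≤ ∑ t ∈ LL Q r, exp (log u) * wt (dl u) (ϱ*(1+dl u)) (log u/(B*u)) t := by
          apply Finset.sum_le_sum_of_subset_of_nonneg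
          · intro t ht
            obtain ⟨h1, h2⟩ := Finset.mem_filter.1 ht
            exact (mem_LL _ _ _).2 ⟨h2, fun q hq => (hQ q).2 ((hT t h1).2.1 q hq)⟩
          · intro t _ _; exact mul_nonneg (Real.exp_pos _).le (wt_nn _ _ _ _)
      _ = exp (log u) * ∑ t ∈ LL Q r, wt (dl u) (ϱ*(1+dl u)) (log u/(B*u)) t := by rw [Finset.mul_sum]
      _ ≤ exp (log u) * ∏ i ∈ Finset.range r, (C*(1+(ϱ*(1+dl u))^i/(log u/(B*u)))) := by
          have hr0 := h.h0
          refine mul_le_mul_of_nonneg_left (hw _ _ hδ (by positivity) Q (fun q hq => ?_) r _ hlam) (Real.exp_pos _).le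
          exact ⟨((hQ q).1 hq).1, (hll q ((hQ q).1 hq)).1⟩
      _ ≤ exp (log u) * ∏ i ∈ Finset.range r, (C*B*(1+(ϱ*(1+dl u))^i*(u/log u))) := by
          have hr0 := h.h0
          have hl0 : 0 < log u := by linarith
          refine mul_le_mul_of_nonneg_left (Finset.prod_le_prod (fun i _ => by positivity) fun i _ => ?_) (Real.exp_pos _).le
          have : (ϱ*(1+dl u))^i/(log u/(B*u)) = B*((ϱ*(1+dl u))^i*(u/log u)) := by field_simp
          rw [this, mul_assoc C B]
          refine mul_le_mul_of_nonneg_left ?_ (by linarith)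
          linarith
      _ ≤ exp (log u) * (exp (r*(log (2*(C*B))+13)) * exp ((log (u/log u))^2/(2*log (1/ϱ)) + log (u/log u))) := by
          refine mul_le_mul_of_nonneg_left (good_prod h.h0 h.h1 (by nlinarith) hδ hz r ?_) (Real.exp_pos _).le
          unfold dl; rw [mul_one_div, div_le_iff₀ (by linarith)]; exact hr13
      _ ≤ _ := by
          have : log (u/log u) ≤ log u := Real.log_le_log (by linarith) (div_le_self hu0.le (by linarith))
          gcongr
  refine (Finset.sum_le_sum hr).trans ?_
  rw [Finset.sum_const, Finset.card_range, nsmul_eq_mul]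
  have hM1 : ((Mx+1:ℕ):ℝ) ≤ exp (13*log u) := by
    push_cast; linarith [Real.add_one_le_exp (13*log u)]
  calc _ ≤ exp (13*log u) * (exp (log u) * (exp (13*log u*(log (2*(C*B))+13)) * exp ((log (u/log u))^2/(2*log (1/ϱ)) + log u))) := by gcongr
    _ = _ := by rw [← Real.exp_add, ← Real.exp_add, ← Real.exp_add]; congr 1; ring
end FordT

namespace FordT
open Real Finset
lemma HR.lpos {ϱ : ℝ} (h : HR ϱ) : 0 < log (1/ϱ) := Real.log_pos (by rw [lt_div_iff₀ h.h0]; linarith [h.h1])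
lemma upper_step {ϱ : ℝ} (h : HR ϱ) : ∃ K L0 : ℝ, 1 ≤ K ∧ 1600 ≤ L0 ∧ ∀ u, 0 < u → L0 ≤ log u → ∀ X : ℕ,
    R X ⌊E u⌋₊ ≤ exp ((log (u/log u))^2/(2*log (1/ϱ)) + K*log u) * R X ⌊E ((log u)^12)⌋₊ := by
  obtain ⟨K, hK, hg⟩ := good_sum h
  obtain ⟨L0, hL0, hu⟩ := upper_rec
  refine ⟨K+1, L0, by linarith, hL0, fun u hu0 hul X => ?_⟩
  have h20 : 20 ≤ log u := by linarith
  have h1 := hu u hu0 hul X _ (hg u hu0 h20)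
  refine h1.trans (mul_le_mul_of_nonneg_right ?_ (RR_nonneg _))
  have h2 : (2:ℝ) ≤ exp (log u) := by linarith [Real.add_one_le_exp (log u)]
  calc _ ≤ exp (log u) * exp ((log (u/log u))^2/(2*log (1/ϱ)) + K*log u) := by gcongr
    _ = _ := by rw [← Real.exp_add]; congr 1; ring
lemma upper_R {ϱ : ℝ} (h : HR ϱ) : ∃ K L0 : ℝ, 1 ≤ K ∧ 1600 ≤ L0 ∧ ∀ u, 0 < u → L0 ≤ log u → ∀ X : ℕ,
    R X ⌊E u⌋₊ ≤ exp ((log (u/log u))^2/(2*log (1/ϱ)) + K*log u) := by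
  obtain ⟨K, L0, hK, hL0, hs⟩ := upper_step h
  obtain ⟨C, hC, ht⟩ := R_triv
  have hl := h.lpos
  obtain ⟨D, hD⟩ : ∃ D : ℝ, D = 144/(2*log (1/ϱ)) + 12*K + 8*12^12 + C := ⟨_, rfl⟩
  have hD0 : 1 ≤ D := by
    have : 0 ≤ 144/(2*log (1/ϱ)) := by positivity
    rw [hD]; linarith
  obtain ⟨s0, hs0⟩ := Filter.eventually_atTop.1 (ev_pow_exp 13 1 one_pos)
  refine ⟨K+1, max L0 (exp (|s0| + D + L0)), by linarith, hL0.trans (le_max_left _ _), fun u hu0 hu X => ?_⟩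
  have hu1 := (le_max_left _ _).trans hu
  have hu2 := (le_max_right _ _).trans hu
  have hlu : 0 < log u := by linarith
  obtain ⟨s, hsd⟩ : ∃ s, s = log (log u) := ⟨_, rfl⟩
  have hsl : |s0| + D + L0 ≤ s := by
    rw [hsd, ← Real.log_exp (|s0| + D + L0)]; exact Real.log_le_log (Real.exp_pos _) hu2
  have hs1 : 1600 ≤ s := by linarith [abs_nonneg s0]
  have he : log u = exp s := by rw [hsd, Real.exp_log hlu]
  have h1 := hs u hu0 hu1 X
  have h12 : log ((log u)^12) = 12*s := by rw [Real.log_pow, hsd]; norm_num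
  have h2 := hs ((log u)^12) (by positivity) (by rw [h12]; linarith [abs_nonneg s0]) X
  have h3 := ht X ((log ((log u)^12))^12) (by rw [h12]; positivity)
  rw [h12] at h2 h3
  have hle : (log ((log u)^12/(12*s)))^2 ≤ (12*s)^2 := by
    have a1 : log ((log u)^12/(12*s)) ≤ 12*s := by
      rw [← h12]
      exact Real.log_le_log (by rw [h12]; positivity) (div_le_self (by positivity) (by rw [h12]; linarith))
    have a2 : 0 ≤ log ((log u)^12/(12*s)) := by
      apply Real.log_nonneg
      rw [le_div_iff₀ (by positivity), ← h12]
      have := Real.log_le_sub_one_of_pos (show 0 < (log u)^12 by positivity)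
      linarith
    gcongr
  have h4 : (log ((log u)^12/(12*s)))^2/(2*log (1/ϱ)) ≤ 144/(2*log (1/ϱ)) * s^12 := by
    calc _ ≤ (12*s)^2/(2*log (1/ϱ)) := by gcongr
      _ = 144/(2*log (1/ϱ)) * s^2 := by ring
      _ ≤ _ := by
        gcongr
        · linarith
        · norm_num
  have h5 : s ≤ s^12 := le_self_pow₀ (by linarith) (by norm_num)
  have h5' : 1 ≤ s^12 := one_le_pow₀ (by linarith)
  have h6 : D*s^12 ≤ exp s := by
    calc D*s^12 ≤ s*s^12 := by gcongr; linarith [abs_nonneg s0]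
      _ = s^13 := by ring
      _ ≤ exp s := by have := hs0 s (by linarith [le_abs_self s0]); rwa [one_mul] at this
  have h7 : R X ⌊E ((log u)^12)⌋₊ ≤ exp (log u) := by
    refine h2.trans ?_
    calc _ ≤ exp ((log ((log u)^12/(12*s)))^2/(2*log (1/ϱ)) + K*(12*s)) * exp (8*(12*s)^12+C) := by gcongr
      _ ≤ exp (log u) := by
        rw [← Real.exp_add, Real.exp_le_exp]
        have a1 : K*(12*s) ≤ 12*K*s^12 := by nlinarith
        have a2 : (12*s)^12 = 12^12*s^12 := by ring
        have a3 : C ≤ C*s^12 := by nlinarith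
        rw [hD, ← he] at h6
        rw [a2]
        linarith only [h4, h6, a1, a3]
  calc _ ≤ _ := h1
    _ ≤ exp ((log (u/log u))^2/(2*log (1/ϱ)) + K*log u) * exp (log u) := by gcongr
    _ = _ := by rw [← Real.exp_add]; congr 1; ring
end FordT

namespace FordT
open Real Finset
lemma sum_inj_le {α β : Type*} [DecidableEq β] (S : Finset α) (T : Finset β) (φ : α → β) (f : α → ℝ) (g : β → ℝ)
    (hi : Set.InjOn φ S) (hm : ∀ a ∈ S, φ a ∈ T) (hf : ∀ a ∈ S, f a ≤ g (φ a)) (hg : ∀ b ∈ T, 0 ≤ g b) :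
    ∑ a ∈ S, f a ≤ ∑ b ∈ T, g b := by
  calc _ ≤ ∑ a ∈ S, g (φ a) := sum_le_sum hf
    _ = ∑ b ∈ S.image φ, g b := (sum_image hi).symm
    _ ≤ _ := sum_le_sum_of_subset_of_nonneg (image_subset_iff.2 hm) (fun b hb _ => hg b hb)
def hh (c : ℕ → ℝ) : ℕ → ℝ := mval (fun p e => c p ^ e)
lemma hh_nn {c : ℕ → ℝ} (hc : ∀ p, 0 ≤ c p) (n : ℕ) : 0 ≤ hh c n :=
  mval_nonneg (fun p e _ _ => pow_nonneg (hc p) e) n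
lemma hh_p {c : ℕ → ℝ} {p a : ℕ} (hp : p.Prime) (ha : a ≠ 0) : hh c (p*a) = c p * hh c a := by
  unfold hh; rw [mval_cm c hp.ne_zero ha, mval_p _ hp, pow_one]
open Classical in
lemma hplus' (c : ℕ → ℝ) (hc : ∀ p, 0 ≤ c p) (Z B : ℕ) : B ≠ 0 →
    ∑ s ∈ B.divisors with (∀ p, p.Prime → p ∣ s → p ≤ Z), hh c (B/s)
      ≤ hh (fun p => c p + if p ≤ Z then 1 else 0) B := by
  induction B using induction_on_primes with
  | zero => simp
  | one => intro; rw [Nat.divisors_one, sum_filter, sum_singleton]; split_ifs <;> simp [hh, mval_one]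
  | prime_mul p a hp ih =>
    intro hpa
    have ha : a ≠ 0 := by rintro rfl; simp at hpa
    have ih := ih ha
    obtain ⟨D, hD⟩ : ∃ D, D = {s ∈ a.divisors | ∀ p, p.Prime → p ∣ s → p ≤ Z} := ⟨_, rfl⟩
    rw [← hD] at ih
    have hm : ∀ s ∈ D, s ∣ a := fun s hs => by rw [hD] at hs; exact Nat.dvd_of_mem_divisors (mem_filter.1 hs).1
    rw [hh_p hp ha, add_mul]
    have e1 : ∑ s ∈ D, hh c (p*a/s) = c p * ∑ s ∈ D, hh c (a/s) := by
      rw [mul_sum]; refine sum_congr rfl fun s hs => ?_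
      have h0 : 0 < s := Nat.pos_of_dvd_of_pos (hm s hs) (Nat.pos_of_ne_zero ha)
      rw [Nat.mul_div_assoc _ (hm s hs), hh_p hp (Nat.div_pos (Nat.le_of_dvd (Nat.pos_of_ne_zero ha) (hm s hs)) h0).ne']
    have e2 : ∑ s ∈ D.image (p * ·), hh c (p*a/s) = ∑ s ∈ D, hh c (a/s) := by
      rw [sum_image (fun x _ y _ h => Nat.eq_of_mul_eq_mul_left hp.pos h)]
      exact sum_congr rfl fun s _ => by rw [Nat.mul_div_mul_left _ _ hp.pos]
    have nn := fun n => hh_nn hc n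
    have key : ∑ s ∈ (p*a).divisors with (∀ p, p.Prime → p ∣ s → p ≤ Z), hh c (p*a/s)
        ≤ ∑ s ∈ D, hh c (p*a/s) + (if p ≤ Z then 1 else 0) * ∑ s ∈ D.image (p * ·), hh c (p*a/s) := by
      have hsub : ∀ s ∈ (p*a).divisors, (∀ p, p.Prime → p ∣ s → p ≤ Z) → s ∈ D ∨ (p ≤ Z ∧ s ∈ D.image (p * ·)) := by
        intro s hs hz
        have hs := Nat.dvd_of_mem_divisors hs
        by_cases h : p ∣ s
        · obtain ⟨t, rfl⟩ := h
          refine Or.inr ⟨hz p hp (dvd_mul_right _ _), mem_image_of_mem _ ?_⟩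
          rw [hD, mem_filter]
          exact ⟨Nat.mem_divisors.2 ⟨Nat.dvd_of_mul_dvd_mul_left hp.pos hs, ha⟩, fun r hr h => hz r hr (h.mul_left _)⟩
        · left; rw [hD, mem_filter]
          exact ⟨Nat.mem_divisors.2 ⟨((Nat.Prime.coprime_iff_not_dvd hp).2 h).symm.dvd_of_dvd_mul_left hs, ha⟩, hz⟩
      split_ifs with hpz
      · rw [one_mul]
        refine le_trans (sum_le_sum_of_subset_of_nonneg (t := D ∪ D.image (p * ·)) (fun s hs => ?_) (fun _ _ _ => nn _)) ?_
        · rw [mem_filter] at hs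
          rcases hsub s hs.1 hs.2 with h | h
          · exact mem_union_left _ h
          · exact mem_union_right _ h.2
        · have := sum_union_inter (s₁ := D) (s₂ := D.image (p * ·)) (f := fun s => hh c (p*a/s))
          have h0 : 0 ≤ ∑ s ∈ D ∩ D.image (p * ·), hh c (p*a/s) := sum_nonneg fun _ _ => nn _
          linarith
      · rw [zero_mul, add_zero]
        refine sum_le_sum_of_subset_of_nonneg (fun s hs => ?_) (fun _ _ _ => nn _)
        rw [mem_filter] at hs
        exact (hsub s hs.1 hs.2).resolve_right fun h => hpz h.1
    refine key.trans ?_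
    rw [e1, e2]
    gcongr
    exact hc p
open Classical in
lemma hplus (c : ℕ → ℝ) (hc : ∀ p, 0 ≤ c p) (Z D m : ℕ) (hm : m ≠ 0) (hD : D ∣ m) :
    ∑ s ∈ Icc 1 Z, (if D*s ∣ m then hh c (m/(D*s)) else 0) ≤ hh (fun p => c p + if p ≤ Z then 1 else 0) (m/D) := by
  obtain ⟨B, rfl⟩ := hD
  have hD0 : 0 < D := Nat.pos_of_ne_zero (left_ne_zero_of_mul hm)
  have hB := right_ne_zero_of_mul hm
  rw [Nat.mul_div_cancel_left _ hD0, ← sum_filter]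
  refine le_trans ?_ (hplus' c hc Z B hB)
  refine sum_inj_le _ _ id _ _ (fun _ _ _ _ h => h) (fun s hs => ?_) (fun s hs => ?_) (fun _ _ => hh_nn hc _)
  · rw [mem_filter, mem_Icc] at hs
    rw [id, mem_filter, Nat.mem_divisors]
    exact ⟨⟨Nat.dvd_of_mul_dvd_mul_left hD0 hs.2, hB⟩, fun p _ h => (Nat.le_of_dvd hs.1.1 h).trans hs.1.2⟩
  · rw [id, Nat.mul_div_mul_left _ _ hD0]
end FordT

namespace FordT
open Real Finset
noncomputable def Uu (Q : Finset ℕ) (h : ℕ → ℝ) (D D' : ℕ) : ℝ :=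
  ∑ n ∈ Q, if D ∣ n ∧ D' ∣ n then h (n/D) * h (n/D') / n else 0
noncomputable def Nn (G : Finset ℕ) (f : ℕ → ℕ → ℝ) (D D' : ℕ) : ℝ :=
  ∑ q ∈ G, ∑ q' ∈ G, if q ≠ q' then f (D*(q-1)) (D'*(q'-1)) else 0
noncomputable def cp (c : ℕ → ℝ) (Z : ℕ) : ℕ → ℝ := fun p => c p + if p ≤ Z then 1 else 0
noncomputable def Xx (c : ℕ → ℝ) (m D s : ℕ) : ℝ := if D*s ∣ m then hh c (m/(D*s)) else 0
lemma Xx_nn {c : ℕ → ℝ} (hc : ∀ p, 0 ≤ c p) (m D s : ℕ) : 0 ≤ Xx c m D s := by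
  unfold Xx; split_ifs
  · exact hh_nn hc _
  · exact le_rfl
lemma Xx_dvd {c : ℕ → ℝ} {m D s : ℕ} (h : ¬ D ∣ m) : Xx c m D s = 0 :=
  if_neg fun h' => h (dvd_of_mul_right_dvd h')
lemma cp_nn {c : ℕ → ℝ} (hc : ∀ p, 0 ≤ c p) (Z p : ℕ) : 0 ≤ cp c Z p := by
  have := hc p
  unfold cp; split_ifs <;> linarith
lemma Uu_nn {Q : Finset ℕ} {h : ℕ → ℝ} (hn : ∀ n, 0 ≤ h n) (D D' : ℕ) : 0 ≤ Uu Q h D D' :=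
  sum_nonneg fun n _ => by
    split_ifs
    · have := hn (n/D); have := hn (n/D'); positivity
    · exact le_rfl
lemma mid {Q : Finset ℕ} {c : ℕ → ℝ} (hc : ∀ p, 0 ≤ c p) (hQ : ∀ n ∈ Q, n ≠ 0) (Z : ℕ) {ε : ℝ} (D D' : ℕ) (w : ℕ → ℕ → ℝ)
    (hε : 0 ≤ ε) (hw : ∀ s s', 1 ≤ s → 1 ≤ s' → w s s' ≤ ε) :
    ∑ m ∈ Q, ∑ s ∈ Icc 1 Z, ∑ s' ∈ Icc 1 Z, Xx c m D s * Xx c m D' s' / m * w s s' ≤ ε * Uu Q (hh (cp c Z)) D D' := by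
  unfold Uu
  rw [mul_sum]
  refine sum_le_sum fun m hm => ?_
  have b1 : ∑ s ∈ Icc 1 Z, ∑ s' ∈ Icc 1 Z, Xx c m D s * Xx c m D' s' / m * w s s'
      ≤ ε * ((∑ s ∈ Icc 1 Z, Xx c m D s) * (∑ s ∈ Icc 1 Z, Xx c m D' s) / m) := by
    rw [sum_mul_sum, sum_div, mul_sum]
    refine sum_le_sum fun s hs => ?_
    rw [sum_div, mul_sum]
    refine sum_le_sum fun s' hs' => ?_
    rw [mul_comm ε]
    have := Xx_nn hc m D s
    have := Xx_nn hc m D' s'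
    exact mul_le_mul_of_nonneg_left (hw s s' (mem_Icc.1 hs).1 (mem_Icc.1 hs').1) (by positivity)
  refine b1.trans (mul_le_mul_of_nonneg_left ?_ hε)
  split_ifs with h
  · have h1 := hplus c hc Z D m (hQ m hm) h.1
    have h2 := hplus c hc Z D' m (hQ m hm) h.2
    have h3 : 0 ≤ ∑ s ∈ Icc 1 Z, Xx c m D' s := sum_nonneg fun s _ => Xx_nn hc m D' s
    have h4 := hh_nn (cp_nn hc Z) (m/D)
    exact div_le_div_of_nonneg_right (mul_le_mul h1 h2 h3 h4) (Nat.cast_nonneg _)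
  · rw [not_and_or] at h
    rcases h with h | h
    · rw [sum_eq_zero (fun s _ => Xx_dvd h)]; simp
    · rw [sum_eq_zero (s := Icc 1 Z) (f := fun s => Xx c m D' s) (fun s _ => Xx_dvd h)]; simp
noncomputable def tm (c : ℕ → ℝ) (D D' : ℕ) (t : ℕ × ℕ × ℕ) : ℝ := hh c (t.2.2/(D*(t.1-1))) * hh c (t.2.2/(D'*(t.2.1-1))) / t.2.2
structure Tc (Q G : Finset ℕ) (Z D D' : ℕ) (t : ℕ × ℕ × ℕ) : Prop where
  a : t.1 ∈ G
  b : t.2.1 ∈ G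
  ne : t.1 ≠ t.2.1
  n : t.2.2 ∈ Q
  d : D*(t.1-1) ∣ t.2.2
  d' : D'*(t.2.1-1) ∣ t.2.2
lemma caseI {Q G : Finset ℕ} {c : ℕ → ℝ} (hc : ∀ p, 0 ≤ c p) (hQ : ∀ n ∈ Q, n ≠ 0 ∧ ∀ d, d ∣ n → d ∈ Q) {Z P0 : ℕ} {ε : ℝ}
    (hε : 0 ≤ ε) {D D' : ℕ} (hG : ∀ q ∈ G, 2 ≤ q ∧ q ≤ Z)
    (h2 : ∀ s s', 1 ≤ s → 1 ≤ s' → s ≠ s' → ∑ P ∈ PL Z with (P0 ≤ P ∧ P*s+1 ∈ G ∧ P*s'+1 ∈ G), 1/(P:ℝ) ≤ ε)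
    (T : Finset (ℕ × ℕ × ℕ)) (pv : ℕ × ℕ × ℕ → ℕ)
    (hT : ∀ t ∈ T, Tc Q G Z D D' t ∧ (pv t).Prime ∧ P0 ≤ pv t ∧ pv t ∣ t.1 - 1 ∧ pv t ∣ t.2.1 - 1) :
    ∑ t ∈ T, tm c D D' t ≤ ε * Uu Q (hh (cp c Z)) D D' := by
  refine le_trans ?_ (mid hc (fun n hn => (hQ n hn).1) Z D D'
    (fun s s' => if s ≠ s' then ∑ P ∈ PL Z with (P0 ≤ P ∧ P*s+1 ∈ G ∧ P*s'+1 ∈ G), 1/(P:ℝ) else 0) hε ?_)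
  · have e : ∀ m s s', Xx c m D s * Xx c m D' s' / m * (if s ≠ s' then ∑ P ∈ PL Z with (P0 ≤ P ∧ P*s+1 ∈ G ∧ P*s'+1 ∈ G), 1/(P:ℝ) else 0)
      = ∑ P ∈ PL Z, Xx c m D s * Xx c m D' s' / m * (if s ≠ s' ∧ (P0 ≤ P ∧ P*s+1 ∈ G ∧ P*s'+1 ∈ G) then 1/(P:ℝ) else 0) := by
      intro m s s'
      rw [← mul_sum]; congr 1
      split_ifs with h
      · rw [sum_filter]; exact sum_congr rfl fun P _ => by simp [h]
      · simp [h]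
    simp only [e]
    have := sum_inj_le T (Q ×ˢ Icc 1 Z ×ˢ Icc 1 Z ×ˢ PL Z) (fun t => (t.2.2/pv t, (t.1-1)/pv t, (t.2.1-1)/pv t, pv t))
      (tm c D D') (fun x => Xx c x.1 D x.2.1 * Xx c x.1 D' x.2.2.1 / x.1 * (if x.2.1 ≠ x.2.2.1 ∧ (P0 ≤ x.2.2.2 ∧ x.2.2.2*x.2.1+1 ∈ G ∧ x.2.2.2*x.2.2.1+1 ∈ G) then 1/(x.2.2.2:ℝ) else 0)) ?_ ?_ ?_ ?_
    · simpa only [sum_product] using this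
    · rintro ⟨q, q', n⟩ ht ⟨r, r', l⟩ ht' heq
      obtain ⟨a, _, _, b, b'⟩ := hT _ ht
      obtain ⟨a', _, _, d, d'⟩ := hT _ ht'
      simp only [Prod.mk.injEq] at heq b b' d d' ⊢
      obtain ⟨e1, e2, e3, e4⟩ := heq
      have k1 := (hG _ a.a).1; have k2 := (hG _ a.b).1; have k3 := (hG _ a'.a).1; have k4 := (hG _ a'.b).1
      simp only at k1 k2 k3 k4
      have f1 := Nat.div_mul_cancel b; have f2 := Nat.div_mul_cancel b'
      have f3 := Nat.div_mul_cancel d; have f4 := Nat.div_mul_cancel d'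
      have f5 := Nat.div_mul_cancel ((b.mul_left D).trans a.d); have f6 := Nat.div_mul_cancel ((d.mul_left D).trans a'.d)
      rw [e4] at e1 e2 e3 f1 f2 f5
      rw [e2] at f1; rw [e3] at f2; rw [e1] at f5
      simp only at f5 f6
      omega
    · rintro ⟨q, q', n⟩ ht
      obtain ⟨a, p, h0, b, b'⟩ := hT _ ht
      have k1 := hG _ a.a; have k2 := hG _ a.b
      have ad := (b.mul_left D).trans a.d
      simp only [mem_product, mem_Icc] at *
      refine ⟨(hQ n a.n).2 _ (Nat.div_dvd_of_dvd ad), ⟨Nat.div_pos (Nat.le_of_dvd (by omega) b) p.pos, (Nat.div_le_self _ _).trans (by omega)⟩,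
        ⟨Nat.div_pos (Nat.le_of_dvd (by omega) b') p.pos, (Nat.div_le_self _ _).trans (by omega)⟩, mem_PL.2 ⟨(Nat.le_of_dvd (by omega) b).trans (by omega), p⟩⟩
    · rintro ⟨q, q', n⟩ ht
      obtain ⟨a, p, h0, b, b'⟩ := hT _ ht
      have k1 := hG _ a.a; have k2 := hG _ a.b
      have ad := (b.mul_left D).trans a.d
      have hn := (hQ _ a.n).1
      have hne := a.ne; have h3 := a.d; have h4 := a.d'; have ha := a.a; have hb := a.b
      simp only [tm] at *
      generalize pv (q, q', n) = P at *
      obtain ⟨s, hs⟩ := b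
      obtain ⟨s', hs'⟩ := b'
      obtain ⟨m, rfl⟩ := ad
      have hq : q = P*s+1 := by omega
      have hq' : q' = P*s'+1 := by omega
      subst hq hq'
      simp only [Nat.add_sub_cancel] at *
      have hP := p.pos
      have x1 : D*s ∣ m := Nat.dvd_of_mul_dvd_mul_left hP (by rwa [mul_left_comm] at h3)
      have x2 : D'*s' ∣ m := Nat.dvd_of_mul_dvd_mul_left hP (by rwa [mul_left_comm] at h4)
      simp only [Nat.mul_div_cancel_left _ hP]
      rw [if_pos ⟨fun h => hne (by rw [h]), h0, ha, hb⟩, Xx, Xx, if_pos x1, if_pos x2, mul_left_comm D, mul_left_comm D',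
        Nat.mul_div_mul_left _ _ hP, Nat.mul_div_mul_left _ _ hP, Nat.cast_mul]
      apply le_of_eq
      rw [div_mul_div_comm, mul_one, mul_comm (P:ℝ)]
    · rintro ⟨m, s, s', P⟩ _
      have := Xx_nn hc m D s
      have := Xx_nn hc m D' s'
      dsimp only
      split_ifs <;> positivity
  · intro s s' a b
    split_ifs with h
    · exact h2 s s' a b h
    · exact hε
end FordT

namespace FordT
open Real Finset
lemma caseII {Q G : Finset ℕ} {c : ℕ → ℝ} {cm : ℝ} (hc : ∀ p, 0 ≤ c p) (hcm : ∀ p, c p ≤ cm) (hQ : ∀ n ∈ Q, n ≠ 0 ∧ ∀ d, d ∣ n → d ∈ Q) {Z P0 : ℕ} {ε : ℝ}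
    (hε : 0 ≤ ε) {D D' : ℕ} (hG : ∀ q ∈ G, 2 ≤ q ∧ q ≤ Z)
    (h1 : ∀ s, 1 ≤ s → ∑ P ∈ PL Z with (P0 ≤ P ∧ P*s+1 ∈ G), 1/(P:ℝ) ≤ ε)
    (T : Finset (ℕ × ℕ × ℕ)) (pf : ℕ → ℕ)
    (hpf : ∀ q ∈ G, (pf q).Prime ∧ P0 ≤ pf q ∧ pf q ∣ q-1) (hD : ∀ P, P.Prime → P0 ≤ P → ¬ P ∣ D ∧ ¬ P ∣ D')
    (hT : ∀ t ∈ T, Tc Q G Z D D' t ∧ ¬ pf t.1 ∣ t.2.1 - 1 ∧ ¬ pf t.2.1 ∣ t.1 - 1) :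
    ∑ t ∈ T, tm c D D' t ≤ cm^2*ε^2 * Uu Q (hh (cp c Z)) D D' := by
  have hdv : ∀ t ∈ T, pf t.1 * pf t.2.1 ∣ t.2.2 := by
    intro t ht
    obtain ⟨a, n1, n2⟩ := hT t ht
    obtain ⟨p, _, b⟩ := hpf _ a.a
    obtain ⟨p', _, b'⟩ := hpf _ a.b
    exact Nat.Coprime.mul_dvd_of_dvd_of_dvd ((Nat.coprime_primes p p').2 fun h => n1 (h ▸ b'))
      ((b.mul_left D).trans a.d) ((b'.mul_left D').trans a.d')
  have hcm0 := (hc 0).trans (hcm 0)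
  refine le_trans ?_ (mid hc (fun n hn => (hQ n hn).1) Z D D'
    (fun s s' => cm^2*((∑ P ∈ PL Z with (P0 ≤ P ∧ P*s+1 ∈ G), 1/(P:ℝ)) * ∑ P ∈ PL Z with (P0 ≤ P ∧ P*s'+1 ∈ G), 1/(P:ℝ))) (by positivity) ?_)
  · have e : ∀ m s s', Xx c m D s * Xx c m D' s' / m * (cm^2*((∑ P ∈ PL Z with (P0 ≤ P ∧ P*s+1 ∈ G), 1/(P:ℝ)) * ∑ P ∈ PL Z with (P0 ≤ P ∧ P*s'+1 ∈ G), 1/(P:ℝ)))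
      = ∑ P ∈ PL Z, ∑ P' ∈ PL Z, Xx c m D s * Xx c m D' s' / m * (cm^2*((if P0 ≤ P ∧ P*s+1 ∈ G then 1/(P:ℝ) else 0) * (if P0 ≤ P' ∧ P'*s'+1 ∈ G then 1/(P':ℝ) else 0))) := by
      intro m s s'
      simp only [← mul_sum, sum_filter, ← sum_mul]
    simp only [e]
    have := sum_inj_le T (Q ×ˢ Icc 1 Z ×ˢ Icc 1 Z ×ˢ PL Z ×ˢ PL Z) (fun t => (t.2.2/(pf t.1*pf t.2.1), (t.1-1)/pf t.1, (t.2.1-1)/pf t.2.1, pf t.1, pf t.2.1))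
      (tm c D D') (fun x => Xx c x.1 D x.2.1 * Xx c x.1 D' x.2.2.1 / x.1 * (cm^2*((if P0 ≤ x.2.2.2.1 ∧ x.2.2.2.1*x.2.1+1 ∈ G then 1/(x.2.2.2.1:ℝ) else 0) * (if P0 ≤ x.2.2.2.2 ∧ x.2.2.2.2*x.2.2.1+1 ∈ G then 1/(x.2.2.2.2:ℝ) else 0)))) ?_ ?_ ?_ ?_
    · simpa only [sum_product] using this
    · rintro ⟨q, q', n⟩ ht ⟨r, r', l⟩ ht' heq
      have a := (hT _ ht).1
      have a' := (hT _ ht').1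
      have b := (hpf _ a.a).2.2; have b' := (hpf _ a.b).2.2; have d := (hpf _ a'.a).2.2; have d' := (hpf _ a'.b).2.2
      have f5 := Nat.div_mul_cancel (hdv _ ht); have f6 := Nat.div_mul_cancel (hdv _ ht')
      simp only [Prod.mk.injEq] at heq b b' d d' f5 f6 ⊢
      obtain ⟨e1, e2, e3, e4, e5⟩ := heq
      have k1 := (hG _ a.a).1; have k2 := (hG _ a.b).1; have k3 := (hG _ a'.a).1; have k4 := (hG _ a'.b).1
      simp only at k1 k2 k3 k4
      have f1 := Nat.div_mul_cancel b; have f2 := Nat.div_mul_cancel b'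
      have f3 := Nat.div_mul_cancel d; have f4 := Nat.div_mul_cancel d'
      rw [e2, e4] at f1; rw [e3, e5] at f2; rw [e1, e4, e5] at f5
      omega
    · rintro ⟨q, q', n⟩ ht
      have a := (hT _ ht).1
      obtain ⟨p, _, b⟩ := hpf _ a.a
      obtain ⟨p', _, b'⟩ := hpf _ a.b
      have k1 := hG _ a.a; have k2 := hG _ a.b
      have ad := hdv _ ht
      simp only [mem_product, mem_Icc] at *
      refine ⟨(hQ n a.n).2 _ (Nat.div_dvd_of_dvd ad), ⟨Nat.div_pos (Nat.le_of_dvd (by omega) b) p.pos, (Nat.div_le_self _ _).trans (by omega)⟩,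
        ⟨Nat.div_pos (Nat.le_of_dvd (by omega) b') p'.pos, (Nat.div_le_self _ _).trans (by omega)⟩,
        mem_PL.2 ⟨(Nat.le_of_dvd (by omega) b).trans (by omega), p⟩, mem_PL.2 ⟨(Nat.le_of_dvd (by omega) b').trans (by omega), p'⟩⟩
    · rintro ⟨q, q', n⟩ ht
      obtain ⟨a, n1, n2⟩ := hT _ ht
      obtain ⟨p, g1, b⟩ := hpf _ a.a
      obtain ⟨p', g2, b'⟩ := hpf _ a.b
      have k1 := hG _ a.a; have k2 := hG _ a.b
      have ad := hdv _ ht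
      have hn := (hQ _ a.n).1
      have h3 := a.d; have h4 := a.d'; have ha := a.a; have hb := a.b
      have hD1 := (hD _ p g1).2; have hD2 := (hD _ p' g2).1
      simp only [tm] at *
      generalize pf q = P at *
      generalize pf q' = P' at *
      obtain ⟨s, hs⟩ := b
      obtain ⟨s', hs'⟩ := b'
      obtain ⟨m, rfl⟩ := ad
      have hq : q = P*s+1 := by omega
      have hq' : q' = P'*s'+1 := by omega
      subst hq hq'
      simp only [Nat.add_sub_cancel] at *
      have hP := p.pos
      have hP' := p'.pos
      have x1 : D*s ∣ m := by
        have : D*s ∣ P'*m := Nat.dvd_of_mul_dvd_mul_left hP (by rwa [mul_left_comm, mul_assoc] at h3)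
        exact Nat.Coprime.dvd_of_dvd_mul_left (Nat.Coprime.symm ((Nat.Prime.coprime_iff_not_dvd p').2 fun h =>
          (p'.dvd_mul.1 h).elim hD2 fun h => n2 (h.mul_left P))) this
      have x2 : D'*s' ∣ m := by
        have : D'*s' ∣ P*m := Nat.dvd_of_mul_dvd_mul_left hP' (by rwa [mul_left_comm, mul_comm P, mul_assoc] at h4)
        exact Nat.Coprime.dvd_of_dvd_mul_left (Nat.Coprime.symm ((Nat.Prime.coprime_iff_not_dvd p).2 fun h =>
          (p.dvd_mul.1 h).elim hD1 fun h => n1 (h.mul_left P'))) this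
      have hm := right_ne_zero_of_mul hn
      have y1 : hh c (P*P'*m/(D*(P*s))) ≤ cm * hh c (m/(D*s)) := by
        rw [mul_left_comm D, mul_assoc, Nat.mul_div_mul_left _ _ hP, Nat.mul_div_assoc _ x1, hh_p p' (Nat.div_ne_zero_iff_of_dvd x1 |>.2 ⟨hm, ne_zero_of_dvd_ne_zero hm x1⟩)]
        exact mul_le_mul_of_nonneg_right (hcm _) (hh_nn hc _)
      have y2 : hh c (P*P'*m/(D'*(P'*s'))) ≤ cm * hh c (m/(D'*s')) := by
        rw [mul_left_comm D', mul_comm P, mul_assoc, Nat.mul_div_mul_left _ _ hP', Nat.mul_div_assoc _ x2, hh_p p (Nat.div_ne_zero_iff_of_dvd x2 |>.2 ⟨hm, ne_zero_of_dvd_ne_zero hm x2⟩)]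
        exact mul_le_mul_of_nonneg_right (hcm _) (hh_nn hc _)
      simp only [Nat.mul_div_cancel_left _ hP, Nat.mul_div_cancel_left _ hP', Nat.mul_div_cancel_left _ (Nat.mul_pos hP hP')]
      rw [if_pos ⟨g1, ha⟩, if_pos ⟨g2, hb⟩, Xx, Xx, if_pos x1, if_pos x2]
      refine (div_le_div_of_nonneg_right (mul_le_mul y1 y2 (hh_nn hc _) (mul_nonneg hcm0 (hh_nn hc _))) (Nat.cast_nonneg _)).trans (le_of_eq ?_)
      push_cast
      field_simp
    · rintro ⟨m, s, s', P, P'⟩ _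
      have := Xx_nn hc m D s
      have := Xx_nn hc m D' s'
      dsimp only
      split_ifs <;> positivity
  · intro s s' a b
    have n1 : 0 ≤ ∑ P ∈ PL Z with (P0 ≤ P ∧ P*s'+1 ∈ G), 1/(P:ℝ) := sum_nonneg fun _ _ => by positivity
    rw [sq ε]
    exact mul_le_mul_of_nonneg_left (mul_le_mul (h1 s a) (h1 s' b) n1 hε) (by positivity)
lemma level {Q G : Finset ℕ} {c : ℕ → ℝ} {cm : ℝ} (hc : ∀ p, 0 ≤ c p) (hcm : ∀ p, c p ≤ cm) (hQ : ∀ n ∈ Q, n ≠ 0 ∧ ∀ d, d ∣ n → d ∈ Q) {Z P0 : ℕ} {ε1 ε2 : ℝ}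
    (hε1 : 0 ≤ ε1) (hε2 : 0 ≤ ε2) {D D' : ℕ} (hG : ∀ q ∈ G, 2 ≤ q ∧ q ≤ Z) (hpf : ∀ q ∈ G, ∃ P, P.Prime ∧ P0 ≤ P ∧ P ∣ q-1)
    (h1 : ∀ s, 1 ≤ s → ∑ P ∈ PL Z with (P0 ≤ P ∧ P*s+1 ∈ G), 1/(P:ℝ) ≤ ε1)
    (h2 : ∀ s s', 1 ≤ s → 1 ≤ s' → s ≠ s' → ∑ P ∈ PL Z with (P0 ≤ P ∧ P*s+1 ∈ G ∧ P*s'+1 ∈ G), 1/(P:ℝ) ≤ ε2)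
    (hD : ∀ P, P.Prime → P0 ≤ P → ¬ P ∣ D ∧ ¬ P ∣ D') :
    Nn G (Uu Q (hh c)) D D' ≤ (2*ε2 + cm^2*ε1^2) * Uu Q (hh (cp c Z)) D D' := by
  choose! pf hpf using hpf
  classical
  obtain ⟨T, hTd⟩ : ∃ T, T = {t ∈ G ×ˢ G ×ˢ Q | t.1 ≠ t.2.1 ∧ D*(t.1-1) ∣ t.2.2 ∧ D'*(t.2.1-1) ∣ t.2.2} := ⟨_, rfl⟩
  have hT : ∀ t ∈ T, Tc Q G Z D D' t := fun t ht => by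
    rw [hTd, mem_filter, mem_product, mem_product] at ht
    exact ⟨ht.1.1, ht.1.2.1, ht.2.1, ht.1.2.2, ht.2.2.1, ht.2.2.2⟩
  have e : Nn G (Uu Q (hh c)) D D' = ∑ t ∈ T, tm c D D' t := by
    rw [hTd, sum_filter]
    simp only [sum_product, Nn, Uu, tm]
    refine sum_congr rfl fun q _ => sum_congr rfl fun q' _ => ?_
    by_cases h : q = q' <;> simp [h]
  have nn : ∀ t, 0 ≤ tm c D D' t := fun t => div_nonneg (mul_nonneg (hh_nn hc _) (hh_nn hc _)) (Nat.cast_nonneg _)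
  have k1 := caseI hc hQ hε2 hG h2 {t ∈ T | pf t.1 ∣ t.2.1-1} (fun t => pf t.1) (D := D) (D' := D') (fun t ht => by
    rw [mem_filter] at ht
    have a := hT t ht.1
    obtain ⟨x, y, z⟩ := hpf _ a.a
    exact ⟨a, x, y, z, ht.2⟩)
  have k2 := caseI hc hQ hε2 hG h2 {t ∈ T | pf t.2.1 ∣ t.1-1} (fun t => pf t.2.1) (D := D) (D' := D') (fun t ht => by
    rw [mem_filter] at ht
    have a := hT t ht.1
    obtain ⟨x, y, z⟩ := hpf _ a.b
    exact ⟨a, x, y, ht.2, z⟩)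
  have k3 := caseII hc hcm hQ hε1 hG h1 {t ∈ T | ¬ pf t.1 ∣ t.2.1-1 ∧ ¬ pf t.2.1 ∣ t.1-1} pf hpf hD (fun t ht => by
    rw [mem_filter] at ht
    exact ⟨hT t ht.1, ht.2⟩)
  have : ∑ t ∈ T, tm c D D' t ≤ ∑ t ∈ T with pf t.1 ∣ t.2.1-1, tm c D D' t + ∑ t ∈ T with pf t.2.1 ∣ t.1-1, tm c D D' t
      + ∑ t ∈ T with (¬ pf t.1 ∣ t.2.1-1 ∧ ¬ pf t.2.1 ∣ t.1-1), tm c D D' t := by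
    simp only [sum_filter, ← sum_add_distrib]
    refine sum_le_sum fun t _ => ?_
    have := nn t
    split_ifs <;> first | linarith | tauto
  rw [e]; linarith
end FordT

namespace FordT
open Real Finset
def Vals : List (Finset ℕ) → Finset ℕ
  | [] => {1}
  | G :: Gs => (G ×ˢ Vals Gs).image fun z => z.2*(z.1-1)
noncomputable def NF : List (Finset ℕ) → (ℕ → ℕ → ℝ) → ℝ
  | [], f => f 1 1
  | G :: Gs, f => NF Gs (Nn G f)
noncomputable def f0 (D D' : ℕ) : ℝ := if D = D' then 1/(D:ℝ) else 0
lemma mem_Vals {G : Finset ℕ} {Gs : List (Finset ℕ)} {w q : ℕ} (hq : q ∈ G) (hw : w ∈ Vals Gs) : w*(q-1) ∈ Vals (G::Gs) :=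
  mem_image.2 ⟨(q,w), mem_product.2 ⟨hq, hw⟩, rfl⟩
lemma NF_mono : ∀ (Gs : List (Finset ℕ)) (f g : ℕ → ℕ → ℝ), (∀ D ∈ Vals Gs, ∀ D' ∈ Vals Gs, f D D' ≤ g D D') → NF Gs f ≤ NF Gs g
  | [], f, g, h => h 1 (mem_singleton_self _) 1 (mem_singleton_self _)
  | G :: Gs, f, g, h => NF_mono Gs _ _ fun D hD D' hD' => by
    refine sum_le_sum fun q hq => sum_le_sum fun q' hq' => ?_
    split_ifs
    · exact h _ (mem_Vals hq hD) _ (mem_Vals hq' hD')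
    · exact le_rfl
lemma NF_smul (K : ℝ) : ∀ (Gs : List (Finset ℕ)) (f : ℕ → ℕ → ℝ), NF Gs (fun D D' => K * f D D') = K * NF Gs f
  | [], f => rfl
  | G :: Gs, f => by
    unfold NF
    rw [← NF_smul K Gs]
    congr 1; funext D D'
    simp only [Nn, mul_sum, mul_ite, mul_zero]
lemma img_sum_le {α : Type*} [DecidableEq α] (S : Finset α) (φ : α → ℕ) (g : ℕ → ℝ) (hg : ∀ b, 0 ≤ g b) : ∑ b ∈ S.image φ, g b ≤ ∑ a ∈ S, g (φ a) := by
  induction S using Finset.induction_on with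
  | empty => simp
  | insert a S ha ih =>
    rw [image_insert, sum_insert ha]
    by_cases h : φ a ∈ S.image φ
    · rw [insert_eq_of_mem h]; linarith [hg (φ a)]
    · rw [sum_insert h]; linarith
lemma img_ge {α : Type*} [DecidableEq α] (S : Finset α) (φ : α → ℕ) (g : ℕ → ℝ) (hg : ∀ b, 0 ≤ g b) :
    ∑ a ∈ S, g (φ a) - ∑ a ∈ S, ∑ a' ∈ S, (if a ≠ a' ∧ φ a = φ a' then g (φ a) else 0) ≤ ∑ b ∈ S.image φ, g b := by
  induction S using Finset.induction_on with
  | empty => simp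
  | insert a S ha ih =>
    have nn : ∀ a b, 0 ≤ if a ≠ b ∧ φ a = φ b then g (φ a) else 0 := fun a b => by
      split_ifs
      · exact hg _
      · exact le_rfl
    rw [image_insert, sum_insert ha, sum_insert ha, sum_insert ha]
    have h1 : ∑ b ∈ S, ∑ a' ∈ S, (if b ≠ a' ∧ φ b = φ a' then g (φ b) else 0) ≤ ∑ b ∈ S, ∑ a' ∈ insert a S, (if b ≠ a' ∧ φ b = φ a' then g (φ b) else 0) :=
      sum_le_sum fun b _ => sum_le_sum_of_subset_of_nonneg (subset_insert _ _) fun c _ _ => nn b c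
    have h2 := nn a a
    by_cases h : φ a ∈ S.image φ
    · rw [insert_eq_of_mem h]
      obtain ⟨a', ha', he⟩ := mem_image.1 h
      have h3 := single_le_sum (f := fun a' => if a ≠ a' ∧ φ a = φ a' then g (φ a) else 0) (fun c _ => nn a c) ha'
      rw [if_pos ⟨fun h => ha (h ▸ ha'), he.symm⟩] at h3
      linarith
    · rw [sum_insert h]
      have := sum_nonneg fun b (_ : b ∈ S) => nn a b
      linarith
lemma vals_pair {B ε : ℝ} (hB : 0 ≤ B) : ∀ (Gs : List (Finset ℕ)) (f : ℕ → ℕ → ℝ),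
    (∀ G ∈ Gs, (∀ q ∈ G, 2 ≤ q) ∧ ∑ q ∈ G, 1/((q-1:ℕ):ℝ) ≤ B) → (∀ D D', 0 ≤ f D D') →
    (∀ a D D', 1 ≤ a → f (D*a) (D'*a) ≤ 1/(a:ℝ) * f D D') → (∀ sub, sub.Sublist Gs → NF sub f ≤ ε) →
    ∑ v ∈ Vals Gs, ∑ v' ∈ Vals Gs, f v v' ≤ (1+B)^Gs.length*ε
  | [], f, _, _, _, h => by simpa [Vals, NF] using h [] (List.Sublist.refl _)
  | G :: Gs, f, hG, hf, hh, h => by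
    have nn : ∀ D D', 0 ≤ Nn G f D D' := fun D D' => sum_nonneg fun q _ => sum_nonneg fun q' _ => by
      split_ifs
      · exact hf _ _
      · exact le_rfl
    have i1 := vals_pair hB Gs (Nn G f) (fun G hG' => hG G (by simp [hG'])) nn (fun a D D' ha => by
        unfold Nn
        rw [mul_sum]
        refine sum_le_sum fun q _ => ?_
        rw [mul_sum]
        refine sum_le_sum fun q' _ => ?_
        split_ifs
        · rw [mul_right_comm, mul_right_comm D']; exact hh a _ _ ha
        · simp) (fun sub hs => h (G::sub) (hs.cons_cons G))
    have i2 := vals_pair hB Gs f (fun G hG' => hG G (by simp [hG'])) hf hh (fun sub hs => h sub (hs.cons G))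
    have e1 : ∑ v ∈ Vals (G::Gs), ∑ v' ∈ Vals (G::Gs), f v v' ≤ ∑ w ∈ Vals Gs, ∑ w' ∈ Vals Gs, (Nn G f w w' + B * f w w') := by
      rw [Vals]
      refine (img_sum_le _ _ _ fun b => sum_nonneg fun _ _ => hf _ _).trans ?_
      refine (sum_le_sum fun z _ => img_sum_le _ _ (fun b => f (z.2*(z.1-1)) b) fun b => hf _ _).trans ?_
      simp only [sum_product]
      rw [sum_comm]
      refine sum_le_sum fun w _ => ?_
      have : ∀ q ∈ G, ∑ q' ∈ G, ∑ w' ∈ Vals Gs, f (w*(q-1)) (w'*(q'-1)) = ∑ w' ∈ Vals Gs, ∑ q' ∈ G, f (w*(q-1)) (w'*(q'-1)) := fun q _ => sum_comm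
      rw [sum_congr rfl this, sum_comm]
      refine sum_le_sum fun w' _ => ?_
      have k : ∑ q ∈ G, f (w*(q-1)) (w'*(q-1)) ≤ B * f w w' := by
        refine le_trans (sum_le_sum fun q hq => hh (q-1) w w' ?_) ?_
        · have := (hG G (by simp)).1 q hq; omega
        · rw [← sum_mul]; exact mul_le_mul_of_nonneg_right (hG G (by simp)).2 (hf _ _)
      refine le_trans (le_of_eq ?_) (add_le_add_right k _)
      unfold Nn
      rw [← sum_add_distrib]
      refine sum_congr rfl fun q hq => ?_
      rw [← sum_erase_add _ _ hq]
      congr 1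
      rw [← sum_filter, filter_ne]
    refine e1.trans ?_
    simp only [sum_add_distrib, ← mul_sum]
    have := mul_le_mul_of_nonneg_left i2 hB
    rw [List.length_cons, pow_succ]
    linarith
lemma f0_nn (D D' : ℕ) : 0 ≤ f0 D D' := by unfold f0; split_ifs <;> positivity
lemma f0_hom (a D D' : ℕ) (ha : 1 ≤ a) : f0 (D*a) (D'*a) ≤ 1/(a:ℝ) * f0 D D' := by
  unfold f0
  by_cases h : D = D'
  · rw [if_pos h, if_pos (by rw [h])]; push_cast
    rw [one_div_mul_one_div_rev]
  · rw [if_neg h, if_neg fun h' => h (Nat.eq_of_mul_eq_mul_right ha h')]; simp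
lemma vals_step (G : Finset ℕ) (Gs : List (Finset ℕ)) (hG : ∀ q ∈ G, 2 ≤ q) (hGs : ∀ G ∈ Gs, ∀ q ∈ G, 2 ≤ q) :
    (∑ q ∈ G, 1/((q-1:ℕ):ℝ)) * (∑ v ∈ Vals Gs, 1/(v:ℝ)) - ∑ v ∈ Vals Gs, ∑ v' ∈ Vals Gs, Nn G f0 v v' ≤ ∑ v ∈ Vals (G::Gs), 1/(v:ℝ) := by
  refine le_trans ?_ (img_ge (G ×ˢ Vals Gs) (fun z => z.2*(z.1-1)) (fun v => 1/(v:ℝ)) fun b => by positivity)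
  refine sub_le_sub (le_of_eq ?_) ?_
  · rw [sum_mul_sum, sum_product]
    refine sum_congr rfl fun q _ => sum_congr rfl fun v _ => ?_
    push_cast; rw [one_div_mul_one_div_rev]
  · simp only [sum_product]
    rw [sum_comm]
    refine sum_le_sum fun w hw => ?_
    unfold Nn
    rw [sum_comm (s := Vals Gs)]
    refine sum_le_sum fun q hq => ?_
    rw [sum_comm]
    refine sum_le_sum fun w' hw' => sum_le_sum fun q' hq' => ?_
    by_cases h : (q,w) ≠ (q',w') ∧ w*(q-1) = w'*(q'-1)
    · have : q ≠ q' := by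
        rintro rfl
        have := hG q hq
        exact h.1 (by rw [Nat.eq_of_mul_eq_mul_right (by omega) h.2])
      rw [if_pos h, if_pos this, f0, if_pos h.2]
    · rw [if_neg h]; split_ifs
      · exact f0_nn _ _
      · exact le_rfl
lemma vals_lower {B ε : ℝ} (hB : 0 ≤ B) (hε : 0 ≤ ε) : ∀ (Gs : List (Finset ℕ)),
    (∀ G ∈ Gs, (∀ q ∈ G, 2 ≤ q) ∧ ∑ q ∈ G, 1/((q-1:ℕ):ℝ) ≤ B ∧ 2 ≤ ∑ q ∈ G, 1/((q-1:ℕ):ℝ)) →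
    (∀ sub, sub.Sublist Gs → sub ≠ [] → NF sub f0 ≤ ε) → (1+B)^Gs.length*ε ≤ 1/2 →
    1 ≤ (Gs.map fun G => (∑ q ∈ G, 1/((q-1:ℕ):ℝ))/2).prod ∧ (Gs.map fun G => (∑ q ∈ G, 1/((q-1:ℕ):ℝ))/2).prod ≤ ∑ v ∈ Vals Gs, 1/(v:ℝ)
  | [], _, _, _ => by simp [Vals]
  | G :: Gs, hG, hN, he => by
    have p1 : (1+B)^Gs.length*ε ≤ 1/2 := by
      refine le_trans (mul_le_mul_of_nonneg_right ?_ hε) he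
      exact pow_le_pow_right₀ (by linarith) (by simp)
    obtain ⟨i0, i1⟩ := vals_lower hB hε Gs (fun G h => hG G (by simp [h])) (fun sub h => hN sub (h.cons G)) p1
    have s1 := vals_step G Gs (hG G (by simp)).1 fun G h => (hG G (by simp [h])).1
    have s2 := vals_pair (B := B) (ε := ε) hB Gs (Nn G f0) (fun G h => ⟨(hG G (by simp [h])).1, (hG G (by simp [h])).2.1⟩)
      (fun D D' => sum_nonneg fun q _ => sum_nonneg fun q' _ => by
        split_ifs
        · exact f0_nn _ _
        · exact le_rfl) (fun a D D' ha => by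
        unfold Nn
        rw [mul_sum]
        refine sum_le_sum fun q _ => ?_
        rw [mul_sum]
        refine sum_le_sum fun q' _ => ?_
        split_ifs
        · rw [mul_right_comm, mul_right_comm D']; exact f0_hom a _ _ ha
        · simp) (fun sub hs => hN (G::sub) (hs.cons_cons G) (by simp))
    have w := (hG G (by simp)).2.2
    rw [List.map_cons, List.prod_cons]
    generalize (∑ q ∈ G, 1/((q-1:ℕ):ℝ)) = W at *
    generalize (Gs.map fun G => (∑ q ∈ G, 1/((q-1:ℕ):ℝ))/2).prod = P at *
    constructor
    · nlinarith
    · have : W*P ≤ W*(∑ v ∈ Vals Gs, 1/(v:ℝ)) := mul_le_mul_of_nonneg_left i1 (by linarith)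
      have : 2*1 ≤ W*P := mul_le_mul w i0 (by norm_num) (by linarith)
      linarith
end FordT

namespace FordT
open Real Finset
lemma cw_ge (t0 : ℕ) (r : List ℕ) (p : ℕ) (hs : r.Pairwise (· ≤ ·)) (hT : ¬ p ≤ ⌊E t0⌋₊) :
    1 + (r.map fun g : ℕ => if p ≤ ⌊E g⌋₊ then (1:ℝ) else 0).sum ≤ cw ⌊E t0⌋₊ r p := by
  induction r with
  | nil => simp [cw]
  | cons g r ih =>
    have hp := List.pairwise_cons.1 hs
    have ih := ih hp.2
    simp only [cw, List.map_cons, List.sum_cons]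
    rw [if_neg hT, mul_one]
    by_cases hG : p ≤ ⌊E g⌋₊
    · have e : (r.map fun g : ℕ => if p ≤ ⌊E g⌋₊ then (1:ℝ) else 0).sum = r.length := by
        rw [List.map_congr_left (g := fun _ => (1:ℝ)) fun x hx => if_pos (hG.trans (Nat.floor_mono (E_mono (by exact_mod_cast hp.1 x hx))))]
        simp
      rw [if_pos hG, if_pos hG, exp_lam]
      rw [e] at ih ⊢
      have : (1 + (r.length:ℝ)) * ((r.length+2)/(r.length+1)) = 1 + (1 + r.length) := by field_simp; ring
      rw [← this]
      exact mul_le_mul_of_nonneg_right ih (by positivity)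
    · rw [if_neg hG, if_neg hG]; linarith
lemma Lh_le {e : ℝ} (he : 0 ≤ e) (t0 G n : ℕ) (s : List ℕ) (r : List ℕ)
    (h : ∀ t : ℕ, (Om t n:ℝ) ≤ (min t G : ℕ) + (s.map fun g => ((min t g : ℕ):ℝ)).sum + e) :
    Lh t0 r n ≤ Hh r G + (s.map (Hh r)).sum + r.length * e := by
  induction r with
  | nil => simp [Hh, Lh]
  | cons g r ih =>
    simp only [Hh, Lh, List.length_cons, List.sum_map_add, List.sum_map_mul_left]
    have h1 : (Om g n : ℝ) - Om t0 n ≤ (min g G : ℕ) + (s.map fun x => ((min g x : ℕ):ℝ)).sum + e := by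
      linarith [h g, Nat.cast_nonneg (α := ℝ) (Om t0 n)]
    have h2 := mul_le_mul_of_nonneg_left h1 (lam_nonneg r.length)
    have h3 := mul_le_mul_of_nonneg_right (lam_le r.length) he
    push_cast at *
    linarith
lemma Uu_bd : ∃ C : ℝ, 1 ≤ C ∧ ∀ (η : ℝ) (t0 G : ℕ) (s : List ℕ), 0 ≤ η → s.Pairwise (· ≥ ·) →
    (∀ g ∈ s, t0 ≤ g ∧ g ≤ G) → (s.length:ℝ) + 1 ≤ ⌊E t0⌋₊/2 → ∀ Q : Finset ℕ,
    (∀ n ∈ Q, n ≠ 0 ∧ (∀ p, p.Prime → p ∣ n → p ≤ ⌊E G⌋₊) ∧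
      ∀ t : ℕ, (Om t n:ℝ) ≤ (min t G : ℕ) + (s.map fun g => ((min t g : ℕ):ℝ)).sum + η*((s.length:ℝ)+1)*G) →
    ∀ c : ℕ → ℝ, (∀ p, 0 ≤ c p) → (∀ p, c p ≤ 1 + (s.map fun g : ℕ => if p ≤ ⌊E g⌋₊ then (1:ℝ) else 0).sum) →
    Uu Q (hh c) 1 1 ≤ exp (G + Wf (fun g => (g:ℝ)) 1 s + 2*(s.map fun g : ℕ => (g:ℝ)).sum + C * ((s.length:ℝ)+1)^2 * (t0 + η*G + 1)) := by
  obtain ⟨C, hC, hPR⟩ := PRE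
  refine ⟨C + 6, by linarith, fun η t0 G s hη hs hg hlen Q hQ c hc0 hc => ?_⟩
  obtain ⟨r, hr⟩ : ∃ r, r = s.reverse := ⟨_, rfl⟩
  have hsr : s = r.reverse := by rw [hr, List.reverse_reverse]
  subst hsr
  rw [List.pairwise_reverse] at hs
  simp only [List.map_reverse, List.sum_reverse, List.length_reverse, List.mem_reverse] at *
  rw [← Wr_eq]
  obtain ⟨m, hm⟩ : ∃ m : ℝ, m = (r.length:ℝ)+1 := ⟨_, rfl⟩
  have hm1 : 1 ≤ m := by rw [hm]; linarith [Nat.cast_nonneg (α := ℝ) r.length]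
  rw [← hm]
  simp only [← hm] at hQ
  have hcb := fun p => cw_bd t0 r p fun g h => (hg g h).1
  have hrk := cw_rk hPR t0 G r (fun g h => (hg g h).1) hlen Q fun v hv => ⟨(hQ v hv).1, fun p hp hd =>
    ((hQ v hv).2.1 p hp hd).trans (Nat.floor_mono (E_mono (by linarith)))⟩
  have he : 0 ≤ η*m*G := by positivity
  have hst : (r.map fun g : ℕ => ((min t0 g : ℕ):ℝ)).sum ≤ r.length * t0 := by
    have : (r.map fun g : ℕ => ((min t0 g : ℕ):ℝ)).sum ≤ (r.map fun g : ℕ => (t0:ℝ)).sum :=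
      List.sum_le_sum fun g _ => by exact_mod_cast min_le_left t0 g
    simpa using this
  have key : ∀ n ∈ Q, hh c n * hh c n / n ≤ exp (2*m*(m*t0+η*m*G) + (Wr (fun g => (g:ℝ)) r + (r.map fun g : ℕ => (g:ℝ)).sum + r.length*(η*m*G))) * (mval (fun p e => cw ⌊E t0⌋₊ r p ^ e) n / n) := by
    intro n hn
    obtain ⟨h0, h1, h2⟩ := hQ n hn
    have a1 : hh c n ≤ exp (log m * Om t0 n) * mval (fun p e => cw ⌊E t0⌋₊ r p ^ e) n := by
      rw [← mval_Om, ← mval_mulfun]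
      refine mval_le (fun p e _ _ => pow_nonneg (hc0 p) e) (fun p e _ _ => ?_) n
      rw [← mul_pow]
      refine pow_le_pow_left₀ (hc0 p) ?_ e
      by_cases hT : p ≤ ⌊E t0⌋₊
      · rw [if_pos hT, (hcb p).2.2.1 hT, mul_one, exp_log (by linarith)]
        refine (hc p).trans ?_
        have : (r.map fun g : ℕ => if p ≤ ⌊E g⌋₊ then (1:ℝ) else 0).sum ≤ (r.map fun g : ℕ => (1:ℝ)).sum :=
          List.sum_le_sum fun g _ => by split_ifs <;> norm_num
        simp only [List.map_const', List.sum_replicate, nsmul_eq_mul, mul_one] at this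
        linarith
      · rw [if_neg hT, one_mul]; exact (hc p).trans (cw_ge t0 r p hs hT)
    have a2 : log m * Om t0 n ≤ m * (m*t0+η*m*G) := by
      refine mul_le_mul ((Real.log_le_sub_one_of_pos (by linarith)).trans (by linarith)) ?_ (Nat.cast_nonneg _) (by linarith)
      have : ((min t0 G:ℕ):ℝ) ≤ t0 := by exact_mod_cast min_le_left _ _
      have := h2 t0
      rw [hm] at *
      linarith
    have a3 : mval (fun p e => cw ⌊E t0⌋₊ r p ^ e) n ≤ exp (Wr (fun g => (g:ℝ)) r + (r.map fun g : ℕ => (g:ℝ)).sum + r.length*(η*m*G)) := by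
      rw [hv_eq, ← DD_eq G r hs fun g h => (hg g h).2]
      exact exp_le_exp.2 (Lh_le he t0 G n r r h2)
    have hn0 := hh_nn hc0 n
    generalize mval (fun p e => cw ⌊E t0⌋₊ r p ^ e) n = v at *
    have hv : 0 ≤ v := nonneg_of_mul_nonneg_right (hn0.trans a1) (exp_pos _)
    have a4 := a1.trans (mul_le_mul_of_nonneg_right (exp_le_exp.2 a2) hv)
    rw [← mul_div_assoc]
    refine div_le_div_of_nonneg_right ((mul_le_mul a4 a4 hn0 (by positivity)).trans ?_) (Nat.cast_nonneg _)
    rw [exp_add, show 2*m*(m*t0+η*m*G) = m * (m*t0+η*m*G) + m * (m*t0+η*m*G) by ring, exp_add]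
    have := mul_le_mul_of_nonneg_left a3 (show 0 ≤ exp (m * (m*t0+η*m*G)) * exp (m * (m*t0+η*m*G)) * v by positivity)
    linarith
  have hU : Uu Q (hh c) 1 1 = ∑ n ∈ Q, hh c n * hh c n / n := by simp [Uu]
  rw [hU]
  refine (sum_le_sum key).trans ?_
  rw [← mul_sum]
  refine (mul_le_mul_of_nonneg_left hrk (exp_pos _).le).trans ?_
  rw [← exp_add]
  apply exp_le_exp.2
  have b3 : m ≤ m^2 := by nlinarith only [hm1]
  have b1 := mul_le_mul_of_nonneg_right b3 he
  have b4 : m * C ≤ m^2 * C := mul_le_mul_of_nonneg_right b3 (by linarith)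
  have b2 : 0 ≤ m^2 * (η*G) := by positivity
  have b0 : 0 ≤ m^2 * t0 := by positivity
  have b5 : 0 ≤ (C-1)*(m^2*(t0+η*G)) := mul_nonneg (by linarith) (by positivity)
  have b6 : (r.length:ℝ) = m - 1 := by rw [hm]; ring
  rw [← hm, b6]
  nlinarith only [b1, b2, b3, b4, b5, b0, he, hm1]
lemma chain {G : ℕ → Finset ℕ} {Z P0 : ℕ → ℕ} {K : ℕ → ℝ} {cm : ℝ} {Q : Finset ℕ} (hK : ∀ j, 0 ≤ K j)
    (hl : ∀ j (c : ℕ → ℝ), (∀ p, 0 ≤ c p) → (∀ p, c p ≤ cm) → ∀ D D', (∀ P, P.Prime → P0 j ≤ P → ¬ P ∣ D ∧ ¬ P ∣ D') →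
      Nn (G j) (Uu Q (hh c)) D D' ≤ K j * Uu Q (hh (cp c (Z j))) D D')
    (hsep : ∀ j j', j < j' → ∀ q ∈ G j', 2 ≤ q ∧ q ≤ P0 j) : ∀ (js : List ℕ) (c : ℕ → ℝ), js.Pairwise (· < ·) → (∀ p, 0 ≤ c p) → (∀ p, c p + js.length ≤ cm) →
    NF (js.map G) (Uu Q (hh c)) ≤ (js.map K).prod * Uu Q (hh fun p => c p + (js.map fun j => if p ≤ Z j then (1:ℝ) else 0).sum) 1 1
  | [], c, _, _, _ => by simp [NF]
  | j :: js, c, hj, hc, hcm => by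
    have hp := List.pairwise_cons.1 hj
    have hd : ∀ l : List ℕ, (∀ i ∈ l, j < i) → ∀ D ∈ Vals (l.map G), ∀ P : ℕ, P.Prime → P0 j ≤ P → ¬ P ∣ D := by
      intro l
      induction l with
      | nil => intro _ D hD P hP _; rw [List.map_nil, Vals, mem_singleton] at hD; rw [hD]; exact hP.one_lt.ne' ∘ Nat.dvd_one.1
      | cons i l ih =>
        intro hl D hD P hP hPP hdv
        obtain ⟨⟨q, w⟩, hz, rfl⟩ := mem_image.1 hD
        have hz := mem_product.1 hz
        rcases hP.dvd_mul.1 hdv with h | h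
        · exact ih (fun i hi => hl i (by simp [hi])) w hz.2 P hP hPP h
        · have h2 := hsep j i (hl i (by simp)) q hz.1
          have := Nat.le_of_dvd (by simp only at *; omega) h
          simp only at *; omega
    have h1 : NF ((j::js).map G) (Uu Q (hh c)) ≤ NF (js.map G) (fun D D' => K j * Uu Q (hh (cp c (Z j))) D D') :=
      NF_mono _ _ _ fun D hD D' hD' => hl j c hc (fun p => by linarith [hcm p, Nat.cast_nonneg (α := ℝ) (j::js).length]) D D' fun P hP hPP =>
        ⟨hd js hp.1 D hD P hP hPP, hd js hp.1 D' hD' P hP hPP⟩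
    rw [NF_smul] at h1
    have h2 := chain hK hl hsep js (cp c (Z j)) hp.2 (cp_nn hc _) fun p => by
      have := hcm p
      rw [List.length_cons] at this
      push_cast at this
      unfold cp
      split_ifs <;> linarith
    refine h1.trans ((mul_le_mul_of_nonneg_left h2 (hK j)).trans (le_of_eq ?_))
    rw [List.map_cons, List.prod_cons, mul_assoc]
    simp only [cp, List.map_cons, List.sum_cons, add_assoc]
end FordT

namespace FordT
open Real Finset
lemma Vals_Om {η : ℝ} {G : ℕ → Finset ℕ} {b : ℕ → ℕ}
    (hG : ∀ j, ∀ q ∈ G j, 2 ≤ q ∧ q ≤ ⌊E (b j)⌋₊ ∧ ∀ t : ℕ, (Om t (q-1):ℝ) ≤ (min t (b j):ℕ) + η*b j) :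
    ∀ js : List ℕ, ∀ D ∈ Vals (js.map G), D ≠ 0 ∧ (∀ p, p.Prime → p ∣ D → ∃ j ∈ js, p ≤ ⌊E (b j)⌋₊) ∧
      ∀ t : ℕ, (Om t D:ℝ) ≤ (js.map fun j => ((min t (b j):ℕ):ℝ)).sum + (js.map fun j => η*b j).sum
  | [], D, hD => by
    rw [List.map_nil, Vals, mem_singleton] at hD
    subst hD
    exact ⟨one_ne_zero, fun p hp h => absurd (Nat.dvd_one.1 h) hp.one_lt.ne', fun t => by simp [Om]⟩
  | j :: js, D, hD => by
    obtain ⟨⟨q, w⟩, hz, rfl⟩ := mem_image.1 hD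
    have hz := mem_product.1 hz
    obtain ⟨g1, g2, g3⟩ := hG j q hz.1
    obtain ⟨w1, w2, w3⟩ := Vals_Om hG js w hz.2
    have hq : q - 1 ≠ 0 := by omega
    refine ⟨mul_ne_zero w1 hq, fun p hp h => ?_, fun t => ?_⟩
    · rcases hp.dvd_mul.1 h with h | h
      · obtain ⟨i, hi, h⟩ := w2 p hp h
        exact ⟨i, by simp [hi], h⟩
      · exact ⟨j, by simp, (Nat.le_of_dvd (by omega) h).trans ((Nat.sub_le _ _).trans g2)⟩
    · simp only [List.map_cons, List.sum_cons]
      rw [Om_mul t w1 hq]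
      push_cast
      have := g3 t; have := w3 t
      push_cast at *
      linarith
open Classical in
lemma NF_bd : ∃ C : ℝ, 1 ≤ C ∧ ∀ (η : ℝ) (t0 : ℕ) (G : ℕ → Finset ℕ) (b P0 : ℕ → ℕ) (K : ℕ → ℝ) (cm : ℝ), 0 ≤ η → (∀ j, 0 ≤ K j) →
    (∀ i j, i < j → b j ≤ b i) →
    (∀ j, ∀ q ∈ G j, 2 ≤ q ∧ q ≤ ⌊E (b j)⌋₊ ∧ ∀ t : ℕ, (Om t (q-1):ℝ) ≤ (min t (b j):ℕ) + η*b j) →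
    (∀ Q : Finset ℕ, (∀ n ∈ Q, n ≠ 0 ∧ ∀ d, d ∣ n → d ∈ Q) → ∀ j (c : ℕ → ℝ), (∀ p, 0 ≤ c p) → (∀ p, c p ≤ cm) → ∀ D D', (∀ P, P.Prime → P0 j ≤ P → ¬ P ∣ D ∧ ¬ P ∣ D') →
      Nn (G j) (Uu Q (hh c)) D D' ≤ K j * Uu Q (hh (cp c ⌊E (b j)⌋₊)) D D') →
    (∀ j j', j < j' → ∀ q ∈ G j', 2 ≤ q ∧ q ≤ P0 j) →
    ∀ (j0 : ℕ) (rest : List ℕ), (j0::rest).Pairwise (· < ·) → (∀ j ∈ rest, t0 ≤ b j) → (rest.length:ℝ) + 1 ≤ ⌊E t0⌋₊/2 → (rest.length:ℝ) + 1 ≤ cm →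
    NF ((j0::rest).map G) f0 ≤ ((j0::rest).map K).prod * exp (b j0 + Wf (fun g => (g:ℝ)) 1 (rest.map b) + 2*((rest.map b).map fun g : ℕ => (g:ℝ)).sum + C * ((rest.length:ℝ)+1)^2 * (t0 + η*b j0 + 1)) := by
  obtain ⟨C, hC, hU⟩ := Uu_bd
  refine ⟨C, hC, fun η t0 G b P0 K cm hη hK hb hG hl hsep j0 rest hj ht hlen hcm => ?_⟩
  have hp := List.pairwise_cons.1 hj
  have hbz : ∀ j ∈ rest, b j ≤ b j0 := fun j h => hb _ _ (hp.1 j h)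
  have hsum : (rest.map fun j => η*(b j:ℝ)).sum ≤ rest.length * (η*b j0) := by
    have : (rest.map fun j => η*(b j:ℝ)).sum ≤ (rest.map fun j => η*(b j0:ℝ)).sum :=
      List.sum_le_sum fun j h => mul_le_mul_of_nonneg_left (by exact_mod_cast hbz j h) hη
    simpa using this
  obtain ⟨pr, hpr⟩ : ∃ pr : ℕ → Prop, pr = fun n => (∀ p, p.Prime → p ∣ n → p ≤ ⌊E (b j0)⌋₊) ∧
      ∀ t : ℕ, (Om t n:ℝ) ≤ (min t (b j0) : ℕ) + ((rest.map b).map fun g => ((min t g : ℕ):ℝ)).sum + η*((rest.length:ℝ)+1)*b j0 := ⟨_, rfl⟩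
  obtain ⟨Q, hQ⟩ : ∃ Q, Q = (Icc 1 ((Vals ((j0::rest).map G)).sup id)).filter pr := ⟨_, rfl⟩
  have hQ1 : ∀ n ∈ Q, n ≠ 0 ∧ ∀ d, d ∣ n → d ∈ Q := by
    intro n hn
    rw [hQ, mem_filter, mem_Icc, hpr] at hn
    refine ⟨by omega, fun d hd => ?_⟩
    rw [hQ, mem_filter, mem_Icc, hpr]
    obtain ⟨⟨n1, n2⟩, n3, n4⟩ := hn
    refine ⟨⟨Nat.pos_of_dvd_of_pos hd n1, (Nat.le_of_dvd n1 hd).trans n2⟩, fun p hp h => n3 p hp (h.trans hd), fun t => le_trans ?_ (n4 t)⟩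
    obtain ⟨k, rfl⟩ := hd
    rw [Om_mul t (fun h => by simp [h] at n1) (fun h => by simp [h] at n1)]
    push_cast; linarith [Nat.cast_nonneg (α := ℝ) (Om t k)]
  have hVQ : ∀ D ∈ Vals ((j0::rest).map G), D ∈ Q := by
    intro D hD
    obtain ⟨v1, v2, v3⟩ := Vals_Om hG (j0::rest) D hD
    rw [hQ, mem_filter, mem_Icc, hpr]
    refine ⟨⟨by omega, le_sup (f := id) hD⟩, fun p hp h => ?_, fun t => (v3 t).trans ?_⟩
    · obtain ⟨j, hj, h⟩ := v2 p hp h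
      refine h.trans (Nat.floor_mono (E_mono ?_))
      rcases List.mem_cons.1 hj with rfl | hj
      · exact le_rfl
      · exact_mod_cast hbz j hj
    · simp only [List.map_cons, List.sum_cons, List.map_map, Function.comp_def]
      linarith
  have hQ2 := hU η t0 (b j0) (rest.map b) hη (List.pairwise_map.2 (hp.2.imp fun h => hb _ _ h)) (fun g hg => by
      obtain ⟨j, hj, rfl⟩ := List.mem_map.1 hg
      exact ⟨ht j hj, hbz j hj⟩) (by rwa [List.length_map]) Q (fun n hn => by
      have := hn
      rw [hQ, mem_filter, mem_Icc, hpr] at hn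
      rw [List.length_map]
      exact ⟨(hQ1 n this).1, hn.2⟩) (fun p => 0 + ((j0::rest).map fun j => if p ≤ ⌊E (b j)⌋₊ then (1:ℝ) else 0).sum)
      (fun p => by
        rw [zero_add]
        exact List.sum_nonneg fun x hx => by
          obtain ⟨j, _, rfl⟩ := List.mem_map.1 hx
          split_ifs <;> norm_num) (fun p => by
        simp only [List.map_cons, List.sum_cons, List.map_map, Function.comp_def, zero_add]
        split_ifs <;> linarith)
  have hc := chain hK (hl Q hQ1) hsep (j0::rest) (fun _ => 0) hj (fun _ => le_rfl) (fun p => by simpa using hcm)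
  have hst : NF ((j0::rest).map G) f0 ≤ NF ((j0::rest).map G) (Uu Q (hh fun _ => 0)) := by
    refine NF_mono _ _ _ fun D hD D' hD' => ?_
    unfold f0
    split_ifs with h
    · subst h
      have hD0 := (hQ1 D (hVQ D hD)).1
      refine le_trans (le_of_eq ?_) (single_le_sum (f := fun n => if D ∣ n ∧ D ∣ n then hh (fun _ => 0) (n/D) * hh (fun _ => 0) (n/D) / (n:ℝ) else 0) (fun n _ => ?_) (hVQ D hD))
      · simp only [dvd_refl, and_self, if_true]
        rw [Nat.div_self (Nat.pos_of_ne_zero hD0), hh, mval_one, mul_one]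
      · split_ifs
        · have := hh_nn (c := fun _ => 0) (fun _ => le_rfl) (n/D); positivity
        · exact le_rfl
    · exact Uu_nn (hh_nn fun _ => le_rfl) _ _
  refine hst.trans (hc.trans (mul_le_mul_of_nonneg_left ?_ (List.prod_nonneg fun x hx => by
    obtain ⟨j, _, rfl⟩ := List.mem_map.1 hx
    exact hK j)))
  rw [List.length_map] at hQ2
  exact hQ2
end FordT

namespace FordT
open Real Finset Filter
lemma hpf_aux {a b q : ℕ} {η : ℝ} (hη : η ≤ 1/2) (ha : 2 ≤ a) (hq : q.Prime) (hN : Nrm η q) (h1 : a ≤ gw q) (h2 : gw q + 1 ≤ b) :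
    (3 ≤ q ∧ q ≤ ⌊E b⌋₊) ∧ ∃ P, P.Prime ∧ ⌈exp (exp a/(3*b))⌉₊ ≤ P ∧ P ∣ q-1 := by
  have hg2 : (2:ℝ) ≤ gw q := by exact_mod_cast ha.trans h1
  have hll : (gw q:ℝ) ≤ log (log q) := Nat.floor_le (by
    by_contra h
    have : gw q = 0 := Nat.floor_of_nonpos (not_le.1 h).le
    rw [this] at hg2; norm_num at hg2)
  have hlq : exp (gw q) ≤ log q := by
    have : 0 < log q := by
      by_contra h
      have h' : log q = 0 := le_antisymm (not_lt.1 h) (Real.log_natCast_nonneg q)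
      rw [h', Real.log_zero] at hll; linarith
    exact (Real.le_log_iff_exp_le this).1 hll
  have he7 : (7:ℝ) < exp (gw q) := by
    have : exp 2 = exp 1 * exp 1 := by rw [← exp_add]; norm_num
    have h3 := exp_le_exp.2 hg2
    nlinarith [exp_one_gt_d9]
  have hq3 : 3 ≤ q := by
    by_contra h
    have : (q:ℝ) ≤ 2 := by exact_mod_cast (by omega : q ≤ 2)
    have := Real.log_le_sub_one_of_pos (show (0:ℝ) < q by exact_mod_cast hq.pos)
    linarith
  have hq1 : (1:ℝ) < q := by exact_mod_cast (by omega)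
  have hqE : (q:ℝ) ≤ E (gw q + 1 : ℕ) := by
    conv_lhs => rw [← E_loglog hq1]
    push_cast
    exact E_mono (Nat.lt_floor_add_one _).le
  refine ⟨⟨hq3, Nat.le_floor (hqE.trans (E_mono (by exact_mod_cast h2)))⟩, ?_⟩
  by_contra hcon
  push Not at hcon
  have hb0 : (0:ℝ) < b := by exact_mod_cast (by omega : 0 < b)
  have k1 := log_le_Om (t := gw q + 1) (n := q-1) (M := exp a/(3*b)) (by omega) ((Nat.sub_le _ _).trans (Nat.le_floor hqE)) fun p hp hd => by
    have h3 : p < ⌈exp (exp a/(3*b))⌉₊ := by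
      by_contra h; exact hcon p hp (not_lt.1 h) hd
    have h4 := Nat.lt_ceil.1 h3
    rw [← Real.log_exp (exp a/(3*b))]
    exact Real.log_le_log (by exact_mod_cast hp.pos) h4.le
  have k2 := (abs_le.1 (hN (gw q + 1))).2
  rw [min_eq_right (Nat.le_succ _)] at k2
  have k3 : (Om (gw q+1) (q-1):ℝ) ≤ 2 * gw q := by nlinarith
  have k4 : exp (a:ℝ) ≤ exp (gw q) := exp_le_exp.2 (by exact_mod_cast h1)
  have k5 : (gw q:ℝ) ≤ b := by exact_mod_cast (by omega)
  have k6 : log q ≤ log ((q-1:ℕ):ℝ) + 1 := by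
    have hp : (0:ℝ) < ((q-1:ℕ):ℝ) := by exact_mod_cast (by omega : 0 < q-1)
    have e : (q:ℝ) ≤ ((q-1:ℕ):ℝ) * 2 := by exact_mod_cast (by omega : q ≤ (q-1)*2)
    have := Real.log_le_log (by linarith) e
    rw [Real.log_mul hp.ne' (by norm_num)] at this
    linarith [Real.log_two_lt_d9]
  have k7 : (Om (gw q+1) (q-1):ℝ) * (exp a/(3*b)) ≤ 2*b*(exp a/(3*b)) := mul_le_mul_of_nonneg_right (by linarith) (by positivity)
  have k8 : 2*b*(exp a/(3*b)) = 2/3*exp (a:ℝ) := by field_simp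
  linarith
lemma lev : ∃ C : ℝ, 1 ≤ C ∧ ∃ a0 : ℕ, 2 ≤ a0 ∧ ∀ (a b : ℕ) (η cm : ℝ) (G : Finset ℕ), a0 ≤ a → 2*b ≤ 3*a → η ≤ 1/2 → 1 ≤ cm →
    (∀ q ∈ G, q.Prime ∧ Nrm η q ∧ a ≤ gw q ∧ gw q + 1 ≤ b) →
    ∀ Q : Finset ℕ, (∀ n ∈ Q, n ≠ 0 ∧ ∀ d, d ∣ n → d ∈ Q) → ∀ (c : ℕ → ℝ), (∀ p, 0 ≤ c p) → (∀ p, c p ≤ cm) → ∀ D D',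
      (∀ P, P.Prime → ⌈exp (exp a/(3*b))⌉₊ ≤ P → ¬ P ∣ D ∧ ¬ P ∣ D') →
      Nn G (Uu Q (hh c)) D D' ≤ (C*cm^2*((b:ℝ)+1)^10*exp (-(2*a))) * Uu Q (hh (cp c ⌊E b⌋₊)) D D' := by
  obtain ⟨C1, Y1, hC1, hY1, s1⟩ := recip_sieve 1 le_rfl
  obtain ⟨C2, Y2, hC2, hY2, s2⟩ := recip_sieve 2 (by norm_num)
  have hev : ∀ᶠ a : ℕ in atTop, 324*(a:ℝ)^3 ≤ exp a ∧ (log (max Y1 Y2) * 6) * a ≤ exp a ∧ 2 ≤ a := by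
    have hev : ∀ᶠ G : ℝ in atTop, 324*G^3 ≤ exp G ∧ (log (max Y1 Y2) * 6) * G ≤ exp G ∧ 2 ≤ G := by
      filter_upwards [ev_pow_exp 2 1 one_pos, ev_pow_exp 4 1 one_pos, eventually_ge_atTop (log (max Y1 Y2) * 6), eventually_ge_atTop (324:ℝ)] with G h1 h2 h3 h4
      rw [one_mul] at h1 h2
      have h5 : 0 ≤ G^3 := by positivity
      exact ⟨le_trans (by nlinarith) h2, le_trans (by nlinarith) h1, by linarith⟩
    filter_upwards [tendsto_natCast_atTop_atTop.eventually hev] with a h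
    exact ⟨h.1, h.2.1, by exact_mod_cast h.2.2⟩
  obtain ⟨a0, ha0⟩ := eventually_atTop.1 hev
  refine ⟨18*C2+9*C1^2, by nlinarith, max a0 2, le_max_right _ _, fun a b η cm G ha hb hη hcm hG Q hQ c hc hc' D D' hD => ?_⟩
  obtain ⟨e1, e2, e3⟩ := ha0 a ((le_max_left _ _).trans ha)
  rcases G.eq_empty_or_nonempty with rfl | ⟨q0, hq0⟩
  · have : Nn ∅ (Uu Q (hh c)) D D' = 0 := by simp [Nn]
    rw [this]; exact mul_nonneg (by positivity) (Uu_nn (hh_nn (cp_nn hc _)) _ _)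
  have hab : a + 1 ≤ b := by have := hG q0 hq0; omega
  have ha' : (2:ℝ) ≤ a := by exact_mod_cast e3
  have hbR : 2*(b:ℝ) ≤ 3*a := by exact_mod_cast hb
  have hb0 : (1:ℝ) ≤ b := by exact_mod_cast (by omega : 1 ≤ b)
  have hgq : ∀ q ∈ G, (3 ≤ q ∧ q ≤ ⌊E b⌋₊) ∧ ∃ P, P.Prime ∧ ⌈exp (exp a/(3*b))⌉₊ ≤ P ∧ P ∣ q-1 := fun q hq => by
    obtain ⟨g1, g2, g3, g4⟩ := hG q hq
    exact hpf_aux hη e3 g1 g2 g3 g4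
  obtain ⟨M, hM⟩ : ∃ M, M = exp (a:ℝ)/(3*b) := ⟨_, rfl⟩
  rw [← hM] at hD
  simp only [← hM] at hgq
  have hM0 : 0 < M := by rw [hM]; positivity
  have hPe : exp M ≤ (⌈exp M⌉₊:ℝ) := Nat.le_ceil _
  obtain ⟨P0, hP0⟩ : ∃ P0, P0 = ⌈exp M⌉₊ := ⟨_, rfl⟩
  rw [← hP0] at hD hPe
  simp only [← hP0] at hgq
  have hlP : M ≤ log P0 := by rw [Real.le_log_iff_exp_le ((exp_pos _).trans_le hPe)]; exact hPe
  have hY : max Y1 Y2 ≤ P0 := by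
    refine le_trans ?_ hPe
    rw [← Real.log_le_iff_le_exp (by positivity), hM, le_div_iff₀ (by positivity)]
    have := Real.log_nonneg (show 1 ≤ max Y1 Y2 from le_max_of_le_left (by linarith))
    nlinarith
  have hcube : 3*exp (b:ℝ) ≤ (log P0)^3 := by
    refine le_trans ?_ (pow_le_pow_left₀ hM0.le hlP 3)
    rw [hM, div_pow, le_div_iff₀ (by positivity), ← exp_nat_mul]
    have x1 : exp (b:ℝ) * exp (a:ℝ) ≤ exp ((3:ℕ)*(a:ℝ)) := by rw [← exp_add]; exact exp_le_exp.2 (by push_cast; linarith)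
    have x2 : (b:ℝ)^3 ≤ 4*(a:ℝ)^3 := by
      have := pow_le_pow_left₀ (by linarith) (show (b:ℝ) ≤ 3/2*a by linarith) 3
      have h : 0 ≤ (a:ℝ)^3 := by positivity
      nlinarith
    have x3 := mul_le_mul_of_nonneg_left (show 81*(b:ℝ)^3 ≤ exp a by linarith) (exp_pos (b:ℝ)).le
    linarith
  have hs : ∀ s P : ℕ, 1 ≤ s → P.Prime → P*s+1 ∈ G → log s ≤ exp b := by
    intro s P h1 hP h
    have h2 := (hgq _ h).1.2
    have h3 : s ≤ ⌊E b⌋₊ := le_trans (by nlinarith [hP.two_le]) h2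
    have h4 := Real.log_le_log (by exact_mod_cast h1) ((Nat.le_floor_iff (E_pos _).le).1 h3)
    rwa [E, log_exp] at h4
  have hI : 1/M = 3*b*exp (-(a:ℝ)) := by rw [hM, exp_neg]; field_simp
  obtain ⟨B, hB⟩ : ∃ B : ℝ, B = (b:ℝ)+1 := ⟨_, rfl⟩
  have hB1 : 1 ≤ B := by linarith
  have hbB : (b:ℝ) ≤ B := by linarith
  refine (level hc hc' hQ (ε1 := 3*C1*B^5*exp (-(a:ℝ))) (ε2 := 9*C2*B^8*exp (-(a:ℝ))^2) (by positivity) (by positivity) (P0 := P0) (Z := ⌊E b⌋₊) (fun q hq => ⟨by linarith [(hgq q hq).1.1], (hgq q hq).1.2⟩) (fun q hq => (hgq q hq).2) ?_ ?_ hD).trans ?_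
  · intro s hs1
    rcases ((PL ⌊E b⌋₊).filter fun P => P0 ≤ P ∧ P*s+1 ∈ G).eq_empty_or_nonempty with h0 | ⟨P, hP⟩
    · rw [h0, sum_empty]; positivity
    rw [mem_filter] at hP
    have hl := hs s P hs1 (mem_PL.1 hP.1).2 hP.2.2
    refine (s1 P0 b ((le_max_left _ _).trans hY) {s} s (card_singleton _) (by omega) (by linarith [exp_pos (b:ℝ)]) (fun p hp hd => ⟨fun x hx => by rwa [mem_singleton.1 hx], fun x hx y hy hxy => absurd ((mem_singleton.1 hx).trans (mem_singleton.1 hy).symm) hxy⟩) _ (fun P hP => ?_)).trans ?_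
    · rw [mem_filter, mem_PL] at hP
      refine ⟨hP.1.2, fun x hx => ?_, by exact_mod_cast hP.2.1, (Nat.le_floor_iff (E_pos _).le).1 hP.1.1⟩
      rw [mem_singleton.1 hx, mul_comm]; exact (hG _ hP.2.2).1
    · rw [← hB, pow_one, div_eq_mul_one_div]
      have : 1/log P0 ≤ 3*B*exp (-(a:ℝ)) := (one_div_le_one_div_of_le hM0 hlP).trans (by rw [hI]; gcongr)
      refine (mul_le_mul_of_nonneg_left this (by positivity)).trans (le_of_eq ?_)
      norm_num; ring
  · intro s s' hs1 hs1' hne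
    rcases ((PL ⌊E b⌋₊).filter fun P => P0 ≤ P ∧ P*s+1 ∈ G ∧ P*s'+1 ∈ G).eq_empty_or_nonempty with h0 | ⟨P, hP⟩
    · rw [h0, sum_empty]; positivity
    rw [mem_filter] at hP
    have hl := hs s P hs1 (mem_PL.1 hP.1).2 hP.2.2.1
    have hl' := hs s' P hs1' (mem_PL.1 hP.1).2 hP.2.2.2
    have hd0 : ((s:ℤ)-s').natAbs ≠ 0 := by omega
    have hdl : log (((s:ℤ)-s').natAbs:ℕ) ≤ exp b := by
      rcases le_total s s' with h | h
      · exact (Real.log_le_log (by exact_mod_cast Nat.pos_of_ne_zero hd0) (by exact_mod_cast (by omega : ((s:ℤ)-s').natAbs ≤ s'))).trans hl'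
      · exact (Real.log_le_log (by exact_mod_cast Nat.pos_of_ne_zero hd0) (by exact_mod_cast (by omega : ((s:ℤ)-s').natAbs ≤ s))).trans hl
    refine (s2 P0 b ((le_max_right _ _).trans hY) {s,s'} (s*s'*((s:ℤ)-s').natAbs) (card_pair hne) (mul_ne_zero (mul_ne_zero (by omega) (by omega)) hd0) ?_ (fun p hp hd => ⟨fun x hx hpx => ?_, fun x hx y hy hxy hm => ?_⟩) _ (fun P hP => ?_)).trans ?_
    · push_cast [-Nat.cast_natAbs]
      rw [Real.log_mul (by positivity) (by exact_mod_cast hd0), Real.log_mul (by positivity) (by positivity)]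
      linarith
    · rcases mem_insert.1 hx with rfl | hx
      · exact hd (((hpx.mul_right _).mul_right _))
      · rw [mem_singleton.1 hx] at hpx; exact hd ((hpx.mul_left _).mul_right _)
    · have key : ∀ x y : ℕ, x ≡ y [MOD p] → p ∣ ((y:ℤ)-x).natAbs := fun x y h => Int.natCast_dvd.1 (Nat.modEq_iff_dvd.1 h)
      simp only [mem_insert, mem_singleton] at hx hy
      rcases hx with rfl | rfl <;> rcases hy with rfl | rfl
      · exact hxy rfl
      · exact hd ((key _ _ hm.symm).mul_left _)
      · exact hd ((key _ _ hm).mul_left _)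
      · exact hxy rfl
    · rw [mem_filter, mem_PL] at hP
      refine ⟨hP.1.2, fun x hx => ?_, by exact_mod_cast hP.2.1, (Nat.le_floor_iff (E_pos _).le).1 hP.1.1⟩
      rw [mul_comm]
      rcases mem_insert.1 hx with rfl | hx
      · exact (hG _ hP.2.2.1).1
      · rw [mem_singleton.1 hx]; exact (hG _ hP.2.2.2).1
    · rw [← hB, div_eq_mul_one_div, ← one_div_pow]
      have : 1/log P0 ≤ 3*B*exp (-(a:ℝ)) := (one_div_le_one_div_of_le hM0 hlP).trans (by rw [hI]; gcongr)
      have := pow_le_pow_left₀ (one_div_nonneg.2 (hM0.le.trans hlP)) this 2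
      refine (mul_le_mul_of_nonneg_left this (by positivity)).trans (le_of_eq ?_)
      norm_num; ring
  · refine mul_le_mul_of_nonneg_right ?_ (Uu_nn (hh_nn (cp_nn hc _)) _ _)
    have e : exp (-(2*(a:ℝ))) = exp (-(a:ℝ))^2 := by rw [← exp_nat_mul]; congr 1; push_cast; ring
    rw [e, ← hB]
    generalize exp (-(a:ℝ)) = x
    have y1 : B^8*1 ≤ B^10*cm^2 := mul_le_mul (pow_le_pow_right₀ hB1 (by norm_num)) (one_le_pow₀ hcm) (by norm_num) (by positivity)
    have y2 := mul_le_mul_of_nonneg_left y1 (show 0 ≤ 18*C2*x^2 by positivity)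
    linarith
end FordT

namespace FordT
open Real Finset Filter
lemma Wf_bd {b : ℕ → ℕ} {x : ℕ → ℝ} (hx : ∀ i j, i ≤ j → x j ≤ x i) (hb : ∀ j, (b j:ℝ) ≤ x j) : ∀ (l : List ℕ) (k i0 : ℕ), 1 ≤ k →
    l.Pairwise (· < ·) → (∀ j ∈ l, i0 ≤ j) →
    Wf (fun g => (g:ℝ)) k (l.map b) ≤ ∑ i ∈ range l.length, fordA (k+i) * x (i0+i) ∧ (l.map x).sum ≤ ∑ i ∈ range l.length, x (i0+i)
  | [], k, i0, _, _, _ => by simp [Wf]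
  | j :: l, k, i0, hk, hl, hi => by
    have hp := List.pairwise_cons.1 hl
    have ih := Wf_bd hx hb l (k+1) (i0+1) (by omega) hp.2 fun j' h => by have := hp.1 j' h; have := hi j (by simp); omega
    have hj := hx i0 j (hi j (by simp))
    simp only [List.map_cons, Wf, List.sum_cons, List.length_cons]
    rw [sum_range_succ', sum_range_succ']
    simp only [add_zero, add_comm _ 1, ← add_assoc] at ih ⊢
    have := mul_le_mul_of_nonneg_left ((hb j).trans hj) (fordA_nn hk)
    constructor <;> linarith [ih.1, ih.2]
lemma expo {ϱ : ℝ} (h : HR ϱ) : ∃ c : ℝ, 1 ≤ c ∧ ∀ m A : ℝ, 2*c ≤ m → 0 ≤ A → ∀ b : ℕ → ℕ, (∀ j, (b j:ℝ) ≤ (1+1/m)*(A*(ϱ*(1-c/m))^j)+1) →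
    ∀ (j0 : ℕ) (rest : List ℕ), (j0::rest).Pairwise (· < ·) →
    b j0 + Wf (fun g => (g:ℝ)) 1 (rest.map b) + 2*((rest.map b).map fun g : ℕ => (g:ℝ)).sum - 2*((j0::rest).map fun j => A*(ϱ*(1-c/m))^j).sum ≤
      -(A*(ϱ*(1-c/m))^j0/m) + ((rest.length:ℝ)+1)^2 := by
  obtain ⟨S, hS⟩ : ∃ S, S = ∑' n : ℕ, ((n:ℝ)+1)*ϱ^(n+1) := ⟨_, rfl⟩
  have h0 := h.h0
  have hS0 : 0 ≤ S := by rw [hS]; exact tsum_nonneg fun n => by positivity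
  refine ⟨3+2*S, by linarith, fun m A hm hA b hb j0 rest hj => ?_⟩
  have hm0 : 0 < m := by linarith
  obtain ⟨θ, hθ⟩ : ∃ θ, θ = 1-(3+2*S)/m := ⟨_, rfl⟩
  rw [← hθ] at hb ⊢
  have hcm : (3+2*S)/m ≤ 1/2 := by rw [div_le_iff₀ hm0]; linarith
  have hcm0 : 0 ≤ (3+2*S)/m := by positivity
  have ht0 : 0 ≤ θ := by linarith
  have ht1 : θ ≤ 1 := by linarith
  have hr0 : 0 ≤ ϱ*θ := by positivity
  have hr1 : ϱ*θ ≤ 1 := by nlinarith [h.h1]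
  have hp := List.pairwise_cons.1 hj
  obtain ⟨w, hw⟩ : ∃ w, w = 1/m := ⟨_, rfl⟩
  have hw0 : 0 ≤ w := by rw [hw]; positivity
  have hw1 : w ≤ 1/6 := by rw [hw]; exact one_div_le_one_div_of_le (by norm_num) (by linarith)
  rw [← hw] at hb
  have hx : ∀ i j, i ≤ j → A*(ϱ*θ)^j ≤ A*(ϱ*θ)^i := fun i j hij => mul_le_mul_of_nonneg_left (pow_le_pow_of_le_one hr0 hr1 hij) hA
  have W := Wf_bd (b := b) (x := fun j => (1+w)*(A*(ϱ*θ)^j)+1) (fun i j hij => by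
    have := mul_le_mul_of_nonneg_left (hx i j hij) (show 0 ≤ 1+w by linarith)
    linarith) hb rest 1 (j0+1) le_rfl hp.2 fun j h => hp.1 j h
  have W2 := (Wf_bd (b := fun _ => 0) (x := fun j => A*(ϱ*θ)^j) hx (fun j => by simp only [Nat.cast_zero]; positivity) rest 1 (j0+1) le_rfl hp.2 fun j h => hp.1 j h).2
  obtain ⟨n, hn⟩ : ∃ n, n = rest.length := ⟨_, rfl⟩
  obtain ⟨a, ha⟩ : ∃ a, a = A*(ϱ*θ)^j0 := ⟨_, rfl⟩
  have ha0 : 0 ≤ a := by rw [ha]; positivity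
  have hrp : ∀ i : ℕ, A*(ϱ*θ)^(j0+1+i) ≤ a*θ*ϱ^(i+1) := fun i => by
    have : θ^(i+1) ≤ θ := by rw [pow_succ]; exact mul_le_of_le_one_left ht0 (pow_le_one₀ ht0 ht1)
    rw [ha, show j0+1+i = j0+(i+1) by omega, pow_add, mul_pow ϱ θ (i+1)]
    have := mul_le_mul_of_nonneg_left this (show 0 ≤ A*(ϱ*θ)^j0*ϱ^(i+1) by positivity)
    linarith
  have s1 : ∑ i ∈ range n, fordA (1+i) * ((1+w)*(A*(ϱ*θ)^(j0+1+i))+1) ≤ (1+w)*(a*θ) + (n:ℝ)^2 := by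
    have t1 : ∑ i ∈ range n, fordA (i+1)*ϱ^(i+1) ≤ 1 := by
      rw [← h.hs]; exact h.summA.sum_le_tsum _ fun i _ => mul_nonneg (fordA_nn (by omega)) (by positivity)
    have t2 : ∀ i ∈ range n, fordA (1+i) * ((1+w)*(A*(ϱ*θ)^(j0+1+i))+1) ≤ (1+w)*(a*θ)*(fordA (i+1)*ϱ^(i+1)) + n := by
      intro i hi
      have g1 : fordA (i+1) ≤ n := (fordA_le_n (by omega)).trans (by exact_mod_cast mem_range.1 hi)
      have g0 : 0 ≤ fordA (i+1) := fordA_nn (by omega)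
      rw [add_comm 1 i]
      have := mul_le_mul_of_nonneg_left (hrp i) (show 0 ≤ fordA (i+1)*(1+w) by positivity)
      linarith
    refine (sum_le_sum t2).trans ?_
    rw [sum_add_distrib, ← mul_sum, sum_const, card_range, nsmul_eq_mul, ← sq]
    have := mul_le_mul_of_nonneg_left t1 (show 0 ≤ (1+w)*(a*θ) by positivity)
    linarith
  have s2 : ∑ i ∈ range n, A*(ϱ*θ)^(j0+1+i) ≤ a*S := by
    have t1 : ∑ i ∈ range n, ϱ^(i+1) ≤ S := by
      rw [hS]
      refine le_trans (sum_le_sum fun i _ => ?_) (h.summ.sum_le_tsum (range n) fun i _ => by positivity)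
      have : 0 ≤ (i:ℝ)*ϱ^(i+1) := by positivity
      linarith
    refine (sum_le_sum fun i _ => (hrp i).trans (show a*θ*ϱ^(i+1) ≤ a*ϱ^(i+1) from mul_le_mul_of_nonneg_right (by nlinarith) (by positivity))).trans ?_
    rw [← mul_sum]; exact mul_le_mul_of_nonneg_left t1 ha0
  have s3 : ((rest.map b).map fun g : ℕ => (g:ℝ)).sum ≤ (1+w)*(rest.map fun j => A*(ϱ*θ)^j).sum + n := by
    rw [List.map_map]
    refine (List.sum_le_sum (g := fun j => (1+w)*(A*(ϱ*θ)^j)+1) fun j _ => hb j).trans (le_of_eq ?_)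
    rw [List.sum_map_add, List.sum_map_mul_left]; simp [hn]
  simp only [← hn] at W W2 ⊢
  have W1 := W.1.trans s1
  have s4 := mul_le_mul_of_nonneg_left (W2.trans s2) hw0
  have hb0 := hb j0
  rw [List.map_cons, List.sum_cons, ← ha]
  rw [← ha] at hb0
  have e1 : a/m = a*w := by rw [hw]; ring
  have e2 : θ = 1-(3+2*S)*w := by rw [hθ, hw]; ring
  have e3 : (1+w)*(a*θ) ≤ a + w*a - (3+2*S)*w*a := by
    rw [e2]; nlinarith only [mul_nonneg (mul_nonneg hw0 hw0) (mul_nonneg ha0 (show 0 ≤ 3+2*S by linarith))]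
  rw [e1]
  linarith
end FordT

namespace FordT
open Real Finset Filter
open Classical in
noncomputable def Gw (η : ℝ) (a b : ℕ) : Finset ℕ := (PL ⌊E b⌋₊).filter fun q => Nrm η q ∧ a ≤ gw q ∧ gw q + 1 ≤ b
lemma mem_Gw {η : ℝ} {a b q : ℕ} (h : q ∈ Gw η a b) : q.Prime ∧ Nrm η q ∧ a ≤ gw q ∧ gw q + 1 ≤ b := by
  classical
  unfold Gw at h
  have := mem_filter.1 h
  exact ⟨(mem_PL.1 this.1).2, this.2⟩
open Classical in
lemma win : ∃ C : ℝ, 1 ≤ C ∧ ∃ g0 : ℕ, 1 ≤ g0 ∧ ∀ (a b : ℕ) (η : ℝ), g0 ≤ a → a ≤ b → 0 < η → η ≤ 1/2 →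
    (b:ℝ) - a - C - C*(b:ℝ)^8*exp (-(η^2/4*a)) ≤ ∑ q ∈ Gw η a b, 1/((q-1:ℕ):ℝ) ∧
    ∑ q ∈ Gw η a b, 1/((q-1:ℕ):ℝ) ≤ 2*b + C := by
  obtain ⟨C1, hC1, hP⟩ := PRE
  obtain ⟨C2, hC2, g0, hg0, hA⟩ := abn_sum
  refine ⟨C2+2*C1+1, by linarith, g0, hg0, fun a b η ha hab hη hη2 => ⟨?_, ?_⟩⟩
  · have hb1 : (1:ℝ) ≤ b := by exact_mod_cast (hg0.trans ha).trans hab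
    have hab' : (a:ℝ) ≤ b := by exact_mod_cast hab
    obtain ⟨n1, hn1⟩ : ∃ n, n = ⌊E ((b:ℝ)-1/2)⌋₊ := ⟨_, rfl⟩
    obtain ⟨n0, hn0⟩ : ∃ n, n = ⌊E a⌋₊ := ⟨_, rfl⟩
    have p1 := (abs_le.1 (hP ((b:ℝ)-1/2) (by linarith))).1
    have p0 := (abs_le.1 (hP a (by positivity))).2
    rw [← hn1] at p1; rw [← hn0] at p0
    obtain ⟨T, hT⟩ : ∃ T, T = (PL n1).filter (fun q => n0 < q) := ⟨_, rfl⟩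
    have hTm : ∀ q ∈ T, q.Prime ∧ a ≤ gw q ∧ gw q + 1 ≤ b ∧ q ≤ ⌊E b⌋₊ := by
      intro q hq
      rw [hT, mem_filter] at hq
      have hq1 := mem_PL.1 hq.1
      have e0 : E a < q := by rw [hn0] at hq; exact Nat.lt_of_floor_lt hq.2
      have e1 : (q:ℝ) ≤ E ((b:ℝ)-1/2) := by rw [hn1] at hq1; exact (Nat.le_floor_iff (E_pos _).le).1 hq1.1
      have l1 : (1:ℝ) < q := by linarith [E_gt (show (0:ℝ) ≤ a by positivity)]
      have l2 : 0 < log q := log_pos l1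
      have lE : ∀ t, 0 < log (E t) := fun t => by unfold E; rw [log_exp]; positivity
      have i0 := log_le_log (lE a) (log_le_log (E_pos _) e0.le)
      have i1 := log_le_log l2 (log_le_log (by linarith) e1)
      rw [loglogE] at i0 i1
      refine ⟨hq1.2, Nat.le_floor i0, (Nat.floor_lt (by linarith [show (0:ℝ) ≤ a by positivity])).2 (by linarith), Nat.le_floor (e1.trans (E_mono (by linarith)))⟩
    have s1 : PR n1 - PR n0 ≤ ∑ q ∈ T, 1/(q:ℝ) := by
      have h1 : PL n1 ⊆ T ∪ PL n0 := fun q hq => by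
        rw [mem_union, hT, mem_filter]
        by_cases h : n0 < q
        · exact Or.inl ⟨hq, h⟩
        · exact Or.inr (mem_PL.2 ⟨by omega, (mem_PL.1 hq).2⟩)
      have h2 := sum_le_sum_of_subset_of_nonneg h1 (f := fun q : ℕ => 1/(q:ℝ)) fun _ _ _ => by positivity
      have h3 := sum_union_inter (s₁ := T) (s₂ := PL n0) (f := fun q : ℕ => 1/(q:ℝ))
      have h4 : 0 ≤ ∑ q ∈ T ∩ PL n0, 1/(q:ℝ) := sum_nonneg fun _ _ => by positivity
      unfold PR; linarith
    rw [← sum_filter_add_sum_filter_not T (fun q => Nrm η q)] at s1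
    have s2 : ∑ q ∈ T.filter (fun q => Nrm η q), 1/(q:ℝ) ≤ ∑ q ∈ Gw η a b, 1/((q-1:ℕ):ℝ) := by
      refine (sum_le_sum fun q hq => ?_).trans (sum_le_sum_of_subset_of_nonneg (f := fun q : ℕ => 1/((q-1:ℕ):ℝ)) ?_ fun _ _ _ => by positivity)
      · have := (hTm q (mem_filter.1 hq).1).1.two_le
        exact one_div_le_one_div_of_le (by exact_mod_cast (by omega : 0 < q-1)) (by exact_mod_cast Nat.sub_le q 1)
      · intro q hq
        have h := hTm q (mem_filter.1 hq).1
        unfold Gw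
        exact mem_filter.2 ⟨mem_PL.2 ⟨h.2.2.2, h.1⟩, (mem_filter.1 hq).2, h.2.1, h.2.2.1⟩
    have s3 : ∑ q ∈ T.filter (fun q => ¬Nrm η q), 1/(q:ℝ) ≤ C2*(b:ℝ)^8*exp (-(η^2/4*a)) := by
      rw [← sum_fiberwise_of_maps_to (g := gw) (t := Ico a b) fun q hq => by
        have h := hTm q (mem_filter.1 hq).1
        rw [mem_Ico]; exact ⟨h.2.1, by have := h.2.2.1; omega⟩]
      have : ∀ g ∈ Ico a b, ∑ q ∈ (T.filter fun q => ¬Nrm η q).filter (fun q => gw q = g), 1/(q:ℝ) ≤ C2*(b:ℝ)^7*exp (-(η^2/4*a)) := by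
        intro g hg
        rw [mem_Ico] at hg
        have hga : (a:ℝ) ≤ g := by exact_mod_cast hg.1
        have hgb : (g:ℝ) ≤ b := by exact_mod_cast hg.2.le
        refine (hA g (ha.trans hg.1) η hη hη2 _ fun q hq => ?_).trans (by gcongr)
        have hq' := mem_filter.1 hq
        exact ⟨(hTm q (mem_filter.1 hq'.1).1).1, hq'.2, (mem_filter.1 hq'.1).2⟩
      refine (sum_le_card_nsmul _ _ _ this).trans ?_
      rw [nsmul_eq_mul, Nat.card_Ico]
      have : ((b-a:ℕ):ℝ) ≤ b := by exact_mod_cast Nat.sub_le b a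
      have := mul_le_mul_of_nonneg_right this (show 0 ≤ C2*(b:ℝ)^7*exp (-(η^2/4*a)) by positivity)
      refine this.trans (le_of_eq (by ring))
    have : 0 ≤ (2*C1+1)*(b:ℝ)^8*exp (-(η^2/4*a)) := by positivity
    linarith
  · have h1 : ∀ q ∈ Gw η a b, 1/((q-1:ℕ):ℝ) ≤ 2*(1/(q:ℝ)) := fun q hq => by
      have := (mem_Gw hq).1.two_le
      rw [Nat.cast_sub (by omega), Nat.cast_one]
      have h2 : (2:ℝ) ≤ q := by exact_mod_cast this
      rw [mul_one_div, div_le_div_iff₀ (by linarith) (by linarith)]; linarith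
    refine (sum_le_sum h1).trans ?_
    rw [← mul_sum]
    have h2 : ∑ q ∈ Gw η a b, 1/(q:ℝ) ≤ PR ⌊E b⌋₊ := sum_le_sum_of_subset_of_nonneg (by unfold Gw; exact filter_subset _ _) fun _ _ _ => by positivity
    have := (abs_le.1 (hP b (by positivity))).2
    linarith
end FordT

namespace FordT
open Real Finset Filter
lemma sum_idR (M : ℕ) : ∑ j ∈ range M, (j:ℝ) = M*(M-1)/2 := by
  induction M with
  | zero => simp
  | succ n ih => rw [sum_range_succ, ih]; push_cast; ring
lemma par {ϱ : ℝ} (h : HR ϱ) {c : ℝ} (hc : 1 ≤ c) : ∃ K : ℝ, 1 ≤ K ∧ ∀ᶠ m : ℝ in atTop, ∃ M : ℕ, 1 ≤ M ∧ (M:ℝ) ≤ K*m ∧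
    (∀ j < M, m^13 ≤ exp m/20*(ϱ*(1-c/m))^j) ∧
    exp ((m-log m)^2/(2*log (1/ϱ)) - K*m) ≤ ∏ j ∈ range M, exp m/20*(ϱ*(1-c/m))^j/(4*m) := by
  obtain ⟨l, hl⟩ : ∃ l, l = log (1/ϱ) := ⟨_, rfl⟩
  have l0 : 0 < l := hl ▸ h.lpos
  rw [← hl]
  have h0 := h.h0
  have : 0 < c/l^2+6/l := by positivity
  refine ⟨c/l^2+6/l+2, by linarith, ?_⟩
  obtain ⟨Z, hZ⟩ : ∃ Z, Z = (13+l+1)^2 := ⟨_, rfl⟩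
  filter_upwards [eventually_ge_atTop (4*c), eventually_ge_atTop (80:ℝ), tendsto_log_atTop.eventually (eventually_ge_atTop (1:ℝ)), ev_log (13*30),
    tendsto_log_atTop.eventually (ev_pow_exp 2 (1/2) (by norm_num)), tendsto_log_atTop.eventually (eventually_ge_atTop Z)] with m hmc hm1 hl1 e3 e4 e5
  have m0 : 0 < m := by linarith
  obtain ⟨y, hy⟩ : ∃ y, y = log m := ⟨_, rfl⟩
  rw [← hy] at hl1 e3 e4 e5 ⊢
  have hmy : exp y = m := by rw [hy, exp_log m0]
  have hcm : c/m ≤ 1/4 := by rw [div_le_iff₀ m0]; linarith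
  have hcm0 : 0 < c/m := by positivity
  obtain ⟨Λ, hΛ⟩ : ∃ Λ, Λ = -log (ϱ*(1-c/m)) := ⟨_, rfl⟩
  have hr : 0 < ϱ*(1-c/m) := mul_pos h0 (by linarith)
  have hre : ϱ*(1-c/m) = exp (-Λ) := by rw [hΛ, neg_neg, exp_log hr]
  have hΛl : Λ = l - log (1-c/m) := by rw [hΛ, hl, log_mul h0.ne' (by linarith), one_div, log_inv]; ring
  have d1 : l ≤ Λ := by rw [hΛl]; linarith [log_le_sub_one_of_pos (show 0 < 1-c/m by linarith)]
  have d2 : Λ ≤ l + 2*(c/m) := by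
    have := log_le_sub_one_of_pos (show 0 < (1-c/m)⁻¹ by apply inv_pos.2; linarith)
    rw [log_inv] at this
    have h2 : (1-c/m)⁻¹ ≤ 1+2*(c/m) := by
      rw [inv_le_comm₀ (by linarith) (by linarith), inv_eq_one_div, div_le_iff₀ (by linarith)]; nlinarith only [hcm, hcm0]
    rw [hΛl]; linarith
  have Λ0 : 0 < Λ := by linarith
  clear hΛ hΛl hl
  have g80 : log 80 ≤ 5 := by
    rw [log_le_iff_le_exp (by norm_num)]
    have : exp 5 = exp 1^5 := by rw [← exp_nat_mul]; norm_num
    rw [this]; exact le_trans (by norm_num) (pow_le_pow_left₀ (by norm_num) exp_one_gt_d9.le 5)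
  have g20 : log 80 = log 20 + log 4 := by rw [← log_mul] <;> norm_num
  have g4 : 0 ≤ log 4 := log_nonneg (by norm_num)
  have g40 : log 4 ≤ 3 := by linarith [log_le_sub_one_of_pos (show (0:ℝ) < 4 by norm_num)]
  obtain ⟨T, hT⟩ : ∃ T, T = m - log 20 - 13*y := ⟨_, rfl⟩
  have T0 : 0 ≤ T := by linarith
  have hA : ∀ j : ℕ, exp m/20*(ϱ*(1-c/m))^j = exp (m-log 20-Λ*j) := fun j => by
    rw [hre, ← exp_nat_mul, exp_sub, exp_sub, exp_log (by norm_num), div_eq_mul_inv _ (exp (Λ*j)), ← exp_neg]; ring_nf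
  obtain ⟨M, hM⟩ : ∃ M, M = ⌊T/Λ⌋₊+1 := ⟨_, rfl⟩
  have f1 := Nat.floor_le (show 0 ≤ T/Λ by positivity)
  have f2 := Nat.lt_floor_add_one (T/Λ)
  have hMc : (M:ℝ) = (⌊T/Λ⌋₊:ℝ)+1 := by rw [hM]; push_cast; ring
  rw [← hMc, div_lt_iff₀ Λ0] at f2
  rw [le_div_iff₀ Λ0, show (⌊T/Λ⌋₊:ℝ) = M-1 by linarith] at f1
  refine ⟨M, by omega, ?_, fun j hj => ?_, ?_⟩
  · have h1 : ((M:ℝ)-1)*l ≤ m := by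
      have : 0 ≤ (M:ℝ)-1 := by rw [hMc]; simp
      linarith only [mul_le_mul_of_nonneg_left d1 this, log_nonneg (show (1:ℝ) ≤ 20 by norm_num), f1, hT, hl1]
    have h2 : (M:ℝ)-1 ≤ m/l := by rwa [le_div_iff₀ l0]
    have h3 : 0 ≤ c/l^2*m := by positivity
    have h4 : m/l ≤ 6/l*m := by rw [div_mul_eq_mul_div]; gcongr; linarith
    linarith
  · rw [hA, ← hmy, ← exp_nat_mul]
    have : (j:ℝ) ≤ M-1 := by
      have : (j:ℝ)+1 ≤ M := by exact_mod_cast hj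
      linarith
    have := mul_le_mul_of_nonneg_right this Λ0.le
    apply exp_le_exp.2; push_cast; linarith
  · have hp : ∀ j ∈ range M, exp m/20*(ϱ*(1-c/m))^j/(4*m) = exp ((m-log 80-y) - Λ*j) := fun j _ => by
      rw [hA, g20, show m - (log 20+log 4)-y-Λ*j = (m-log 20-Λ*j) - (log 4+y) by ring, exp_sub _ (log 4+y), exp_add, exp_log (by norm_num), hmy]
    rw [prod_congr rfl hp, ← exp_sum, sum_sub_distrib, sum_const, card_range, nsmul_eq_mul, ← mul_sum]
    apply exp_le_exp.2
    have hs := sum_idR M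
    rw [hs]
    obtain ⟨w, hw⟩ : ∃ w, w = m-y := ⟨_, rfl⟩
    have w1 : w ≤ m := by linarith
    have w0 : 0 ≤ w := by linarith
    have k1 : (m-log 80-y-Λ*M)^2 ≤ m := by
      have e6 : (y*(13+l+1))^2 ≤ m := by
        have h2 : exp (1/2*y)^2 = m := by rw [← exp_nat_mul, ← hmy]; congr 1; push_cast; ring
        have h3 := mul_le_mul_of_nonneg_left e5 (sq_nonneg y)
        have h5 : y^2*y ≤ (y^2)^2 := by
          have := mul_le_mul_of_nonneg_left (show y ≤ y^2 by nlinarith only [hl1]) (sq_nonneg y)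
          linarith
        have := pow_le_pow_left₀ (by positivity) e4 2
        rw [mul_pow, ← hZ]; linarith
      have q1 : 0 ≤ y*l := by positivity
      have q2 := mul_le_mul_of_nonneg_right hl1 l0.le
      refine le_trans (sq_le_sq' ?_ ?_) e6 <;> linarith
    have k2 : w^2 - 10*m ≤ (m-log 80-y)^2 := by
      have : m-log 80-y = w - log 80 := by linarith
      rw [this]; nlinarith only [mul_le_mul_of_nonneg_left g80 w0, sq_nonneg (log 80), w1]
    have k3 : (w^2-11*m)/(2*Λ) ≤ M*(m-log 80-y) - Λ*(M*(M-1)/2) := by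
      rw [div_le_iff₀ (by linarith)]
      have : 0 ≤ Λ^2*M := by positivity
      linarith
    refine le_trans ?_ k3
    rw [← hw]
    have k4 : w^2/(2*l) - w^2/(2*Λ) ≤ c/l^2*m := by
      rw [div_sub_div _ _ (by linarith) (by linarith), div_le_iff₀ (by positivity)]
      have q1 : Λ - l ≤ 2*(c/m) := by linarith
      have q2 : w^2*(2*Λ) - 2*l*w^2 ≤ w^2*2*(2*(c/m)) := by linarith [mul_le_mul_of_nonneg_left q1 (sq_nonneg w)]
      have q3 : w^2*(c/m) ≤ c*m := by
        rw [mul_div_assoc', div_le_iff₀ m0]; linarith [mul_le_mul_of_nonneg_left (pow_le_pow_left₀ w0 w1 2) (show 0 ≤ c by linarith)]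
      have q4 : c/l^2*m*(2*l*(2*Λ)) = 4*(c*m)*(Λ/l) := by field_simp; try ring
      have q5 : 1 ≤ Λ/l := by rw [le_div_iff₀ l0]; linarith
      have : 0 < c*m := by positivity
      rw [q4]; linarith [mul_le_mul_of_nonneg_left q5 this.le]
    have k5 : 11*m/(2*Λ) ≤ 6/l*m := by
      rw [div_mul_eq_mul_div, div_le_div_iff₀ (by linarith) l0]; linarith [mul_le_mul_of_nonneg_left d1 m0.le, mul_pos m0 Λ0]
    rw [sub_div]; linarith
end FordT

namespace FordT
open Real Finset Filter
noncomputable def al (ϱ c m : ℝ) (j : ℕ) : ℝ := exp m/20*(ϱ*(1-c/m))^j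
noncomputable def bj (ϱ c m : ℝ) (j : ℕ) : ℕ := ⌈(1+1/m)*al ϱ c m j⌉₊
noncomputable def Gj (ϱ c m : ℝ) (M j : ℕ) : Finset ℕ := if j < M then Gw (1/m^4) ⌈al ϱ c m j⌉₊ (bj ϱ c m j) else ∅
lemma ab_bd {m x : ℝ} (hm : 10 ≤ m) (hx : m^13 ≤ x) (hx2 : x ≤ exp m/20) : 10 ≤ x ∧ m+1 ≤ x ∧ x ≤ ⌈x⌉₊ ∧ (⌈x⌉₊:ℝ) ≤ x+1 ∧
    (1+1/m)*x ≤ ⌈(1+1/m)*x⌉₊ ∧ (⌈(1+1/m)*x⌉₊:ℝ) ≤ (1+1/m)*x+1 ∧ 2*⌈(1+1/m)*x⌉₊ ≤ 3*⌈x⌉₊ ∧ (⌈(1+1/m)*x⌉₊:ℝ) ≤ 2*x ∧ (⌈(1+1/m)*x⌉₊:ℝ)+1 ≤ exp m/10 ∧ ⌈x⌉₊ ≤ ⌈(1+1/m)*x⌉₊ := by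
  have h1 : m*m ≤ x := by
    have : m^2 ≤ m^13 := pow_le_pow_right₀ (by linarith) (by norm_num)
    linarith
  have h2 : 10*m ≤ m*m := by nlinarith only [hm]
  have h3 : 1/m ≤ 1/10 := one_div_le_one_div_of_le (by norm_num) hm
  have h4 : 0 < 1/m := by positivity
  have x0 : 0 < x := by linarith
  have h5 : 1/m*x ≤ 1/10*x := mul_le_mul_of_nonneg_right h3 x0.le
  have h6 : 0 < 1/m*x := by positivity
  have k1 := Nat.le_ceil x
  have k2 := (Nat.ceil_lt_add_one x0.le).le
  have k3 := Nat.le_ceil ((1+1/m)*x)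
  have k4 := (Nat.ceil_lt_add_one (show 0 ≤ (1+1/m)*x by linarith)).le
  refine ⟨by linarith, by linarith, k1, k2, k3, k4, ?_, by linarith, by linarith, Nat.ceil_mono (by linarith)⟩
  have : 2*(⌈(1+1/m)*x⌉₊:ℝ) ≤ 3*⌈x⌉₊ := by linarith
  exact_mod_cast this
lemma sep_ev {ϱ : ℝ} (h : HR ϱ) : ∀ᶠ m : ℝ in atTop, ∀ x x' : ℝ, m^13 ≤ x → x ≤ exp m/20 → 0 ≤ x' → x' ≤ ϱ*x → E (⌈(1+1/m)*x'⌉₊:ℝ) ≤ exp (exp (⌈x⌉₊:ℝ)/(3*⌈(1+1/m)*x⌉₊)) := by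
  obtain ⟨δ, hδ⟩ : ∃ δ, δ = (1-ϱ)/2 := ⟨_, rfl⟩
  have d0 : 0 < δ := by have := h.h1; linarith
  have h0 := h.h0
  obtain ⟨X0, hX0⟩ := eventually_atTop.1 ((ev_log (2/δ)).and (eventually_ge_atTop (2*(1+log 6)/δ)))
  filter_upwards [eventually_ge_atTop 10, eventually_ge_atTop X0, eventually_ge_atTop (1/δ)] with m hm hmX hmd x x' hx hx2 hx0' hx'
  obtain ⟨k0, k9, k1, k2, k3, k4, k5, k6, -, -⟩ := ab_bd hm hx hx2
  obtain ⟨e1, e2⟩ := hX0 x (by linarith)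
  rw [div_mul_eq_mul_div, div_le_iff₀ d0] at e1
  rw [div_le_iff₀ d0] at e2
  have m0 : 0 < m := by linarith
  have h3 : 1/m ≤ δ := by rw [div_le_iff₀ m0]; rw [div_le_iff₀ d0] at hmd; linarith
  have k7 := (Nat.ceil_lt_add_one (show 0 ≤ (1+1/m)*x' by positivity)).le
  obtain ⟨b, hb⟩ : ∃ b : ℝ, b = (⌈(1+1/m)*x⌉₊:ℝ) := ⟨_, rfl⟩
  rw [← hb] at k3 k4 k6 ⊢
  have b00 : 0 < (1+1/m)*x := by positivity
  have b0 : 0 < b := by linarith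
  have e4 : log (3*b) ≤ log 6 + log x := by rw [← log_mul (by norm_num) (by linarith)]; exact log_le_log (by linarith) (by linarith)
  have e5 : (1+1/m)*x' ≤ (1-δ)*x := by
    have e6 : (1+1/m)*x' ≤ (1+1/m)*(ϱ*x) := by gcongr
    have e7 : (1+1/m)*ϱ ≤ 1-δ := by
      have := mul_le_mul h3 h.h1.le h0.le d0.le
      linarith
    have := mul_le_mul_of_nonneg_right e7 (show 0 ≤ x by linarith)
    linarith
  unfold E
  apply exp_le_exp.2
  rw [le_div_iff₀ (by linarith), show exp (⌈(1+1/m)*x'⌉₊:ℝ)*(3*b) = exp (⌈(1+1/m)*x'⌉₊+log (3*b)) by rw [exp_add, exp_log (by linarith)]]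
  apply exp_le_exp.2; linarith
end FordT

namespace FordT
open Real Finset Filter
lemma fin_ineq {m n C1 K x : ℝ} (hm : 10 ≤ m) (hC : 1 ≤ C1) (hK : 1 ≤ K) (hD : 4*C1*K^2 ≤ m) (hn0 : 0 ≤ n) (hn : n ≤ K*m) (hx : m^13 ≤ x) :
    11*m*n - x/m + n^2 + C1*n^2*(m+2+1/m^4*(2*x)) ≤ -m^3 := by
  have m0 : 0 < m := by linarith
  have x0 : 0 ≤ x := le_trans (by positivity) hx
  have k1 : C1*n^2*4 ≤ m^3 := by
    have := pow_le_pow_left₀ hn0 hn 2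
    calc C1*n^2*4 ≤ C1*(K*m)^2*4 := by gcongr
      _ = 4*C1*K^2*m^2 := by ring
      _ ≤ m*m^2 := by gcongr
      _ = m^3 := by ring
  have k2 : n^2*4 ≤ m^3 := le_trans (by nlinarith only [mul_nonneg (sub_nonneg.2 hC) (sq_nonneg n)]) k1
  have k3 : K ≤ m := by nlinarith only [hC, hK, hD, mul_nonneg (sub_nonneg.2 hC) (sq_nonneg K)]
  have k4 : 11*m*n ≤ 11*m^3 := by
    have := mul_le_mul_of_nonneg_right k3 m0.le
    have := mul_le_mul_of_nonneg_left (hn.trans this) m0.le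
    linarith
  have k5 : C1*n^2*(1/m^4*(2*x)) ≤ 1/2*(x/m) := by
    calc C1*n^2*(1/m^4*(2*x)) = C1*n^2*4*(x/(2*m^4)) := by ring
      _ ≤ m^3*(x/(2*m^4)) := by gcongr
      _ = 1/2*(x/m) := by field_simp
  have k6 : m^12 ≤ x/m := by rw [le_div_iff₀ m0, ← pow_succ]; exact hx
  have k7 : 10^8*m^4 ≤ m^12 := by
    rw [show m^12 = m^8*m^4 by ring]; gcongr
  have k8 : 10*m^3 ≤ m^4 := by rw [show m^4 = m*m^3 by ring]; gcongr
  have k9 : C1*n^2*(m+2) ≤ m^3*(m+2)/4 := by linarith [mul_le_mul_of_nonneg_right k1 (show 0 ≤ (m+2)/4 by linarith)]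
  have e : C1*n^2*(m+2+1/m^4*(2*x)) = C1*n^2*(m+2) + C1*n^2*(1/m^4*(2*x)) := by ring
  have e2 : m^3*(m+2)/4 = m^4/4+m^3/2 := by ring
  have : 0 < m^3 := by positivity
  rw [e]; linarith
lemma exp_list (u : ℝ) (f : ℕ → ℝ) : ∀ l : List ℕ, (l.map fun j => exp (u-2*f j)).prod = exp (u*l.length - 2*(l.map f).sum)
  | [] => by simp
  | j :: l => by simp only [List.map_cons, List.prod_cons, List.sum_cons, List.length_cons, exp_list u f l, ← exp_add]; congr 1; push_cast; ring
lemma al_facts {ϱ c m : ℝ} (h : HR ϱ) (hc : 1 ≤ c) (hm : 2*c ≤ m) : (∀ j, 0 ≤ al ϱ c m j) ∧ (∀ i j, i ≤ j → al ϱ c m j ≤ al ϱ c m i) ∧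
    (∀ i j, i < j → al ϱ c m j ≤ ϱ*al ϱ c m i) ∧ ∀ j, al ϱ c m j ≤ exp m/20 := by
  have m0 : 0 < m := by linarith
  have hcm : c/m ≤ 1/2 := by rw [div_le_iff₀ m0]; linarith
  have hcm0 : 0 < c/m := by positivity
  have r0 : 0 ≤ ϱ*(1-c/m) := mul_nonneg h.h0.le (by linarith)
  have r2 : ϱ*(1-c/m) ≤ ϱ := mul_le_of_le_one_right h.h0.le (by linarith)
  have r1 := r2.trans h.h1.le
  unfold al
  refine ⟨fun j => by positivity, fun i j hij => mul_le_mul_of_nonneg_left (pow_le_pow_of_le_one r0 r1 hij) (by positivity), fun i j hij => ?_,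
    fun j => mul_le_of_le_one_right (by positivity) (pow_le_one₀ r0 r1)⟩
  have := mul_le_mul_of_nonneg_left (pow_le_pow_of_le_one r0 r1 (Nat.succ_le_of_lt hij)) (show 0 ≤ exp m/20 by positivity)
  refine this.trans ?_
  rw [Nat.succ_eq_add_one, pow_succ']
  have := mul_le_mul_of_nonneg_right r2 (show 0 ≤ exp m/20*(ϱ*(1-c/m))^i by positivity)
  linarith
lemma nf_small {ϱ : ℝ} (h : HR ϱ) : ∃ c : ℝ, 1 ≤ c ∧ ∀ K : ℝ, 1 ≤ K → ∀ᶠ m : ℝ in atTop, ∀ M : ℕ, (M:ℝ) ≤ K*m → (∀ j < M, m^13 ≤ al ϱ c m j) →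
    ∀ l : List ℕ, l.Sublist (List.range M) → l ≠ [] → NF (l.map (Gj ϱ c m M)) f0 ≤ exp (-m^3) := by
  obtain ⟨c, hc, hexpo⟩ := expo h
  obtain ⟨C1, hC1, hNF⟩ := NF_bd
  obtain ⟨C2, hC2, a0, ha0, hlev⟩ := lev
  refine ⟨c, hc, fun K hK => ?_⟩
  filter_upwards [eventually_ge_atTop 10, eventually_ge_atTop (2*c), eventually_ge_atTop (a0:ℝ), eventually_ge_atTop (4*C1*K^2), eventually_ge_atTop (C2*K^2),
    eventually_ge_atTop (4*K+2), ev_pow_exp 3 1 one_pos, sep_ev h] with m hm hmc hma hmC hmC2 hmK he3 hsep M hMK hal l hl hne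
  obtain ⟨p0, p1, p2, p3⟩ := al_facts h hc hmc
  have m0 : 0 < m := by linarith
  rw [one_mul] at he3
  obtain ⟨j0, rest, rfl⟩ : ∃ j0 rest, l = j0::rest := List.exists_cons_of_ne_nil hne
  have hlM : ∀ j ∈ j0::rest, j < M := fun j hj => List.mem_range.1 (hl.subset hj)
  have hpw : (j0::rest).Pairwise (· < ·) := List.pairwise_lt_range.sublist hl
  have hlen : (rest.length:ℝ)+1 ≤ K*m := by
    have := hl.length_le
    rw [List.length_cons, List.length_range] at this
    exact le_trans (by exact_mod_cast this) hMK
  have hM1 : 1 ≤ K*m := by nlinarith only [hK, hm]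
  have ab : ∀ j < M, _ := fun j hj => ab_bd hm (hal j hj) (p3 j)
  have hη : 1/m^4 ≤ 1/2 := one_div_le_one_div_of_le (by norm_num) (by nlinarith only [hm, pow_le_pow_left₀ (by norm_num) hm 4])
  have hG : ∀ j q, q ∈ Gj ϱ c m M j → j < M ∧ q ∈ Gw (1/m^4) ⌈al ϱ c m j⌉₊ (bj ϱ c m j) := fun j q hq => by
    unfold Gj at hq
    split_ifs at hq with hj
    · exact ⟨hj, hq⟩
    · simp at hq
  have ha0' : ∀ j < M, a0 ≤ ⌈al ϱ c m j⌉₊ := fun j hj => by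
    have := ab j hj
    have : (a0:ℝ) ≤ ⌈al ϱ c m j⌉₊ := by linarith [this.2.1, this.2.2.1]
    exact_mod_cast this
  have hG2 : ∀ j q, q ∈ Gj ϱ c m M j → 3 ≤ q ∧ q ≤ ⌊E (bj ϱ c m j)⌋₊ := fun j q hq => by
    have h1 := hG j q hq
    have h2 := mem_Gw h1.2
    exact (hpf_aux hη (ha0.trans (ha0' j h1.1)) h2.1 h2.2.1 h2.2.2.1 h2.2.2.2).1
  have key := hNF (1/m^4) ⌈m⌉₊ (Gj ϱ c m M) (bj ϱ c m) (fun j => ⌈exp (exp (⌈al ϱ c m j⌉₊:ℝ)/(3*(bj ϱ c m j:ℝ)))⌉₊)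
    (fun j => C2*(K*m)^2*((bj ϱ c m j:ℝ)+1)^10*exp (-(2*(⌈al ϱ c m j⌉₊:ℝ)))) (K*m) (by positivity) (fun j => by positivity)
    (fun i j hij => Nat.ceil_mono (mul_le_mul_of_nonneg_left (p1 i j hij.le) (by positivity))) (fun j q hq => ?_) (fun Q hQ j cc h0 h1 D D' hD => ?_) (fun j j' hjj q hq => ?_) j0 rest hpw (fun j hj => ?_) ?_ hlen
  rotate_left
  · have h1 := hG2 j q hq
    refine ⟨by omega, h1.2, fun t => ?_⟩
    have h2 := mem_Gw (hG j q hq).2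
    have h3 := (abs_le.1 (h2.2.1 t)).2
    have h4 : (gw q:ℝ) ≤ bj ϱ c m j := by exact_mod_cast (by omega : gw q ≤ bj ϱ c m j)
    have h5 : ((min t (gw q):ℕ):ℝ) ≤ (min t (bj ϱ c m j):ℕ) := by exact_mod_cast min_le_min_left t (by omega)
    have := mul_le_mul_of_nonneg_left h4 (show 0 ≤ 1/m^4 by positivity)
    linarith
  · by_cases hj : j < M
    · exact hlev _ _ (1/m^4) (K*m) _ (ha0' j hj) (ab j hj).2.2.2.2.2.2.1 hη hM1 (fun q hq => mem_Gw (hG j q hq).2) Q hQ cc h0 h1 D D' hD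
    · have : Gj ϱ c m M j = ∅ := by unfold Gj; rw [if_neg hj]
      rw [this]; unfold Nn; rw [sum_empty]
      refine mul_nonneg (by positivity) (Uu_nn (fun n => hh_nn (fun p => ?_) n) D D')
      unfold cp; split_ifs <;> linarith [h0 p]
  · have h1 := hG2 j' q hq
    have hj' := (hG j' q hq).1
    refine ⟨by omega, h1.2.trans (Nat.cast_le.1 ((Nat.floor_le (E_pos _).le).trans ?_) : _ ≤ _)⟩
    exact (hsep _ _ (hal j (by omega)) (p3 j) (p0 j') (p2 j j' hjj)).trans (Nat.le_ceil _)
  · have := ab j (hlM j (by simp [hj]))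
    exact Nat.ceil_le.2 (le_trans (by linarith [this.2.1, this.2.2.1]) (Nat.cast_le.2 this.2.2.2.2.2.2.2.2.2 : ((⌈al ϱ c m j⌉₊:ℕ):ℝ) ≤ _))
  · have h1 : exp m ≤ E (⌈m⌉₊:ℝ) := (exp_le_exp.2 (by linarith [add_one_le_exp m, exp_le_exp.2 (Nat.le_ceil m)]))
    have h2 := Nat.lt_floor_add_one (E (⌈m⌉₊:ℝ))
    have h3 : 2*(K*m)+1 ≤ m^3 := by
      have : (4*K+2)*m ≤ m*m := mul_le_mul_of_nonneg_right hmK m0.le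
      nlinarith only [this, hm]
    linarith
  refine key.trans ?_
  have hKj : ((j0::rest).map fun j => C2*(K*m)^2*((bj ϱ c m j:ℝ)+1)^10*exp (-(2*(⌈al ϱ c m j⌉₊:ℝ)))).prod ≤ ((j0::rest).map fun j => exp (11*m-2*al ϱ c m j)).prod := by
    refine List.prod_map_le_prod_map₀ _ _ (fun j _ => by positivity) fun j hj => ?_
    have h1 := ab j (hlM j hj)
    have h2 : (bj ϱ c m j:ℝ)+1 ≤ exp m := by have := h1.2.2.2.2.2.2.2.2.1; unfold bj; linarith [exp_pos m]
    have h3 : C2*(K*m)^2 ≤ exp m := by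
      refine le_trans ?_ he3
      have := mul_le_mul_of_nonneg_right hmC2 (sq_nonneg m)
      linarith
    calc C2*(K*m)^2*((bj ϱ c m j:ℝ)+1)^10*exp (-(2*(⌈al ϱ c m j⌉₊:ℝ))) ≤ exp m*(exp m)^10*exp (-(2*al ϱ c m j)) := by
          gcongr; exact h1.2.2.1
      _ = exp (11*m-2*al ϱ c m j) := by rw [← pow_succ', ← exp_nat_mul, ← exp_add]; ring_nf
  rw [exp_list (11*m) (al ϱ c m), List.length_cons, Nat.cast_succ] at hKj
  refine (mul_le_mul_of_nonneg_right hKj (exp_pos _).le).trans ?_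
  rw [← exp_add]
  apply exp_le_exp.2
  have hj0 : j0 < M := hlM j0 (by simp)
  have X : _ + _ + _ - 2*((j0::rest).map (al ϱ c m)).sum ≤ -(al ϱ c m j0/m) + _ := hexpo m (exp m/20) hmc (by positivity) (bj ϱ c m) (fun j => (Nat.ceil_lt_add_one (mul_nonneg (by positivity) (p0 j))).le) j0 rest hpw
  have Y := fin_ineq hm hC1 hK hmC (show (0:ℝ) ≤ (rest.length:ℝ)+1 by positivity) hlen (hal j0 hj0)
  have Z1 := (Nat.ceil_lt_add_one m0.le).le
  have Z : C1*((rest.length:ℝ)+1)^2*((⌈m⌉₊:ℝ)+1/m^4*(bj ϱ c m j0:ℝ)+1) ≤ C1*((rest.length:ℝ)+1)^2*(m+2+1/m^4*(2*al ϱ c m j0)) := by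
    apply mul_le_mul_of_nonneg_left _ (by positivity)
    have := mul_le_mul_of_nonneg_left (ab j0 hj0).2.2.2.2.2.2.2.1 (show 0 ≤ 1/m^4 by positivity)
    have e : (bj ϱ c m j0:ℝ) = ⌈(1+1/m)*al ϱ c m j0⌉₊ := rfl
    rw [e]; linarith
  linarith
end FordT

namespace FordT
open Real Finset Filter
lemma prod_lr (f : ℕ → ℝ) (M : ℕ) : ((List.range M).map f).prod = ∏ j ∈ range M, f j := by
  induction M with
  | zero => simp
  | succ n ih => simp [List.range_succ, prod_range_succ, ih]
lemma Vals_qs {G : ℕ → Finset ℕ} (hp : ∀ j, ∀ q ∈ G j, q.Prime) (hs : ∀ j j', j < j' → ∀ q ∈ G j, ∀ q' ∈ G j', q' < q) : ∀ js : List ℕ, js.Pairwise (· < ·) →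
    ∀ v ∈ Vals (js.map G), ∃ qs : List ℕ, qs.Pairwise (· > ·) ∧ (∀ q ∈ qs, ∃ j ∈ js, q ∈ G j) ∧ v = (qs.map (· - 1)).prod ∧ qs.length = js.length
  | [], _, v, hv => ⟨[], by simpa [Vals] using hv⟩
  | j :: js, hj, v, hv => by
    simp only [List.map_cons, Vals, mem_image, mem_product, Prod.exists] at hv
    obtain ⟨q, w, ⟨hq, hw⟩, rfl⟩ := hv
    have hj' := List.pairwise_cons.1 hj
    obtain ⟨qs, h1, h2, h3, h4⟩ := Vals_qs hp hs js hj'.2 w hw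
    refine ⟨q::qs, List.pairwise_cons.2 ⟨fun q' hq' => ?_, h1⟩, fun q' hq' => ?_, by simp [h3, mul_comm], by simp [h4]⟩
    · obtain ⟨j', a1, a2⟩ := h2 q' hq'
      exact hs j j' (hj'.1 j' a1) q hq q' a2
    · rcases List.mem_cons.1 hq' with rfl | h
      · exact ⟨j, by simp, hq⟩
      · obtain ⟨j', a1, a2⟩ := h2 q' h
        exact ⟨j', by simp [a1], a2⟩
lemma gw_lt {q q' : ℕ} (hq : 3 ≤ q) (h : gw q' < gw q) : q' < q := by
  by_contra hc
  have h1 : (q:ℝ) ≤ q' := by exact_mod_cast not_lt.1 hc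
  have h3 : (3:ℝ) ≤ q := by exact_mod_cast hq
  have h2 := Nat.floor_mono (log_le_log (log_pos (by linarith)) (log_le_log (by linarith) h1))
  unfold gw at h; omega
lemma lower_B {ϱ : ℝ} (h : HR ϱ) : ∃ K : ℝ, 1 ≤ K ∧ ∀ᶠ m : ℝ in atTop, ∃ Bs : Finset ℕ,
    (∀ v ∈ Bs, (∃ n, 1 ≤ n ∧ F n = v ∧ ∀ p : ℕ, p.Prime → p ∣ n → 7 ≤ p ∧ (p:ℝ) ≤ E (exp m/10)) ∧
      1 ≤ v ∧ (v:ℝ) ≤ E (exp m/5) ∧ ∀ p : ℕ, p.Prime → p ∣ v → (p:ℝ) ≤ E (exp m/10)) ∧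
    exp ((m-log m)^2/(2*log (1/ϱ)) - K*m) ≤ ∑ v ∈ Bs, 1/(v:ℝ) := by
  obtain ⟨c, hc, hnf⟩ := nf_small h
  obtain ⟨K, hK, hpar⟩ := par h hc
  obtain ⟨C, hC, g0, hg0, hwin⟩ := win
  refine ⟨K, hK, ?_⟩
  filter_upwards [eventually_ge_atTop 10, eventually_ge_atTop (2*c), eventually_ge_atTop (g0:ℝ), eventually_ge_atTop C,
    eventually_ge_atTop (3*K+1), ev_pow_exp 3 1 one_pos, hnf K hK, hpar, sep_ev h] with m hm hmc hmg hmC hmK he3 hNF ⟨M, hM1, hMK, hal, hprod⟩ hsep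
  obtain ⟨p0, p1, p2, p3⟩ := al_facts h hc hmc
  have m0 : 0 < m := by linarith
  rw [one_mul] at he3
  replace hal : ∀ j < M, m^13 ≤ al ϱ c m j := hal
  have ab : ∀ j < M, _ := fun j hj => ab_bd hm (hal j hj) (p3 j)
  have hη : 1/m^4 ≤ 1/2 := one_div_le_one_div_of_le (by norm_num) (by nlinarith only [hm, pow_le_pow_left₀ (by norm_num) hm 4])
  have hG : ∀ j q, q ∈ Gj ϱ c m M j → j < M ∧ q.Prime ∧ Nrm (1/m^4) q ∧ ⌈al ϱ c m j⌉₊ ≤ gw q ∧ gw q + 1 ≤ bj ϱ c m j := fun j q hq => by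
    unfold Gj at hq
    split_ifs at hq with hj
    · exact ⟨hj, mem_Gw hq⟩
    · simp at hq
  have ha10 : ∀ j < M, 10 ≤ ⌈al ϱ c m j⌉₊ := fun j hj => by
    have := ab j hj
    have : (10:ℝ) ≤ ⌈al ϱ c m j⌉₊ := by linarith only [this.1, this.2.2.1]
    exact_mod_cast this
  have hG2 : ∀ j q, q ∈ Gj ϱ c m M j → 7 ≤ q ∧ q ≤ ⌊E (exp m/10)⌋₊ := fun j q hq => by
    have h1 := hG j q hq
    have h2 := ha10 j h1.1
    have h3 := (hpf_aux hη (by omega) h1.2.1 h1.2.2.1 h1.2.2.2.1 h1.2.2.2.2).1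
    refine ⟨?_, h3.2.trans (Nat.floor_mono (E_mono ?_))⟩
    · by_contra hq
      have h4 : (q:ℝ) ≤ 6 := by exact_mod_cast (by omega : q ≤ 6)
      have h5 : (3:ℝ) ≤ q := by exact_mod_cast h3.1
      have h6 := log_le_sub_one_of_pos (show (0:ℝ) < q by linarith)
      have h7 := log_le_sub_one_of_pos (log_pos (show (1:ℝ) < q by linarith))
      have : gw q ≤ 4 := Nat.floor_le_of_le (by push_cast; linarith)
      omega
    · have := (ab j h1.1).2.2.2.2.2.2.2.2.1
      unfold bj; linarith
  have hs : ∀ j j', j < j' → ∀ q ∈ Gj ϱ c m M j, ∀ q' ∈ Gj ϱ c m M j', q' < q := fun j j' hjj q hq q' hq' => by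
    have h1 := hG j q hq
    have h2 := hG j' q' hq'
    have h3 := exp_le_exp.1 (hsep _ _ (hal j h1.1) (p3 j) (p0 j') (p2 j j' hjj))
    have h4 : (1:ℝ) ≤ 3*⌈(1+1/m)*al ϱ c m j⌉₊ := by
      have := (ab j h1.1); linarith only [this.1, this.2.2.1, (Nat.cast_le.2 this.2.2.2.2.2.2.2.2.2 : ((⌈al ϱ c m j⌉₊:ℕ):ℝ) ≤ _)]
    have h5 := exp_le_exp.1 (h3.trans (div_le_self (exp_pos _).le h4))
    have h6 : bj ϱ c m j' ≤ ⌈al ϱ c m j⌉₊ := by exact_mod_cast h5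
    exact gw_lt (by have := (hG2 j q hq).1; omega) (by omega)
  obtain ⟨W, hW⟩ : ∃ W : ℕ → ℝ, W = fun j => ∑ q ∈ Gj ϱ c m M j, 1/((q-1:ℕ):ℝ) := ⟨_, rfl⟩
  have hWb : ∀ j < M, al ϱ c m j/(2*m) ≤ W j ∧ W j ≤ exp (2*m) ∧ 2 ≤ W j := fun j hj => by
    obtain ⟨x, hx⟩ : ∃ x, x = al ϱ c m j := ⟨_, rfl⟩
    obtain ⟨k0, k1, k2, k3, k4, k5, k6, k7, k8, k9⟩ := ab j hj
    have w := hwin ⌈al ϱ c m j⌉₊ (bj ϱ c m j) (1/m^4) (Nat.cast_le.1 (by linarith : (g0:ℝ) ≤ _)) k9 (by positivity) hη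
    have e : W j = ∑ q ∈ Gw (1/m^4) ⌈al ϱ c m j⌉₊ (bj ϱ c m j), 1/((q-1:ℕ):ℝ) := by rw [hW]; unfold Gj; simp only [if_pos hj]
    rw [← e] at w
    have hal' := hal j hj
    have z1 : C*(bj ϱ c m j:ℝ)^8*exp (-((1/m^4)^2/4*⌈al ϱ c m j⌉₊)) ≤ 1 := by
      have b1 : (bj ϱ c m j:ℝ) ≤ exp m := by unfold bj; linarith [exp_pos m]
      have b2 : m^5/4 ≤ (1/m^4)^2/4*⌈al ϱ c m j⌉₊ := by
        have : (1/m^4)^2/4*m^13 ≤ (1/m^4)^2/4*⌈al ϱ c m j⌉₊ := mul_le_mul_of_nonneg_left (hal'.trans k2) (by positivity)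
        refine le_trans (le_of_eq ?_) this
        field_simp
      have b3 : 36*m ≤ m^5 := by
        rw [show m^5 = m^4*m by ring]
        exact mul_le_mul_of_nonneg_right (by linarith [pow_le_pow_left₀ (by norm_num) hm 4]) m0.le
      calc C*(bj ϱ c m j:ℝ)^8*exp (-((1/m^4)^2/4*⌈al ϱ c m j⌉₊)) ≤ exp m*(exp m)^8*exp (-(9*m)) := by
            exact mul_le_mul (mul_le_mul (by linarith [add_one_le_exp m]) (pow_le_pow_left₀ (by positivity) b1 8) (by positivity) (exp_pos _).le) (exp_le_exp.2 (by linarith)) (exp_pos _).le (by positivity)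
        _ = 1 := by rw [← pow_succ', ← exp_nat_mul, ← exp_add, ← exp_zero]; congr 1; push_cast; ring
    have z2 : m^12 ≤ al ϱ c m j/m := by rw [le_div_iff₀ m0, ← pow_succ]; exact hal'
    have z3 : 10*m ≤ m^12 := by
      rw [show m^12 = m^11*m by ring]
      exact mul_le_mul_of_nonneg_right (by linarith [pow_le_pow_left₀ (by norm_num) hm 11]) m0.le
    have z4 : al ϱ c m j/(2*m) = al ϱ c m j/m/2 := by ring
    have z5 : (1+1/m)*al ϱ c m j = al ϱ c m j + al ϱ c m j/m := by ring
    have z6 : exp (2*m) = exp m*exp m := by rw [← exp_add]; congr 1; ring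
    have z7 : exp m*2 ≤ exp m*exp m := by gcongr; linarith [add_one_le_exp m]
    have z8 : m ≤ exp m := by linarith [add_one_le_exp m]
    rw [z5] at k4
    have k4' : al ϱ c m j + al ϱ c m j/m ≤ bj ϱ c m j := by unfold bj; rw [z5]; exact k4
    have k8' : (bj ϱ c m j:ℝ)+1 ≤ exp m/10 := k8
    refine ⟨?_, ?_, ?_⟩
    · rw [z4]; linarith only [w.1, z1, z2, z3, k4', k3, hmC, hm]
    · rw [z6]; linarith only [w.2, k8', z7, z8, hmC]
    · linarith only [w.1, z1, z2, z3, k4', k3, hmC, hm]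
  have V := vals_lower (B := exp (2*m)) (ε := exp (-m^3)) (exp_pos _).le (exp_pos _).le ((List.range M).map (Gj ϱ c m M)) (fun G hGm => ?_) (fun sub hsub hne => ?_) ?_
  rotate_left
  · obtain ⟨j, hj, rfl⟩ := List.mem_map.1 hGm
    have := hWb j (List.mem_range.1 hj)
    rw [hW] at this
    exact ⟨fun q hq => by have := (hG2 j q hq).1; omega, this.2.1, this.2.2⟩
  · obtain ⟨l, hl, rfl⟩ := List.sublist_map_iff.1 hsub
    exact hNF M hMK hal l hl (by rintro rfl; simp at hne)
  · rw [List.length_map, List.length_range]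
    have e1 : 1+exp (2*m) ≤ exp (3*m) := by
      rw [show exp (3*m) = exp (2*m)*exp m by rw [← exp_add]; congr 1; ring]
      nlinarith only [add_one_le_exp (2*m), add_one_le_exp m, hm]
    have e2 := pow_le_pow_left₀ (by positivity) e1 M
    rw [← exp_nat_mul] at e2
    refine (mul_le_mul_of_nonneg_right e2 (exp_pos _).le).trans ?_
    rw [← exp_add]
    refine (exp_le_exp.2 (show _ ≤ (-1:ℝ) from ?_)).trans (by linarith [exp_neg_one_lt_d9])
    have e3 := mul_le_mul_of_nonneg_right hMK (show 0 ≤ 3*m by linarith)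
    have e4 := mul_le_mul_of_nonneg_right hmK (sq_nonneg m)
    nlinarith only [e3, e4, hm]
  refine ⟨_, fun v hv => ?_, le_trans hprod (le_trans ?_ V.2)⟩
  · obtain ⟨qs, h1, h2, h3, h4⟩ := Vals_qs (fun j q hq => (hG j q hq).2.1) hs _ List.pairwise_lt_range v hv
    have h2' : ∀ q ∈ qs, q.Prime ∧ 7 ≤ q ∧ q ≤ ⌊E (exp m/10)⌋₊ := fun q hq => by
      obtain ⟨j, _, hj⟩ := h2 q hq
      exact ⟨(hG j q hj).2.1, hG2 j q hj⟩
    have hfl : ∀ p : ℕ, p ≤ ⌊E (exp m/10)⌋₊ → (p:ℝ) ≤ E (exp m/10) := fun p hp => (Nat.le_floor_iff (E_pos _).le).1 hp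
    have hd : ∀ p : ℕ, p.Prime → p ∣ v → (p:ℝ) ≤ E (exp m/10) := fun p hp hpv => by
      rw [h3] at hpv
      obtain ⟨z, hz, hz2⟩ := (Prime.dvd_prod_iff hp.prime).1 hpv
      obtain ⟨q, hq, rfl⟩ := List.mem_map.1 hz
      have := h2' q hq
      exact hfl p ((Nat.le_of_dvd (by omega) hz2).trans (by omega))
    refine ⟨⟨qs.prod, ?_, ?_, fun p hp hpd => ?_⟩, ?_, ?_, hd⟩
    · exact List.prod_pos fun q hq => (h2' q hq).1.pos
    · rw [F_prod qs h1 fun q hq => (h2' q hq).1, h3]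
    · obtain ⟨q, hq, hq2⟩ := (Prime.dvd_prod_iff hp.prime).1 hpd
      rw [(Nat.prime_dvd_prime_iff_eq hp (h2' q hq).1).1 hq2]
      exact ⟨(h2' q hq).2.1, hfl q (h2' q hq).2.2⟩
    · rw [h3]
      refine Nat.one_le_iff_ne_zero.2 (List.prod_ne_zero fun hz => ?_)
      obtain ⟨q, hq, hq0⟩ := List.mem_map.1 hz
      have := h2' q hq; omega
    · have k1 : v ≤ ⌊E (exp m/10)⌋₊^M := by
        have := List.prod_le_pow_card (qs.map (· - 1)) ⌊E (exp m/10)⌋₊ fun z hz => by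
          obtain ⟨q, hq, rfl⟩ := List.mem_map.1 hz
          have := h2' q hq; omega
        rwa [List.length_map, h4, List.length_range, ← h3] at this
      have k2 : (v:ℝ) ≤ E (exp m/10)^M := le_trans (by exact_mod_cast k1) (pow_le_pow_left₀ (by positivity) (Nat.floor_le (E_pos _).le) M)
      refine k2.trans ?_
      unfold E
      rw [← exp_nat_mul]
      apply exp_le_exp.2
      rw [show exp m/5 = exp m/10+exp m/10 by ring, exp_add]
      refine mul_le_mul_of_nonneg_right ?_ (exp_pos _).le
      have k3 := add_one_le_exp (exp m/10)
      have k4 : K*m ≤ m*m := mul_le_mul_of_nonneg_right (by linarith) m0.le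
      have k5 : 10*(m*m) ≤ m^3 := by nlinarith only [mul_le_mul_of_nonneg_right hm (mul_self_nonneg m)]
      linarith
  · rw [List.map_map, prod_lr]
    refine prod_le_prod (fun j _ => div_nonneg (p0 j) (by linarith)) fun j hj => ?_
    have := (hWb j (mem_range.1 hj)).1
    rw [hW] at this
    refine le_trans (le_of_eq (show _ = al ϱ c m j/(2*m)/2 from ?_)) ((div_le_div_iff_of_pos_right two_pos).2 this)
    unfold al; ring
end FordT

namespace FordT
open Real Finset Filter
lemma gcd_sum (n : ℕ) (Bs : Finset ℕ) (hB : ∀ v ∈ Bs, v ≠ 0 ∧ ∀ p, p.Prime → p ∣ v → p ≤ n) :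
    ∑ a ∈ Bs ×ˢ Bs, (Nat.gcd a.1 a.2 : ℝ)/(a.1*a.2) ≤ exp (3*(PR n + 9)) := by
  classical
  obtain ⟨T, hT⟩ : ∃ T, T = Bs.biUnion Nat.divisors := ⟨_, rfl⟩
  have hTm : ∀ d v, v ∈ Bs → d ∣ v → d ∈ T := fun d v h1 h2 => by
    rw [hT, mem_biUnion]; exact ⟨v, h1, Nat.mem_divisors.2 ⟨h2, (hB v h1).1⟩⟩
  have hTs : ∑ d ∈ T, (1/d:ℝ) ≤ exp (PR n + 9) := by
    have := rankin' (fun _ => 1) n (fun p _ => by norm_num) T (fun d hd => by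
      rw [hT, mem_biUnion] at hd
      obtain ⟨v, h1, h2⟩ := hd
      exact ⟨(Nat.pos_of_mem_divisors h2).ne', fun p hp h3 => (hB v h1).2 p hp (h3.trans (Nat.dvd_of_mem_divisors h2))⟩)
    simpa [mval, PR] using this
  have hpos : ∀ v ∈ Bs, 0 < v := fun v h => Nat.pos_of_ne_zero (hB v h).1
  have e1 : ∑ a ∈ Bs ×ˢ Bs, (Nat.gcd a.1 a.2 : ℝ)/(a.1*a.2) =
      ∑ a ∈ Bs ×ˢ Bs, (fun c : ℕ × ℕ × ℕ => (1/c.1:ℝ)*((1/c.2.1)*(1/c.2.2))) ((fun a : ℕ × ℕ => (Nat.gcd a.1 a.2, a.1/Nat.gcd a.1 a.2, a.2/Nat.gcd a.1 a.2)) a) := by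
    refine sum_congr rfl fun a ha => ?_
    rw [mem_product] at ha
    have h0 := hpos _ ha.1
    have g0 : (0:ℝ) < Nat.gcd a.1 a.2 := by exact_mod_cast Nat.gcd_pos_of_pos_left _ h0
    have h1 : (0:ℝ) < a.1 := by exact_mod_cast h0
    have h2 : (0:ℝ) < a.2 := by exact_mod_cast hpos _ ha.2
    simp only []
    rw [Nat.cast_div (Nat.gcd_dvd_left _ _) g0.ne', Nat.cast_div (Nat.gcd_dvd_right _ _) g0.ne']
    field_simp
  rw [e1, ← sum_image (s := Bs ×ˢ Bs) (f := fun c : ℕ × ℕ × ℕ => (1/c.1:ℝ)*((1/c.2.1)*(1/c.2.2)))]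
  · refine (sum_le_sum_of_subset_of_nonneg (t := T ×ˢ T ×ˢ T) (fun c hc => ?_) fun c _ _ => by positivity).trans ?_
    · obtain ⟨a, ha, rfl⟩ := mem_image.1 hc
      rw [mem_product] at ha
      simp only [mem_product]
      exact ⟨hTm _ _ ha.1 (Nat.gcd_dvd_left _ _), hTm _ _ ha.1 (Nat.div_dvd_of_dvd (Nat.gcd_dvd_left _ _)), hTm _ _ ha.2 (Nat.div_dvd_of_dvd (Nat.gcd_dvd_right _ _))⟩
    · rw [sum_product]
      simp only []
      rw [← sum_mul_sum, sum_product]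
      simp only []
      rw [← sum_mul_sum, show 3*(PR n+9) = (PR n+9)+((PR n+9)+(PR n+9)) by ring, exp_add _ (_+_), exp_add (PR n+9)]
      have : 0 ≤ ∑ d ∈ T, (1/d:ℝ) := sum_nonneg fun _ _ => by positivity
      gcongr
  · intro a ha b hb hab
    simp only [Prod.mk.injEq] at hab
    obtain ⟨h1, h2, h3⟩ := hab
    apply Prod.ext
    · rw [← Nat.div_mul_cancel (Nat.gcd_dvd_left a.1 a.2), h2, h1, Nat.div_mul_cancel (Nat.gcd_dvd_left _ _)]
    · rw [← Nat.div_mul_cancel (Nat.gcd_dvd_right a.1 a.2), h3, h1, Nat.div_mul_cancel (Nat.gcd_dvd_right _ _)]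
open Classical in
noncomputable def Qs (y : ℝ) : Finset ℕ := {q ∈ PL ⌊y⌋₊ | √y < q ∧ Nrm (1/2) q}
lemma pl_card (n : ℕ) : (PL n).card = Nat.primeCounting n := by
  rw [Nat.primeCounting, Nat.primeCounting', Nat.count_eq_card_filter_range, PL]
lemma Qs_card : ∀ᶠ y : ℝ in atTop, y/(4*log y) ≤ ((Qs y).card : ℝ) := by
  classical
  obtain ⟨C, y0, hC, hy0, h⟩ := abn_count
  have hg : ∀ᶠ g : ℝ in atTop, C*g^7*exp (-((1/2:ℝ)^2/4*g)) ≤ 1/16 := by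
    filter_upwards [ev_pow_exp 8 (1/16) (by norm_num), eventually_ge_atTop (16*C), eventually_gt_atTop 0] with g h1 h2 h3
    rw [Real.exp_neg, ← div_eq_mul_inv, div_le_iff₀ (by positivity), show (1/2:ℝ)^2/4*g = 1/16*g by ring]
    have : 16*C*g^7 ≤ g*g^7 := by gcongr
    nlinarith only [this, h1]
  have hl : ∀ᶠ l : ℝ in atTop, C*(log l)^7*exp (-((1/2:ℝ)^2/4*log l)) ≤ 1/16 ∧ l^2 ≤ exp (1/2*l) ∧ 16 ≤ l :=
    (tendsto_log_atTop.eventually hg).and ((ev_pow_exp 2 (1/2) (by norm_num)).and (eventually_ge_atTop 16))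
  filter_upwards [tendsto_log_atTop.eventually hl, eventually_ge_atTop y0, eventually_ge_atTop 100] with y ⟨h1, h2, h3⟩ h4 h5
  have hy : 0 < y := by linarith
  have hs : √y = exp (1/2*log y) := by
    rw [← Real.exp_log (Real.sqrt_pos.2 hy), Real.log_sqrt hy.le]; congr 1; ring
  have hss : √y*√y = y := Real.mul_self_sqrt hy.le
  rw [← hs] at h2
  have hb := h y h4 (1/2) (by norm_num) (by norm_num) {q ∈ PL ⌊y⌋₊ | √y < q ∧ ¬ Nrm (1/2) q} (fun q hq => by
    rw [mem_filter, mem_PL] at hq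
    exact ⟨hq.1.2, (Nat.le_floor_iff hy.le).1 hq.1.1, hq.2⟩)
  have hp := Chebyshev.pi_ge' (show 1 < y by linarith)
  rw [← pl_card] at hp
  have hc : (PL ⌊y⌋₊).card ≤ (Qs y).card + ({q ∈ PL ⌊y⌋₊ | √y < q ∧ ¬ Nrm (1/2) q} : Finset ℕ).card + (Finset.Icc 1 ⌊√y⌋₊).card := by
    refine (card_le_card (t := Qs y ∪ {q ∈ PL ⌊y⌋₊ | √y < q ∧ ¬ Nrm (1/2) q} ∪ Finset.Icc 1 ⌊√y⌋₊) fun q hq => ?_).trans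
      ((card_union_le _ _).trans (Nat.add_le_add_right (card_union_le _ _) _))
    simp only [mem_union, Qs, mem_filter (s := PL _), mem_Icc, Nat.le_floor_iff (sqrt_nonneg y)]
    have := (mem_PL.1 hq).2.one_le
    by_cases a : √y < q
    · by_cases b : Nrm (1/2) q
      · exact Or.inl (Or.inl ⟨hq, a, b⟩)
      · exact Or.inl (Or.inr ⟨hq, a, b⟩)
    · exact Or.inr ⟨this, not_lt.1 a⟩
  have hc' : ((PL ⌊y⌋₊).card:ℝ) ≤ (Qs y).card + ({q ∈ PL ⌊y⌋₊ | √y < q ∧ ¬ Nrm (1/2) q} : Finset ℕ).card + ⌊√y⌋₊ := by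
    have : (Finset.Icc 1 ⌊√y⌋₊).card = ⌊√y⌋₊ := by simp
    rw [this] at hc; exact_mod_cast hc
  have hf := Nat.floor_le (sqrt_nonneg y)
  have l0 : 0 < log y := by linarith
  have hlog : log (y+2) ≤ log y + 1 := by
    rw [← log_exp (log y + 1), exp_add, exp_log hy]
    apply log_le_log (by linarith)
    nlinarith only [h5, add_one_le_exp (1:ℝ)]
  have hb2 : C*(y/log y)*(log (log y))^7*exp (-((1/2:ℝ)^2/4*log (log y))) ≤ y/log y*(1/16) := by
    have : 0 < y/log y := by positivity
    nlinarith only [this, h1]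
  rw [div_le_iff₀ l0] at hp
  have h6 : y/(4*log y)*log y = y/4 := by field_simp
  have h7 : y/log y*(1/16)*log y = y/16 := by field_simp
  have h8 : √y*log y ≤ y/16 := by nlinarith only [h2, h3, hss, l0, sqrt_nonneg y]
  refine le_of_mul_le_mul_right ?_ l0
  rw [h6]
  have h9 : ((PL ⌊y⌋₊).card:ℝ)*log y ≤ ((Qs y).card + y/log y*(1/16) + √y)*log y := by
    apply mul_le_mul_of_nonneg_right _ l0.le; linarith
  have h10 : (y-1)*log 2 ≥ (y-1)*0.69 := mul_le_mul_of_nonneg_left (by linarith [log_two_gt_d9]) (by linarith)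
  have h11 : 1*log y ≤ √y*log y := mul_le_mul_of_nonneg_right (Real.one_le_sqrt.2 (by linarith)) l0.le
  have h12 : (((Qs y).card:ℝ) + y/log y*(1/16) + √y)*log y = (Qs y).card*log y + y/16 + √y*log y := by rw [← h7]; ring
  linarith
end FordT

namespace FordT
open Real Finset Filter
lemma res_aux {b b' k p : ℕ} (hp : p.Prime) (h : ¬ p ∣ (b*k)*(b'*k)*((b-b')+(b'-b))) :
    ¬ p ∣ b*k ∧ ¬ p ∣ b'*k ∧ ¬ b*k ≡ b'*k [MOD p] := by
  have h1 : ¬ p ∣ b*k := fun a => h ((a.mul_right _).mul_right _)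
  refine ⟨h1, fun a => h ((a.mul_left _).mul_right _), fun hm => h (Dvd.dvd.mul_left ?_ _)⟩
  have hk : ¬ p ∣ k := fun a => h1 (a.mul_left _)
  have h2 := Nat.ModEq.cancel_right_of_coprime ((Nat.Prime.coprime_iff_not_dvd hp).2 hk) hm
  rcases le_total b b' with h3 | h3
  · rw [Nat.sub_eq_zero_of_le h3, zero_add]; exact (Nat.modEq_iff_dvd' h3).1 h2
  · rw [Nat.sub_eq_zero_of_le h3, add_zero]; exact (Nat.modEq_iff_dvd' h3).1 h2.symm
lemma harm {X : ℝ} (hX : 1 ≤ X) : ∑ k ∈ Finset.Icc 1 ⌊X⌋₊, (1/k:ℝ) ≤ 1 + log X := by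
  have := harmonic_floor_le_one_add_log X hX
  rw [harmonic_eq_sum_Icc] at this
  push_cast at this
  simpa only [one_div] using this
lemma coll : ∃ C Y0 : ℝ, 0 < C ∧ ∀ (X M : ℝ) (v v' : ℕ) (Q Q' : Finset ℕ), v ≠ v' → 1 ≤ v → 1 ≤ v' → Y0 ≤ exp M → 0 < M → 1 ≤ X →
    3*log X ≤ M^3 → (∀ q ∈ Q, q.Prime ∧ (q:ℝ)*v ≤ X ∧ ∃ P : ℕ, P.Prime ∧ exp M ≤ P ∧ P ∣ q-1) → (∀ q ∈ Q', q.Prime) →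
    (∀ p : ℕ, p.Prime → p ∣ v' → (p:ℝ) < exp M) →
    (#{a ∈ Q ×ˢ Q' | (a.1-1)*v = (a.2-1)*v'} : ℝ) ≤ (Nat.gcd v v':ℝ)/(v*v') * (C*X*(log (log X))^6/M^3*(1+log X)) := by
  classical
  obtain ⟨C, Y0, hC, hY0, hS⟩ := sieve 2
  refine ⟨C, Y0, hC, fun X M v v' Q Q' hvv hv hv' hYM hM hX hXM hQ hQ' hp => ?_⟩
  obtain ⟨g, hg⟩ : ∃ g, g = Nat.gcd v v' := ⟨_, rfl⟩
  have g0 : 0 < g := hg ▸ Nat.gcd_pos_of_pos_left _ hv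
  obtain ⟨b, hb⟩ : g ∣ v := hg ▸ Nat.gcd_dvd_left _ _
  obtain ⟨b', hb'⟩ : g ∣ v' := hg ▸ Nat.gcd_dvd_right _ _
  have cop : Nat.Coprime b b' := by
    have := Nat.coprime_div_gcd_div_gcd (hg ▸ g0 : 0 < Nat.gcd v v')
    rwa [← hg, hb, hb', Nat.mul_div_cancel_left _ g0, Nat.mul_div_cancel_left _ g0] at this
  have b0 : 0 < b := Nat.pos_of_ne_zero fun h => by rw [h] at hb; omega
  have b0' : 0 < b' := Nat.pos_of_ne_zero fun h => by rw [h] at hb'; omega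
  have hbb : b ≠ b' := fun h => hvv (by rw [hb, hb', h])
  rw [← hg]
  obtain ⟨Y, hY⟩ : ∃ Y : ℕ → ℝ, Y = fun k : ℕ => X/(k*(g*b*b')) := ⟨_, rfl⟩
  obtain ⟨S, hSd⟩ : ∃ S : ℕ → Finset ℕ, S = fun k => if exp M ≤ Y k then {n ∈ Finset.range (⌊Y k⌋₊+1) | n.Prime ∧ ∀ c ∈ ({b*k, b'*k} : Finset ℕ), (c*n+1).Prime} else ∅ := ⟨_, rfl⟩
  have g0' : (1:ℝ) ≤ g := by exact_mod_cast g0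
  have c0 : (1:ℝ) ≤ b := by exact_mod_cast b0
  have c0' : (1:ℝ) ≤ b' := by exact_mod_cast b0'
  have hsub : ({a ∈ Q ×ˢ Q' | (a.1-1)*v = (a.2-1)*v'} : Finset (ℕ × ℕ)) ⊆
      (Finset.Icc 1 ⌊X⌋₊).biUnion fun k => (S k).image fun P => (b'*k*P+1, b*k*P+1) := by
    rintro ⟨q, q'⟩ ha
    rw [mem_filter, mem_product] at ha
    simp only [] at ha
    obtain ⟨⟨h1, h2⟩, h3⟩ := ha
    obtain ⟨q1, q2, P, q3, q4, q5⟩ := hQ q h1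
    have q1' := hQ' q' h2
    have h4 : (q-1)*b = (q'-1)*b' := by
      apply Nat.eq_of_mul_eq_mul_left g0
      rw [hb, hb'] at h3; linarith
    obtain ⟨t, ht⟩ : b' ∣ q-1 := cop.symm.dvd_of_dvd_mul_right (Dvd.intro_left _ h4.symm)
    have ht' : q'-1 = b*t := by
      apply Nat.eq_of_mul_eq_mul_right b0'
      rw [← h4, ht]; ring
    obtain ⟨k, hk⟩ : P ∣ t := by
      rw [ht] at q5
      refine ((Nat.Prime.dvd_mul q3).1 q5).resolve_left fun h => ?_
      exact absurd (hp P q3 (hb' ▸ h.mul_left g)) (not_lt.2 q4)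
    have hqe : q = b'*k*P+1 := by have := q1.two_le; rw [hk] at ht; rw [← Nat.sub_add_cancel (show 1 ≤ q by omega), ht]; ring
    have hqe' : q' = b*k*P+1 := by have := q1'.two_le; rw [hk] at ht'; rw [← Nat.sub_add_cancel (show 1 ≤ q' by omega), ht']; ring
    have k0 : 1 ≤ k := Nat.one_le_iff_ne_zero.2 fun h => by rw [hqe, h] at q1; simp at q1; exact Nat.not_prime_one q1
    have k1 : (1:ℝ) ≤ k := by exact_mod_cast k0
    have hPY : (P:ℝ) ≤ Y k := by
      rw [hY]; simp only []
      rw [le_div_iff₀ (by positivity)]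
      refine le_trans (le_of_eq ?_) ((mul_le_mul_of_nonneg_right (show ((q:ℝ)-1) ≤ q by linarith) (Nat.cast_nonneg v)).trans q2)
      rw [hqe, hb]; push_cast; ring
    have hkX : (k:ℝ) ≤ X := by
      rw [hY, le_div_iff₀ (by positivity)] at hPY
      have p1 : (1:ℝ) ≤ P := by exact_mod_cast q3.one_le
      calc (k:ℝ) = 1*(k*(1*1*1)) := by ring
        _ ≤ P*(k*(g*b*b')) := by gcongr
        _ ≤ X := hPY
    rw [mem_biUnion]
    refine ⟨k, mem_Icc.2 ⟨k0, Nat.le_floor hkX⟩, mem_image.2 ⟨P, ?_, by rw [← hqe, ← hqe']⟩⟩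
    rw [hSd]; simp only []
    rw [if_pos (q4.trans hPY), mem_filter, mem_range, Nat.lt_succ_iff]
    refine ⟨Nat.le_floor hPY, q3, fun c hc => ?_⟩
    rw [mem_insert, mem_singleton] at hc
    rcases hc with rfl | rfl
    · rwa [← hqe']
    · rwa [← hqe]
  have hSc : ∀ k ∈ Finset.Icc 1 ⌊X⌋₊, ((S k).card:ℝ) ≤ (1/k)*((g:ℝ)/(v*v')*(C*X*(log (log X))^6/M^3)) := fun k hk => by
    rw [mem_Icc] at hk
    have k1 : (1:ℝ) ≤ k := by exact_mod_cast hk.1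
    have hl : 0 ≤ (log (log X))^6 := by positivity
    rw [hSd]; simp only []
    split_ifs with hc
    · have hYk : Y0 ≤ Y k := hYM.trans hc
      have hYp : 3 ≤ Y k := hY0.trans hYk
      have hE : Y k = X/(k*(g*b*b')) := by rw [hY]
      have hYX : (k:ℝ)*(g*b*b') ≤ X := by
        have h1 : 1 ≤ X/(k*(g*b*b')) := by rw [← hE]; linarith
        rwa [le_div_iff₀ (by positivity), one_mul] at h1
      have hYX' : Y k ≤ X := by
        rw [hE]; apply div_le_self (by linarith)
        calc (1:ℝ) = 1*(1*1*1) := by ring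
          _ ≤ k*(g*b*b') := by gcongr
      have hlY : M ≤ log (Y k) := by rw [← log_exp M]; exact log_le_log (exp_pos _) hc
      have hl1 : 1 ≤ log (Y k) := by rw [le_log_iff_exp_le (by linarith)]; linarith [exp_one_lt_d9]
      have e1 : (b*k:ℝ) ≤ X := le_trans (by
        calc (b*k:ℝ) = k*(1*b*1) := by ring
          _ ≤ k*(g*b*b') := by gcongr) hYX
      have e2 : (b'*k:ℝ) ≤ X := le_trans (by
        calc (b'*k:ℝ) = k*(1*1*b') := by ring
          _ ≤ k*(g*b*b') := by gcongr) hYX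
      have e3 : (((b-b')+(b'-b):ℕ):ℝ) ≤ X := by
        have : (b-b')+(b'-b) ≤ max (b*k) (b'*k) := by
          have := Nat.le_mul_of_pos_right b hk.1
          have := Nat.le_mul_of_pos_right b' hk.1
          omega
        refine le_trans (by exact_mod_cast this : (((b-b')+(b'-b):ℕ):ℝ) ≤ ((max (b*k) (b'*k):ℕ):ℝ)) ?_
        push_cast; exact max_le e1 e2
      have hD0 : (b*k)*(b'*k)*((b-b')+(b'-b)) ≠ 0 := by
        have : (b-b')+(b'-b) ≠ 0 := by omega
        have : k ≠ 0 := by omega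
        simp [*, b0.ne', b0'.ne']; omega
      have := hS (Y k) hYk {b*k, b'*k} ((b*k)*(b'*k)*((b-b')+(b'-b))) (card_pair fun h => hbb (Nat.eq_of_mul_eq_mul_right hk.1 h)) hD0 (by
        have h1 : log (((b*k)*(b'*k)*((b-b')+(b'-b)):ℕ):ℝ) ≤ log (X^3) := by
          apply log_le_log (by exact_mod_cast Nat.pos_of_ne_zero hD0)
          push_cast at e3 ⊢
          calc _ ≤ X*X*X := by gcongr
            _ = X^3 := by ring
        rw [log_pow] at h1
        refine h1.trans (le_trans (by exact_mod_cast hXM) (by gcongr))) (fun p hp hpD => by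
          obtain ⟨a1, a2, a3⟩ := res_aux hp hpD
          refine ⟨fun c hc => ?_, fun c hc c' hc' hcc => ?_⟩
          · rw [mem_insert, mem_singleton] at hc
            rcases hc with rfl | rfl <;> assumption
          · rw [mem_insert, mem_singleton] at hc hc'
            rcases hc with rfl | rfl <;> rcases hc' with rfl | rfl
            · exact absurd rfl hcc
            · exact a3
            · exact fun h => a3 h.symm
            · exact absurd rfl hcc)
      refine this.trans ?_
      have hll : (log (log (Y k)))^(2*(2+1)) ≤ (log (log X))^6 :=
        pow_le_pow_left₀ (log_nonneg hl1) (log_le_log (by linarith) (log_le_log (by linarith) hYX')) 6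
      calc _ ≤ C * Y k * (log (log X))^6 / M^3 := by
            apply div_le_div₀ (by positivity) _ (by positivity) (pow_le_pow_left₀ hM.le hlY 3)
            gcongr
        _ = _ := by rw [hE, hb, hb']; push_cast; field_simp
    · simp only [card_empty, Nat.cast_zero]; positivity
  have h1 : (#{a ∈ Q ×ˢ Q' | (a.1-1)*v = (a.2-1)*v'} : ℝ) ≤ ∑ k ∈ Finset.Icc 1 ⌊X⌋₊, ((S k).card:ℝ) := by
    have := (card_le_card hsub).trans (card_biUnion_le.trans (sum_le_sum fun k _ => card_image_le))
    exact_mod_cast this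
  refine h1.trans ((sum_le_sum hSc).trans ?_)
  rw [← sum_mul]
  have := mul_le_mul_of_nonneg_right (harm hX) (show 0 ≤ (g:ℝ)/(v*v')*(C*X*(log (log X))^6/M^3) by positivity)
  linarith
end FordT

namespace FordT
open Real Finset Filter
noncomputable def Mt (L : ℝ) : ℝ := exp (L-4)/(3*(L+1))
lemma top_q {X L : ℝ} {v q : ℕ} (hX : 1 < X) (hL : L = log (log X)) (L0 : 100 ≤ L) (hv : 1 ≤ v) (hv2 : (v:ℝ) ≤ E (L/5)) (hq : q ∈ Qs (X/v)) :
    q.Prime ∧ (q:ℝ)*v ≤ X ∧ ∃ P : ℕ, P.Prime ∧ exp (Mt L) ≤ P ∧ P ∣ q-1 := by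
  classical
  have hXE : X = exp (exp L) := by rw [hL, exp_log (log_pos hX), exp_log (by linarith)]
  have hv0 : (0:ℝ) < v := by exact_mod_cast hv
  have hlX : log X = exp L := by rw [hXE, log_exp]
  have hlv : log v ≤ exp (L/5) := by rw [log_le_iff_le_exp hv0]; exact hv2
  have h1 : exp (L-1) ≤ log (X/v) := by
    rw [log_div (by linarith) hv0.ne', hlX]
    have a1 : exp L = exp (L-1)*exp 1 := by rw [← exp_add]; ring_nf
    have a2 : exp (L/5) ≤ exp (L-1) := exp_le_exp.2 (by linarith)
    nlinarith only [a1, a2, hlv, exp_one_gt_d9, exp_pos (L-1)]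
  have hl0 := exp_pos (L-1)
  have hXv : 0 < X/v := by positivity
  have h2 : L - 1 ≤ log (log (X/v)) := by rw [le_log_iff_exp_le (by linarith)]; exact h1
  have h3 : log (log (X/v)) ≤ L := by
    rw [hL]
    apply log_le_log (by linarith) (log_le_log hXv (div_le_self (by linarith) (by exact_mod_cast hv)))
  rw [Qs, mem_filter, mem_PL, Nat.le_floor_iff hXv.le] at hq
  obtain ⟨⟨q1, q2⟩, q3, q4⟩ := hq
  have hy16 : 16 ≤ X/v := by
    have := add_one_le_exp (L-1)
    have := log_le_sub_one_of_pos hXv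
    linarith
  obtain ⟨-, g1, g2⟩ := gw_bd hy16 q3 q1
  have f1 := Nat.floor_le (show 0 ≤ L-3 by linarith)
  have f2 := Nat.lt_floor_add_one (L-3)
  have f3 := Nat.floor_le (show 0 ≤ L by linarith)
  have f4 := Nat.lt_floor_add_one L
  have f5 : 2 ≤ ⌊L-3⌋₊ := Nat.le_floor (by push_cast; linarith)
  have f6 : ⌊L-3⌋₊ ≤ gw q := Nat.floor_le_of_le (by linarith)
  have f7 : gw q + 1 ≤ ⌊L⌋₊+1 := Nat.succ_le_succ (Nat.le_floor (by linarith))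
  obtain ⟨-, P, p1, p2, p3⟩ := hpf_aux le_rfl f5 q2 q4 f6 f7
  refine ⟨q2, (le_div_iff₀ hv0).1 q1, P, p1, le_trans ?_ ((Nat.le_ceil _).trans (by exact_mod_cast p2)), p3⟩
  rw [exp_le_exp, Mt]
  push_cast
  apply div_le_div₀ (exp_pos _).le (exp_le_exp.2 (by linarith)) (by positivity) (by linarith)
lemma coll_tot : ∃ C : ℝ, 0 < C ∧ ∀ᶠ X : ℝ in atTop, ∀ Bs : Finset ℕ, (∀ v ∈ Bs, 1 ≤ v ∧ (v:ℝ) ≤ E (log (log X)/5) ∧ ∀ p : ℕ, p.Prime → p ∣ v → (p:ℝ) ≤ E (log (log X)/10)) →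
    ∑ v ∈ Bs, ((Qs (X/v)).card:ℝ) - C*X*(log (log X))^6*exp (-(7/5*log (log X))) ≤ (((Bs.sigma fun v => Qs (X/v)).image fun a => (a.2-1)*a.1).card : ℝ) := by
  classical
  obtain ⟨C, Y0, hC, hco⟩ := coll
  obtain ⟨C1, hC1, hPR⟩ := PRE
  refine ⟨exp (3*(C1+9))*(C*2), by positivity, ?_⟩
  have hev : ∀ᶠ L : ℝ in atTop, exp (9/10*L) ≤ Mt L ∧ 100 ≤ L ∧ 2*Y0 ≤ L := by
    filter_upwards [ev_pow_exp 2 (1/20) (by norm_num), eventually_ge_atTop 100, eventually_ge_atTop (2*Y0)] with L h1 h2 h3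
    refine ⟨?_, h2, h3⟩
    rw [Mt, le_div_iff₀ (by positivity), show L-4 = 9/10*L+(1/20*L+(1/20*L-4)) by ring, exp_add, exp_add]
    refine mul_le_mul_of_nonneg_left ?_ (exp_pos _).le
    have h4 : 1 ≤ exp (1/20*L-4) := one_le_exp (by linarith)
    nlinarith only [h1, h2, h4]
  filter_upwards [(tendsto_log_atTop.comp tendsto_log_atTop).eventually hev, eventually_gt_atTop 1] with X hX X1 Bs hB
  obtain ⟨L, hL⟩ : ∃ L, L = log (log X) := ⟨_, rfl⟩
  simp only [Function.comp, ← hL] at hX hB ⊢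
  obtain ⟨hM, L0, hY⟩ := hX
  have hlX : log X = exp L := by rw [hL, exp_log (log_pos X1)]
  have hM0 : 0 < Mt L := (exp_pos _).trans_le hM
  have hM1 : exp (L/10) < Mt L := lt_of_lt_of_le (exp_lt_exp.2 (by linarith)) hM
  have hM3 : exp (27/10*L) ≤ Mt L^3 := by
    calc _ = exp (9/10*L)^3 := by rw [← exp_nat_mul]; congr 1; push_cast; ring
      _ ≤ _ := by gcongr
  obtain ⟨Z, hZ⟩ : ∃ Z, Z = C*X*(log (log X))^6/Mt L^3*(1+log X) := ⟨_, rfl⟩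
  have hZ0 : 0 ≤ Z := by rw [hZ, hlX]; positivity
  have hvv : ∀ v ∈ Bs, ∀ v' ∈ Bs, ∑ q ∈ Qs (X/v), ∑ q' ∈ Qs (X/v'), (if (⟨v, q⟩ : (_ : ℕ) × ℕ) ≠ ⟨v', q'⟩ ∧ (q-1)*v = (q'-1)*v' then (1:ℝ) else 0) ≤ (Nat.gcd v v':ℝ)/(v*v')*Z := fun v hv v' hv' => by
    obtain ⟨v1, v2, v3⟩ := hB v hv
    obtain ⟨v1', v2', v3'⟩ := hB v' hv'
    have nn : 0 ≤ (Nat.gcd v v':ℝ)/(v*v')*Z := by positivity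
    by_cases hne : v = v'
    · subst hne
      refine le_trans (le_of_eq (sum_eq_zero fun q hq => sum_eq_zero fun q' hq' => if_neg ?_)) nn
      rintro ⟨h1, h2⟩
      have h3 := (top_q X1 hL L0 v1 v2 hq).1.two_le
      have h4 := (top_q X1 hL L0 v1 v2 hq').1.two_le
      have h5 := Nat.eq_of_mul_eq_mul_right v1 h2
      exact h1 (by rw [show q = q' by omega])
    · have hc := hco X (Mt L) v v' (Qs (X/v)) (Qs (X/v')) hne v1 v1' (by linarith [add_one_le_exp (Mt L), add_one_le_exp (9/10*L), exp_pos (L/10), add_one_le_exp (9/10*L)]) hM0 X1.le (by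
        refine le_trans ?_ hM3
        rw [hlX, show 27/10*L = L + 17/10*L by ring, exp_add]
        nlinarith only [exp_pos L, add_one_le_exp (17/10*L), L0]) (fun q hq => top_q X1 hL L0 v1 v2 hq) (fun q hq => (top_q X1 hL L0 v1' v2' hq).1)
        (fun p hp hpv => (v3' p hp hpv).trans_lt (exp_lt_exp.2 hM1))
      rw [← hZ] at hc
      refine le_trans ?_ hc
      rw [card_filter, Nat.cast_sum, sum_product]
      refine sum_le_sum fun q _ => sum_le_sum fun q' _ => ?_
      by_cases h : (q-1)*v = (q'-1)*v'
      · simp [h, hne]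
      · simp [h]
  have key := img_ge (Bs.sigma fun v => Qs (X/v)) (fun a => (a.2-1)*a.1) (fun _ => 1) (fun _ => zero_le_one)
  simp only [sum_const, nsmul_eq_mul, mul_one] at key
  refine le_trans (sub_le_sub ?_ ?_) key
  · rw [card_sigma]; push_cast; rfl
  · rw [sum_sigma]
    simp only [sum_sigma]
    have h1 : ∑ v ∈ Bs, ∑ q ∈ Qs (X/v), ∑ v' ∈ Bs, ∑ q' ∈ Qs (X/v'), (if (⟨v, q⟩ : (_ : ℕ) × ℕ) ≠ ⟨v', q'⟩ ∧ (q-1)*v = (q'-1)*v' then (1:ℝ) else 0) ≤ ∑ a ∈ Bs ×ˢ Bs, (Nat.gcd a.1 a.2:ℝ)/(a.1*a.2)*Z := by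
      rw [sum_product]
      refine sum_le_sum fun v hv => ?_
      rw [sum_comm]
      exact sum_le_sum fun v' hv' => hvv v hv v' hv'
    refine h1.trans ?_
    rw [← sum_mul]
    have h2 := gcd_sum ⌊E (L/10)⌋₊ Bs fun v hv => ⟨by have := (hB v hv).1; omega, fun p hp h => Nat.le_floor ((hB v hv).2.2 p hp h)⟩
    have h3 := (abs_le.1 (hPR (L/10) (by linarith))).2
    have h4 : exp (3*(PR ⌊E (L/10)⌋₊ + 9)) ≤ exp (3*(C1+9))*exp (3/10*L) := by
      rw [← exp_add]; exact exp_le_exp.2 (by linarith)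
    have h5 : Z ≤ C*2*X*L^6*exp (-(17/10*L)) := by
      rw [hZ, ← hL, hlX]
      have : 1 + exp L ≤ 2*exp L := by linarith [add_one_le_exp L]
      calc _ ≤ C*X*L^6/exp (27/10*L)*(2*exp L) := by gcongr
        _ = _ := by rw [show 27/10*L = L + 17/10*L by ring, exp_add, exp_neg]; field_simp
    calc _ ≤ exp (3*(C1+9))*exp (3/10*L)*(C*2*X*L^6*exp (-(17/10*L))) := mul_le_mul (h2.trans h4) h5 hZ0 (by positivity)
      _ = _ := by rw [show -(7/5*L) = 3/10*L + -(17/10*L) by ring, exp_add]; ring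
end FordT

namespace FordT
open Real Finset Filter
noncomputable def l3 (x : ℝ) : ℝ := log (log (log x))
lemma tl3 : Tendsto l3 atTop atTop := tendsto_log_atTop.comp (tendsto_log_atTop.comp tendsto_log_atTop)
lemma lower_V {ϱ : ℝ} (h : HR ϱ) : ∃ K : ℝ, 1 ≤ K ∧ ∀ᶠ X : ℝ in atTop, ∃ S : Finset ℕ,
    (∀ s ∈ S, (s:ℝ) ≤ X ∧ ∃ q n : ℕ, q.Prime ∧ 7 ≤ q ∧ s = (q-1)*F n ∧ ¬ q ∣ n ∧ 1 ≤ n ∧ ∀ p : ℕ, p.Prime → p ∣ n → 7 ≤ p) ∧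
    X/log X*exp ((l3 X - log (l3 X))^2/(2*log (1/ϱ)) - K*l3 X) ≤ (S.card : ℝ) := by
  obtain ⟨K, hK, hB⟩ := lower_B h
  obtain ⟨C, hC, hcol⟩ := coll_tot
  refine ⟨K+3, by linarith, ?_⟩
  obtain ⟨y1, hy1⟩ := eventually_atTop.1 Qs_card
  have hLe : ∀ᶠ L : ℝ in atTop, 8*C*L^(6+⌈K⌉₊) ≤ exp (2/5*L) ∧ 100 ≤ L ∧ 6*(L+1) ≤ exp (1/10*L) := by
    filter_upwards [ev_pow_exp (7+⌈K⌉₊) (2/5) (by norm_num), eventually_ge_atTop (8*C), eventually_ge_atTop 100, ev_pow_exp 2 (1/10) (by norm_num)] with L h1 h2 h3 h4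
    refine ⟨le_trans ?_ h1, h3, by nlinarith only [h3, h4]⟩
    rw [show 7+⌈K⌉₊ = (6+⌈K⌉₊)+1 by ring, pow_succ, mul_comm _ L]
    gcongr
  filter_upwards [hcol, tl3.eventually hB, (tendsto_log_atTop.comp tendsto_log_atTop).eventually hLe, eventually_ge_atTop (max 1 y1^2+1), tl3.eventually_ge_atTop 1] with X h1 h2 h3 h4 h5
  obtain ⟨L, hL⟩ : ∃ L, L = log (log X) := ⟨_, rfl⟩
  obtain ⟨m, hm⟩ : ∃ m, m = l3 X := ⟨_, rfl⟩
  have hmL : m = log L := by rw [hm, hL, l3]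
  rw [← hm] at h2 h5 ⊢
  simp only [Function.comp, ← hL] at h1 h3
  obtain ⟨a1, a2, a3⟩ := h3
  have L0 : 0 < L := by linarith
  have heL : exp m = L := by rw [hmL, exp_log L0]
  rw [heL] at h2
  obtain ⟨Bs, b1, b2⟩ := h2
  have hy0 : (0:ℝ) < max 1 y1^2 := by positivity
  have X1 : 1 < X := by linarith
  have hlX : log X = exp L := by rw [hL, exp_log (log_pos X1)]
  have hXE : X = exp (exp L) := by rw [← hlX, exp_log (by linarith)]
  have h6 := h1 Bs fun v hv => (b1 v hv).2
  refine ⟨_, fun s hs => ?_, le_trans ?_ h6⟩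
  · obtain ⟨⟨v, q⟩, ha, rfl⟩ := mem_image.1 hs
    rw [mem_sigma] at ha
    obtain ⟨hv, hq⟩ := ha
    simp only [] at hv hq ⊢
    obtain ⟨⟨n, n1, n2, n3⟩, v1, v2, v3⟩ := b1 v hv
    obtain ⟨q1, q2, P, q3, q4, q5⟩ := top_q X1 hL a2 v1 v2 hq
    have hM : exp (L/10) ≤ Mt L := by
      rw [Mt, le_div_iff₀ (by positivity)]
      calc _ ≤ exp (L/10)*exp (1/10*L) := by gcongr; linarith
        _ ≤ _ := by rw [← exp_add]; exact exp_le_exp.2 (by linarith)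
    have hPq : (P:ℝ) < q := by
      have := Nat.le_of_dvd (by have := q1.two_le; omega) q5
      have := q1.two_le
      exact_mod_cast (by omega : P < q)
    have hEP : E (L/10) < q := (exp_le_exp.2 hM).trans_lt (q4.trans_lt hPq)
    refine ⟨?_, q, n, q1, ?_, by rw [n2], fun hd => absurd (n3 q q1 hd).2 (not_le.2 hEP), n1, fun p hp hd => (n3 p hp hd).1⟩
    · refine le_trans ?_ q2
      push_cast
      exact mul_le_mul_of_nonneg_right (by exact_mod_cast Nat.sub_le q 1) (Nat.cast_nonneg _)
    · have e1 := add_one_le_exp (L/10)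
      have e2 := add_one_le_exp (exp (L/10))
      have : (7:ℝ) ≤ q := by unfold E at hEP; linarith
      exact_mod_cast this
  · obtain ⟨T, hT⟩ : ∃ T, T = ∑ v ∈ Bs, 1/(v:ℝ) := ⟨_, rfl⟩
    have e1 : X/(4*log X)*T ≤ ∑ v ∈ Bs, ((Qs (X/v)).card:ℝ) := by
      rw [hT, mul_sum]
      refine sum_le_sum fun v hv => ?_
      obtain ⟨-, v1, v2, -⟩ := b1 v hv
      have v0 : (1:ℝ) ≤ v := by exact_mod_cast v1
      have v3 : (v:ℝ)^2 ≤ X := by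
        calc (v:ℝ)^2 ≤ E (L/5)^2 := by gcongr
          _ = exp (2*exp (L/5)) := by rw [E, ← exp_nat_mul]; norm_num
          _ ≤ X := by
            rw [hXE, exp_le_exp, show L = L/5+4/5*L by ring, exp_add]
            rw [show (L/5+4/5*L)/5 = L/5 by ring]
            nlinarith only [exp_pos (L/5), add_one_le_exp (4/5*L), a2]
      have v4 : max 1 y1 < X/v := by
        rw [lt_div_iff₀ (by linarith)]
        have := abs_lt_of_sq_lt_sq (a := max 1 y1 * v) (b := X) (by
          rw [mul_pow]
          calc _ ≤ max 1 y1^2*X := by gcongr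
            _ < X*X := by gcongr; linarith
            _ = X^2 := by ring) (by linarith)
        exact (le_abs_self _).trans_lt this
      have v5 : 1 < X/v := (le_max_left _ _).trans_lt v4
      refine le_trans ?_ (hy1 (X/v) ((le_max_right _ _).trans v4.le))
      have := log_le_log (by linarith) (div_le_self (by linarith : 0 ≤ X) v0)
      have := log_pos v5
      calc _ = X/v/(4*log X) := by ring
        _ ≤ _ := by gcongr
    obtain ⟨w, hw⟩ : ∃ w, w = (m-log m)^2/(2*log (1/ϱ)) := ⟨_, rfl⟩
    have w0 : 0 ≤ w := by rw [hw]; have := h.lpos; positivity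
    rw [← hw, ← hT] at b2
    rw [← hw]
    have e2 : C*X*L^6*exp (-(7/5*L)) ≤ X/(8*log X)*T := by
      have f1 : exp (-(K*m)) ≤ T := le_trans (exp_le_exp.2 (by linarith)) b2
      have f2 : exp (K*m) ≤ L^⌈K⌉₊ := by
        rw [← heL, ← exp_nat_mul]
        exact exp_le_exp.2 (mul_le_mul_of_nonneg_right (Nat.le_ceil _) (by linarith))
      have f3 : 8*C*L^6*exp (K*m) ≤ exp (2/5*L) := by
        refine le_trans ?_ a1
        rw [pow_add, ← mul_assoc]; gcongr
      refine le_trans ?_ (mul_le_mul_of_nonneg_left f1 (by rw [hlX]; positivity))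
      rw [hlX, show 7/5*L = L + 2/5*L by ring, neg_add, exp_add, exp_neg (K*m), exp_neg, exp_neg]
      rw [show X/(8*exp L)*(exp (K*m))⁻¹ = X*(exp L)⁻¹*(8*exp (K*m))⁻¹ by field_simp]
      rw [show C*X*L^6*((exp L)⁻¹*(exp (2/5*L))⁻¹) = X*(exp L)⁻¹*(C*L^6*(exp (2/5*L))⁻¹) by ring]
      refine mul_le_mul_of_nonneg_left ?_ (by positivity)
      rw [← div_eq_mul_inv, ← one_div, div_le_div_iff₀ (exp_pos _) (by positivity)]
      linarith
    have e3 : exp (w-(K+3)*m) ≤ T*(1/8) := by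
      rw [show w-(K+3)*m = (w-K*m) + -(3*m) by ring, exp_add]
      refine mul_le_mul b2 ?_ (exp_pos _).le ((exp_pos _).le.trans b2)
      rw [exp_neg, ← one_div]
      apply one_div_le_one_div_of_le (by norm_num)
      have g := exp_one_gt_d9
      calc (8:ℝ) ≤ exp 1^3 := by nlinarith only [g, mul_self_nonneg (exp 1-2)]
        _ = exp 3 := by rw [← exp_nat_mul]; norm_num
        _ ≤ _ := exp_le_exp.2 (by linarith)
    have e4 : X/log X*(T*(1/8)) = X/(4*log X)*T - X/(8*log X)*T := by
      rw [hlX]; field_simp; ring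
    have e5 : X/log X*exp (w-(K+3)*m) ≤ X/log X*(T*(1/8)) := mul_le_mul_of_nonneg_left e3 (by rw [hlX]; positivity)
    linarith
end FordT

namespace FordT
open Real Finset Filter
lemma mval_z {f : ℕ → ℕ → ℝ} {b p e : ℕ} (hp : p.Prime) (he : e ≠ 0) (h : (p^e).Coprime b) (hf : f p e = 0) : mval f (p^e*b) = 0 := by
  rw [mval_mul f h, mval_pp f hp he, hf, zero_mul]
lemma d125 (k q n : ℕ) (hq : q.Prime) (hq7 : 7 ≤ q) (hqn : ¬ q ∣ n) (hn : 1 ≤ n) (hp : ∀ p : ℕ, p.Prime → p ∣ n → 7 ≤ p) :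
    dNew k (5^3*(q*n)) = ((k:ℝ)-1)/12*(96*((q-1)*F n:ℕ)) := by
  have h5 : Nat.Prime 5 := by norm_num
  have hc : (5^3).Coprime (q*n) := by
    apply Nat.Coprime.pow_left
    rw [Nat.Prime.coprime_iff_not_dvd h5, Nat.Prime.dvd_mul h5]
    rintro (h | h)
    · have := (Nat.prime_dvd_prime_iff_eq h5 hq).1 h; omega
    · have := hp 5 h5 h; omega
  have hF : F (5^3*(q*n)) = 96*((q-1)*F n) := by
    rw [F_mul hc, F_mul ((Nat.Prime.coprime_iff_not_dvd hq).2 hqn), F_p hq, F_pp h5 (by norm_num)]; rfl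
  have hmu : ArithmeticFunction.moebius (5^3*(q*n)) = 0 := by
    apply ArithmeticFunction.moebius_eq_zero_of_not_squarefree
    intro h
    have := h 5 ⟨5*(q*n), by ring⟩
    norm_num at this
  rw [dNew, ← F_cast, hF, nuInfNew, nu2New, nu3New, mval_z h5 (by norm_num) hc (by norm_num), mval_z h5 (by norm_num) hc (by norm_num), mval_z h5 (by norm_num) hc (by norm_num), hmu]
  push_cast; ring
lemma W_low {ϱ : ℝ} (h : HR ϱ) (K c : ℝ) (hK : 0 ≤ K) (hc : 1 ≤ c) : ∃ K', 1 ≤ K' ∧ ∀ᶠ x : ℝ in atTop, x/log x*exp ((l3 x - log (l3 x))^2/(2*log (1/ϱ)) - K'*l3 x) ≤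
    x/c/log (x/c)*exp ((l3 (x/c) - log (l3 (x/c)))^2/(2*log (1/ϱ)) - K*l3 (x/c)) := by
  have hl := h.lpos
  refine ⟨K + 1/log (1/ϱ) + log c + 1, by have := log_nonneg hc; have : 0 < 1/log (1/ϱ) := by positivity
                                          linarith, ?_⟩
  have hc0 : 0 < c := by linarith
  filter_upwards [tl3.eventually_ge_atTop 8, tendsto_log_atTop.eventually_ge_atTop (2*log c+2), eventually_gt_atTop 1, (tendsto_log_atTop.comp tendsto_log_atTop).eventually_ge_atTop 8] with x h1 h2 h3 h4
  simp only [Function.comp] at h4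
  have lc := log_nonneg hc
  have hlx : log (x/c) = log x - log c := log_div (by linarith) (by linarith)
  obtain ⟨m, hm⟩ : ∃ m, m = l3 x := ⟨_, rfl⟩
  obtain ⟨m', hm'⟩ : ∃ m', m' = l3 (x/c) := ⟨_, rfl⟩
  have a0 : log x/2 ≤ log (x/c) := by linarith
  have a1 : log (log x) - 1 ≤ log (log (x/c)) := by
    have : log (log x/2) ≤ log (log (x/c)) := log_le_log (by linarith) a0
    rw [log_div (by linarith) (by norm_num)] at this
    linarith [log_two_lt_d9]
  have a2 : log (log (x/c)) ≤ log (log x) := log_le_log (by linarith) (by linarith)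
  have b1 : m' ≤ m := by rw [hm, hm']; exact log_le_log (by linarith) a2
  have b3 : m ≤ log (log x) := by rw [hm, l3]; linarith [log_le_sub_one_of_pos (show 0 < log (log x) by linarith)]
  have b2 : m - 1/(m-1) ≤ m' := by
    have : log (log (log x)) ≤ log (log (log (x/c))) + 1/(m-1) := by
      have e0 : 0 < log (log (x/c)) := by linarith
      have e1 := log_le_sub_one_of_pos (show 0 < log (log x)/log (log (x/c)) by apply div_pos <;> linarith)
      rw [log_div (by linarith) (by linarith)] at e1
      have e2 : log (log x)/log (log (x/c)) - 1 ≤ 1/(m-1) := by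
        rw [show log (log x)/log (log (x/c)) - 1 = (log (log x)-log (log (x/c)))/log (log (x/c)) by field_simp]
        rw [div_le_div_iff₀ e0 (by linarith)]
        nlinarith only [a1, a2, b3, h1, hm]
      linarith
    rw [hm', hm, l3, l3]; rw [hm, l3] at this; linarith
  rw [← hm] at h1
  have c1 : log m' ≤ log m := log_le_log (by have : 1/(m-1) ≤ 1 := by rw [div_le_one (by linarith)]; linarith
                                             linarith) b1
  have c2 : log m ≤ m-1 := log_le_sub_one_of_pos (by linarith)
  have c4 : 0 ≤ log m := log_nonneg (by linarith)
  have c5 : log m ≤ m/2 := by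
    have := log_le_sub_one_of_pos (show 0 < m/4 by linarith)
    rw [log_div (by linarith) (by norm_num), show (4:ℝ) = 2^2 by norm_num, log_pow] at this
    have := log_two_lt_d9
    push_cast at *; linarith
  have c3 : (m-log m)^2 - 2*m ≤ (m'-log m')^2 := by
    have d1 : 1/(m-1) ≤ 1 := by rw [div_le_one (by linarith)]; linarith
    have d2 : 0 < 1/(m-1) := by apply div_pos <;> linarith
    have d3 : m - log m - 1 ≤ m' - log m' := by linarith
    nlinarith only [d3, c4, c5, h1]
  have key : (m-log m)^2/(2*log (1/ϱ)) - (K+1/log (1/ϱ)+log c+1)*m ≤ (m'-log m')^2/(2*log (1/ϱ)) - K*m' - log c := by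
    have e1 : ((m-log m)^2-2*m)/(2*log (1/ϱ)) ≤ (m'-log m')^2/(2*log (1/ϱ)) := by gcongr
    have e2 : ((m-log m)^2-2*m)/(2*log (1/ϱ)) = (m-log m)^2/(2*log (1/ϱ)) - 1/log (1/ϱ)*m := by field_simp
    nlinarith only [e1, e2, b1, hK, lc, h1]
  rw [← hm, ← hm']
  have hx0 : 0 < log (x/c) := by linarith
  calc _ ≤ x/log x*exp ((m'-log m')^2/(2*log (1/ϱ)) - K*m' - log c) := by
        refine mul_le_mul_of_nonneg_left (exp_le_exp.2 key) (div_nonneg (by linarith) (by linarith))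
    _ = x/c/log x*exp ((m'-log m')^2/(2*log (1/ϱ)) - K*m') := by rw [exp_sub, exp_log hc0]; ring
    _ ≤ _ := by
        refine mul_le_mul_of_nonneg_right ?_ (exp_pos _).le
        apply div_le_div_of_nonneg_left (by positivity) hx0
        linarith
lemma lower_D {ϱ : ℝ} (h : HR ϱ) : ∃ K : ℝ, 1 ≤ K ∧ ∀ᶠ x : ℝ in atTop, ∀ k : ℕ, 2 ≤ k → ∃ T : Finset ℝ,
    (∀ y ∈ T, ∃ N : ℕ, 1 ≤ N ∧ dNew k N = y ∧ dNew k N ≤ ((k:ℝ)-1)/12*x) ∧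
    x/log x*exp ((l3 x - log (l3 x))^2/(2*log (1/ϱ)) - K*l3 x) ≤ (T.card:ℝ) := by
  obtain ⟨K, hK, hV⟩ := lower_V h
  obtain ⟨K', hK', hW⟩ := W_low h K 96 (by linarith) (by norm_num)
  refine ⟨K', hK', ?_⟩
  have ht : Tendsto (fun x : ℝ => x/96) atTop atTop := tendsto_id.atTop_div_const (by norm_num)
  filter_upwards [hW, ht.eventually hV] with x h1 ⟨S, h2, h3⟩ k hk
  have k0 : 0 < ((k:ℝ)-1)/12 := by
    have : (2:ℝ) ≤ k := by exact_mod_cast hk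
    linarith
  refine ⟨S.image fun s : ℕ => ((k:ℝ)-1)/12*(96*(s:ℝ)), fun y hy => ?_, ?_⟩
  · obtain ⟨s, hs, rfl⟩ := mem_image.1 hy
    obtain ⟨s1, q, n, q1, q2, q3, q4, q5, q6⟩ := h2 s hs
    have := d125 k q n q1 q2 q4 q5 q6
    refine ⟨5^3*(q*n), Nat.mul_pos (by norm_num) (Nat.mul_pos q1.pos q5), by rw [this, q3], ?_⟩
    rw [this, ← q3]
    gcongr; linarith
  · rw [card_image_of_injective _ fun a b hab => by
      have := mul_left_cancel₀ k0.ne' hab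
      exact_mod_cast mul_left_cancel₀ (by norm_num : (96:ℝ) ≠ 0) this]
    exact h1.trans h3
end FordT

namespace FordT
open Real Finset Filter
lemma nu_sq (f : ℕ → ℕ → ℝ) (hf : ∀ p e, p.Prime → 1 ≤ e → f p e^2 ≤ (if p ≤ 3 then 4 else 1)*(Fl p e:ℝ)) (N : ℕ) :
    |mval f N| ≤ 4*√(F N) := by
  have h1 : (mval f N)^2 ≤ 16*F N := by
    have h2 : (mval f N)^2 ≤ mval (fun p e => (if p ≤ 3 then 4 else 1)*(Fl p e:ℝ)) N := by
      rw [show (mval f N)^2 = mval (fun p e => f p e^2) N by rw [mval, mval, Finset.prod_pow]]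
      exact mval_le (fun p e _ _ => sq_nonneg _) hf N
    refine h2.trans ?_
    rw [mval, Finset.prod_mul_distrib, F, Nat.cast_prod]
    refine mul_le_mul_of_nonneg_right ?_ (Finset.prod_nonneg fun _ _ => Nat.cast_nonneg _)
    rw [Finset.prod_ite, Finset.prod_const, Finset.prod_const_one, mul_one]
    have : (N.primeFactors.filter (· ≤ 3)).card ≤ 2 := by
      refine (card_le_card (t := {2, 3}) fun p hp => ?_).trans (by simp)
      rw [mem_filter] at hp
      have := (Nat.prime_of_mem_primeFactors hp.1).two_le
      rw [mem_insert, mem_singleton]; omega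
    calc (4:ℝ)^_ ≤ 4^2 := pow_le_pow_right₀ (by norm_num) this
      _ = 16 := by norm_num
  have : √(16*F N) = 4*√(F N) := by
    rw [Real.sqrt_mul (by norm_num), show (16:ℝ) = 4^2 by norm_num, Real.sqrt_sq (by norm_num)]
  rw [← this]
  exact Real.abs_le_sqrt h1
lemma nuInf_bd (N : ℕ) : |nuInfNew N| ≤ 4*√(F N) := by
  refine nu_sq _ (fun p e hp he => ?_) N
  have h2 : (2:ℝ) ≤ p := by exact_mod_cast hp.two_le
  have hF : (0:ℝ) ≤ Fl p e := Nat.cast_nonneg _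
  refine le_trans ?_ (show (Fl p e:ℝ) ≤ _ by split_ifs <;> linarith)
  rw [Fl_cast hp]
  rw [Fl_cast hp] at hF
  split_ifs with a b c d
  · omega
  · nlinarith only [h2]
  · omega
  · obtain ⟨⟨j, hj⟩, h3⟩ := ‹Even e ∧ 2 < e›
    have e1 : e/2-2 = j-2 := by omega
    have e2 : e-3 = (j-2)*2+1 := by omega
    rw [e1, e2, pow_succ (p:ℝ), pow_mul]
    nlinarith only [mul_nonneg (mul_nonneg (sq_nonneg ((p:ℝ)^(j-2))) (sq_nonneg ((p:ℝ)-1))) (show 0 ≤ (p:ℝ)*(p+1)-(p-1)^2 by nlinarith only [h2])]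
  · rw [if_pos ‹_›] at hF; linarith
  · rw [if_neg ‹_›, if_neg ‹_›] at hF; linarith
lemma nu_loc {v : ℝ} {p e : ℕ} (hp : p.Prime) (he : 1 ≤ e) (hv : v = 0 ∨ v = 1 ∨ v = -1 ∨ (v = -2 ∧ e = 1 ∧ p ≠ 4)) :
    v^2 ≤ (if p ≤ 3 then 4 else 1)*(Fl p e:ℝ) := by
  have h1 : (1:ℝ) ≤ Fl p e := by exact_mod_cast (by have := Fl_pos hp he; exact_mod_cast this : 0 < Fl p e)
  have h2 : (Fl p e:ℝ) ≤ (if p ≤ 3 then 4 else 1)*(Fl p e:ℝ) := by split_ifs <;> linarith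
  rcases hv with h | h | h | ⟨h, h3, h4⟩ <;> rw [h]
  · linarith
  · linarith
  · linarith
  · split_ifs with h5
    · linarith
    · have : 4 ≤ Fl p e := by rw [h3, Fl, if_pos rfl]; omega
      have : (4:ℝ) ≤ Fl p e := by exact_mod_cast this
      linarith
lemma nu2_val {p e : ℕ} (hp : p.Prime) : ∀ v : ℝ, v = (if p % 4 = 3 ∧ e = 1 then -2
  else if (p % 4 = 3 ∧ e = 2) ∨ p^e = 8 then 1
  else if (p % 4 = 1 ∧ e = 2) ∨ p^e = 2 ∨ p^e = 4 then -1
  else 0) → v = 0 ∨ v = 1 ∨ v = -1 ∨ (v = -2 ∧ e = 1 ∧ p ≠ 4) := by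
  intro v hv
  split_ifs at hv with h <;> simp [hv]
  exact Or.inr ⟨h.2, by omega⟩
lemma nu3_val {p e : ℕ} (hp : p.Prime) : ∀ v : ℝ, v = (if p % 3 = 2 ∧ e = 1 then -2
  else if (p % 3 = 2 ∧ e = 2) ∨ p^e = 27 then 1
  else if (p % 3 = 1 ∧ e = 2) ∨ p^e = 3 ∨ p^e = 9 then -1
  else 0) → v = 0 ∨ v = 1 ∨ v = -1 ∨ (v = -2 ∧ e = 1 ∧ p ≠ 4) := by
  intro v hv
  split_ifs at hv with h <;> simp [hv]
  exact Or.inr ⟨h.2, fun h4 => by rw [h4] at hp; norm_num at hp⟩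
lemma nu2_bd (N : ℕ) : |nu2New N| ≤ 4*√(F N) := nu_sq _ (fun p e hp he => nu_loc hp he (nu2_val hp _ rfl)) N
lemma nu3_bd (N : ℕ) : |nu3New N| ≤ 4*√(F N) := nu_sq _ (fun p e hp he => nu_loc hp he (nu3_val hp _ rfl)) N
lemma c_bd (k : ℕ) : |c2 k| ≤ 1 ∧ |c3 k| ≤ 1 ∧ |delta2 k| ≤ 1 := by
  unfold c2 c3 delta2 chi4 chi3
  refine ⟨?_, ?_, ?_⟩ <;> split_ifs <;> norm_num
lemma F_bd {k N : ℕ} {x : ℝ} (hk : 2 ≤ k) (h : dNew k N ≤ ((k:ℝ)-1)/12*x) : (F N:ℝ) ≤ 2*x + 20000 := by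
  have hk' : (2:ℝ) ≤ k := by exact_mod_cast hk
  obtain ⟨a1, a2, a3⟩ := c_bd k
  obtain ⟨s, hs⟩ : ∃ s, s = √(F N) := ⟨_, rfl⟩
  have hs0 : 0 ≤ s := hs ▸ sqrt_nonneg _
  have hF : (F N:ℝ) = s*s := by rw [hs, Real.mul_self_sqrt (Nat.cast_nonneg _)]
  have b1 := (abs_le.1 (nuInf_bd N)).2
  have b2 : |c2 k*nu2New N| ≤ 1*(4*s) := by rw [abs_mul, hs]; exact mul_le_mul a1 (nu2_bd N) (abs_nonneg _) zero_le_one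
  have b3 : |c3 k*nu3New N| ≤ 1*(4*s) := by rw [abs_mul, hs]; exact mul_le_mul a2 (nu3_bd N) (abs_nonneg _) zero_le_one
  have b4 : |delta2 k*((ArithmeticFunction.moebius N : ℤ) : ℝ)| ≤ 1*1 := by
    rw [abs_mul]
    refine mul_le_mul a3 ?_ (abs_nonneg _) zero_le_one
    exact_mod_cast ArithmeticFunction.abs_moebius_le_one
  rw [← hs] at b1
  rw [dNew, ← F_cast] at h
  have c1 := (abs_le.1 b2).1
  have c2 := (abs_le.1 b3).1
  have c3 := (abs_le.1 b4).1
  have d1 : ((k:ℝ)-1)/12*((F N:ℝ)-x) ≤ 10*s+1 := by linarith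
  rcases le_total (F N:ℝ) x with h1 | h1
  · have : (0:ℝ) ≤ F N := Nat.cast_nonneg _
    linarith
  · have d2 : 1/12*((F N:ℝ)-x) ≤ ((k:ℝ)-1)/12*((F N:ℝ)-x) := mul_le_mul_of_nonneg_right (by linarith) (by linarith)
    nlinarith only [d1, d2, hF, sq_nonneg (s-120)]
noncomputable def TB (B : ℕ) : Finset ℝ := insert 0 ((range (B+1)).image (fun j => (2:ℝ)^j) ∪ (range (B+1)).image fun j => -(2:ℝ)^j)
lemma TB_card (B : ℕ) : (TB B).card ≤ 2*B+3 := by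
  refine (card_insert_le _ _).trans ?_
  have h1 := card_union_le ((range (B+1)).image (fun j => (2:ℝ)^j)) ((range (B+1)).image fun j => -(2:ℝ)^j)
  have h2 : ((range (B+1)).image (fun j => (2:ℝ)^j)).card ≤ B+1 := card_image_le.trans (by simp)
  have h3 : ((range (B+1)).image (fun j => -(2:ℝ)^j)).card ≤ B+1 := card_image_le.trans (by simp)
  omega
lemma TB_prod (s : Finset ℕ) (g : ℕ → ℝ) (hg : ∀ p ∈ s, g p = 0 ∨ g p = 1 ∨ g p = -1 ∨ g p = -2) :
    ∏ p ∈ s, g p = 0 ∨ ∃ j ≤ s.card, ∏ p ∈ s, g p = 2^j ∨ ∏ p ∈ s, g p = -2^j := by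
  induction s using Finset.induction_on with
  | empty => exact Or.inr ⟨0, le_rfl, by simp⟩
  | insert a s ha ih =>
    rw [prod_insert ha, card_insert_of_notMem ha]
    rcases ih fun p hp => hg p (mem_insert_of_mem hp) with h | ⟨j, h1, h2⟩
    · left; rw [h, mul_zero]
    · rcases hg a (mem_insert_self _ _) with h | h | h | h <;> rw [h]
      · left; simp
      · right; exact ⟨j, by omega, by simpa using h2⟩
      · right; refine ⟨j, by omega, ?_⟩
        rcases h2 with h2 | h2 <;> rw [h2] <;> simp
      · right; refine ⟨j+1, by omega, ?_⟩
        rcases h2 with h2 | h2 <;> rw [h2, pow_succ]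
        · right; ring
        · left; ring
lemma TB_mem {f : ℕ → ℕ → ℝ} {N B : ℕ} (hB : N.primeFactors.card ≤ B) (hf : ∀ p e, p.Prime → f p e = 0 ∨ f p e = 1 ∨ f p e = -1 ∨ (f p e = -2 ∧ e = 1 ∧ p ≠ 4)) : mval f N ∈ TB B := by
  have := TB_prod N.primeFactors (fun p => f p (N.factorization p)) fun p hp => by
    rcases hf p (N.factorization p) (Nat.prime_of_mem_primeFactors hp) with h | h | h | h
    · exact Or.inl h
    · exact Or.inr (Or.inl h)
    · exact Or.inr (Or.inr (Or.inl h))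
    · exact Or.inr (Or.inr (Or.inr h.1))
  rw [mval, TB, mem_insert, mem_union, mem_image, mem_image]
  rcases this with h | ⟨j, h1, h2 | h2⟩
  · exact Or.inl h
  · exact Or.inr (Or.inl ⟨j, mem_range.2 (by omega), h2.symm⟩)
  · exact Or.inr (Or.inr ⟨j, mem_range.2 (by omega), h2.symm⟩)
end FordT

namespace FordT
open Real Finset Filter
noncomputable def wtx (p e : ℕ) : ℝ := (3/2)^e*(if 2 ≤ e then (p:ℝ) else 1)
lemma wt_loc {p : ℕ} (hp : p.Prime) (K : ℕ) : ∑ e ∈ Finset.Icc 1 K, wtx p e/Fl p e ≤ 48/p := by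
  have h2 : (2:ℝ) ≤ p := by exact_mod_cast hp.two_le
  have hg : ∀ K : ℕ, ∑ e ∈ Finset.Icc 1 K, (16/p:ℝ)*(3/4)^e ≤ 48/p*(1-(3/4)^K) := fun K => by
    induction K with
    | zero => simp
    | succ n ih =>
      rw [sum_Icc_succ_top (by omega), pow_succ]
      have : (16/p:ℝ)*((3/4)^n*(3/4)) = 48/p*((3/4)^n*(1/4)) := by ring
      rw [this]; linarith
  refine (sum_le_sum fun e he => ?_).trans ((hg K).trans ?_)
  · rw [mem_Icc] at he
    have h3 := Fl_ge hp he.1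
    have h4 : (0:ℝ) < Fl p e := Fl_pos hp he.1
    rw [wtx]
    have h5 : (0:ℝ) < (p:ℝ)^e := by positivity
    calc _ ≤ (3/2)^e*(if 2 ≤ e then (p:ℝ) else 1)/(p^e/4) := by
          apply div_le_div_of_nonneg_left (by split_ifs <;> positivity) (by positivity) (by linarith)
      _ ≤ _ := by
          rw [div_le_iff₀ (by positivity)]
          split_ifs with h
          · obtain ⟨j, rfl⟩ := Nat.exists_eq_add_of_le h
            have h6 : (3/2:ℝ)^j ≤ (3/4)^j*p^j := by
              rw [← mul_pow]; exact pow_le_pow_left₀ (by norm_num) (by linarith) _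
            rw [pow_add, pow_add, pow_add]
            calc (3/2:ℝ)^2*(3/2)^j*p ≤ (3/2)^2*((3/4)^j*p^j)*p := by gcongr
              _ = _ := by field_simp; norm_num
          · have : e = 1 := by omega
            subst this
            rw [pow_one, pow_one, pow_one]; field_simp; norm_num
  · have : (0:ℝ) ≤ (3/4)^K := by positivity
    have h6 : (0:ℝ) ≤ 48/p := by positivity
    nlinarith only [this, h6]
lemma wt_ge {p e : ℕ} (hp : p.Prime) (he : 1 ≤ e) : (3/2:ℝ)^e ≤ wtx p e := by
  rw [wtx]
  have h2 : (2:ℝ) ≤ p := by exact_mod_cast hp.two_le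
  refine le_mul_of_one_le_right (by positivity) ?_
  split_ifs <;> linarith
lemma exc_count : ∃ C : ℝ, 0 ≤ C ∧ ∀ u y Θ : ℝ, 0 ≤ u → 0 ≤ y → 0 < Θ → ∀ S : Finset ℕ, (∀ N ∈ S, 1 ≤ N ∧ (N:ℝ) ≤ E u ∧ Θ*F N ≤ y*mval wtx N) →
    (S.card:ℝ) ≤ y/Θ*exp (48*(u+C)) := by
  obtain ⟨C, hC, hP⟩ := PRE
  refine ⟨C, by linarith, fun u y Θ hu hy hΘ S hS => ?_⟩
  have h1 := euler (fun p e => wtx p e/Fl p e) (fun p => 48/p) ⌊E u⌋₊ (fun p e hp he => div_nonneg (le_trans (by positivity) (wt_ge hp he)) (Nat.cast_nonneg _))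
    (fun p hp _ K => wt_loc hp K) S (fun N hN => ⟨by have := (hS N hN).1; omega, fun p hp hd => (Nat.le_of_dvd (hS N hN).1 hd).trans (Nat.le_floor (hS N hN).2.1)⟩)
  have h2 : ∑ p ∈ PL ⌊E u⌋₊, (48/p:ℝ) ≤ 48*(u+C) := by
    have := (abs_le.1 (hP u hu)).2
    rw [PR] at this
    calc _ = 48*∑ p ∈ PL ⌊E u⌋₊, (1/p:ℝ) := by rw [mul_sum]; exact sum_congr rfl fun _ _ => by ring
      _ ≤ _ := by linarith
  calc (S.card:ℝ) = ∑ N ∈ S, (1:ℝ) := by simp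
    _ ≤ ∑ N ∈ S, y/Θ*mval (fun p e => wtx p e/Fl p e) N := sum_le_sum fun N hN => by
        have h3 : mval (fun p e => wtx p e/Fl p e) N = mval wtx N/F N := by
          rw [mval, mval, F, Finset.prod_div_distrib, Nat.cast_prod]
        have h4 : (0:ℝ) < F N := by exact_mod_cast F_pos N
        rw [h3, div_mul_div_comm, le_div_iff₀ (by positivity), one_mul]
        exact (hS N hN).2.2
    _ ≤ _ := by
        rw [← mul_sum]
        exact mul_le_mul_of_nonneg_left (h1.trans (exp_le_exp.2 h2)) (by positivity)
lemma good_exc {N B : ℕ} {y z Θ : ℝ} (hN : 1 ≤ N) (hy : 1 ≤ y) (hF : (F N:ℝ) ≤ y) (hz : 1 ≤ z) (h1 : Θ ≤ z) (h2 : Θ ≤ √y) (h3 : Θ ≤ (3/2)^(B+1))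
    (h4 : ∀ w : ℕ, √y < z^w → Θ ≤ (3/2)^w) (hex : ¬ Θ*F N ≤ y*mval wtx N) :
    N.primeFactors.card ≤ B ∧ ∃ q b : ℕ, q.Prime ∧ z < q ∧ N = q*b ∧ ¬ q ∣ b := by
  have hF0 : (0:ℝ) < F N := by exact_mod_cast F_pos N
  have hlt : mval wtx N < Θ := by
    by_contra h
    exact hex (by rw [mul_comm]; exact mul_le_mul hF (not_lt.1 h) (by
      by_contra h0
      exact hex (le_trans (mul_nonpos_of_nonpos_of_nonneg (not_le.1 h0).le hF0.le) (mul_nonneg (by linarith) (mval_nonneg (fun p e hp he => le_trans (by positivity) (wt_ge hp he)) N)))) (by linarith))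
  have hO : mval (fun p e => (3/2:ℝ)^e) N ≤ mval wtx N := mval_le (fun p e _ _ => by positivity) (fun p e hp he => wt_ge hp he) N
  have hOe : mval (fun p e => (3/2:ℝ)^e) N = (3/2)^(∑ p ∈ N.primeFactors, N.factorization p) := by rw [mval, Finset.prod_pow_eq_pow_sum]
  have hone : 1 ≤ mval wtx N := le_trans (by rw [hOe]; exact one_le_pow₀ (by norm_num)) hO
  have hfp : ∀ p ∈ N.primeFactors, 1 ≤ N.factorization p := fun p hp =>
    (Nat.prime_of_mem_primeFactors hp).factorization_pos_of_dvd (by omega) (Nat.dvd_of_mem_primeFactors hp)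
  constructor
  · by_contra h
    have h5 : B+1 ≤ ∑ p ∈ N.primeFactors, N.factorization p := by
      refine le_trans (by omega : B+1 ≤ N.primeFactors.card) ?_
      rw [card_eq_sum_ones]; exact sum_le_sum hfp
    have := pow_le_pow_right₀ (by norm_num : (1:ℝ) ≤ 3/2) h5
    linarith
  · have hsm : ∃ q ∈ N.primeFactors, z < q := by
      by_contra h
      push Not at h
      have hNz : (N:ℝ) ≤ z^(∑ p ∈ N.primeFactors, N.factorization p) := by
        rw [mval_id (by omega : N ≠ 0), mval, ← Finset.prod_pow_eq_pow_sum]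
        exact Finset.prod_le_prod (fun _ _ => by positivity) fun p hp => by have := h p hp; gcongr
      have hFN : (F N:ℝ) ≤ N := by
        rw [mval_id (by omega : N ≠ 0), F_mval]
        refine mval_le (fun _ _ _ _ => Nat.cast_nonneg _) (fun p e hp he => ?_) N
        rw [Fl_cast hp]
        have h2 : (2:ℝ) ≤ p := by exact_mod_cast hp.two_le
        split_ifs with a b
        · rw [a]; linarith
        · rw [b]; linarith
        · obtain ⟨j, rfl⟩ := Nat.exists_eq_add_of_le (show 3 ≤ e by omega)
          rw [Nat.add_sub_cancel_left, pow_add]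
          have : 0 < (p:ℝ)^j := by positivity
          nlinarith only [mul_nonneg this.le (show 0 ≤ (p:ℝ)^3-((p:ℝ)-1)^2*(p+1) by nlinarith only [h2])]
      by_cases h5 : √y < F N
      · have := h4 _ (h5.trans_le (hFN.trans hNz))
        linarith
      · refine hex ?_
        have h6 : √y*√y = y := Real.mul_self_sqrt (by linarith)
        have h7 : 0 ≤ √y := sqrt_nonneg _
        calc Θ*F N ≤ √y*√y := mul_le_mul h2 (not_lt.1 h5) hF0.le h7
          _ ≤ y*mval wtx N := by rw [h6]; exact le_mul_of_one_le_right (by linarith) hone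
    obtain ⟨q, hq, hqz⟩ := hsm
    have hqp := Nat.prime_of_mem_primeFactors hq
    obtain ⟨b, hb⟩ := Nat.dvd_of_mem_primeFactors hq
    refine ⟨q, b, hqp, hqz, hb, fun hd => ?_⟩
    have hq2 : 2 ≤ N.factorization q := by
      rw [← Nat.Prime.pow_dvd_iff_le_factorization hqp (by omega), hb, pow_two]
      exact Nat.mul_dvd_mul_left _ hd
    have h8 : (q:ℝ) ≤ mval wtx N := by
      rw [mval, ← Finset.mul_prod_erase _ _ hq]
      have h9 : (1:ℝ) ≤ ∏ p ∈ N.primeFactors.erase q, wtx p (N.factorization p) :=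
        le_trans (le_of_eq (Finset.prod_const_one (s := N.primeFactors.erase q)).symm) <| Finset.prod_le_prod (fun _ _ => zero_le_one) fun p hp => le_trans (one_le_pow₀ (by norm_num)) (wt_ge (Nat.prime_of_mem_primeFactors (mem_of_mem_erase hp)) (hfp p (mem_of_mem_erase hp)))
      have h10 : (q:ℝ) ≤ wtx q (N.factorization q) := by
        rw [wtx, if_pos hq2]
        exact le_mul_of_one_le_left (Nat.cast_nonneg _) (one_le_pow₀ (by norm_num))
      have : (0:ℝ) ≤ q := Nat.cast_nonneg _
      nlinarith only [h9, h10, this]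
    linarith
end FordT

namespace FordT
open Real Finset Filter
lemma FS_ex (y z : ℝ) (hy : 0 ≤ y) (hz : 1 < z) (X : ℕ) : ∃ FS : Finset ℕ, (∀ q b : ℕ, q.Prime → z < q → 1 ≤ b → b ≤ X → (((q-1)*F b:ℕ):ℝ) ≤ y → (q-1)*F b ∈ FS) ∧
    (FS.card:ℝ) ≤ 12*y/log z*R X X := by
  classical
  have hlz : 0 < log z := log_pos hz
  refine ⟨((SM X X).image F).biUnion fun w => ((PL ⌊y/w+1⌋₊).filter fun q : ℕ => z < q).image fun q => (q-1)*w, fun q b hq hqz hb hbX hle => ?_, ?_⟩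
  · rw [mem_biUnion]
    refine ⟨F b, mem_image_of_mem _ (mem_SM.2 ⟨⟨hb, hbX⟩, fun p hp hd => (Nat.le_of_dvd hb hd).trans hbX⟩), ?_⟩
    rw [mem_image]
    refine ⟨q, mem_filter.2 ⟨mem_PL.2 ⟨Nat.le_floor ?_, hq⟩, hqz⟩, rfl⟩
    have h4 : (0:ℝ) < F b := by exact_mod_cast F_pos b
    rw [Nat.cast_mul, Nat.cast_sub hq.one_le, Nat.cast_one] at hle
    have := (le_div_iff₀ h4).2 hle
    linarith
  · rw [R, RR, mul_sum]
    refine (Nat.cast_le.2 card_biUnion_le).trans ?_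
    rw [Nat.cast_sum]
    refine sum_le_sum fun w hw => ?_
    obtain ⟨a, ha, rfl⟩ := mem_image.1 hw
    have h4 : (0:ℝ) < F a := by exact_mod_cast F_pos a
    have hR : 0 ≤ 12*y/log z*(1/(F a:ℝ)) := by positivity
    refine (Nat.cast_le.2 card_image_le).trans ?_
    rcases Finset.eq_empty_or_nonempty ((PL ⌊y/(F a:ℝ)+1⌋₊).filter fun q : ℕ => z < q) with he | ⟨q, hq⟩
    · rw [he, card_empty, Nat.cast_zero]; exact hR
    · obtain ⟨t, ht⟩ : ∃ t, t = y/(F a:ℝ)+1 := ⟨_, rfl⟩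
      rw [← ht] at hq ⊢
      rw [mem_filter, mem_PL] at hq
      have ht1 : 0 ≤ t := by rw [ht]; positivity
      have hqt : (q:ℝ) ≤ t := (Nat.cast_le.2 hq.1.1).trans (Nat.floor_le ht1)
      have hq2 : (2:ℝ) ≤ q := by exact_mod_cast hq.1.2.two_le
      have hzt : z < t := hq.2.trans_le hqt
      have hpi := Chebyshev.pi_le_log4_mul_div (show 1 < t by linarith)
      rw [← pl_card] at hpi
      have hlt : log z ≤ log t := log_le_log (by linarith) hzt.le
      have hst : log (√t) = log t/2 := log_sqrt ht1
      have hl4 : log 4 ≤ 2 := by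
        have := log_two_lt_d9
        rw [show (4:ℝ) = 2^2 by norm_num, log_pow]; push_cast; linarith
      have hsq : √t*√t = t := mul_self_sqrt ht1
      have hs0 : 0 < √t := sqrt_pos.2 (by linarith)
      have hls := log_le_sub_one_of_pos hs0
      rw [hst] at hls hpi
      have hlt0 : 0 < log t := by linarith
      have h5 : √t ≤ t/(log t/2) := by
        rw [le_div_iff₀ (by linarith), ← hsq]
        conv_lhs => rw [hsq]
        exact mul_le_mul_of_nonneg_left (by linarith) hs0.le
      have h6 : log 4*t/(log t/2) ≤ 2*(t/(log t/2)) := by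
        rw [← mul_div_assoc]; gcongr
      have h7 : t/(log t/2) ≤ 2*t/log z := by
        rw [div_le_div_iff₀ (by linarith) hlz]
        nlinarith only [hlt, ht1]
      have h8 : t ≤ 2*(y/F a) := by linarith
      have h9 : 2*t/log z*3 ≤ 12*y/log z*(1/(F a:ℝ)) := by
        have : 12*y/log z*(1/(F a:ℝ)) = 2*(2*(y/F a))/log z*3 := by field_simp; ring
        rw [this]; gcongr
      have h10 : (((PL ⌊t⌋₊).filter fun q : ℕ => z < q).card:ℝ) ≤ (PL ⌊t⌋₊).card := by exact_mod_cast card_filter_le _ _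
      linarith
lemma count_T : ∃ C : ℝ, 0 ≤ C ∧ ∀ (k B : ℕ) (u y z Θ : ℝ), 0 ≤ u → 1 ≤ y → 4*y^2 ≤ E u → 1 < z → 0 < Θ → Θ ≤ z → Θ ≤ √y → Θ ≤ (3/2)^(B+1) → (∀ w : ℕ, √y < z^w → Θ ≤ (3/2)^w) →
    ∃ T : Finset ℝ, (∀ N : ℕ, 1 ≤ N → (F N:ℝ) ≤ y → dNew k N ∈ T) ∧ (T.card:ℝ) ≤ y/Θ*exp (48*(u+C)) + 12*y/log z*R ⌊E u⌋₊ ⌊E u⌋₊*((2*B+3)*((2*B+3)*3)) := by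
  classical
  obtain ⟨C, hC, hP⟩ := exc_count
  refine ⟨C, hC, fun k B u y z Θ hu hy hE hz hΘ h1 h2 h3 h4 => ?_⟩
  obtain ⟨FS, hFS, hFSc⟩ := FS_ex y z (by linarith) hz ⌊E u⌋₊
  obtain ⟨S, hS⟩ : ∃ S, S = (Finset.Icc 1 ⌊E u⌋₊).filter fun N => Θ*F N ≤ y*mval wtx N := ⟨_, rfl⟩
  have hSc := hP u y Θ hu (by linarith) hΘ S (fun N hN => by
    rw [hS, mem_filter, mem_Icc] at hN
    exact ⟨hN.1.1, (Nat.cast_le.2 hN.1.2).trans (Nat.floor_le (E_pos u).le), hN.2⟩)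
  obtain ⟨Q, hQ⟩ : ∃ Q : Finset (ℕ × ℝ × ℝ × ℤ), Q = FS ×ˢ (TB B ×ˢ (TB B ×ˢ ({-1,0,1} : Finset ℤ))) := ⟨_, rfl⟩
  have hQc : (Q.card:ℝ) ≤ 12*y/log z*R ⌊E u⌋₊ ⌊E u⌋₊*((2*B+3)*((2*B+3)*3)) := by
    rw [hQ, card_product, card_product, card_product]
    have hb : ((TB B).card:ℝ) ≤ 2*B+3 := by exact_mod_cast TB_card B
    have h3 : ((({-1,0,1} : Finset ℤ).card:ℕ):ℝ) = 3 := by norm_num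
    push_cast [h3]
    have h0 : (0:ℝ) ≤ FS.card := Nat.cast_nonneg _
    gcongr
    linarith
  refine ⟨S.image (dNew k) ∪ Q.image (fun s => ((k:ℝ)-1)/12*s.1 + c2 k*s.2.1 + c3 k*s.2.2.1 + delta2 k*(s.2.2.2:ℝ)), fun N hN hF => ?_, ?_⟩
  · have hNE : (N:ℝ) ≤ E u := by
      have h0 : (0:ℝ) ≤ F N := Nat.cast_nonneg _
      refine (F_ge (by omega)).trans (le_trans ?_ hE)
      gcongr
    rw [mem_union]
    by_cases hex : Θ*F N ≤ y*mval wtx N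
    · left
      refine mem_image_of_mem _ ?_
      rw [hS, mem_filter, mem_Icc]
      exact ⟨⟨hN, Nat.le_floor hNE⟩, hex⟩
    · right
      obtain ⟨hB, q, b, hq, hqz, hb, hqb⟩ := good_exc hN hy hF hz.le h1 h2 h3 h4 hex
      have hb1 : 1 ≤ b := Nat.one_le_iff_ne_zero.2 fun h => by rw [h, mul_zero] at hb; omega
      have hcop : q.Coprime b := (Nat.Prime.coprime_iff_not_dvd hq).2 hqb
      have hFN : F N = (q-1)*F b := by rw [hb, F_mul hcop, F_p hq]
      have hnu : nuInfNew N = 0 := by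
        rw [hb, nuInfNew]
        have := mval_z (f := fun p e : ℕ => if e = 2 then (p:ℝ)-2 else if Even e ∧ 2 < e then (p:ℝ)^(e/2-2)*((p:ℝ)-1)^2 else 0) (b := b) hq one_ne_zero (by rw [pow_one]; exact hcop) (by simp)
        rw [pow_one] at this
        exact this
      rw [mem_image]
      refine ⟨(F N, nu2New N, nu3New N, ArithmeticFunction.moebius N), ?_, ?_⟩
      · rw [hQ, mem_product, mem_product, mem_product]
        refine ⟨?_, TB_mem hB (fun p e hp => nu2_val hp _ rfl), TB_mem hB (fun p e hp => nu3_val hp _ rfl), ?_⟩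
        · show F N ∈ FS
          rw [hFN]
          refine hFS q b hq hqz hb1 (Nat.le_floor (le_trans ?_ hNE)) (by rw [← hFN]; exact hF)
          rw [hb]; exact_mod_cast Nat.le_mul_of_pos_left _ hq.pos
        · show ArithmeticFunction.moebius N ∈ _
          rcases ArithmeticFunction.moebius_eq_or N with h | h | h <;> rw [h] <;> decide
      · rw [dNew, hnu, ← F_cast]; ring
  · refine (Nat.cast_le.2 (card_union_le _ _)).trans ?_
    rw [Nat.cast_add]
    exact add_le_add ((Nat.cast_le.2 card_image_le).trans hSc) ((Nat.cast_le.2 card_image_le).trans hQc)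
lemma upper_D {ϱ : ℝ} (h : HR ϱ) : ∃ K : ℝ, 1 ≤ K ∧ ∀ᶠ x : ℝ in atTop, ∀ k : ℕ, 2 ≤ k → ∃ T : Finset ℝ,
    (∀ N : ℕ, 1 ≤ N → dNew k N ≤ ((k:ℝ)-1)/12*x → dNew k N ∈ T) ∧
    (T.card:ℝ) ≤ x/log x*exp ((l3 x - log (l3 x))^2/(2*log (1/ϱ)) + K*l3 x) := by
  obtain ⟨C, hC, hT⟩ := count_T
  obtain ⟨K, L0, hK, hL0, hR⟩ := upper_R h
  have hlam := h.lpos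
  obtain ⟨lam, hlm⟩ : ∃ lam, lam = log (1/ϱ) := ⟨_, rfl⟩
  rw [← hlm] at hlam
  have hl := tendsto_log_atTop
  have hL := hl.comp hl
  refine ⟨3/(2*lam)+2*K+6, by have : 0 ≤ 3/(2*lam) := by positivity
                              linarith, ?_⟩
  filter_upwards [eventually_ge_atTop 20000, hL.eventually (ev_pow_exp 2 (1/2) (by norm_num)), hL.eventually (eventually_ge_atTop (120000:ℝ)),
    hL.eventually (eventually_ge_atTop (log 3+96+48*C)), tl3.eventually_ge_atTop L0, tl3.eventually_ge_atTop (log (10^12)), tl3.eventually_ge_atTop 2] with x x1 x2 x3 x4 x5 x6 x7 k hk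
  simp only [Function.comp] at x2 x3 x4
  obtain ⟨l, hl⟩ : ∃ l, l = log x := ⟨_, rfl⟩
  obtain ⟨L, hL⟩ : ∃ L, L = log l := ⟨_, rfl⟩
  obtain ⟨m, hm⟩ : ∃ m, m = l3 x := ⟨_, rfl⟩
  have hm' : m = log L := by rw [hm, hL, hl, l3]
  rw [← hm] at x5 x6 x7 ⊢
  rw [← hl] at x2 x3 x4 ⊢
  rw [← hL] at x2 x3 x4
  have hx0 : 0 < x := by linarith
  have hl0 : 0 < l := by rw [hl]; exact log_pos (by linarith)
  have hxl : x = exp l := by rw [hl, exp_log hx0]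
  have hlL : l = exp L := by rw [hL, exp_log hl0]
  have hL0' : 0 < L := by linarith
  have hLm : L = exp m := by rw [hm', exp_log hL0']
  have hexL : exp L = exp (1/2*L)*exp (1/2*L) := by rw [← exp_add]; ring_nf
  have hL2 : 60000*L^2 ≤ l := by
    rw [hlL, hexL]
    have := add_one_le_exp (1/2*L)
    exact mul_le_mul (by linarith) x2 (by positivity) (by positivity)
  have hLl : 120*L ≤ l := by nlinarith only [hL2, x3]
  have hl23 : (1/3:ℝ) ≤ log (3/2) := by
    have := one_sub_inv_le_log_of_pos (show (0:ℝ) < 3/2 by norm_num)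
    linarith
  have h32 : ∀ w : ℕ, 180*L ≤ w → exp (60*L) ≤ (3/2:ℝ)^w := fun w hw => by
    rw [← exp_log (show (0:ℝ) < 3/2 by norm_num), ← exp_nat_mul]
    apply exp_le_exp.2
    nlinarith only [hw, hl23, x3]
  obtain ⟨y, hy⟩ : ∃ y, y = 2*x+20000 := ⟨_, rfl⟩
  have hy3 : y ≤ 3*x := by linarith
  have hyx : x ≤ y := by linarith
  have hy0 : 0 ≤ y := by linarith
  have hsy : exp (l/2) ≤ √y := by
    apply le_sqrt_of_sq_le
    rw [← exp_nat_mul]; push_cast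
    rw [show 2*(l/2) = l by ring, ← hxl]; exact hyx
  have hE : 4*y^2 ≤ E (L+2) := by
    have e2 : (3:ℝ) ≤ exp 2 := by have := add_one_le_exp (2:ℝ); linarith
    calc 4*y^2 ≤ 4*(3*x)^2 := by gcongr
      _ = 36*x^2 := by ring
      _ ≤ x^3 := by nlinarith only [x1, sq_nonneg x]
      _ ≤ _ := by
        rw [E, exp_add, ← hlL, hxl, ← exp_nat_mul]
        apply exp_le_exp.2; push_cast
        rw [mul_comm]; exact mul_le_mul_of_nonneg_left e2 hl0.le
  have hz0 : 0 < l/(1000*L) := by positivity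
  obtain ⟨T, hT1, hT2⟩ := hT k ⌊1000*L⌋₊ (L+2) y (exp (l/(1000*L))) (exp (60*L)) (by linarith) (by linarith) hE (by
      rw [← exp_zero]; exact exp_lt_exp.2 hz0) (exp_pos _)
    (by
      apply exp_le_exp.2
      rw [le_div_iff₀ (by positivity)]; linarith)
    (le_trans (exp_le_exp.2 (by linarith)) hsy)
    (h32 _ (by push_cast; have := Nat.lt_floor_add_one (1000*L); linarith))
    (fun w hw => h32 w (by
      have h1 := hsy.trans_lt hw
      rw [← exp_nat_mul, exp_lt_exp] at h1
      have h2 : (w:ℝ)*(l/(1000*L)) = w/(1000*L)*l := by ring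
      rw [h2] at h1
      have h3 : 1/2 < w/(1000*L) := by
        by_contra h4
        nlinarith only [h1, h4, hl0, not_lt.1 h4]
      rw [lt_div_iff₀ (by positivity)] at h3
      linarith))
  refine ⟨T, fun N hN hd => hT1 N hN (by rw [hy]; exact F_bd hk hd), hT2.trans ?_⟩
  have hu1 : L+2 ≤ L*exp 1 := by
    have := add_one_le_exp (1:ℝ); nlinarith only [this, x3]
  have hv1 : m ≤ log (L+2) := by rw [hm']; exact log_le_log hL0' (by linarith)
  have hv2 : log (L+2) ≤ m+1 := by
    refine (log_le_log (by linarith) hu1).trans ?_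
    rw [log_mul hL0'.ne' (exp_pos _).ne', log_exp, hm']
  have hRR := hR (L+2) (by linarith) (x5.trans hv1) ⌊E (L+2)⌋₊
  obtain ⟨v, hv⟩ : ∃ v, v = log (L+2) := ⟨_, rfl⟩
  rw [log_div (by linarith) (by rw [← hv]; linarith), ← hv, ← hlm] at hRR
  rw [← hv] at hv1 hv2
  have hlm0 : 0 ≤ log m := log_nonneg (by linarith)
  have hlmv : log m ≤ log v := log_le_log (by linarith) hv1
  have hvv := log_le_sub_one_of_pos (show 0 < v by linarith)
  have hmm := log_le_sub_one_of_pos (show 0 < m by linarith)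
  have hsq : (v - log v)^2 ≤ (m - log m)^2 + 3*m := by
    have : (v - log v)^2 ≤ (m - log m+1)^2 := pow_le_pow_left₀ (by linarith) (by linarith) 2
    nlinarith only [this, hlm0, x7]
  obtain ⟨G, hG⟩ : ∃ G, G = (m - log m)^2/(2*lam) := ⟨_, rfl⟩
  have hG0 : 0 ≤ G := by rw [hG]; positivity
  have hc0 : 0 ≤ 3/(2*lam) := by positivity
  have hRR2 : R ⌊E (L+2)⌋₊ ⌊E (L+2)⌋₊ ≤ exp (G + 3/(2*lam)*m + 2*K*m) := by
    refine hRR.trans (exp_le_exp.2 ?_)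
    have h1 : (v - log v)^2/(2*lam) ≤ ((m - log m)^2 + 3*m)/(2*lam) := by gcongr
    have h2 : ((m - log m)^2 + 3*m)/(2*lam) = G + 3/(2*lam)*m := by rw [hG]; ring
    nlinarith only [h1, h2, hv2, hK, x7]
  rw [← hlm, ← hG]
  have hR0 : 0 ≤ R ⌊E (L+2)⌋₊ ⌊E (L+2)⌋₊ := by rw [R, RR]; exact sum_nonneg fun _ _ => by positivity
  have hA : y/exp (60*L)*exp (48*(L+2+C)) ≤ x/l := by
    rw [div_mul_eq_mul_div, div_le_div_iff₀ (exp_pos _) hl0]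
    calc y*exp (48*(L+2+C))*l ≤ 3*x*exp (48*(L+2+C))*l := by gcongr
      _ = x*(exp (log 3)*exp (48*(L+2+C))*exp L) := by rw [exp_log (by norm_num : (0:ℝ) < 3), ← hlL]; ring
      _ ≤ _ := by
        rw [← exp_add, ← exp_add]
        refine mul_le_mul_of_nonneg_left (exp_le_exp.2 ?_) hx0.le
        linarith
  have hBB : (2*(⌊1000*L⌋₊:ℝ)+3) ≤ 2001*L := by
    have := Nat.floor_le (show 0 ≤ 1000*L by positivity); linarith
  have hL3 : 36000*L*(2001*L*(2001*L*3)) ≤ exp (4*m) := by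
    rw [show 4*m = m+(m+(m+m)) by ring, exp_add, exp_add, exp_add, ← hLm]
    have : (10:ℝ)^12 ≤ L := by rw [hLm, ← log_le_iff_le_exp (by norm_num)]; exact x6
    have h3 : 0 ≤ L*(L*L) := by positivity
    nlinarith only [mul_le_mul_of_nonneg_right this h3, h3]
  have hM : 12*y/log (exp (l/(1000*L)))*R ⌊E (L+2)⌋₊ ⌊E (L+2)⌋₊*((2*(⌊1000*L⌋₊:ℝ)+3)*((2*(⌊1000*L⌋₊:ℝ)+3)*3)) ≤ x/l*exp (G + 3/(2*lam)*m + 2*K*m + 4*m) := by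
    rw [log_exp]
    calc _ ≤ 12*(3*x)/(l/(1000*L))*exp (G + 3/(2*lam)*m + 2*K*m)*(2001*L*(2001*L*3)) := by gcongr
      _ = x/l*exp (G + 3/(2*lam)*m + 2*K*m)*(36000*L*(2001*L*(2001*L*3))) := by field_simp; ring
      _ ≤ x/l*exp (G + 3/(2*lam)*m + 2*K*m)*exp (4*m) := by gcongr
      _ = _ := by rw [mul_assoc, ← exp_add]
  refine (add_le_add hA hM).trans ?_
  have hg : 1 ≤ exp (G + 3/(2*lam)*m + 2*K*m + 4*m) := one_le_exp (by positivity)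
  have he : 2 ≤ exp m := by have := add_one_le_exp m; linarith
  calc x/l + x/l*exp (G + 3/(2*lam)*m + 2*K*m + 4*m) = x/l*(1+exp (G + 3/(2*lam)*m + 2*K*m + 4*m)) := by ring
    _ ≤ x/l*(exp m*exp (G + 3/(2*lam)*m + 2*K*m + 4*m)) := by
        apply mul_le_mul_of_nonneg_left _ (by positivity)
        nlinarith only [hg, he]
    _ ≤ _ := by
        rw [← exp_add]
        refine mul_le_mul_of_nonneg_left (exp_le_exp.2 ?_) (by positivity)
        nlinarith only [x7]
end FordT

namespace FordT
open Real Finset Filter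
lemma d_one {k : ℕ} {x : ℝ} (hk : 2 ≤ k) (hx : 16 ≤ x) : dNew k 1 ≤ ((k:ℝ)-1)/12*x := by
  have h1 : c2 k ≤ 1/4 := by rw [c2, chi4]; split_ifs <;> norm_num
  have h2 : c3 k ≤ 1/3 := by rw [c3, chi3]; split_ifs <;> norm_num
  have h3 : delta2 k ≤ 1 := by rw [delta2]; split_ifs <;> norm_num
  have hk' : (2:ℝ) ≤ k := by exact_mod_cast hk
  rw [dNew, psiNew, nuInfNew, nu2New, nu3New, mval_one, mval_one, mval_one, mval_one, ArithmeticFunction.moebius_apply_one, Int.cast_one]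
  nlinarith only [h1, h2, h3, hk', hx]
lemma D_sub {k : ℕ} {x : ℝ} (hk : 2 ≤ k) (hx : 0 ≤ x) : {y : ℝ | ∃ N : ℕ, 1 ≤ N ∧ dNew k N = y ∧ dNew k N ≤ ((k:ℝ)-1)/12*x} ⊆
    ((Finset.Icc 1 ⌊4*(2*x+20000)^2⌋₊).image (dNew k) : Finset ℝ) := by
  rintro y ⟨N, hN, rfl, h⟩
  rw [mem_coe]
  refine mem_image_of_mem _ (mem_Icc.2 ⟨hN, Nat.le_floor ?_⟩)
  have h0 : (0:ℝ) ≤ F N := Nat.cast_nonneg _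
  refine (F_ge (by omega)).trans ?_
  have := F_bd hk h
  gcongr
lemma main_thm {ϱ : ℝ} (h : HR ϱ) : ∃ A : ℝ, 0 < A ∧ ∀ k : ℕ, 2 ≤ k → ∀ x : ℝ, 16 ≤ x →
      x/log x*exp ((l3 x - log (l3 x))^2/(2*log (1/ϱ)) - A*l3 x)
        ≤ (Set.ncard {y : ℝ | ∃ N : ℕ, 1 ≤ N ∧ dNew k N = y ∧ dNew k N ≤ ((k:ℝ)-1)/12 * x} : ℝ) ∧
      (Set.ncard {y : ℝ | ∃ N : ℕ, 1 ≤ N ∧ dNew k N = y ∧ dNew k N ≤ ((k:ℝ)-1)/12 * x} : ℝ)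
        ≤ x/log x*exp ((l3 x - log (l3 x))^2/(2*log (1/ϱ)) + A*l3 x) ∧ 1 < log (log x) ∧ 0 < l3 x := by
  obtain ⟨K1, hK1, e1⟩ := lower_D h
  obtain ⟨K2, hK2, e2⟩ := upper_D h
  obtain ⟨x0, hx0⟩ := eventually_atTop.1 (e1.and e2)
  have hlam := h.lpos
  obtain ⟨lam, hlm⟩ : ∃ lam, lam = log (1/ϱ) := ⟨_, rfl⟩
  rw [← hlm] at hlam hx0 ⊢
  obtain ⟨c, hc⟩ : ∃ c, c = l3 16 := ⟨_, rfl⟩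
  have h16 : exp 1 < log 16 := by
    have := log_two_gt_d9
    have := exp_one_lt_d9
    rw [show (16:ℝ) = 2^4 by norm_num, log_pow]; push_cast; linarith
  have h16' : 1 < log (log 16) := by
    rw [lt_log_iff_exp_lt ((exp_pos _).trans h16)]; exact h16
  have hc0 : 0 < c := by rw [hc, l3]; exact log_pos h16'
  obtain ⟨X, hX⟩ : ∃ X, X = max x0 16 := ⟨_, rfl⟩
  have hX16 : 16 ≤ X := by rw [hX]; exact le_max_right _ _
  obtain ⟨M, hM⟩ : ∃ M, M = l3 X := ⟨_, rfl⟩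
  obtain ⟨Q, hQ⟩ : ∃ Q, Q = (M + |log c| + |log M|)^2/(2*lam) := ⟨_, rfl⟩
  obtain ⟨N0, hN0⟩ : ∃ N0, N0 = 4*(2*X+20000)^2+1 := ⟨_, rfl⟩
  have hN01 : 1 ≤ N0 := by rw [hN0]; linarith [sq_nonneg (2*X+20000)]
  obtain ⟨A, hA⟩ : ∃ A, A = K1+K2+(log X+Q)/c+log N0/c := ⟨_, rfl⟩
  have hQ0 : 0 ≤ Q := by rw [hQ]; positivity
  have hlX : 0 ≤ log X := log_nonneg (by linarith)
  have hlN : 0 ≤ log N0 := log_nonneg hN01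
  have p1 : 0 ≤ (log X+Q)/c := by positivity
  have p2 : 0 ≤ log N0/c := by positivity
  refine ⟨A, by linarith, fun k hk x hx => ?_⟩
  have hmono : ∀ a b : ℝ, 16 ≤ a → a ≤ b → log a ≤ log b ∧ log (log a) ≤ log (log b) ∧ exp 1 < log a ∧ 1 < log (log a) ∧ l3 a ≤ l3 b := fun a b h1 h2 => by
    have q0 : log 16 ≤ log a := log_le_log (by norm_num) h1
    have q1 : log a ≤ log b := log_le_log (by linarith) h2
    have q2 : exp 1 < log a := by linarith
    have q3 : 1 < log (log a) := by rw [lt_log_iff_exp_lt ((exp_pos _).trans q2)]; exact q2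
    have q4 : log (log a) ≤ log (log b) := log_le_log ((exp_pos _).trans q2) q1
    exact ⟨q1, q4, q2, q3, log_le_log (by linarith) q4⟩
  obtain ⟨-, -, r1, r2, -⟩ := hmono x x hx le_rfl
  have r5 : l3 16 ≤ l3 x := (hmono 16 x le_rfl hx).2.2.2.2
  rw [← hc] at r5
  have hlx0 : 0 < log x := (exp_pos _).trans r1
  have hxl : 1 ≤ x/log x := by
    rw [one_le_div hlx0]
    have := log_le_sub_one_of_pos (show 0 < x by linarith); linarith
  have hsub := D_sub hk (show 0 ≤ x by linarith)
  have hfin := (Finset.finite_toSet _).subset hsub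
  obtain ⟨S, hS⟩ : ∃ S, S = {y : ℝ | ∃ N : ℕ, 1 ≤ N ∧ dNew k N = y ∧ dNew k N ≤ ((k:ℝ)-1)/12*x} := ⟨_, rfl⟩
  rw [← hS] at hsub hfin ⊢
  obtain ⟨m, hm⟩ : ∃ m, m = l3 x := ⟨_, rfl⟩
  rw [← hm] at r5 ⊢
  refine (fun hh : _ ∧ _ => ⟨hh.1, hh.2, r2, hc0.trans_le r5⟩) ?_
  have hm0 : 0 < m := hc0.trans_le r5
  by_cases hbig : X ≤ x
  · obtain ⟨g1, g2⟩ := hx0 x (le_trans (by rw [hX]; exact le_max_left _ _) hbig)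
    rw [← hm] at g1 g2
    obtain ⟨T1, a1, b1⟩ := g1 k hk
    obtain ⟨T2, a2, b2⟩ := g2 k hk
    have hxl0 : 0 ≤ x/log x := by linarith
    constructor
    · refine le_trans (mul_le_mul_of_nonneg_left (exp_le_exp.2 ?_) hxl0) (b1.trans ?_)
      · have : K1*m ≤ A*m := mul_le_mul_of_nonneg_right (by linarith) hm0.le
        linarith
      · rw [← Set.ncard_coe_finset]
        exact Nat.cast_le.2 (Set.ncard_le_ncard (fun y hy => by rw [hS]; exact a1 y hy) hfin)
    · refine le_trans ?_ (b2.trans (mul_le_mul_of_nonneg_left (exp_le_exp.2 ?_) hxl0))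
      · rw [← Set.ncard_coe_finset]
        exact Nat.cast_le.2 (Set.ncard_le_ncard (fun y hy => by rw [hS] at hy; obtain ⟨N, n1, rfl, n3⟩ := hy; exact a2 N n1 n3) (Finset.finite_toSet _))
      · have : K2*m ≤ A*m := mul_le_mul_of_nonneg_right (by linarith) hm0.le
        linarith
  · have hxX : x ≤ X := (not_le.1 hbig).le
    have hmM : m ≤ M := by rw [hm, hM]; exact (hmono x X hx hxX).2.2.2.2
    have j1 : log c ≤ log m := log_le_log hc0 r5
    have j2 : log m ≤ log M := log_le_log hm0 hmM
    have hG : (m - log m)^2/(2*lam) ≤ Q := by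
      rw [hQ]
      refine div_le_div_of_nonneg_right ?_ (by positivity)
      rw [sq_le_sq]
      refine le_trans ?_ (le_abs_self _)
      rw [abs_le]
      have := le_abs_self (log M)
      have := neg_abs_le (log c)
      have := abs_nonneg (log M)
      have := abs_nonneg (log c)
      constructor <;> linarith
    have hG0 : 0 ≤ (m - log m)^2/(2*lam) := by positivity
    have hAc1 : log X+Q ≤ A*m := by
      have := div_mul_cancel₀ (log X+Q) hc0.ne'
      have h2 : (log X+Q)/c*c ≤ A*m := mul_le_mul (by linarith) r5 hc0.le (by linarith)
      linarith
    have hAc2 : log N0 ≤ A*m := by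
      have := div_mul_cancel₀ (log N0) hc0.ne'
      have h2 : log N0/c*c ≤ A*m := mul_le_mul (by linarith) r5 hc0.le (by linarith)
      linarith
    constructor
    · have hone : (1:ℝ) ≤ S.ncard := by
        have : 0 < S.ncard := (Set.ncard_pos hfin).2 ⟨dNew k 1, by rw [hS]; exact ⟨1, le_rfl, rfl, d_one hk hx⟩⟩
        exact_mod_cast this
      refine le_trans ?_ hone
      have e1 : (1:ℝ) ≤ exp 1 := one_le_exp (by norm_num)
      calc x/log x*exp ((m - log m)^2/(2*lam) - A*m) ≤ X*exp (-log X) := by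
            refine mul_le_mul ?_ (exp_le_exp.2 (by linarith)) (exp_pos _).le (by linarith)
            rw [div_le_iff₀ hlx0]
            nlinarith only [hxX, r1, e1, hX16]
        _ = 1 := by rw [exp_neg, exp_log (by linarith)]; exact mul_inv_cancel₀ (by linarith)
    · have h1 : (S.ncard:ℝ) ≤ N0 := by
        have q1 := Set.ncard_le_ncard hsub (Finset.finite_toSet _)
        rw [Set.ncard_coe_finset] at q1
        have q2 := q1.trans card_image_le
        rw [Nat.card_Icc, Nat.add_sub_cancel] at q2
        have q3 : ((⌊4*(2*x+20000)^2⌋₊:ℕ):ℝ) ≤ 4*(2*x+20000)^2 := Nat.floor_le (by positivity)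
        have q4 : (2*x+20000)^2 ≤ (2*X+20000)^2 := pow_le_pow_left₀ (by linarith) (by linarith) 2
        have q5 : (S.ncard:ℝ) ≤ ((⌊4*(2*x+20000)^2⌋₊:ℕ):ℝ) := by exact_mod_cast q2
        rw [hN0]; linarith
      calc (S.ncard:ℝ) ≤ N0 := h1
        _ = 1*exp (log N0) := by rw [exp_log (by linarith), one_mul]
        _ ≤ _ := mul_le_mul hxl (exp_le_exp.2 (by linarith)) (exp_pos _).le (by linarith)
end FordT
theorem dimension_count_new
    (ϱ : ℝ) (hϱ₀ : 0 < ϱ) (hϱ₁ : ϱ < 1)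
    (hϱ : ∑' n : ℕ, fordA (n+1) * ϱ^(n+1) = 1) :
    ∃ A : ℝ, 0 < A ∧ ∀ k : ℕ, Even k → 2 ≤ k → ∀ x : ℝ, 16 ≤ x →
      x / Real.log x *
          Real.exp ((1/(2*Real.log (1/ϱ))) * (Real.log (loglog x / logloglog x))^2
            - A * logloglog x)
        ≤ (Set.ncard {y : ℝ | ∃ N : ℕ, 1 ≤ N ∧ dNew k N = y ∧
            dNew k N ≤ ((k:ℝ)-1)/12 * x} : ℝ) ∧
      (Set.ncard {y : ℝ | ∃ N : ℕ, 1 ≤ N ∧ dNew k N = y ∧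
            dNew k N ≤ ((k:ℝ)-1)/12 * x} : ℝ)
        ≤ x / Real.log x *
          Real.exp ((1/(2*Real.log (1/ϱ))) * (Real.log (loglog x / logloglog x))^2
            + A * logloglog x) := by
  obtain ⟨A, hA, hh⟩ := FordT.main_thm (FordT.HR.mk hϱ₀ hϱ₁ hϱ)
  refine ⟨A, hA, fun k _ hk x hx => ?_⟩
  obtain ⟨h1, h2, h3, h4⟩ := hh k hk x hx
  have e1 : logloglog x = FordT.l3 x := rfl
  have e2 : Real.log (loglog x / logloglog x) = FordT.l3 x - Real.log (FordT.l3 x) := by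
    rw [e1, Real.log_div (by rw [loglog]; linarith) h4.ne']; rfl
  have e3 : ∀ t : ℝ, (1/(2*Real.log (1/ϱ)))*t = t/(2*Real.log (1/ϱ)) := fun t => by ring
  rw [e2, e1, e3]
  exact ⟨h1, h2⟩
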